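/- For every ε > 0 there exist constants C > 0 and p₀ such that for every prime p > p₀ and all integers L, N with 0 < L+1 < L+N < p and N ≥ C·p^(7/8)·log p, one has |A_N| ≥ (1 − ε)·√p. -/

import Mathlib

/-- For a prime `p` and integers `L, N`, `A_N = {n! mod p : L+1 ≤ n ≤ L+N} ⊆ ZMod p`. -/
def intervalFactorials (p L N : ℕ) : Finset (ZMod p) :=
  (Finset.Icc (L + 1) (L + N)).image (fun n => (n.factorial : ZMod p))

section Filtration
open Module

/-- A basis of an algebra `A` consisting of the monomials `z ^ a * y ^ i` with `i < d`, such that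
`y ^ d` is a combination of monomials of weight at most `c * d`, where `z` has weight `1` and `y`
has weight `c`. -/
structure MonomialBasis (F A : Type*) [Field F] [CommRing A] [Algebra F A] (c d : ℕ) where
  z : A
  y : A
  basis : Basis (ℕ × Fin d) F A
  basis_apply : ∀ j, basis j = z ^ j.1 * y ^ (j.2 : ℕ)
  y_pow_mem : y ^ d ∈ Submodule.span F (basis '' {j | j.1 + c * (j.2 : ℕ) ≤ c * d})

namespace MonomialBasis
variable {F A : Type*} [Field F] [CommRing A] [Algebra F A] {c d : ℕ} (B : MonomialBasis F A c d)

/-- The span of the basis monomials of weight at most `m`. -/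
def fil (m : ℕ) : Submodule F A :=
  Submodule.span F (B.basis '' {j | j.1 + c * (j.2 : ℕ) ≤ m})

lemma fil_mono {m n : ℕ} (h : m ≤ n) : B.fil m ≤ B.fil n :=
  Submodule.span_mono (Set.image_mono fun _ hj => le_trans hj h)

lemma basis_mem_fil {m : ℕ} (j : ℕ × Fin d) (h : j.1 + c * (j.2 : ℕ) ≤ m) :
    B.basis j ∈ B.fil m :=
  Submodule.subset_span ⟨j, h, rfl⟩

lemma exists_mem_fil (x : A) : ∃ m, x ∈ B.fil m := by
  refine ⟨(B.basis.repr x).support.sup fun j => j.1 + c * (j.2 : ℕ), ?_⟩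
  rw [fil, Basis.mem_span_image]
  intro j hj
  exact Finset.le_sup (f := fun j : ℕ × Fin d => j.1 + c * (j.2 : ℕ)) hj

lemma z_mul_mem {m : ℕ} {x : A} (hx : x ∈ B.fil m) : B.z * x ∈ B.fil (m + 1) := by
  induction hx using Submodule.span_induction with
  | mem x h =>
    obtain ⟨j, hj, rfl⟩ := h
    have : B.z * B.basis j = B.basis (j.1 + 1, j.2) := by
      rw [B.basis_apply, B.basis_apply]; ring
    rw [this]
    exact B.basis_mem_fil _ (by simp only [Set.mem_ofPred_eq] at hj ⊢; omega)
  | zero => simp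
  | add x y _ _ h1 h2 => rw [mul_add]; exact add_mem h1 h2
  | smul a x _ h => rw [mul_smul_comm]; exact Submodule.smul_mem _ _ h

lemma z_pow_mul_mem {m : ℕ} {x : A} (hx : x ∈ B.fil m) (a : ℕ) : B.z ^ a * x ∈ B.fil (m + a) := by
  induction a with
  | zero => simpa using hx
  | succ a ih =>
    rw [pow_succ', mul_assoc, ← add_assoc]
    exact B.z_mul_mem ih

lemma y_mul_mem {m : ℕ} {x : A} (hx : x ∈ B.fil m) : B.y * x ∈ B.fil (m + c) := by
  induction hx using Submodule.span_induction with
  | mem x h =>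
    obtain ⟨j, hj, rfl⟩ := h
    simp only [Set.mem_ofPred_eq] at hj
    by_cases hd : (j.2 : ℕ) + 1 < d
    · have : B.y * B.basis j = B.basis (j.1, ⟨j.2 + 1, hd⟩) := by
        rw [B.basis_apply, B.basis_apply]; simp only; ring
      rw [this]
      refine B.basis_mem_fil _ ?_
      simp only
      rw [mul_add]
      omega
    · have hd' : (j.2 : ℕ) + 1 = d := by have := j.2.2; omega
      have : B.y * B.basis j = B.z ^ j.1 * B.y ^ d := by
        rw [B.basis_apply, show B.y ^ d = B.y ^ ((j.2 : ℕ) + 1) by rw [hd']]; ring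
      rw [this]
      refine B.fil_mono ?_ (B.z_pow_mul_mem B.y_pow_mem j.1)
      have : c * d = c * (j.2 : ℕ) + c := by rw [← mul_add_one, hd']
      omega
  | zero => simp
  | add x y _ _ h1 h2 => rw [mul_add]; exact add_mem h1 h2
  | smul a x _ h => rw [mul_smul_comm]; exact Submodule.smul_mem _ _ h

lemma y_pow_mul_mem {m : ℕ} {x : A} (hx : x ∈ B.fil m) (a : ℕ) :
    B.y ^ a * x ∈ B.fil (m + c * a) := by
  induction a with
  | zero => simpa using hx
  | succ a ih =>
    rw [pow_succ', mul_assoc, mul_add, mul_one, ← add_assoc]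
    exact B.y_mul_mem ih

lemma mul_mem {m n : ℕ} {x x' : A} (hx : x ∈ B.fil m) (hx' : x' ∈ B.fil n) :
    x * x' ∈ B.fil (m + n) := by
  induction hx using Submodule.span_induction with
  | mem x h =>
    obtain ⟨j, hj, rfl⟩ := h
    rw [B.basis_apply, mul_assoc]
    refine B.fil_mono ?_ (B.z_pow_mul_mem (B.y_pow_mul_mem hx' j.2) j.1)
    simp only [Set.mem_ofPred_eq] at hj
    omega
  | zero => simp
  | add x y _ _ h1 h2 => rw [add_mul]; exact add_mem h1 h2
  | smul a x _ h => rw [smul_mul_assoc]; exact Submodule.smul_mem _ _ h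

lemma d_pos [Nontrivial A] (B : MonomialBasis F A c d) : 0 < d := by
  obtain ⟨j⟩ := B.basis.index_nonempty
  exact j.2.pos

lemma one_mem [Nontrivial A] : (1 : A) ∈ B.fil 0 := by
  have : (1 : A) = B.basis (0, ⟨0, B.d_pos⟩) := by rw [B.basis_apply]; simp
  rw [this]
  exact B.basis_mem_fil _ (by simp)

lemma pow_mem [Nontrivial A] {m : ℕ} {x : A} (hx : x ∈ B.fil m) (n : ℕ) :
    x ^ n ∈ B.fil (n * m) := by
  induction n with
  | zero => simpa using B.one_mem
  | succ n ih =>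
    rw [pow_succ, add_mul, one_mul]
    exact B.mul_mem ih hx

lemma z_mem [Nontrivial A] : B.z ∈ B.fil 1 := by simpa using B.z_mul_mem B.one_mem

lemma y_mem [Nontrivial A] : B.y ∈ B.fil c := by simpa using B.y_mul_mem B.one_mem

/-- The indices of the monomials of weight at most `m`. -/
def idx (c d m : ℕ) : Finset (ℕ × Fin d) :=
  (Finset.range (m + 1) ×ˢ Finset.univ).filter fun j => j.1 + c * (j.2 : ℕ) ≤ m

lemma mem_idx {m : ℕ} {j : ℕ × Fin d} : j ∈ idx c d m ↔ j.1 + c * (j.2 : ℕ) ≤ m := by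
  simp only [idx, Finset.mem_filter, Finset.mem_product, Finset.mem_range, Finset.mem_univ,
    and_true, and_iff_right_iff_imp]
  omega

lemma card_idx (m : ℕ) : (idx c d m).card = ∑ i : Fin d, (m + 1 - c * (i : ℕ)) := by
  classical
  have : idx c d m = Finset.univ.biUnion fun i : Fin d =>
      (Finset.range (m + 1 - c * (i : ℕ))).image fun a => (a, i) := by
    ext ⟨a, i⟩
    simp only [mem_idx, Finset.mem_biUnion, Finset.mem_univ, true_and, Finset.mem_image,
      Finset.mem_range, Prod.mk.injEq]
    constructor
    · intro h
      exact ⟨i, a, by omega, rfl, rfl⟩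
    · rintro ⟨i, a, h, rfl, rfl⟩
      omega
  rw [this, Finset.card_biUnion]
  · refine Finset.sum_congr rfl fun i _ => ?_
    rw [Finset.card_image_of_injective _ fun a b h => (Prod.ext_iff.1 h).1, Finset.card_range]
  · intro i _ j _ hij
    rw [Function.onFun, Finset.disjoint_left]
    rintro x hx hx'
    rw [Finset.mem_image] at hx hx'
    obtain ⟨a, -, rfl⟩ := hx
    obtain ⟨b, -, hb⟩ := hx'
    exact hij (Prod.ext_iff.1 hb).2.symm

lemma card_idx_le (m : ℕ) : (idx c d m).card ≤ d * (m + 1) := by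
  rw [card_idx]
  calc _ ≤ ∑ i : Fin d, (m + 1) := Finset.sum_le_sum fun i _ => Nat.sub_le _ _
    _ = _ := by simp

lemma card_idx_add_le (m e : ℕ) : (idx c d (m + e)).card ≤ (idx c d m).card + d * e := by
  rw [card_idx, card_idx]
  calc _ ≤ ∑ i : Fin d, (m + 1 - c * (i : ℕ) + e) := Finset.sum_le_sum fun i _ => by omega
    _ = _ := by simp [Finset.sum_add_distrib]

lemma le_card_idx (m : ℕ) : d * m ≤ (idx c d m).card + c * d ^ 2 := by
  rw [card_idx]
  calc d * m = ∑ i : Fin d, m := by simp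
    _ ≤ ∑ i : Fin d, ((m + 1 - c * (i : ℕ)) + c * d) := Finset.sum_le_sum fun i _ => by
        have : c * (i : ℕ) ≤ c * d := Nat.mul_le_mul_left _ i.2.le
        omega
    _ = _ := by rw [Finset.sum_add_distrib]; simp; ring

lemma fil_eq (m : ℕ) : B.fil m = Submodule.span F (Set.range fun j : idx c d m => B.basis j) := by
  rw [fil]
  congr 1
  ext x
  simp [mem_idx]

instance finite_fil (m : ℕ) : Module.Finite F (B.fil m) := by
  rw [fil_eq]
  exact Module.Finite.span_of_finite F (Set.finite_range _)

lemma finrank_fil (m : ℕ) : finrank F (B.fil m) = (idx c d m).card := by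
  rw [fil_eq, finrank_span_eq_card, Fintype.card_coe]
  exact B.basis.linearIndependent.comp _ Subtype.val_injective

/-- A quotient killed by the multiples of a nonzero element of weight at most `e` has dimension at
most `d * e`. -/
lemma finrank_le_of_mul_eq_zero [IsDomain A] {W : Type*} [AddCommGroup W] [Module F W]
    [Module.Finite F W] (E : A →ₗ[F] W) (hE : Function.Surjective E) {e : ℕ} {φ : A}
    (hφ : φ ∈ B.fil e) (h0 : φ ≠ 0) (hk : ∀ a, E (φ * a) = 0) : finrank F W ≤ d * e := by
  obtain ⟨n, s, hs⟩ := Module.Finite.exists_fin (R := F) (M := W)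
  choose g hg using fun i => hE (s i)
  choose M' hM' using fun i => B.exists_mem_fil (g i)
  set M := Finset.univ.sup M'
  have hgM : ∀ i, g i ∈ B.fil M := fun i => B.fil_mono (Finset.le_sup (Finset.mem_univ i)) (hM' i)
  let f : B.fil (M + e) →ₗ[F] W := E.domRestrict (B.fil (M + e))
  have hf : LinearMap.range f = ⊤ := by
    rw [eq_top_iff, ← hs, Submodule.span_le]
    rintro _ ⟨i, rfl⟩
    exact ⟨⟨g i, B.fil_mono (Nat.le_add_right _ _) (hgM i)⟩, hg i⟩
  have hrn := f.finrank_range_add_finrank_ker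
  rw [hf, finrank_top, finrank_fil] at hrn
  let μ : B.fil M →ₗ[F] LinearMap.ker f :=
    LinearMap.codRestrict _ (LinearMap.codRestrict (B.fil (M + e))
      ((LinearMap.mulLeft F φ).domRestrict (B.fil M))
      (fun x => by
        rw [add_comm]
        exact B.mul_mem hφ x.2)) (fun x => hk x)
  have hμ : Function.Injective μ := by
    intro a b hab
    have : φ * (a : A) = φ * b := congrArg (fun x : LinearMap.ker f => ((x : B.fil (M + e)) : A)) hab
    exact Subtype.ext (mul_left_cancel₀ h0 this)
  have h1 := LinearMap.finrank_le_finrank_of_injective hμ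
  rw [finrank_fil] at h1
  have h2 := card_idx_add_le (c := c) (d := d) M e
  omega

/-- A nonzero element of weight at most `e` has at most `d * e` zeros. -/
lemma card_zeros_le [IsDomain A] (P : Finset (A →ₐ[F] F)) {e : ℕ} {φ : A}
    (hφ : φ ∈ B.fil e) (h0 : φ ≠ 0) (hP : ∀ σ ∈ P, σ φ = 0) : P.card ≤ d * e := by
  classical
  let E : A →ₗ[F] (P → F) := LinearMap.pi fun σ => (σ : A →ₐ[F] F).toLinearMap
  have hE : Function.Surjective E := by
    rw [← LinearMap.range_eq_top]
    by_contra hne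
    obtain ⟨f, hf, hle⟩ := Submodule.exists_le_ker_of_lt_top _ (lt_top_iff_ne_top.2 hne)
    have hli := (linearIndependent_monoidHom A F).comp (fun σ : P => ((σ : A →ₐ[F] F) : A →* F))
      (fun a b hab => Subtype.ext (AlgHom.ext fun x => DFunLike.congr_fun hab x))
    rw [Fintype.linearIndependent_iff] at hli
    have h3 := hli (fun σ => f (Pi.single σ 1)) (by
      ext a
      have : f (E a) = 0 := hle ⟨a, rfl⟩
      rw [LinearMap.pi_apply_eq_sum_univ f] at this
      simp only [Finset.sum_apply, Pi.smul_apply, smul_eq_mul, Pi.zero_apply, Function.comp]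
      rw [← this]
      refine Finset.sum_congr rfl fun σ _ => ?_
      rw [smul_eq_mul, mul_comm]
      congr 2
      ext j
      simp [Pi.single_apply, eq_comm])
    apply hf
    refine LinearMap.pi_ext' fun σ => LinearMap.ext_ring ?_
    simpa using h3 σ
  have := B.finrank_le_of_mul_eq_zero E hE hφ h0 (fun a => by
    ext σ
    simp only [E, LinearMap.pi_apply, AlgHom.toLinearMap_apply, map_mul, hP σ σ.2, zero_mul,
      Pi.zero_apply])
  simpa using this

end MonomialBasis
end Filtration

section Stepanov
open Module Polynomial

namespace MonomialBasis
variable {F A : Type*} [Field F] [CommRing A] [Algebra F A] {c d : ℕ} (B : MonomialBasis F A c d)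

/-- A nonzero element of weight at most `n` vanishes to order at most `d * n` at a smooth point
at which `z` is a local parameter. -/
lemma le_of_X_pow_dvd [IsDomain A] (f : A →ₐ[F] PowerSeries F) {z₀ : F}
    (hz : f B.z = PowerSeries.C z₀ + PowerSeries.X) {n k : ℕ} {φ : A} (hφ : φ ∈ B.fil n)
    (h0 : φ ≠ 0) (hk : PowerSeries.X ^ k ∣ f φ) : k ≤ d * n := by
  let E : A →ₗ[F] (Fin k → F) :=
    LinearMap.pi fun i => (PowerSeries.coeff (i : ℕ)).comp f.toLinearMap
  have hE : Function.Surjective E := by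
    intro w
    refine ⟨∑ i : Fin k, w i • (B.z - algebraMap F A z₀) ^ (i : ℕ), ?_⟩
    ext j
    have hx : f (B.z - algebraMap F A z₀) = PowerSeries.X := by
      rw [map_sub, hz, AlgHom.commutes]
      simp
    simp only [E, LinearMap.pi_apply, LinearMap.comp_apply, AlgHom.toLinearMap_apply, map_sum,
      map_smul, map_pow, hx, PowerSeries.coeff_X_pow, smul_eq_mul, Fin.val_inj]
    simp
  have := B.finrank_le_of_mul_eq_zero E hE hφ h0 (fun a => by
    ext i
    simp only [E, LinearMap.pi_apply, LinearMap.comp_apply, AlgHom.toLinearMap_apply, map_mul,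
      Pi.zero_apply]
    exact PowerSeries.X_pow_dvd_iff.1 (hk.mul_right _) i i.2)
  simpa using this

variable {p : ℕ} [Fact p.Prime] [CharP F p]

/-- Elements of small weight independent over `F` are independent over the `Q`-th powers. -/
lemma eq_zero_of_sum_mul_pow_eq_zero [IsDomain A] (f : A →ₐ[F] PowerSeries F) {z₀ : F}
    (hz : f B.z = PowerSeries.C z₀ + PowerSeries.X) {ι : Type*} [Fintype ι] {s : ι → A}
    (hs : LinearIndependent F s) {n b : ℕ} (hn : ∀ i, s i ∈ B.fil n) (hd : d * n < p ^ b)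
    {β : ι → PowerSeries F} (hβ : ∑ i, f (s i) * β i ^ p ^ b = 0) : β = 0 := by
  have : CharP (PowerSeries F) p := charP_of_injective_algebraMap
    (algebraMap F (PowerSeries F)).injective p
  have key : ∀ k, ∀ i, PowerSeries.X ^ k ∣ β i := by
    intro k
    induction k with
    | zero => simp
    | succ k ih =>
      choose γ hγ using ih
      have h1 : ∑ i, f (s i) * γ i ^ p ^ b = 0 := by
        have : PowerSeries.X ^ (k * p ^ b) * ∑ i, f (s i) * γ i ^ p ^ b = 0 := by
          rw [← hβ, Finset.mul_sum]
          refine Finset.sum_congr rfl fun i _ => ?_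
          rw [hγ i, mul_pow, pow_mul]
          ring
        exact (mul_eq_zero.1 this).resolve_left (pow_ne_zero _ PowerSeries.X_ne_zero)
      choose g hg using fun i => PowerSeries.X_dvd_iff.2
        (show PowerSeries.constantCoeff (γ i - PowerSeries.C (PowerSeries.constantCoeff (γ i))) = 0
          by simp)
      have hγ' : ∀ i, γ i ^ p ^ b = PowerSeries.C (PowerSeries.constantCoeff (γ i) ^ p ^ b)
          + PowerSeries.X ^ p ^ b * g i ^ p ^ b := by
        intro i
        rw [map_pow, ← mul_pow, ← hg i, ← add_pow_char_pow]
        congr 1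
        ring
      have h2 : ∑ i, (PowerSeries.constantCoeff (γ i) ^ p ^ b) • s i = 0 := by
        by_contra hne
        have := B.le_of_X_pow_dvd f hz (n := n) (k := p ^ b)
          (Submodule.sum_mem _ fun i _ => Submodule.smul_mem _ _ (hn i)) hne (by
            refine ⟨-∑ i, f (s i) * g i ^ p ^ b, ?_⟩
            rw [map_sum, ← sub_eq_zero, ← h1, mul_neg, sub_neg_eq_add, Finset.mul_sum,
              ← Finset.sum_add_distrib]
            refine Finset.sum_congr rfl fun i _ => ?_
            rw [map_smul, hγ' i, PowerSeries.smul_eq_C_mul]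
            ring)
        omega
      have h3 := Fintype.linearIndependent_iff.1 hs _ h2
      intro i
      have h4 : PowerSeries.constantCoeff (γ i) = 0 :=
        eq_zero_of_pow_eq_zero (h3 i)
      obtain ⟨u, hu⟩ := PowerSeries.X_dvd_iff.2 h4
      exact ⟨u, by rw [hγ i, hu]; ring⟩
  funext i
  ext k
  exact PowerSeries.X_pow_dvd_iff.1 (key (k + 1) i) k (Nat.lt_succ_self k)

/-- The coefficient of `X ^ b` has weight at most `e - c * b`. -/
def HasWeight (e : ℕ) (S : A[X]) : Prop :=
  ∀ b, S.coeff b = 0 ∨ (c * b ≤ e ∧ S.coeff b ∈ B.fil (e - c * b))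

lemma HasWeight.sum {e : ℕ} {ι : Type*} {t : Finset ι} {S : ι → A[X]}
    (h : ∀ i ∈ t, B.HasWeight e (S i)) : B.HasWeight e (∑ i ∈ t, S i) := by
  intro b
  rw [finsetSum_coeff]
  by_cases hb : c * b ≤ e
  · refine Or.inr ⟨hb, Submodule.sum_mem _ fun i hi => ?_⟩
    rcases h i hi b with h | h
    · rw [h]; exact zero_mem _
    · exact h.2
  · exact Or.inl (Finset.sum_eq_zero fun i hi => (h i hi b).resolve_right fun h => hb h.1)

lemma HasWeight.modByMonic [IsDomain A] {G : A[X]} (hG : G.Monic)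
    (hGw : ∀ i ≤ G.natDegree, G.coeff i ∈ B.fil (c * (G.natDegree - i))) {e : ℕ} {S : A[X]}
    (hS : B.HasWeight e S) : B.HasWeight e (S %ₘ G) := by
  induction hn : S.degree using WellFoundedLT.induction generalizing S with
  | _ n ih =>
    subst hn
    by_cases h : G.degree ≤ S.degree ∧ S ≠ 0
    · have hlt := div_wf_lemma h hG
      set T := S - G * (C S.leadingCoeff * X ^ (S.natDegree - G.natDegree)) with hT
      have hmod : S %ₘ G = T %ₘ G := modByMonic_eq_of_dvd_sub hG (by rw [hT]; simp)
      rw [hmod]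
      refine ih _ hlt ?_ rfl
      have hdeg : G.natDegree ≤ S.natDegree := natDegree_le_natDegree h.1
      rcases hS S.natDegree with h0 | ⟨hle, hlc⟩
      · exact absurd (leadingCoeff_eq_zero.1 h0) h.2
      intro b
      have hcoe : T.coeff b = S.coeff b - if S.natDegree - G.natDegree ≤ b then
          G.coeff (b - (S.natDegree - G.natDegree)) * S.leadingCoeff else 0 := by
        rw [hT, coeff_sub, ← mul_assoc, coeff_mul_X_pow']
        simp only [coeff_mul_C]
      by_cases hb : b ≤ S.natDegree
      · have hcb : c * b ≤ e := le_trans (Nat.mul_le_mul_left _ hb) hle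
        refine Or.inr ⟨hcb, ?_⟩
        rw [hcoe]
        refine sub_mem ?_ ?_
        · rcases hS b with h | h
          · rw [h]; exact zero_mem _
          · exact h.2
        · split_ifs with hb'
          · have h1 := B.mul_mem (hGw (b - (S.natDegree - G.natDegree)) (by omega)) hlc
            have h4 : G.natDegree - (b - (S.natDegree - G.natDegree)) = S.natDegree - b := by omega
            rw [h4] at h1
            have h5 : c * S.natDegree = c * b + c * (S.natDegree - b) := by
              rw [← mul_add]; congr 1; omega
            rwa [show e - c * b = c * (S.natDegree - b) + (e - c * S.natDegree) by omega]
          · exact zero_mem _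
      · left
        rw [hcoe, coeff_eq_zero_of_natDegree_lt (by omega), zero_sub, neg_eq_zero]
        split_ifs with hb'
        · rw [coeff_eq_zero_of_natDegree_lt (by omega), zero_mul]
        · rfl
    · have : S %ₘ G = S := by
        by_cases hS0 : S = 0
        · simp [hS0]
        · exact (modByMonic_eq_self_iff hG).2 (not_le.1 fun h' => h ⟨h', hS0⟩)
      rwa [this]

/-- **Stepanov's method.** Let `P` be a set of points at which `z` is fixed by the `q`-th power
map, `q = p ^ (a + b)`, and at which the `q`-th power of `y` is a root of `G`. -/
lemma card_le_of_frobenius_root [IsDomain A] [IsAlgClosed F] (f : A →ₐ[F] PowerSeries F) {z₀ : F}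
    (hf : Function.Injective f) (hz : f B.z = PowerSeries.C z₀ + PowerSeries.X)
    {G : A[X]} (hG : G.Monic)
    (hGw : ∀ i ≤ G.natDegree, G.coeff i ∈ B.fil (c * (G.natDegree - i))) {a b m n : ℕ}
    (hd : d * n < p ^ b)
    (hmn : G.natDegree * (d * (n * p ^ a + m + 1)) < (idx c d n).card * (idx c d m).card)
    (P : Finset (A →ₐ[F] F)) (hPz : ∀ σ ∈ P, σ B.z ^ p ^ (a + b) = σ B.z)
    (hPG : ∀ σ ∈ P, G.eval₂ (σ : A →+* F) (σ B.y ^ p ^ (a + b)) = 0) :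
    P.card ≤ d * (n + m * p ^ b) := by
  have hcA : CharP A p := charP_of_injective_algebraMap (algebraMap F A).injective p
  have hppos : ∀ k, 0 < p ^ k := fun k => pow_pos (Fact.out : p.Prime).pos k
  set e := n * p ^ a + m with he
  let T : idx c d n × idx c d m → A[X] := fun ij =>
    C (B.basis ij.1 ^ p ^ a * B.z ^ (ij.2 : ℕ × Fin d).1) * X ^ ((ij.2 : ℕ × Fin d).2 : ℕ)
  have hT : ∀ ij, B.HasWeight e (T ij) := by
    intro ij k
    have h1 := mem_idx.1 ij.1.2
    have h2 := mem_idx.1 ij.2.2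
    simp only [T, coeff_C_mul_X_pow]
    split_ifs with hk
    · right
      rw [hk]
      refine ⟨by omega, ?_⟩
      rw [mul_comm (B.basis _ ^ _)]
      refine B.fil_mono ?_ (B.z_pow_mul_mem (B.pow_mem (B.basis_mem_fil _ h1) (p ^ a)) _)
      rw [he, mul_comm (p ^ a)]
      omega
    · exact Or.inl rfl
  let Φ : (idx c d n × idx c d m → F) →ₗ[F] (Fin G.natDegree → B.fil e) :=
    LinearMap.pi fun i => LinearMap.codRestrict (B.fil e)
      (((lcoeff A i).restrictScalars F).comp (((modByMonicHom G).restrictScalars F).comp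
        (Fintype.linearCombination F T)))
      (fun x => by
        have h1 : B.HasWeight e (Fintype.linearCombination F T x %ₘ G) := by
          refine HasWeight.modByMonic B hG hGw ?_
          rw [Fintype.linearCombination_apply]
          refine HasWeight.sum B fun ij _ k => ?_
          rw [coeff_smul]
          rcases hT ij k with h | h
          · left; rw [h, smul_zero]
          · exact Or.inr ⟨h.1, Submodule.smul_mem _ _ h.2⟩
        rcases h1 i with h | h
        · simp only [LinearMap.comp_apply, LinearMap.restrictScalars_apply, lcoeff_apply,
            modByMonicHom_apply, h, zero_mem]
        · exact B.fil_mono (Nat.sub_le _ _) h.2)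
  have hker : LinearMap.ker Φ ≠ ⊥ := by
    apply LinearMap.ker_ne_bot_of_finrank_lt
    rw [Module.finrank_pi_fintype]
    simp only [finrank_fil, Finset.sum_const, Finset.card_univ, Fintype.card_fin, smul_eq_mul,
      Module.finrank_fintype_fun_eq_card, Fintype.card_prod, Fintype.card_coe]
    exact lt_of_le_of_lt (Nat.mul_le_mul_left _ (card_idx_le e)) hmn
  obtain ⟨x, hx, hx0⟩ := (Submodule.ne_bot_iff _).1 hker
  set S := Fintype.linearCombination F T x with hS
  have hdvd : G ∣ S := by
    rw [← modByMonic_eq_zero_iff_dvd hG]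
    ext i
    by_cases hi : i < G.natDegree
    · have := congrArg (fun g : Fin G.natDegree → B.fil e => (g ⟨i, hi⟩ : A))
        (LinearMap.mem_ker.1 hx)
      simpa [Φ] using this
    · rw [coeff_zero]
      refine coeff_eq_zero_of_degree_lt (lt_of_lt_of_le (degree_modByMonic_lt _ hG) ?_)
      rw [degree_eq_natDegree hG.ne_zero]
      exact_mod_cast not_lt.1 hi
  choose w hw using fun ij => IsAlgClosed.exists_pow_nat_eq (x ij) (hppos a)
  choose v hv using fun ij => IsAlgClosed.exists_pow_nat_eq (w ij) (hppos b)
  set φ : A := ∑ ij : idx c d n × idx c d m,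
    w ij • (B.basis ij.1 * B.basis ij.2 ^ p ^ b) with hφ
  refine B.card_zeros_le P (e := n + m * p ^ b) (φ := φ) ?_ ?_ ?_
  · refine Submodule.sum_mem _ fun ij _ => Submodule.smul_mem _ _ ?_
    rw [mul_comm m]
    exact B.mul_mem (B.basis_mem_fil _ (mem_idx.1 ij.1.2))
      (B.pow_mem (B.basis_mem_fil _ (mem_idx.1 ij.2.2)) _)
  · intro h0
    apply hx0
    have hli := (B.basis.linearIndependent.comp (fun j : idx c d n => (j : ℕ × Fin d))
      Subtype.val_injective)
    have hli' := (B.basis.linearIndependent.comp (fun j : idx c d m => (j : ℕ × Fin d))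
      Subtype.val_injective)
    have h1 := B.eq_zero_of_sum_mul_pow_eq_zero f hz hli
      (fun i => B.basis_mem_fil _ (mem_idx.1 i.2)) hd
      (β := fun i => f (∑ j : idx c d m, v (i, j) • B.basis j)) (by
        have : f φ = 0 := by rw [h0, map_zero]
        rw [← this, hφ, Fintype.sum_prod_type, map_sum]
        refine Finset.sum_congr rfl fun i _ => ?_
        rw [← map_pow, sum_pow_char_pow, ← map_mul, Finset.mul_sum]
        congr 1
        refine Finset.sum_congr rfl fun j _ => ?_
        rw [_root_.smul_pow, hv, mul_smul_comm]
        rfl)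
    funext ⟨i, j⟩
    have h2 : ∑ j : idx c d m, v (i, j) • B.basis j = 0 := by
      apply hf
      rw [map_zero]
      exact congrFun h1 i
    have h3 := Fintype.linearIndependent_iff.1 hli' (fun j => v (i, j)) h2 j
    rw [← hw, ← hv, h3, zero_pow (hppos b).ne', zero_pow (hppos a).ne']
    rfl
  · intro σ hσ
    have h1 : S.eval₂ (σ : A →+* F) (σ B.y ^ p ^ (a + b)) = 0 := by
      obtain ⟨g, hg⟩ := hdvd
      rw [hg, eval₂_mul, hPG σ hσ, zero_mul]
    have h2 : σ φ ^ p ^ a = 0 := by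
      rw [← h1, hS, Fintype.linearCombination_apply, eval₂_finsetSum, hφ, map_sum,
        sum_pow_char_pow]
      refine Finset.sum_congr rfl fun ij _ => ?_
      rw [map_smul, map_mul, map_pow, _root_.smul_pow, hw, ← algebraMap_smul A (x ij) (T ij),
        smul_eq_C_mul, eval₂_mul, eval₂_C]
      simp only [T, eval₂_mul, eval₂_C, eval₂_X_pow]
      simp only [RingHom.coe_coe, map_mul, map_pow, AlgHom.commutes, smul_eq_mul,
        Algebra.algebraMap_self, RingHom.id_apply]
      rw [B.basis_apply ij.2, map_mul, map_pow, map_pow, mul_pow, ← pow_mul, mul_pow,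
        ← pow_mul, ← pow_mul, ← pow_mul, ← pow_add, add_comm b a, mul_assoc,
        mul_comm _ (p ^ (a + b)), pow_mul (σ B.z), hPz σ hσ, mul_comm _ (p ^ (a + b)),
        pow_mul (σ B.y)]
    exact eq_zero_of_pow_eq_zero h2

end MonomialBasis
end Stepanov

section Parameters
open Module Polynomial

lemma exists_stepanov_parameters (c d r : ℕ) (hd : 0 < d) : ∃ R₀ S : ℕ, ∀ R Q : ℕ,
    R₀ < R → R ≤ Q → ∃ m n : ℕ, d * n < Q ∧ d * (n + m * Q) ≤ r * (R * Q) + S * Q ∧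
      ∀ x y : ℕ, d * n ≤ x + c * d ^ 2 → d * m ≤ y + c * d ^ 2 →
        r * (d * (n * R + m + 1)) < x * y := by
  set κ := c * d ^ 2
  set s := r * κ + r ^ 2 with hs
  refine ⟨(d + κ) * (s + 1) + r * (s + κ + 2 * d), s + κ + d + 1, fun R Q hR hRQ =>
    ⟨(r * R + s + κ) / d + 1, (Q - 1) / d, ?_, ?_, ?_⟩⟩
  · have := Nat.mul_div_le (Q - 1) d
    omega
  · have h1 := Nat.mul_div_le (Q - 1) d
    have h2 := Nat.mul_div_le (r * R + s + κ) d
    set u := (Q - 1) / d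
    set v := (r * R + s + κ) / d
    calc d * (u + (v + 1) * Q) = d * u + (d * v) * Q + d * Q := by ring
      _ ≤ Q + (r * R + s + κ) * Q + d * Q := by gcongr; omega
      _ = _ := by ring
  · intro x y hx hy
    have h1 := Nat.mul_div_le (r * R + s + κ) d
    have h2 := Nat.lt_mul_div_succ (r * R + s + κ) hd
    have h3 := Nat.lt_mul_div_succ (Q - 1) hd
    have h4 := Nat.mul_div_le (Q - 1) d
    set u := (Q - 1) / d
    set v := (r * R + s + κ) / d
    have hy' : r * R + s + 1 ≤ y := by omega
    have hx' : R ≤ x + d + κ := by rw [mul_add] at h3; omega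
    calc r * (d * (u * R + (v + 1) + 1)) = r * R * (d * u) + r * (d * v) + r * (2 * d) := by ring
      _ ≤ r * R * (x + κ) + r * (r * R + s + κ) + r * (2 * d) := by gcongr
      _ < x * (r * R + s + 1) := by
        have : (R - (d + κ) : ℤ) * (s + 1) ≤ x * (s + 1) := by
          gcongr
          zify at hx'
          linarith
        zify at hR ⊢
        rw [hs] at *
        push_cast at *
        nlinarith
      _ ≤ x * y := by gcongr

end Parameters
section PointBounds
open Module Polynomial
namespace MonomialBasis

variable {F A : Type*} [Field F] [CommRing A] [Algebra F A] {c d : ℕ} (B : MonomialBasis F A c d)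

lemma z_pow_ne_z [Nontrivial A] {q : ℕ} (hq : 1 < q) : B.z ^ q - B.z ≠ 0 := by
  intro h
  have h1 : B.basis (q, ⟨0, B.d_pos⟩) = B.basis (1, ⟨0, B.d_pos⟩) := by
    rw [B.basis_apply, B.basis_apply]
    simpa using sub_eq_zero.1 h
  have := B.basis.injective h1
  simp only [Prod.mk.injEq] at this
  omega

lemma card_le_mul [IsDomain A] {q : ℕ} (hq : 1 < q) (P : Finset (A →ₐ[F] F))
    (hPz : ∀ σ ∈ P, σ B.z ^ q = σ B.z) : P.card ≤ d * q := by
  refine B.card_zeros_le P (φ := B.z ^ q - B.z) ?_ (B.z_pow_ne_z hq) fun σ hσ => ?_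
  · refine sub_mem ?_ (B.fil_mono hq.le B.z_mem)
    simpa using B.pow_mem B.z_mem q
  · rw [map_sub, map_pow, hPz σ hσ, sub_self]

end MonomialBasis

lemma exists_card_le_of_frobenius_root (p c d r : ℕ) [hp : Fact p.Prime] : ∃ S : ℕ,
    ∀ {F A : Type} [Field F] [CommRing A] [Algebra F A] [CharP F p] [IsAlgClosed F] [IsDomain A]
      (B : MonomialBasis F A c d) (f : A →ₐ[F] PowerSeries F) (z₀ : F)
      (_ : Function.Injective f) (_ : f B.z = PowerSeries.C z₀ + PowerSeries.X)
      (G : A[X]) (_ : G.Monic) (_ : G.natDegree = r)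
      (_ : ∀ i ≤ G.natDegree, G.coeff i ∈ B.fil (c * (G.natDegree - i))) (ν : ℕ) (_ : 1 ≤ ν)
      (P : Finset (A →ₐ[F] F)) (_ : ∀ σ ∈ P, σ B.z ^ p ^ ν = σ B.z)
      (_ : ∀ σ ∈ P, G.eval₂ (σ : A →+* F) (σ B.y ^ p ^ ν) = 0),
      P.card ≤ r * p ^ ν + S * p ^ (ν - ν / 2) := by
  rcases Nat.eq_zero_or_pos d with rfl | hd
  · refine ⟨0, fun B => ?_⟩
    intros
    exact absurd B.d_pos (lt_irrefl 0)
  obtain ⟨R₀, S, hS⟩ := exists_stepanov_parameters c d r hd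
  refine ⟨S + d * R₀, ?_⟩
  intro F A _ _ _ _ _ _ B f z₀ hf hz G hG hr hGw ν hν P hPz hPG
  have hab : ν / 2 + (ν - ν / 2) = ν := by omega
  have hle : p ^ (ν / 2) ≤ p ^ (ν - ν / 2) := Nat.pow_le_pow_right hp.out.pos (by omega)
  by_cases hR : R₀ < p ^ (ν / 2)
  · obtain ⟨m, n, hn, hb, hmn⟩ := hS _ _ hR hle
    rw [← pow_add, hab] at hb
    rw [← hab] at hPz hPG
    have := B.card_le_of_frobenius_root f hf hz hG hGw hn (m := m)
      (by rw [hr]; exact hmn _ _ (MonomialBasis.le_card_idx n) (MonomialBasis.le_card_idx m))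
      P hPz hPG
    calc _ ≤ _ := this
      _ ≤ _ := hb
      _ ≤ _ := by gcongr; omega
  · have := B.card_le_mul (Nat.one_lt_pow (by omega) hp.out.one_lt) P hPz
    calc _ ≤ _ := this
      _ = d * (p ^ (ν / 2) * p ^ (ν - ν / 2)) := by rw [← pow_add, hab]
      _ ≤ d * (R₀ * p ^ (ν - ν / 2)) := by gcongr; omega
      _ ≤ _ := by
        rw [add_mul, ← mul_assoc]
        omega

end PointBounds

section PlaneCurve
open Module Polynomial

/-- `H` is monic in the outer variable, of degree `d`, and weighted homogeneous degree at most
`c * d` when the outer variable has weight `c`. -/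
structure IsWeightedMonic {R : Type*} [CommRing R] (H : R[X][X]) (c d : ℕ) : Prop where
  monic : H.Monic
  natDegree_eq : H.natDegree = d
  natDegree_coeff_le : ∀ i ≤ d, (H.coeff i).natDegree ≤ c * (d - i)

variable {F : Type} [Field F] {H : F[X][X]} {c d : ℕ}

lemma algebraMap_X_pow_smul (a : ℕ) (x : AdjoinRoot H) :
    (X ^ a : F[X]) • x = AdjoinRoot.of H X ^ a * x := by
  rw [Algebra.smul_def, map_pow]; rfl

lemma IsWeightedMonic.sum_eq_zero (h : IsWeightedMonic H c d) :
    ∑ i ∈ Finset.range d, AdjoinRoot.of H (H.coeff i) * AdjoinRoot.root H ^ i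
      + AdjoinRoot.root H ^ d = 0 := by
  have h1 := AdjoinRoot.eval₂_root H
  rw [eval₂_eq_sum_range, h.natDegree_eq, Finset.sum_range_succ] at h1
  have : H.coeff d = 1 := by rw [← h.natDegree_eq]; exact h.monic
  rwa [this, map_one, one_mul] at h1

lemma of_eq_sum (f : F[X]) : AdjoinRoot.of H f =
    ∑ k ∈ Finset.range (f.natDegree + 1), f.coeff k • AdjoinRoot.of H X ^ k := by
  conv_lhs => rw [f.as_sum_range_C_mul_X_pow]
  rw [map_sum]
  refine Finset.sum_congr rfl fun k _ => ?_
  rw [map_mul, map_pow, Algebra.smul_def]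
  rfl

/-- The monomial basis of the coordinate ring of a plane curve. -/
noncomputable def IsWeightedMonic.monomialBasis (h : IsWeightedMonic H c d) :
    MonomialBasis F (AdjoinRoot H) c d where
  z := AdjoinRoot.of H X
  y := AdjoinRoot.root H
  basis := (basisMonomials F).smulTower
    ((AdjoinRoot.powerBasis' h.monic).basis.reindex (finCongr h.natDegree_eq))
  basis_apply j := by
    rw [Basis.smulTower_apply, Basis.reindex_apply, PowerBasis.coe_basis, coe_basisMonomials]
    change (monomial j.1 1 : F[X]) • _ = _
    rw [monomial_one_right_eq_X_pow, algebraMap_X_pow_smul]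
    rfl
  y_pow_mem := by
    rw [eq_neg_of_add_eq_zero_right h.sum_eq_zero]
    refine neg_mem (Submodule.sum_mem _ fun i hi => ?_)
    rw [Finset.mem_range] at hi
    rw [of_eq_sum, Finset.sum_mul]
    refine Submodule.sum_mem _ fun k hk => ?_
    rw [smul_mul_assoc]
    refine Submodule.smul_mem _ _ (Submodule.subset_span ⟨(k, ⟨i, hi⟩), ?_, ?_⟩)
    · have h1 := h.natDegree_coeff_le i hi.le
      rw [Finset.mem_range] at hk
      have h2 : c * d = c * i + c * (d - i) := by rw [← mul_add]; congr 1; omega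
      simp only [Set.mem_ofPred_eq]
      omega
    · rw [Basis.smulTower_apply, Basis.reindex_apply, PowerBasis.coe_basis, coe_basisMonomials]
      change (monomial k 1 : F[X]) • _ = _
      rw [monomial_one_right_eq_X_pow, algebraMap_X_pow_smul]
      rfl

namespace IsWeightedMonic

lemma monomialBasis_y (h : IsWeightedMonic H c d) : h.monomialBasis.y = AdjoinRoot.root H := rfl

lemma of_mem_fil (h : IsWeightedMonic H c d) [Nontrivial (AdjoinRoot H)] {f : F[X]} {m : ℕ}
    (hf : f.natDegree ≤ m) : AdjoinRoot.of H f ∈ h.monomialBasis.fil m := by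
  rw [of_eq_sum]
  refine Submodule.sum_mem _ fun k hk => Submodule.smul_mem _ _ ?_
  rw [Finset.mem_range] at hk
  refine h.monomialBasis.fil_mono (show k * 1 ≤ m by omega) ?_
  exact h.monomialBasis.pow_mem h.monomialBasis.z_mem k

lemma isDomain (hH : Irreducible H) : IsDomain (AdjoinRoot H) :=
  AdjoinRoot.isDomain_of_prime hH.prime

/-- The point of the curve with the given coordinates. -/
noncomputable def point {z y : F} (h : (H.map (evalRingHom z)).eval y = 0) :
    AdjoinRoot H →ₐ[F] F where
  toRingHom := AdjoinRoot.lift (evalRingHom z) y (by rwa [eval_map] at h)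
  commutes' a := by
    have : algebraMap F (AdjoinRoot H) a = AdjoinRoot.of H (C a) := rfl
    simp [this]

lemma point_z {z y : F} (h : (H.map (evalRingHom z)).eval y = 0) :
    point h (AdjoinRoot.of H X) = z := by
  change AdjoinRoot.lift (evalRingHom z) y (by rwa [eval_map] at h) _ = z
  simp

lemma point_y {z y : F} (h : (H.map (evalRingHom z)).eval y = 0) :
    point h (AdjoinRoot.root H) = y := by
  change AdjoinRoot.lift (evalRingHom z) y (by rwa [eval_map] at h) _ = y
  simp

lemma algHom_of (σ : AdjoinRoot H →ₐ[F] F) (f : F[X]) :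
    σ (AdjoinRoot.of H f) = f.eval (σ (AdjoinRoot.of H X)) := by
  have h1 : (σ : AdjoinRoot H →+* F).comp (AdjoinRoot.of H)
      = evalRingHom (σ (AdjoinRoot.of H X)) := by
    refine Polynomial.ringHom_ext (fun a => ?_) (by simp)
    have : AdjoinRoot.of H (C a) = algebraMap F (AdjoinRoot H) a := rfl
    simp [this]
  exact RingHom.congr_fun h1 f

lemma algHom_eval₂ (σ : AdjoinRoot H →ₐ[F] F) (P : F[X][X]) :
    σ (P.eval₂ (AdjoinRoot.of H) (AdjoinRoot.root H)) =
      (P.map (evalRingHom (σ (AdjoinRoot.of H X)))).eval (σ (AdjoinRoot.root H)) := by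
  have h1 : (σ : AdjoinRoot H →+* F).comp (AdjoinRoot.of H)
      = evalRingHom (σ (AdjoinRoot.of H X)) := RingHom.ext (algHom_of σ)
  have := hom_eval₂ P (AdjoinRoot.of H) (σ : AdjoinRoot H →+* F) (AdjoinRoot.root H)
  rw [h1] at this
  rw [eval_map]
  exact this

lemma exists_finset_algHom (N : Finset (F × F))
    (hN : ∀ x ∈ N, (H.map (evalRingHom x.1)).eval x.2 = 0) :
    ∃ P : Finset (AdjoinRoot H →ₐ[F] F), P.card = N.card ∧
      ∀ σ ∈ P, (σ (AdjoinRoot.of H X), σ (AdjoinRoot.root H)) ∈ N := by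
  classical
  refine ⟨N.attach.image fun x => point (hN x.1 x.2), ?_, ?_⟩
  · rw [Finset.card_image_of_injective, Finset.card_attach]
    intro x x' hx
    have h1 := DFunLike.congr_fun hx (AdjoinRoot.of H X)
    have h2 := DFunLike.congr_fun hx (AdjoinRoot.root H)
    simp only [point_z, point_y] at h1 h2
    exact Subtype.ext (Prod.ext h1 h2)
  · intro σ hσ
    obtain ⟨x, -, rfl⟩ := Finset.mem_image.1 hσ
    rw [point_z, point_y]
    exact x.2

/-- The derivative of `H`, as an element of the coordinate ring. -/
noncomputable def deriv (H : F[X][X]) : AdjoinRoot H :=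
  (derivative H).eval₂ (AdjoinRoot.of H) (AdjoinRoot.root H)

lemma deriv_mem_fil (h : IsWeightedMonic H c d) [Nontrivial (AdjoinRoot H)] :
    deriv H ∈ h.monomialBasis.fil (c * d) := by
  rw [deriv, eval₂_eq_sum_range]
  refine Submodule.sum_mem _ fun i _ => ?_
  rw [coeff_derivative]
  by_cases hi : i + 1 ≤ d
  · have h1 := h.natDegree_coeff_le _ hi
    have h2 : AdjoinRoot.of H (H.coeff (i + 1) * ((i : F[X]) + 1)) ∈
        h.monomialBasis.fil (c * (d - (i + 1))) := by
      refine h.of_mem_fil (le_trans natDegree_mul_le ?_)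
      have : ((i : F[X]) + 1).natDegree = 0 := by exact_mod_cast natDegree_natCast (i + 1)
      omega
    refine h.monomialBasis.fil_mono ?_ (h.monomialBasis.mul_mem h2
      (h.monomialBasis.pow_mem h.monomialBasis.y_mem i))
    rw [mul_comm i, ← mul_add]
    exact Nat.mul_le_mul_left _ (by omega)
  · rw [coeff_eq_zero_of_natDegree_lt (by rw [h.natDegree_eq]; omega)]
    simp

lemma deriv_ne_zero (h : IsWeightedMonic H c d) (hd : (d : F) ≠ 0) : deriv H ≠ 0 := by
  have h0 : deriv H = AdjoinRoot.mk H (derivative H) := AdjoinRoot.aeval_eq (derivative H)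
  have hd0 : d ≠ 0 := by rintro rfl; simp at hd
  have h1 : derivative H ≠ 0 := by
    intro h2
    obtain ⟨e, rfl⟩ := Nat.exists_eq_succ_of_ne_zero hd0
    have h4 : H.coeff (e + 1) = 1 := by rw [← Nat.succ_eq_add_one, ← h.natDegree_eq]; exact h.monic
    have h3 : (derivative H).coeff e = 0 := by rw [h2, coeff_zero]
    rw [coeff_derivative, h4, one_mul] at h3
    have : C ((e.succ : ℕ) : F) = 0 := by simpa using h3
    exact hd (C_eq_zero.1 this)
  rw [h0]
  refine AdjoinRoot.mk_ne_zero_of_natDegree_lt h.monic h1 ?_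
  exact natDegree_derivative_lt (by rw [h.natDegree_eq]; exact hd0)

/-- The local expansion in powers of `z - z₀` of the coordinate ring at an étale point. -/
lemma exists_powerSeries (h : IsWeightedMonic H c d) (hH : Irreducible H) {z₀ y₀ : F}
    (h0 : (H.map (evalRingHom z₀)).eval y₀ = 0)
    (h1 : ((derivative H).map (evalRingHom z₀)).eval y₀ ≠ 0) :
    ∃ f : AdjoinRoot H →ₐ[F] PowerSeries F, Function.Injective f ∧
      f (AdjoinRoot.of H X) = PowerSeries.C z₀ + PowerSeries.X := by
  have := isDomain hH
  let φ : F[X] →+* PowerSeries F := eval₂RingHom PowerSeries.C (PowerSeries.C z₀ + PowerSeries.X)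
  have hφ0 : (PowerSeries.constantCoeff (R := F)).comp φ = evalRingHom z₀ := by
    refine Polynomial.ringHom_ext (fun a => ?_) ?_ <;> simp [φ]
  have hev : ∀ P : F[X][X], PowerSeries.constantCoeff ((P.map φ).eval (PowerSeries.C y₀)) =
      (P.map (evalRingHom z₀)).eval y₀ := by
    intro P
    rw [eval_map, hom_eval₂, hφ0, eval_map]
    simp
  obtain ⟨a, ha, -⟩ := HenselianRing.is_henselian (R := PowerSeries F)
    (I := Ideal.span {PowerSeries.X}) (H.map φ) (h.monic.map φ) (PowerSeries.C y₀)
    (by rw [Ideal.mem_span_singleton, PowerSeries.X_dvd_iff, hev, h0])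
    (by
      refine IsUnit.map _ ?_
      rw [PowerSeries.isUnit_iff_constantCoeff, derivative_map, hev]
      exact isUnit_iff_ne_zero.2 h1)
  have ha' : H.eval₂ φ a = 0 := by rwa [IsRoot.def, eval_map] at ha
  have hφinj : Function.Injective φ := by
    have : ∀ P, φ P = ((taylor z₀ P : F[X]) : PowerSeries F) := by
      intro P
      have h2 : φ = (coeToPowerSeries.ringHom).comp (taylorAlgHom z₀ : F[X] →+* F[X]) := by
        refine Polynomial.ringHom_ext (fun a => ?_) ?_ <;> simp [φ, add_comm]
      rw [h2]
      simp
    intro P Q hPQ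
    rw [this, this] at hPQ
    exact taylor_injective z₀ (Polynomial.coe_injective F hPQ)
  refine ⟨{ toRingHom := AdjoinRoot.lift φ a ha', commutes' := fun b => ?_ }, ?_, ?_⟩
  · have : algebraMap F (AdjoinRoot H) b = AdjoinRoot.of H (C b) := rfl
    simp only [RingHom.toMonoidHom_eq_coe, OneHom.toFun_eq_coe, MonoidHom.toOneHom_coe,
      MonoidHom.coe_coe, this, AdjoinRoot.lift_of]
    simp [φ]
  · change Function.Injective (AdjoinRoot.lift φ a ha')
    rw [RingHom.injective_iff_ker_eq_bot]
    have := h.monic.finite_adjoinRoot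
    refine Ideal.eq_bot_of_comap_eq_bot (R := F[X]) ?_
    rw [RingHom.comap_ker]
    have : (AdjoinRoot.lift φ a ha').comp (algebraMap F[X] (AdjoinRoot H)) = φ := by
      ext1 <;> simp [AdjoinRoot.algebraMap_eq]
    rw [this, (RingHom.injective_iff_ker_eq_bot _).1 hφinj]
  · change AdjoinRoot.lift φ a ha' (AdjoinRoot.of H X) = _
    simp [φ]

end IsWeightedMonic
end PlaneCurve

section CurveCount
open Polynomial

variable {F : Type} [Field F]

lemma separable_X_pow_sub_X' {p : ℕ} [Fact p.Prime] [CharP F p] {ν : ℕ} (hν : 1 ≤ ν) :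
    (X ^ p ^ ν - X : F[X]).Separable := by
  have : ((p ^ ν : ℕ) : F) = 0 := by
    rw [Nat.cast_pow, CharP.cast_eq_zero, zero_pow (by omega)]
  rw [separable_def]
  refine ⟨0, -1, ?_⟩
  simp only [derivative_sub, derivative_X_pow, derivative_X, this, C_0]
  ring

/-- The subfield of elements fixed by the `q`-th power map, as a finite set. -/
noncomputable def fixedPow (F : Type) [Field F] (q : ℕ) : Finset F :=
  by classical exact (X ^ q - X : F[X]).roots.toFinset

lemma X_pow_sub_X_ne_zero {q : ℕ} (hq : 1 < q) : (X ^ q - X : F[X]) ≠ 0 :=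
  FiniteField.X_pow_card_sub_X_ne_zero F hq

lemma mem_fixedPow {q : ℕ} (hq : 1 < q) {x : F} : x ∈ fixedPow F q ↔ x ^ q = x := by
  classical
  simp [fixedPow, X_pow_sub_X_ne_zero hq, sub_eq_zero]

lemma card_fixedPow [IsAlgClosed F] {p : ℕ} [hp : Fact p.Prime] [CharP F p] {ν : ℕ} (hν : 1 ≤ ν) :
    (fixedPow F (p ^ ν)).card = p ^ ν := by
  classical
  have h1 := Nat.one_lt_pow (by omega : ν ≠ 0) hp.out.one_lt
  rw [fixedPow, Multiset.toFinset_card_of_nodup (nodup_roots (separable_X_pow_sub_X' hν)),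
    IsAlgClosed.card_roots_eq_natDegree]
  exact FiniteField.X_pow_card_sub_X_natDegree_eq F h1

variable {H : F[X][X]} {c d : ℕ}

/-- The `y`-coordinates of the points of the curve with the given `z`-coordinate. -/
noncomputable def curveFiber (H : F[X][X]) (z : F) : Finset F :=
  by classical exact (H.map (evalRingHom z)).roots.toFinset

/-- The points of the curve whose `z`-coordinate is fixed by the `q`-th power map. -/
noncomputable def curvePoints (H : F[X][X]) (q : ℕ) : Finset (F × F) :=
  by classical exact (fixedPow F q).biUnion fun z => (curveFiber H z).image fun y => (z, y)

namespace IsWeightedMonic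

lemma mem_curveFiber (h : IsWeightedMonic H c d) {z y : F} :
    y ∈ curveFiber H z ↔ (H.map (evalRingHom z)).eval y = 0 := by
  classical
  simp [curveFiber, (h.monic.map (evalRingHom z)).ne_zero]

lemma mem_curvePoints (h : IsWeightedMonic H c d) {q : ℕ} (hq : 1 < q) {x : F × F} :
    x ∈ curvePoints H q ↔ x.1 ^ q = x.1 ∧ (H.map (evalRingHom x.1)).eval x.2 = 0 := by
  classical
  obtain ⟨z, y⟩ := x
  simp only [curvePoints, Finset.mem_biUnion, Finset.mem_image, mem_fixedPow hq, h.mem_curveFiber,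
    Prod.mk.injEq]
  constructor
  · rintro ⟨z', h1, y', h2, rfl, rfl⟩
    exact ⟨h1, h2⟩
  · rintro ⟨h1, h2⟩
    exact ⟨z, h1, y, h2, rfl, rfl⟩

lemma card_curvePoints (q : ℕ) :
    (curvePoints H q).card = ∑ z ∈ fixedPow F q, (curveFiber H z).card := by
  classical
  rw [curvePoints, Finset.card_biUnion]
  · refine Finset.sum_congr rfl fun z _ => Finset.card_image_of_injective _ fun y y' hy => ?_
    simpa using hy
  · intro z _ z' _ hz
    rw [Function.onFun, Finset.disjoint_left]
    rintro x hx hx'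
    obtain ⟨y, -, rfl⟩ := Finset.mem_image.1 hx
    obtain ⟨y', -, h2⟩ := Finset.mem_image.1 hx'
    exact hz (Prod.mk.inj h2).1.symm

lemma natDegree_map (h : IsWeightedMonic H c d) (z : F) :
    (H.map (evalRingHom z)).natDegree = d := by
  rw [h.monic.natDegree_map, h.natDegree_eq]

/-- A set of critical points of the projection to the `z`-coordinate. -/
lemma card_le_of_derivative_eq_zero (h : IsWeightedMonic H c d) (hH : Irreducible H)
    (hd : (d : F) ≠ 0) (N : Finset (F × F))
    (hN : ∀ x ∈ N, (H.map (evalRingHom x.1)).eval x.2 = 0)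
    (hN' : ∀ x ∈ N, ((derivative H).map (evalRingHom x.1)).eval x.2 = 0) :
    N.card ≤ d * (c * d) := by
  have := isDomain hH
  obtain ⟨P, hP, hPN⟩ := exists_finset_algHom N hN
  rw [← hP]
  refine h.monomialBasis.card_zeros_le P h.deriv_mem_fil (h.deriv_ne_zero hd) fun σ hσ => ?_
  rw [deriv, algHom_eval₂]
  exact hN' _ (hPN σ hσ)

lemma exists_double_point [IsAlgClosed F] (h : IsWeightedMonic H c d) {z : F}
    (hz : (curveFiber H z).card ≠ d) : ∃ y, (H.map (evalRingHom z)).eval y = 0 ∧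
      ((derivative H).map (evalRingHom z)).eval y = 0 := by
  classical
  by_contra! hcon
  apply hz
  rw [curveFiber, ← h.natDegree_map z, ← IsAlgClosed.card_roots_eq_natDegree]
  refine Multiset.toFinset_card_of_nodup ?_
  refine nodup_roots ?_
  refine isCoprime_of_irreducible_dvd (fun h1 => (h.monic.map (evalRingHom z)).ne_zero h1.1) ?_
  intro g hg hg1 hg2
  obtain ⟨y, hy⟩ := IsAlgClosed.exists_root g (degree_pos_of_irreducible hg).ne'
  refine hcon y ?_ ?_
  · exact hy.dvd hg1
  · rw [← derivative_map]
    exact hy.dvd hg2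

lemma sum_card_curveFiber_ge [IsAlgClosed F] (h : IsWeightedMonic H c d) (hH : Irreducible H)
    (hd : (d : F) ≠ 0) (T : Finset F) :
    d * T.card ≤ ∑ z ∈ T, (curveFiber H z).card + d * (d * (c * d)) := by
  classical
  let bad := T.filter fun z => (curveFiber H z).card ≠ d
  have hbad : bad.card ≤ d * (c * d) := by
    choose! y hy hy' using fun z (hz : z ∈ bad) =>
      h.exists_double_point (Finset.mem_filter.1 hz).2
    have := h.card_le_of_derivative_eq_zero hH hd (bad.image fun z => (z, y z))
      (fun x hx => by obtain ⟨z, hz, rfl⟩ := Finset.mem_image.1 hx; exact hy z hz)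
      (fun x hx => by obtain ⟨z, hz, rfl⟩ := Finset.mem_image.1 hx; exact hy' z hz)
    rwa [Finset.card_image_of_injective] at this
    intro z z' hz
    exact (Prod.mk.inj hz).1
  rw [← Finset.sum_filter_add_sum_filter_not T (fun z => (curveFiber H z).card ≠ d),
    ← Finset.card_filter_add_card_filter_not (s := T) (fun z => (curveFiber H z).card ≠ d), mul_add]
  have h1 : ∑ z ∈ T with ¬ (curveFiber H z).card ≠ d, (curveFiber H z).card =
      d * (T.filter fun z => ¬ (curveFiber H z).card ≠ d).card := by
    rw [Finset.sum_congr rfl (g := fun _ => d), Finset.sum_const, smul_eq_mul, mul_comm]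
    intro z hz
    simpa using (Finset.mem_filter.1 hz).2
  rw [h1]
  have h2 : d * (T.filter fun z => (curveFiber H z).card ≠ d).card ≤ _ :=
    Nat.mul_le_mul_left d hbad
  omega

lemma exists_smooth_point [IsAlgClosed F] (h : IsWeightedMonic H c d) (hH : Irreducible H)
    (hd : (d : F) ≠ 0) : ∃ z y, (H.map (evalRingHom z)).eval y = 0 ∧
      ((derivative H).map (evalRingHom z)).eval y ≠ 0 := by
  classical
  have hd0 : d ≠ 0 := by rintro rfl; simp at hd
  obtain ⟨T, hT⟩ := Infinite.exists_subset_card_eq F (d * (c * d) + 1)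
  have hr : ∀ z, ∃ y, (H.map (evalRingHom z)).eval y = 0 := by
    intro z
    refine IsAlgClosed.exists_root _ ?_
    rw [degree_eq_natDegree (h.monic.map (evalRingHom z)).ne_zero, h.natDegree_map]
    exact_mod_cast hd0
  choose y hy using hr
  by_contra! hcon
  have := h.card_le_of_derivative_eq_zero hH hd (T.image fun z => (z, y z))
    (fun x hx => by obtain ⟨z, hz, rfl⟩ := Finset.mem_image.1 hx; exact hy z)
    (fun x hx => by obtain ⟨z, hz, rfl⟩ := Finset.mem_image.1 hx; exact hcon _ _ (hy z))
  rw [Finset.card_image_of_injective, hT] at this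
  · omega
  · intro z z' hz
    exact (Prod.mk.inj hz).1

end IsWeightedMonic

end CurveCount

section CurveCount
open Polynomial

variable {F : Type} [Field F] {H : F[X][X]} {c d : ℕ}

lemma eval_frobenius {p ν : ℕ} [Fact p.Prime] [CharP F p]
    (hfix : H.map (mapRingHom (iterateFrobenius F p ν)) = H) {z : F} (hz : z ^ p ^ ν = z) (y : F) :
    (H.map (evalRingHom z)).eval (y ^ p ^ ν) = (H.map (evalRingHom z)).eval y ^ p ^ ν := by
  have h1 : ∀ x : F, x ^ p ^ ν = iterateFrobenius F p ν x := fun x =>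
    (iterateFrobenius_def p ν x).symm
  have h2 : (evalRingHom z).comp (mapRingHom (iterateFrobenius F p ν)) =
      (iterateFrobenius F p ν).comp (evalRingHom z) := by
    refine Polynomial.ringHom_ext (fun a => by simp) ?_
    simp [← h1, hz]
  conv_lhs => rw [← hfix]
  rw [h1, h1, map_map, h2, ← map_map, eval_map, eval₂_at_apply]

lemma exists_abs_card_sub_le (p c d : ℕ) [hp : Fact p.Prime] (hd : ¬ p ∣ d) : ∃ S : ℕ,
    ∀ {F : Type} [Field F] [CharP F p] [IsAlgClosed F] {H : F[X][X]} (_ : IsWeightedMonic H c d)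
      (_ : Irreducible H) (ν : ℕ) (_ : 1 ≤ ν)
      (_ : H.map (mapRingHom (iterateFrobenius F p ν)) = H) (N : Finset (F × F))
      (_ : ∀ x, x ∈ N ↔ x.1 ^ p ^ ν = x.1 ∧ x.2 ^ p ^ ν = x.2 ∧
        (H.map (evalRingHom x.1)).eval x.2 = 0),
      |(N.card : ℤ) - (p ^ ν : ℕ)| ≤ (S * p ^ (ν - ν / 2) : ℕ) := by
  classical
  obtain ⟨S₁, hS₁⟩ := exists_card_le_of_frobenius_root p c d 1
  obtain ⟨S₂, hS₂⟩ := exists_card_le_of_frobenius_root p c d (d - 1)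
  refine ⟨S₁ + S₂ + d * (d * (c * d)), ?_⟩
  intro F _ _ _ H h hH ν hν hfix N hN
  have hdF : (d : F) ≠ 0 := by rwa [Ne, CharP.cast_eq_zero_iff F p]
  have hd0 : d ≠ 0 := by rintro rfl; simp at hd
  have hq : 1 < p ^ ν := Nat.one_lt_pow (by omega) hp.out.one_lt
  have hpow : 0 < p ^ (ν - ν / 2) := pow_pos hp.out.pos _
  have := IsWeightedMonic.isDomain hH
  obtain ⟨z₀, y₀, h0, h1⟩ := h.exists_smooth_point hH hdF
  obtain ⟨f, hf, hfz⟩ := h.exists_powerSeries hH h0 h1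
  have hlow := h.sum_card_curveFiber_ge hH hdF (fixedPow F (p ^ ν))
  rw [card_fixedPow hν, ← IsWeightedMonic.card_curvePoints] at hlow
  have hNsub : N ⊆ curvePoints H (p ^ ν) := fun x hx => by
    rw [h.mem_curvePoints hq]
    exact ⟨((hN x).1 hx).1, ((hN x).1 hx).2.2⟩
  -- the points fixed by Frobenius
  have hup : N.card ≤ 1 * p ^ ν + S₁ * p ^ (ν - ν / 2) := by
    obtain ⟨P, hP, hPN⟩ := IsWeightedMonic.exists_finset_algHom N fun x hx => ((hN x).1 hx).2.2
    rw [← hP]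
    refine hS₁ h.monomialBasis f z₀ hf hfz (X - C (AdjoinRoot.root H)) (monic_X_sub_C _)
      (natDegree_X_sub_C _) ?_ ν hν P (fun σ hσ => ((hN _).1 (hPN σ hσ)).1) fun σ hσ => ?_
    · rw [natDegree_X_sub_C]
      intro i hi
      interval_cases i
      · have := h.monomialBasis.y_mem
        rw [IsWeightedMonic.monomialBasis_y] at this
        simpa using this
      · simpa [coeff_X_one, coeff_C] using h.monomialBasis.one_mem
    · rw [IsWeightedMonic.monomialBasis_y, ((hN _).1 (hPN σ hσ)).2.1]
      simp
  -- the other points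
  have hup' : (curvePoints H (p ^ ν) \ N).card ≤ (d - 1) * p ^ ν + S₂ * p ^ (ν - ν / 2) := by
    obtain ⟨P, hP, hPN⟩ := IsWeightedMonic.exists_finset_algHom (curvePoints H (p ^ ν) \ N)
      fun x hx => ((h.mem_curvePoints hq).1 (Finset.mem_sdiff.1 hx).1).2
    rw [← hP]
    set G := H.map (AdjoinRoot.of H) /ₘ (X - C (AdjoinRoot.root H)) with hG
    have hHm : (H.map (AdjoinRoot.of H)).Monic := h.monic.map _
    have hmul : (X - C (AdjoinRoot.root H)) * G = H.map (AdjoinRoot.of H) :=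
      mul_divByMonic_eq_iff_isRoot.2 (by rw [IsRoot.def, eval_map, AdjoinRoot.eval₂_root])
    have hGd : G.natDegree = d - 1 := by
      rw [hG, natDegree_divByMonic _ (monic_X_sub_C _), natDegree_X_sub_C, h.monic.natDegree_map,
        h.natDegree_eq]
    refine hS₂ h.monomialBasis f z₀ hf hfz G ?_ hGd ?_ ν hν P
      (fun σ hσ => ((h.mem_curvePoints hq).1 (Finset.mem_sdiff.1 (hPN σ hσ)).1).1) fun σ hσ => ?_
    · exact Monic.of_mul_monic_left (monic_X_sub_C _) (by rwa [hmul])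
    · intro i hi
      rw [hGd] at hi ⊢
      rw [hG, coeff_divByMonic_X_sub_C]
      refine Submodule.sum_mem _ fun j hj => ?_
      rw [Finset.mem_Icc, h.monic.natDegree_map, h.natDegree_eq] at hj
      rw [coeff_map]
      refine h.monomialBasis.fil_mono ?_ (h.monomialBasis.mul_mem
        (h.monomialBasis.pow_mem h.monomialBasis.y_mem (j - (i + 1)))
        (h.of_mem_fil (h.natDegree_coeff_le j hj.2)))
      rw [mul_comm _ c, ← mul_add]
      exact Nat.mul_le_mul_left _ (by omega)
    · obtain ⟨h3, h4⟩ := Finset.mem_sdiff.1 (hPN σ hσ)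
      rw [h.mem_curvePoints hq] at h3
      rw [hN, not_and, not_and] at h4
      have h5 : σ (AdjoinRoot.root H) ^ p ^ ν - σ (AdjoinRoot.root H) ≠ 0 := fun h6 =>
        h4 h3.1 (sub_eq_zero.1 h6) h3.2
      have h6 := congr_arg (eval₂ (σ : AdjoinRoot H →+* F) (σ (AdjoinRoot.root H) ^ p ^ ν)) hmul
      have h7 : (σ : AdjoinRoot H →+* F).comp (AdjoinRoot.of H)
          = evalRingHom (σ (AdjoinRoot.of H X)) := RingHom.ext (IsWeightedMonic.algHom_of σ)
      have h8 := eval_frobenius hfix h3.1 (σ (AdjoinRoot.root H))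
      rw [h3.2, zero_pow (by omega)] at h8
      rw [eval₂_mul, eval₂_map, h7, ← eval_map (f := evalRingHom _), h8] at h6
      simp only [eval₂_sub, eval₂_X, eval₂_C, RingHom.coe_coe] at h6
      exact (mul_eq_zero.1 h6).resolve_left h5
  have hcard := Finset.card_sdiff_add_card_eq_card hNsub
  have h9 : d * (d * (c * d)) ≤ d * (d * (c * d)) * p ^ (ν - ν / 2) := Nat.le_mul_of_pos_right _ hpow
  have h10 : (d - 1) * p ^ ν + p ^ ν = d * p ^ ν := by
    obtain ⟨e, rfl⟩ := Nat.exists_eq_succ_of_ne_zero hd0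
    simp; ring
  rw [abs_le, add_mul, add_mul]
  constructor <;> omega

end CurveCount

section ArtinSchreier
open Polynomial

variable {F : Type} [Field F] {p : ℕ} [hp : Fact p.Prime] [CharP F p]

/-- The Artin–Schreier substitution `X ↦ X ^ p - X + b`. -/
noncomputable def artinSchreier (p : ℕ) (b : F) : F[X] →+* F[X] :=
  (aeval (X ^ p - X + C b) : F[X] →ₐ[F] F[X])

/-- The translation `X ↦ X + a`. -/
noncomputable def translateX (a : F) : F[X] →+* F[X] := (aeval (X + C a) : F[X] →ₐ[F] F[X])

lemma translateX_translateX (a b : F) (f : F[X]) :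
    translateX a (translateX b f) = translateX (a + b) f := by
  have : (translateX a).comp (translateX b) = translateX (a + b) := by
    refine Polynomial.ringHom_ext (fun c => by simp [translateX]) ?_
    simp [translateX, add_assoc]
  exact RingHom.congr_fun this f

lemma translateX_zero (f : F[X]) : translateX 0 f = f := by simp [translateX]

lemma natDegree_artinSchreier_gen (b : F) : (X ^ p - X + C b : F[X]).natDegree = p := by
  rw [natDegree_add_C]
  exact FiniteField.X_pow_card_sub_X_natDegree_eq F hp.out.one_lt

lemma monic_artinSchreier_gen (b : F) : (X ^ p - X + C b : F[X]).Monic := by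
  have h1 : (X ^ p + (-X + C b) : F[X]).Monic := by
    refine monic_X_pow_add ?_
    refine lt_of_le_of_lt (degree_add_le _ _) (max_lt ?_ ?_)
    · rw [degree_neg, degree_X]; exact_mod_cast hp.out.one_lt
    · exact lt_of_le_of_lt degree_C_le (by exact_mod_cast hp.out.pos)
  convert h1 using 1; ring

lemma natDegree_artinSchreier (b : F) (f : F[X]) :
    (artinSchreier p b f).natDegree = p * f.natDegree := by
  change (aeval (X ^ p - X + C b) f).natDegree = _
  rw [← comp_eq_aeval, natDegree_comp, natDegree_artinSchreier_gen, mul_comm]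

lemma artinSchreier_injective (b : F) : Function.Injective (artinSchreier p b) := by
  rw [injective_iff_map_eq_zero]
  intro f hf
  change aeval (X ^ p - X + C b) f = 0 at hf
  by_contra h0
  refine h0 ?_
  rw [← comp_eq_aeval, comp_eq_zero_iff] at hf
  rcases hf with h | ⟨-, h⟩
  · exact h
  · have := congr_arg natDegree h
    rw [natDegree_artinSchreier_gen, natDegree_C] at this
    exact absurd this hp.out.ne_zero

lemma translateX_artinSchreier (b : F) (f : F[X]) :
    translateX 1 (artinSchreier p b f) = artinSchreier p b f := by
  have : (translateX 1).comp (artinSchreier p b) = artinSchreier p b := by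
    refine Polynomial.ringHom_ext (fun c => by simp [translateX, artinSchreier]) ?_
    simp [translateX, artinSchreier, add_pow_char]
  exact RingHom.congr_fun this f

lemma translateX_monic_divMod (a : F) {f g : F[X]} (hg : g.Monic) (hga : translateX a g = g)
    (hfa : translateX a f = f) : translateX a (f /ₘ g) = f /ₘ g ∧ translateX a (f %ₘ g) = f %ₘ g := by
  have hd : ∀ h : F[X], (translateX a h).degree = h.degree := by
    intro h
    change (aeval (X + C a) h).degree = _
    rw [← comp_eq_aeval, ← taylor_apply, degree_taylor]
  have h1 := congr_arg (translateX a) (modByMonic_add_div f g)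
  rw [map_add, map_mul, hga, hfa] at h1
  have := div_modByMonic_unique _ _ hg ⟨h1, by rw [hd]; exact degree_modByMonic_lt _ hg⟩
  exact ⟨this.1.symm, this.2.symm⟩

lemma exists_artinSchreier_eq (b : F) (n : ℕ) : ∀ f : F[X], f.natDegree ≤ n → translateX 1 f = f →
    ∃ g, artinSchreier p b g = f := by
  induction n using Nat.strong_induction_on with
  | _ n ih =>
    intro f hn hf
    set g : F[X] := X ^ p - X + C b with hg
    have hgm : g.Monic := monic_artinSchreier_gen b
    have hgd : g.natDegree = p := natDegree_artinSchreier_gen b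
    have hga : translateX 1 g = g := by
      have := translateX_artinSchreier (p := p) b X
      have hX : artinSchreier p b X = g := by simp [artinSchreier, hg]
      rwa [hX] at this
    obtain ⟨hq, hr⟩ := translateX_monic_divMod 1 hgm hga hf
    have hrd : (f %ₘ g).natDegree < p := by
      rw [← hgd]
      exact natDegree_modByMonic_lt _ hgm (fun h => by
        rw [h, natDegree_one] at hgd; exact hp.out.ne_zero hgd.symm)
    have hrC : f %ₘ g = C ((f %ₘ g).eval 0) := by
      set r := f %ₘ g
      have hev : ∀ i : ℕ, r.eval (i : F) = r.eval 0 := by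
        intro i
        induction i with
        | zero => simp
        | succ i ih =>
          rw [← ih]
          conv_rhs => rw [← hr]
          change _ = (aeval (X + C (1 : F)) r).eval _
          rw [← comp_eq_aeval, eval_comp]
          simp
      rw [← sub_eq_zero]
      classical
      by_contra h0
      have hinj : Set.InjOn (fun i : ℕ => (i : F)) (Finset.range p) := by
        intro i hi j hj hij
        simp only [Finset.coe_range, Set.mem_Iio] at hi hj
        exact CharP.natCast_injOn_Iio F p hi hj hij
      have := card_le_degree_of_subset_roots (p := r - C (r.eval 0))
        (Z := (Finset.range p).image fun i : ℕ => (i : F)) (by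
          intro x hx
          obtain ⟨i, -, rfl⟩ := Finset.mem_image.1 (Finset.mem_def.2 hx)
          rw [mem_roots h0, IsRoot.def, eval_sub, eval_C, hev, sub_self])
      rw [Finset.card_image_of_injOn hinj, Finset.card_range, natDegree_sub_C] at this
      omega
    have hfd := modByMonic_add_div f g
    by_cases hn0 : f.natDegree < p
    · refine ⟨C (f.eval 0), ?_⟩
      have : f %ₘ g = f := (modByMonic_eq_self_iff hgm).2 (by
        exact degree_lt_degree (by rw [hgd]; exact hn0))
      rw [this] at hrC
      conv_rhs => rw [hrC]
      simp [artinSchreier]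
    · have hp0 := hp.out.pos
      have h1 : (f /ₘ g).natDegree < n := by
        rw [natDegree_divByMonic _ hgm, hgd]; omega
      obtain ⟨h, hh⟩ := ih _ h1 _ le_rfl hq
      refine ⟨C ((f %ₘ g).eval 0) + X * h, ?_⟩
      rw [map_add, map_mul, hh]
      have h2 : artinSchreier p b X = g := by simp [artinSchreier, hg]
      have h3 : artinSchreier p b (C ((f %ₘ g).eval 0)) = f %ₘ g := by
        conv_rhs => rw [hrC]
        simp [artinSchreier]
      rw [h2, h3, hfd]

variable {H : F[X][X]} {c d : ℕ}

lemma IsWeightedMonic.artinSchreier (h : IsWeightedMonic H c d) (b : F) :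
    IsWeightedMonic (H.map (artinSchreier p b)) (p * c) d where
  monic := h.monic.map _
  natDegree_eq := by rw [h.monic.natDegree_map, h.natDegree_eq]
  natDegree_coeff_le i hi := by
    rw [coeff_map, natDegree_artinSchreier, mul_assoc]
    exact Nat.mul_le_mul_left _ (h.natDegree_coeff_le i hi)

lemma irreducible_map_artinSchreier (b : F) (hm : H.Monic) (hH : Irreducible H)
    (hd : H.natDegree.Coprime p) : Irreducible (H.map (artinSchreier p b)) := by
  have hm' := hm.map (artinSchreier p b)
  rw [hm'.irreducible_iff_natDegree]
  refine ⟨fun h1 => ?_, fun P Q hP hQ hPQ => ?_⟩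
  · have := congr_arg natDegree h1
    rw [hm.natDegree_map, natDegree_one] at this
    rw [this] at hd
    exact hp.out.one_lt.ne' (by simpa using hd)
  -- the norm of a monic factor
  have key : ∀ P : F[X][X], P.Monic → ∃ P' : F[X][X], P'.Monic ∧
      P'.natDegree = p * P.natDegree ∧ P'.map (artinSchreier p b) =
        ∏ i ∈ Finset.range p, P.map (translateX (i : F)) := by
    intro P hP
    set M := ∏ i ∈ Finset.range p, P.map (translateX (i : F)) with hM
    have hMm : M.Monic := monic_prod_of_monic _ _ fun i _ => hP.map _
    have hMt : M.map (translateX 1) = M := by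
      have h1 : ∀ i : ℕ, (P.map (translateX (i : F))).map (translateX 1) =
          P.map (translateX ((i + 1 : ℕ) : F)) := by
        intro i
        rw [map_map]
        congr 1
        refine RingHom.ext fun f => ?_
        rw [RingHom.comp_apply, translateX_translateX, Nat.cast_succ, add_comm]
      rw [hM, Polynomial.map_prod, Finset.prod_congr rfl fun i _ => h1 i]
      have h2 := Finset.prod_range_succ' (fun i : ℕ => P.map (translateX (i : F))) p
      rw [Finset.prod_range_succ, CharP.cast_eq_zero, Nat.cast_zero] at h2
      exact (mul_right_cancel₀ (hP.map _).ne_zero h2).symm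
    have hlift : M ∈ lifts (artinSchreier p b) := by
      rw [lifts_iff_coeff_lifts]
      intro n
      refine exists_artinSchreier_eq b _ (M.coeff n) le_rfl ?_
      conv_rhs => rw [← hMt]
      rw [coeff_map]
    obtain ⟨P', h1, h2, h3⟩ := lifts_and_natDegree_eq_and_monic hlift hMm
    refine ⟨P', h3, ?_, h1⟩
    rw [h2, hM, natDegree_prod_of_monic _ _ fun i _ => hP.map _]
    simp [hP.natDegree_map]
  obtain ⟨P', hP'm, hP'd, hP'⟩ := key P hP
  obtain ⟨Q', hQ'm, hQ'd, hQ'⟩ := key Q hQ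
  have hmul : P' * Q' = H ^ p := by
    apply map_injective _ (artinSchreier_injective (p := p) b)
    rw [Polynomial.map_mul, hP', hQ', Polynomial.map_pow, ← Finset.prod_mul_distrib]
    rw [Finset.prod_congr rfl (g := fun _ => H.map (artinSchreier p b)), Finset.prod_const,
      Finset.card_range]
    intro i hi
    rw [← Polynomial.map_mul, hPQ, map_map]
    congr 1
    refine RingHom.ext fun f => ?_
    rw [RingHom.comp_apply]
    clear hP' hQ'
    clear hi
    induction i with
    | zero => rw [Nat.cast_zero, translateX_zero]
    | succ i ih => rw [Nat.cast_succ, ← translateX_translateX, translateX_artinSchreier, ih]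
  obtain ⟨j, hj, hass⟩ := (dvd_prime_pow hH.prime p).1 (Dvd.intro Q' hmul)
  have h1 := eq_of_monic_of_associated hP'm (hm.pow j) hass
  have h2 := congr_arg natDegree h1
  rw [hP'd, hm.natDegree_pow] at h2
  have hdeg : P.natDegree + Q.natDegree = H.natDegree := by
    rw [← hP.natDegree_mul hQ, hPQ, hm.natDegree_map]
  have hpj : p ∣ j := hd.symm.dvd_of_dvd_mul_right (Dvd.intro _ h2)
  obtain ⟨e, rfl⟩ := hpj
  have hp0 := hp.out.pos
  have he : e ≤ 1 := by
    by_contra! he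
    have := Nat.mul_le_mul_left p he
    omega
  rw [mul_assoc] at h2
  have h3 := Nat.eq_of_mul_eq_mul_left hp0 h2
  interval_cases e
  · left; omega
  · right; omega

end ArtinSchreier

section TwistedCount
open Polynomial

variable {F : Type} [Field F] {p : ℕ} [hp : Fact p.Prime] [CharP F p]

/-- The trace from the field with `p ^ ν` elements, as a function on an extension. -/
def frobTrace (p ν : ℕ) (x : F) : F := ∑ i ∈ Finset.range ν, x ^ p ^ i

lemma frobTrace_add (ν : ℕ) (x y : F) : frobTrace p ν (x + y) = frobTrace p ν x + frobTrace p ν y := by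
  simp [frobTrace, add_pow_char_pow, Finset.sum_add_distrib]

lemma frobTrace_pow_sub (ν : ℕ) (x : F) : frobTrace p ν (x ^ p - x) = x ^ p ^ ν - x := by
  simp_rw [frobTrace, sub_pow_char_pow, ← pow_mul, ← pow_succ']
  rw [Finset.sum_range_sub (fun i => x ^ p ^ i), pow_zero, pow_one]

lemma card_roots_artinSchreier [IsAlgClosed F] {q : ℕ} (hq : 1 < q) (hq0 : (q : F) = 0) (a : F) :
    ∃ T : Finset F, T.card = q ∧ ∀ z, z ∈ T ↔ z ^ q - z = a := by
  classical
  have hne : (X ^ q - X - C a : F[X]).natDegree = q := by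
    rw [natDegree_sub_C]
    exact FiniteField.X_pow_card_sub_X_natDegree_eq F hq
  have hne0 : (X ^ q - X - C a : F[X]) ≠ 0 := by
    intro h
    rw [h, natDegree_zero] at hne
    omega
  have hsep : (X ^ q - X - C a : F[X]).Separable := by
    rw [separable_def]
    refine ⟨0, -1, ?_⟩
    simp only [derivative_sub, derivative_X_pow, derivative_X, hq0, C_0, derivative_C]
    ring
  refine ⟨(X ^ q - X - C a : F[X]).roots.toFinset, ?_, fun z => ?_⟩
  · rw [Multiset.toFinset_card_of_nodup (nodup_roots hsep), IsAlgClosed.card_roots_eq_natDegree, hne]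
  · simp [hne0, sub_eq_zero]

variable {H : F[X][X]}

lemma map_artinSchreier_eval (b z : F) : (H.map (artinSchreier p b)).map (evalRingHom z) =
    H.map (evalRingHom (z ^ p - z + b)) := by
  rw [map_map]
  congr 1
  refine Polynomial.ringHom_ext (fun a => ?_) ?_ <;> simp [artinSchreier]

lemma map_artinSchreier_frobenius {ν : ℕ} {b : F} (hb : b ^ p ^ ν = b)
    (hfix : H.map (mapRingHom (iterateFrobenius F p ν)) = H) :
    (H.map (artinSchreier p b)).map (mapRingHom (iterateFrobenius F p ν)) =
      H.map (artinSchreier p b) := by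
  conv_rhs => rw [← hfix]
  rw [map_map, map_map]
  congr 1
  refine Polynomial.ringHom_ext (fun a => ?_) ?_
  · simp [artinSchreier]
  · simp [artinSchreier, iterateFrobenius_def, hb]

lemma exists_abs_card_twist_sub_le (p c d : ℕ) [hp : Fact p.Prime] (hd : d.Coprime p) : ∃ S : ℕ,
    ∀ {F : Type} [Field F] [CharP F p] [IsAlgClosed F] {H : F[X][X]} (_ : IsWeightedMonic H c d)
      (_ : Irreducible H) (ν : ℕ) (_ : 1 ≤ ν)
      (_ : H.map (mapRingHom (iterateFrobenius F p ν)) = H) (a : F) (_ : a ^ p = a)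
      (N : Finset (F × F))
      (_ : ∀ x, x ∈ N ↔ x.1 ^ p ^ ν = x.1 ∧ x.2 ^ p ^ ν = x.2 ∧
        (H.map (evalRingHom x.1)).eval x.2 = 0 ∧ frobTrace p ν x.1 = a),
      |((p * N.card : ℕ) : ℤ) - (p ^ ν : ℕ)| ≤ (S * p ^ (ν - ν / 2) : ℕ) := by
  classical
  have hpd : ¬ p ∣ d := hp.out.coprime_iff_not_dvd.1 hd.symm
  obtain ⟨S, hS⟩ := exists_abs_card_sub_le p (p * c) d hpd
  refine ⟨S, ?_⟩
  intro F _ _ _ H h hH ν hν hfix a ha N hN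
  have hq : 1 < p ^ ν := Nat.one_lt_pow (by omega) hp.out.one_lt
  have hp0 : ((p : ℕ) : F) = 0 := CharP.cast_eq_zero F p
  have hq0 : ((p ^ ν : ℕ) : F) = 0 := by rw [Nat.cast_pow, hp0, zero_pow (by omega)]
  obtain ⟨T, hT, hT'⟩ := card_roots_artinSchreier hq hq0 a
  obtain ⟨w, hw⟩ : T.Nonempty := Finset.card_pos.1 (by omega)
  rw [hT'] at hw
  set b := w ^ p - w with hb
  have hbtr : frobTrace p ν b = a := by rw [hb, frobTrace_pow_sub, hw]
  have hbq : b ^ p ^ ν = b := by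
    rw [hb, sub_pow_char_pow, ← pow_mul, mul_comm, pow_mul, eq_add_of_sub_eq hw, add_pow_char, ha]
    ring
  have hWM := h.artinSchreier (p := p) b
  have hpts : ∀ x : F × F, x ∈ (curvePoints (H.map (artinSchreier p b)) (p ^ ν)).filter
      (fun x => x.2 ^ p ^ ν = x.2) ↔ x.1 ^ p ^ ν = x.1 ∧ x.2 ^ p ^ ν = x.2 ∧
        ((H.map (artinSchreier p b)).map (evalRingHom x.1)).eval x.2 = 0 := by
    intro x
    rw [Finset.mem_filter, hWM.mem_curvePoints hq]
    tauto
  have key := hS hWM (irreducible_map_artinSchreier b h.monic hH (by rwa [h.natDegree_eq])) ν hν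
    (map_artinSchreier_frobenius hbq hfix) _ hpts
  convert key using 4
  refine Eq.symm ((Finset.card_eq_sum_card_fiberwise
    (f := fun x : F × F => (x.1 ^ p - x.1 + b, x.2)) (t := N) ?_).trans ?_)
  · rintro ⟨z, y⟩ hx
    rw [Finset.mem_coe, hpts] at hx
    rw [map_artinSchreier_eval] at hx
    obtain ⟨h1, h2, h3⟩ := hx
    simp only at h1 h2 h3
    rw [Finset.mem_coe, hN]
    refine ⟨?_, h2, h3, ?_⟩
    · simp only
      rw [add_pow_char_pow, sub_pow_char_pow, hbq, ← pow_mul, mul_comm, pow_mul, h1]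
    · simp only
      rw [frobTrace_add, frobTrace_pow_sub, hbtr, h1, sub_self, zero_add]
  · rw [Finset.sum_congr rfl (g := fun _ => p), Finset.sum_const, smul_eq_mul, mul_comm]
    rintro ⟨t, y⟩ hty
    rw [hN] at hty
    obtain ⟨h1, h2, h3, h4⟩ := hty
    obtain ⟨T', hT'c, hT''⟩ := card_roots_artinSchreier hp.out.one_lt hp0 (t - b)
    refine Eq.trans ?_ hT'c
    conv_rhs => rw [← Finset.card_image_of_injective T' (f := fun z => (z, y))
      (fun z z' hz => (Prod.mk.inj hz).1)]
    congr 1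
    ext ⟨z, y'⟩
    simp only [Finset.mem_filter, hWM.mem_curvePoints hq, Finset.mem_image, Prod.mk.injEq, hT'',
      map_artinSchreier_eval]
    constructor
    · rintro ⟨-, h5, rfl⟩
      exact ⟨z, eq_sub_of_add_eq h5, rfl, rfl⟩
    · rintro ⟨z', h5, rfl, rfl⟩
      have h6 : z' ^ p - z' + b = t := by rw [h5, sub_add_cancel]
      have h7 : frobTrace p ν (z' ^ p - z') = 0 := by
        have := frobTrace_add (p := p) ν (z' ^ p - z') b
        rw [h6, h4, hbtr] at this
        simpa using this.symm
      rw [frobTrace_pow_sub, sub_eq_zero] at h7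
      rw [h6]
      exact ⟨⟨⟨h7, h3⟩, h2⟩, rfl, rfl⟩

end TwistedCount

section InftyFiltration
open Module Polynomial

variable (k : Type*) [Field k]

/-- The rational functions of degree at most `m`. -/
noncomputable def ratDegLE (m : ℤ) : Submodule k (RatFunc k) where
  carrier := {f | f = 0 ∨ f.intDegree ≤ m}
  zero_mem' := Or.inl rfl
  add_mem' := by
    intro f g hf hg
    by_cases hf0 : f = 0
    · simpa [hf0] using hg
    by_cases hg0 : g = 0
    · simpa [hg0] using hf
    by_cases h : f + g = 0
    · exact Or.inl h
    right
    exact (RatFunc.intDegree_add_le hg0 h).trans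
      (max_le (hf.resolve_left hf0) (hg.resolve_left hg0))
  smul_mem' := by
    intro a f hf
    rw [Set.mem_ofPred_eq, RatFunc.smul_eq_C_mul]
    by_cases hf0 : f = 0
    · simp [hf0]
    by_cases ha : a = 0
    · simp [ha]
    right
    rw [RatFunc.intDegree_mul (by simpa using ha) hf0, RatFunc.intDegree_C, zero_add]
    exact hf.resolve_left hf0

variable {k}

lemma mem_ratDegLE {m : ℤ} {f : RatFunc k} : f ∈ ratDegLE k m ↔ f = 0 ∨ f.intDegree ≤ m := Iff.rfl

lemma ratDegLE_mono {m n : ℤ} (h : m ≤ n) : ratDegLE k m ≤ ratDegLE k n :=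
  fun _ hf => hf.imp_right fun h' => h'.trans h

lemma mul_mem_ratDegLE {m n : ℤ} {f g : RatFunc k} (hf : f ∈ ratDegLE k m)
    (hg : g ∈ ratDegLE k n) : f * g ∈ ratDegLE k (m + n) := by
  by_cases hf0 : f = 0
  · simp [hf0]
  by_cases hg0 : g = 0
  · simp [hg0]
  right
  rw [RatFunc.intDegree_mul hf0 hg0]
  exact add_le_add (hf.resolve_left hf0) (hg.resolve_left hg0)

lemma one_mem_ratDegLE : (1 : RatFunc k) ∈ ratDegLE k 0 := Or.inr RatFunc.intDegree_one.le

lemma intDegree_X_zpow (m : ℤ) : ((RatFunc.X : RatFunc k) ^ m).intDegree = m := by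
  have hX : (RatFunc.X : RatFunc k) ≠ 0 := RatFunc.X_ne_zero
  have h1 : ∀ n : ℕ, ((RatFunc.X : RatFunc k) ^ n).intDegree = n := by
    intro n
    induction n with
    | zero => simp
    | succ n ih => rw [pow_succ, RatFunc.intDegree_mul (pow_ne_zero _ hX) hX, ih,
        RatFunc.intDegree_X]; push_cast; rfl
  obtain ⟨n, rfl | rfl⟩ := m.eq_nat_or_neg
  · simpa using h1 n
  · rw [zpow_neg, RatFunc.intDegree_inv, zpow_natCast, h1]

lemma X_zpow_mem_ratDegLE (m : ℤ) : (RatFunc.X : RatFunc k) ^ m ∈ ratDegLE k m :=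
  Or.inr (intDegree_X_zpow m).le

lemma algebraMap_mem_ratDegLE {f : k[X]} {m : ℤ} :
    algebraMap k[X] (RatFunc k) f ∈ ratDegLE k m ↔ f = 0 ∨ (f.natDegree : ℤ) ≤ m := by
  rw [mem_ratDegLE, RatFunc.intDegree_polynomial,
    (IsFractionRing.injective k[X] (RatFunc k)).eq_iff' (map_zero _)]

lemma exists_sub_C_mul_mem {m : ℤ} {f : RatFunc k} (hf : f ∈ ratDegLE k m) :
    ∃ a : k, f - a • RatFunc.X ^ m ∈ ratDegLE k (m - 1) := by
  have hX : (RatFunc.X : RatFunc k) ≠ 0 := RatFunc.X_ne_zero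
  have key : ∀ g ∈ ratDegLE k 0, ∃ a : k, g - a • (1 : RatFunc k) ∈ ratDegLE k (-1) := by
    intro g hg
    by_cases h0 : g ∈ ratDegLE k (-1)
    · exact ⟨0, by simpa using h0⟩
    have hg0 : g ≠ 0 := fun h => h0 (h ▸ zero_mem _)
    have hdeg : g.intDegree = 0 := by
      have h1 := hg.resolve_left hg0
      have h2 : ¬ g.intDegree ≤ -1 := fun h => h0 (Or.inr h)
      omega
    have hnum := RatFunc.num_ne_zero hg0
    have hden := RatFunc.denom_ne_zero g
    have hnd : g.num.natDegree = g.denom.natDegree := by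
      rw [RatFunc.intDegree] at hdeg; omega
    refine ⟨g.num.leadingCoeff, ?_⟩
    have heq : g - g.num.leadingCoeff • (1 : RatFunc k) = algebraMap k[X] (RatFunc k)
        (g.num - C g.num.leadingCoeff * g.denom) / algebraMap k[X] (RatFunc k) g.denom := by
      have hne : algebraMap k[X] (RatFunc k) g.denom ≠ 0 := by simpa using hden
      rw [map_sub, map_mul, sub_div, RatFunc.num_div_denom, mul_div_assoc, div_self hne,
        RatFunc.smul_eq_C_mul, RatFunc.algebraMap_C]
    rw [heq]
    by_cases hz : g.num - C g.num.leadingCoeff * g.denom = 0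
    · simp [hz]
    right
    rw [RatFunc.intDegree_div ((map_ne_zero_iff _ (IsFractionRing.injective _ _)).2 hz)
      (by simpa using hden), RatFunc.intDegree_polynomial, RatFunc.intDegree_polynomial]
    have hlt : (g.num - C g.num.leadingCoeff * g.denom).degree < g.num.degree := by
      have hl : g.num.leadingCoeff ≠ 0 := leadingCoeff_ne_zero.2 hnum
      refine degree_sub_lt_left ?_ hnum ?_
      · rw [degree_C_mul hl, degree_eq_natDegree hnum, degree_eq_natDegree hden, hnd]
      · rw [leadingCoeff_mul, leadingCoeff_C, (RatFunc.monic_denom g).leadingCoeff, mul_one]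
    have := natDegree_lt_natDegree hz hlt
    omega
  obtain ⟨a, ha⟩ := key (f * RatFunc.X ^ (-m)) (by
    simpa using mul_mem_ratDegLE hf (X_zpow_mem_ratDegLE (-m)))
  refine ⟨a, ?_⟩
  have h2 := mul_mem_ratDegLE ha (X_zpow_mem_ratDegLE m)
  have h3 : (f * RatFunc.X ^ (-m) - a • (1 : RatFunc k)) * RatFunc.X ^ m
      = f - a • RatFunc.X ^ m := by
    rw [sub_mul, mul_assoc, ← zpow_add₀ hX]
    simp
  rw [h3] at h2
  convert h2 using 2
  ring

lemma smul_X_zpow_mem_iff {m : ℤ} {a : k} :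
    a • (RatFunc.X : RatFunc k) ^ m ∈ ratDegLE k (m - 1) ↔ a = 0 := by
  constructor
  · intro h
    by_contra ha
    have h2 := (ratDegLE k (m - 1)).smul_mem a⁻¹ h
    rw [smul_smul, inv_mul_cancel₀ ha, one_smul] at h2
    rcases h2 with h2 | h2
    · exact zpow_ne_zero m RatFunc.X_ne_zero h2
    · rw [intDegree_X_zpow] at h2; omega
  · rintro rfl
    simp

/-- A rational function is the sum of a polynomial and a function of negative degree. -/
lemma exists_sub_algebraMap_mem (f : RatFunc k) :
    ∃ g : k[X], f - algebraMap k[X] (RatFunc k) g ∈ ratDegLE k (-1) := by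
  have hden := RatFunc.denom_ne_zero f
  have hne : algebraMap k[X] (RatFunc k) f.denom ≠ 0 := by simpa using hden
  refine ⟨f.num / f.denom, ?_⟩
  have heq : f - algebraMap k[X] (RatFunc k) (f.num / f.denom) =
      algebraMap k[X] (RatFunc k) (f.num % f.denom) / algebraMap k[X] (RatFunc k) f.denom := by
    rw [eq_div_iff hne, sub_mul]
    have h1 : f * algebraMap k[X] (RatFunc k) f.denom = algebraMap k[X] (RatFunc k) f.num :=
      (div_eq_iff hne).1 (RatFunc.num_div_denom f) |>.symm
    rw [h1, ← map_mul, ← map_sub]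
    congr 1
    rw [sub_eq_iff_eq_add, add_comm]
    rw [mul_comm]; exact (EuclideanDomain.div_add_mod f.num f.denom).symm
  rw [heq]
  by_cases hz : f.num % f.denom = 0
  · simp [hz]
  right
  rw [RatFunc.intDegree_div (by simpa using hz) hne, RatFunc.intDegree_polynomial,
    RatFunc.intDegree_polynomial]
  have := natDegree_lt_natDegree hz (EuclideanDomain.mod_lt f.num hden)
  omega

lemma prod_mem_ratDegLE {ι : Type*} (s : Finset ι) (f : ι → RatFunc k) (n : ι → ℤ)
    (h : ∀ i ∈ s, f i ∈ ratDegLE k (n i)) : ∏ i ∈ s, f i ∈ ratDegLE k (∑ i ∈ s, n i) := by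
  classical
  induction s using Finset.induction_on with
  | empty => simpa using one_mem_ratDegLE
  | insert a s ha ih =>
    rw [Finset.prod_insert ha, Finset.sum_insert ha]
    exact mul_mem_ratDegLE (h a (Finset.mem_insert_self a s))
      (ih fun i hi => h i (Finset.mem_insert_of_mem hi))

lemma det_mem_ratDegLE {ι : Type*} [Fintype ι] [DecidableEq ι] (M : Matrix ι ι (RatFunc k)) (m : ℤ)
    (h : ∀ i j, M i j ∈ ratDegLE k m) : M.det ∈ ratDegLE k (Fintype.card ι * m) := by
  rw [Matrix.det_apply']
  refine Submodule.sum_mem _ fun σ _ => ?_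
  have h1 := prod_mem_ratDegLE Finset.univ (fun i => M (σ i) i) (fun _ => m) fun i _ => h _ _
  rw [Finset.sum_const, Finset.card_univ, nsmul_eq_mul] at h1
  rcases Int.units_eq_one_or (Equiv.Perm.sign σ) with hs | hs
  · simpa [hs] using h1
  · simpa [hs] using h1

lemma prod_add_sub_prod_mem {ι : Type*} (s : Finset ι) (f g : ι → RatFunc k) {m : ℤ} (hm : m ≤ 0)
    (hf : ∀ i, f i ∈ ratDegLE k 0) (hg : ∀ i, g i ∈ ratDegLE k m) :
    ∏ i ∈ s, (f i + g i) - ∏ i ∈ s, f i ∈ ratDegLE k m := by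
  classical
  induction s using Finset.induction_on with
  | empty => simp
  | insert a s ha ih =>
    rw [Finset.prod_insert ha, Finset.prod_insert ha]
    have h1 : ∏ i ∈ s, f i ∈ ratDegLE k 0 := by
      simpa using prod_mem_ratDegLE s f (fun _ => 0) fun i _ => hf i
    have e : (f a + g a) * ∏ i ∈ s, (f i + g i) - f a * ∏ i ∈ s, f i =
        f a * (∏ i ∈ s, (f i + g i) - ∏ i ∈ s, f i)
        + g a * (∏ i ∈ s, (f i + g i) - ∏ i ∈ s, f i) + g a * ∏ i ∈ s, f i := by ring
    rw [e]
    refine add_mem (add_mem ?_ ?_) ?_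
    · simpa using mul_mem_ratDegLE (hf a) ih
    · exact ratDegLE_mono (by omega) (mul_mem_ratDegLE (hg a) ih)
    · simpa using mul_mem_ratDegLE (hg a) h1

lemma det_one_add_sub_one_mem {ι : Type*} [Fintype ι] [DecidableEq ι]
    (M : Matrix ι ι (RatFunc k)) {m : ℤ} (hm : m ≤ 0) (h : ∀ i j, M i j ∈ ratDegLE k m) :
    (1 + M).det - 1 ∈ ratDegLE k m := by
  rw [← Matrix.det_one (n := ι), Matrix.det_apply', Matrix.det_apply', ← Finset.sum_sub_distrib]
  refine Submodule.sum_mem _ fun σ _ => ?_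
  rw [← mul_sub]
  have h1 := prod_add_sub_prod_mem Finset.univ
    (fun i => (1 : Matrix ι ι (RatFunc k)) (σ i) i) (fun i => M (σ i) i) hm
    (fun i => by
      rw [Matrix.one_apply]; split_ifs
      · exact one_mem_ratDegLE
      · exact zero_mem _) (fun i => h _ _)
  rcases Int.units_eq_one_or (Equiv.Perm.sign σ) with hs | hs
  · simpa [hs] using h1
  · have := neg_mem h1
    simpa [hs] using this

end InftyFiltration

section InftyFiltration
open Module Polynomial

variable {k L : Type*} [Field k] [Field L] [Algebra (RatFunc k) L] [Algebra k L]
  [IsScalarTower k (RatFunc k) L] {d : ℕ} (e : Basis (Fin d) (RatFunc k) L)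

/-- The elements all of whose coordinates in the basis `e` have degree at most `m`. -/
noncomputable def inftyFil (m : ℤ) : Submodule k L :=
  ⨅ i, (ratDegLE k m).comap ((e.coord i).restrictScalars k)

variable {e}

lemma mem_inftyFil {m : ℤ} {α : L} : α ∈ inftyFil e m ↔ ∀ i, e.repr α i ∈ ratDegLE k m := by
  simp [inftyFil]

lemma inftyFil_mono {m n : ℤ} (h : m ≤ n) : inftyFil e m ≤ inftyFil e n :=
  fun _ hα => mem_inftyFil.2 fun i => ratDegLE_mono h (mem_inftyFil.1 hα i)

lemma smul_mem_inftyFil {m n : ℤ} {f : RatFunc k} {α : L} (hf : f ∈ ratDegLE k m)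
    (hα : α ∈ inftyFil e n) : f • α ∈ inftyFil e (m + n) :=
  mem_inftyFil.2 fun i => by
    rw [map_smul, Finsupp.smul_apply, smul_eq_mul]
    exact mul_mem_ratDegLE hf (mem_inftyFil.1 hα i)

lemma exists_mem_inftyFil (α : L) : ∃ m, α ∈ inftyFil e m := by
  refine ⟨∑ i, |(e.repr α i).intDegree|, mem_inftyFil.2 fun i => Or.inr ?_⟩
  exact (le_abs_self _).trans (Finset.single_le_sum
    (f := fun i => |(e.repr α i).intDegree|) (fun i _ => abs_nonneg _) (Finset.mem_univ i))

lemma basis_mem_inftyFil (i : Fin d) : e i ∈ inftyFil e 0 := mem_inftyFil.2 fun j => by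
  rw [e.repr_self, Finsupp.single_apply]
  split_ifs
  · exact one_mem_ratDegLE
  · exact zero_mem _

lemma mul_mem_inftyFil_of_basis {β : L} {m n : ℤ} (h : ∀ i, e i * β ∈ inftyFil e n) {α : L}
    (hα : α ∈ inftyFil e m) : α * β ∈ inftyFil e (m + n) := by
  rw [← e.sum_repr α, Finset.sum_mul]
  refine Submodule.sum_mem _ fun i _ => ?_
  rw [smul_mul_assoc]
  exact smul_mem_inftyFil (mem_inftyFil.1 hα i) (h i)

lemma mul_mem_inftyFil (h : ∀ i j, e i * e j ∈ inftyFil e 0) {m n : ℤ} {α β : L}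
    (hα : α ∈ inftyFil e m) (hβ : β ∈ inftyFil e n) : α * β ∈ inftyFil e (m + n) := by
  refine mul_mem_inftyFil_of_basis (fun i => ?_) hα
  rw [mul_comm]
  simpa using mul_mem_inftyFil_of_basis (fun j => h j i) hβ

/-- The elements of the form `∑ aᵢ X ^ m eᵢ` with constant `aᵢ`. -/
noncomputable def leadingMap (e : Basis (Fin d) (RatFunc k) L) (m : ℤ) : (Fin d → k) →ₗ[k] L :=
  ∑ i, (LinearMap.toSpanSingleton k L ((RatFunc.X : RatFunc k) ^ m • e i)) ∘ₗ LinearMap.proj i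

lemma repr_leadingMap (m : ℤ) (a : Fin d → k) (i : Fin d) :
    e.repr (leadingMap e m a) i = a i • (RatFunc.X : RatFunc k) ^ m := by
  have : leadingMap e m a = ∑ i, (a i • (RatFunc.X : RatFunc k) ^ m) • e i := by
    simp [leadingMap, smul_assoc]
  rw [this, e.repr_sum_self]

lemma leadingMap_mem (m : ℤ) (a : Fin d → k) : leadingMap e m a ∈ inftyFil e m :=
  mem_inftyFil.2 fun i => by
    rw [repr_leadingMap]; exact Submodule.smul_mem _ _ (X_zpow_mem_ratDegLE m)

lemma leadingMap_mem_sub_one_iff {m : ℤ} {a : Fin d → k} :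
    leadingMap e m a ∈ inftyFil e (m - 1) ↔ a = 0 := by
  rw [mem_inftyFil, funext_iff]
  exact forall_congr' fun i => by rw [repr_leadingMap, smul_X_zpow_mem_iff]; rfl

lemma inftyFil_eq_sup (m : ℤ) :
    inftyFil e m = inftyFil e (m - 1) ⊔ LinearMap.range (leadingMap e m) := by
  refine le_antisymm (fun α hα => ?_) (sup_le (inftyFil_mono (by omega)) ?_)
  · choose a ha using fun i => exists_sub_C_mul_mem (mem_inftyFil.1 hα i)
    rw [← sub_add_cancel α (leadingMap e m a)]
    refine add_mem (Submodule.mem_sup_left (mem_inftyFil.2 fun i => ?_))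
      (Submodule.mem_sup_right ⟨a, rfl⟩)
    rw [map_sub, Finsupp.sub_apply, repr_leadingMap]
    exact ha i
  · rintro _ ⟨a, rfl⟩
    exact leadingMap_mem m a

lemma relIndex_inftyFil_sub_one (m : ℤ) :
    (inftyFil e (m - 1)).toAddSubgroup.relIndex (inftyFil e m).toAddSubgroup
      = Nat.card k ^ d := by
  rw [inftyFil_eq_sup m, Submodule.sup_toAddSubgroup, sup_comm, AddSubgroup.relIndex_sup_right,
    ← AddSubgroup.inf_relIndex_right]
  have hinj : Function.Injective (leadingMap e m) := by
    rw [← LinearMap.ker_eq_bot, LinearMap.ker_eq_bot']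
    intro a ha
    exact leadingMap_mem_sub_one_iff.1 (ha ▸ zero_mem _)
  have hbot : (inftyFil e (m - 1)).toAddSubgroup ⊓ (LinearMap.range (leadingMap e m)).toAddSubgroup
      = ⊥ := by
    rw [eq_bot_iff]
    rintro _ ⟨h1, ⟨a, rfl⟩⟩
    have := leadingMap_mem_sub_one_iff.1 h1
    simp [this]
  rw [hbot, AddSubgroup.relIndex_bot_left]
  have : Nat.card (LinearMap.range (leadingMap e m)) = Nat.card (Fin d → k) :=
    (Nat.card_congr (LinearEquiv.ofInjective _ hinj).toEquiv).symm
  refine this.trans ?_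
  rw [Nat.card_fun, Nat.card_eq_fintype_card (α := Fin d), Fintype.card_fin]

lemma relIndex_inftyFil (m : ℤ) (n : ℕ) :
    (inftyFil e (m - n)).toAddSubgroup.relIndex (inftyFil e m).toAddSubgroup
      = Nat.card k ^ (d * n) := by
  induction n with
  | zero => simp
  | succ n ih =>
    rw [← AddSubgroup.relIndex_mul_relIndex (inftyFil e (m - (n + 1 : ℕ))).toAddSubgroup
      (inftyFil e (m - n)).toAddSubgroup _ (inftyFil_mono (by push_cast; omega))
      (inftyFil_mono (by omega)), ih, mul_add, pow_add, mul_comm, mul_one]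
    congr 1
    convert! relIndex_inftyFil_sub_one (e := e) (m - n) using 3
    push_cast; ring_nf

lemma one_add_inv_mem (h : ∀ i j, e i * e j ∈ inftyFil e 0) (h1 : (1 : L) ∈ inftyFil e 0) {v : L}
    {j : ℕ} (hj : 1 ≤ j) (hv : v ∈ inftyFil e (-j)) (hne : 1 + v ≠ 0) :
    (1 + v)⁻¹ - 1 ∈ inftyFil e (-j) := by
  have hw : (1 + v)⁻¹ = 1 - v * (1 + v)⁻¹ := by
    linear_combination mul_inv_cancel₀ hne
  have key : ∀ n : ℕ, (1 + v)⁻¹ ∈ inftyFil e n → (1 + v)⁻¹ ∈ inftyFil e 0 := by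
    intro n
    induction n with
    | zero => simp
    | succ n ih =>
      intro hn
      refine ih ?_
      rw [hw]
      refine sub_mem (inftyFil_mono (by omega) h1) ?_
      exact inftyFil_mono (by push_cast; omega) (mul_mem_inftyFil h hv hn)
  obtain ⟨m, hm⟩ := exists_mem_inftyFil (e := e) (1 + v)⁻¹
  have h0 := key m.toNat (inftyFil_mono (Int.self_le_toNat m) hm)
  have : (1 + v)⁻¹ - 1 = -(v * (1 + v)⁻¹) := by linear_combination hw
  rw [this]
  exact neg_mem (by simpa using mul_mem_inftyFil h hv h0)

lemma norm_mem_ratDegLE (h : ∀ i j, e i * e j ∈ inftyFil e 0) {α : L} {m : ℤ}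
    (hα : α ∈ inftyFil e m) : Algebra.norm (RatFunc k) α ∈ ratDegLE k (d * m) := by
  rw [Algebra.norm_eq_matrix_det e]
  have := det_mem_ratDegLE (Algebra.leftMulMatrix e α) m fun i j => by
    rw [Algebra.leftMulMatrix_eq_repr_mul]
    have := mul_mem_inftyFil h hα (basis_mem_inftyFil j)
    rw [add_zero] at this
    exact mem_inftyFil.1 this i
  simpa using this

lemma norm_one_add_sub_one_mem (h : ∀ i j, e i * e j ∈ inftyFil e 0) {v : L} {m : ℤ} (hm : m ≤ 0)
    (hv : v ∈ inftyFil e m) : Algebra.norm (RatFunc k) (1 + v) - 1 ∈ ratDegLE k m := by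
  rw [Algebra.norm_eq_matrix_det e, map_add, map_one]
  refine det_one_add_sub_one_mem _ hm fun i j => ?_
  rw [Algebra.leftMulMatrix_eq_repr_mul]
  have := mul_mem_inftyFil h hv (basis_mem_inftyFil j)
  rw [add_zero] at this
  exact mem_inftyFil.1 this i

end InftyFiltration

section LatticeCount
open Module

lemma AddSubgroup.relIndex_eq_card_inf_mul {G : Type*} [AddCommGroup G] {B Λ V : AddSubgroup G}
    (hB : B ≤ Λ) (hV : B ⊓ V = ⊥) :
    B.relIndex Λ = Nat.card (Λ ⊓ V : AddSubgroup G) * (B ⊔ V).relIndex Λ := by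
  have hle : B ≤ Λ ⊓ (B ⊔ V) := le_inf hB le_sup_left
  have hmod : Λ ⊓ (B ⊔ V) = (Λ ⊓ V) ⊔ B := by
    rw [inf_comm, sup_inf_assoc_of_le V hB, inf_comm, sup_comm]
  rw [← AddSubgroup.relIndex_mul_relIndex B (Λ ⊓ (B ⊔ V)) Λ hle inf_le_left, inf_comm,
    AddSubgroup.inf_relIndex_right, inf_comm, hmod, AddSubgroup.relIndex_sup_right,
    ← AddSubgroup.inf_relIndex_right]
  congr 1
  have : B ⊓ (Λ ⊓ V) = ⊥ := by
    rw [eq_bot_iff, ← hV]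
    exact le_inf inf_le_left (inf_le_right.trans inf_le_right)
  rw [this, AddSubgroup.relIndex_bot_left]

lemma AddSubgroup.relIndex_eq_card_inf_mul_index {G : Type*} [AddCommGroup G]
    {B Λ V : AddSubgroup G} (hB : B ≤ Λ) (hV : B ⊓ V = ⊥) (hΛ : Λ ⊔ V = ⊤) :
    B.relIndex Λ = Nat.card (Λ ⊓ V : AddSubgroup G) * (B ⊔ V).index := by
  rw [AddSubgroup.relIndex_eq_card_inf_mul hB hV]
  congr 1
  rw [← AddSubgroup.relIndex_sup_right, ← AddSubgroup.relIndex_top_right]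
  congr 1
  rw [eq_top_iff, ← hΛ]
  exact sup_le le_sup_left (le_sup_right.trans le_sup_right)

variable {k L : Type*} [Field k] [Field L] [Algebra k L]

lemma card_le_index_of_sup_ne_top [Finite k] {B Λ V₁ V₂ V₃ : Submodule k L}
    (hmul : ∀ x ∈ Λ, ∀ b ∈ B, x * b ∈ Λ) (hV : ∀ x ∈ V₁, ∀ v ∈ V₂, x * v ∈ V₃)
    (hne : Λ ⊔ V₃ ≠ ⊤) (hfin : (B ⊔ V₂).toAddSubgroup.index ≠ 0) :
    Nat.card (Λ ⊓ V₁ : Submodule k L) ≤ (B ⊔ V₂).toAddSubgroup.index := by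
  obtain ⟨φ, hφ0, hφ⟩ := Submodule.exists_le_ker_of_lt_top (Λ ⊔ V₃) hne.lt_top
  have hQ : Finite (L ⧸ (B ⊔ V₂)) :=
    AddSubgroup.index_ne_zero_iff_finite.1 hfin
  have hQ' : Module.Finite k (L ⧸ (B ⊔ V₂)) := inferInstance
  have hker : ∀ x : (Λ ⊓ V₁ : Submodule k L),
      B ⊔ V₂ ≤ LinearMap.ker (φ ∘ₗ LinearMap.mulLeft k (x : L)) := by
    intro x
    refine sup_le (fun b hb => ?_) (fun v hv => ?_)
    · exact hφ (Submodule.mem_sup_left (hmul _ x.2.1 b hb))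
    · exact hφ (Submodule.mem_sup_right (hV _ x.2.2 v hv))
  let ι : (Λ ⊓ V₁ : Submodule k L) → Dual k (L ⧸ (B ⊔ V₂)) := fun x =>
    (B ⊔ V₂).liftQ _ (hker x)
  have hι : Function.Injective ι := by
    intro x y hxy
    by_contra hne
    have hz : (x : L) - y ≠ 0 := fun h => hne (Subtype.ext (sub_eq_zero.1 h))
    apply hφ0
    ext u
    have h1 := LinearMap.congr_fun hxy (Submodule.Quotient.mk (((x : L) - y)⁻¹ * u))
    have h2 : φ (x * (((x : L) - y)⁻¹ * u)) = φ (y * (((x : L) - y)⁻¹ * u)) := h1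
    have h3 : φ (((x : L) - y) * (((x : L) - y)⁻¹ * u)) = 0 := by
      rw [sub_mul, map_sub, h2, sub_self]
    rwa [mul_inv_cancel_left₀ hz] at h3
  have hD : Finite (Dual k (L ⧸ (B ⊔ V₂))) := Module.finite_of_finite k
  refine (Nat.card_le_card_of_injective ι hι).trans (le_of_eq ?_)
  rw [Module.natCard_eq_pow_finrank (K := k) (V := Dual k _), Subspace.dual_finrank_eq,
    ← Module.natCard_eq_pow_finrank (K := k)]
  rfl

variable [Algebra (RatFunc k) L] [IsScalarTower k (RatFunc k) L] {d : ℕ}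
  {e : Basis (Fin d) (RatFunc k) L} {B : Submodule k L}

lemma index_sup_inftyFil_le [Finite k] {M : ℕ} (hM : B ⊔ inftyFil e M = ⊤) (j : ℕ) :
    (B ⊔ inftyFil e (-j)).toAddSubgroup.index ≠ 0 ∧
    (B ⊔ inftyFil e (-j)).toAddSubgroup.index ≤ Nat.card k ^ (d * (M + j)) := by
  have h1 : (B ⊔ inftyFil e (-j)).toAddSubgroup.index ∣
      (inftyFil e (-j)).toAddSubgroup.relIndex (inftyFil e M).toAddSubgroup := by
    have h2 : (B ⊔ inftyFil e (-j)).toAddSubgroup.index =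
        (B ⊔ inftyFil e (-j)).toAddSubgroup.relIndex (inftyFil e M).toAddSubgroup := by
      rw [← AddSubgroup.relIndex_sup_right, ← AddSubgroup.relIndex_top_right]
      congr 1
      rw [← Submodule.sup_toAddSubgroup, eq_comm]
      rw [show inftyFil e M ⊔ (B ⊔ inftyFil e (-j)) = ⊤ from ?_]
      · rfl
      · rw [eq_top_iff, ← hM]
        exact sup_le (le_sup_left.trans le_sup_right) le_sup_left
    rw [h2]
    exact AddSubgroup.relIndex_dvd_of_le_left _ (show inftyFil e (-j) ≤ _ from le_sup_right)
  have h3 := relIndex_inftyFil (e := e) M (M + j)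
  rw [show ((M : ℤ) - (M + j : ℕ)) = -j by push_cast; ring] at h3
  rw [h3] at h1
  have hpos : 0 < Nat.card k ^ (d * (M + j)) := pow_pos Nat.card_pos _
  exact ⟨fun h => hpos.ne' (Nat.eq_zero_of_zero_dvd (h ▸ h1)), Nat.le_of_dvd hpos h1⟩

lemma index_sup_inftyFil_add (hB : B ⊓ inftyFil e (-1) = ⊥) (j : ℕ) :
    (B ⊔ inftyFil e (-1 - j)).toAddSubgroup.index =
      (B ⊔ inftyFil e (-1)).toAddSubgroup.index * Nat.card k ^ (d * j) := by
  have hle : inftyFil e (-1 - j) ≤ inftyFil e (-1) := inftyFil_mono (by omega)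
  rw [← AddSubgroup.relIndex_mul_index
    (show (B ⊔ inftyFil e (-1 - j)).toAddSubgroup ≤ (B ⊔ inftyFil e (-1)).toAddSubgroup from
      sup_le_sup_left hle B), mul_comm, ← relIndex_inftyFil (e := e) (-1) j]
  congr 1
  have h1 : (B ⊔ inftyFil e (-1)).toAddSubgroup = (inftyFil e (-1)).toAddSubgroup ⊔
      (B ⊔ inftyFil e (-1 - j)).toAddSubgroup := by
    rw [← Submodule.sup_toAddSubgroup]
    congr 1
    refine le_antisymm (sup_le (le_sup_left.trans le_sup_right) le_sup_left)
      (sup_le le_sup_right (sup_le_sup_left hle B))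
  rw [h1, AddSubgroup.relIndex_sup_right, ← AddSubgroup.inf_relIndex_right]
  congr 1
  have h2 : (B ⊔ inftyFil e (-1 - j)) ⊓ inftyFil e (-1) = inftyFil e (-1 - j) := by
    rw [sup_comm, sup_inf_assoc_of_le B hle, hB, sup_bot_eq]
  exact congrArg Submodule.toAddSubgroup h2

end LatticeCount

section IdealTrace
open Module Polynomial

lemma LinearMap.trace_eq_add_of_exact {k M N Q : Type*} [Field k] [AddCommGroup M] [Module k M]
    [AddCommGroup N] [Module k N] [AddCommGroup Q] [Module k Q] [FiniteDimensional k M]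
    [FiniteDimensional k N] [FiniteDimensional k Q] {ι : N →ₗ[k] M} {π : M →ₗ[k] Q}
    (hι : Function.Injective ι) (hπ : Function.Surjective π)
    (hex : LinearMap.ker π = LinearMap.range ι) {f : M →ₗ[k] M} {g : N →ₗ[k] N} {h : Q →ₗ[k] Q}
    (hfg : f ∘ₗ ι = ι ∘ₗ g) (hfh : π ∘ₗ f = h ∘ₗ π) :
    LinearMap.trace k M f = LinearMap.trace k N g + LinearMap.trace k Q h := by
  obtain ⟨s, hs⟩ := π.exists_rightInverse_of_surjective (LinearMap.range_eq_top.2 hπ)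
  have hmem : ∀ x, x - s (π x) ∈ LinearMap.range ι := by
    intro x
    rw [← hex, LinearMap.mem_ker, map_sub, sub_eq_zero]
    exact (LinearMap.congr_fun hs (π x)).symm
  let r : M →ₗ[k] N := (LinearEquiv.ofInjective ι hι).symm.toLinearMap ∘ₗ
    (LinearMap.id - s ∘ₗ π).codRestrict (LinearMap.range ι) hmem
  have hr : ∀ x, ι (r x) = x - s (π x) := fun x =>
    congrArg Subtype.val ((LinearEquiv.ofInjective ι hι).apply_symm_apply ⟨x - s (π x), hmem x⟩)
  have hrι : r ∘ₗ ι = LinearMap.id := by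
    ext x
    apply hι
    have h0 : π (ι x) = 0 := by
      rw [← LinearMap.mem_ker, hex]; exact ⟨x, rfl⟩
    rw [LinearMap.comp_apply, hr, h0, map_zero, sub_zero]; rfl
  have hdec : f = ι ∘ₗ (g ∘ₗ r) + (f ∘ₗ s) ∘ₗ π := by
    ext x
    have h1 : ι (g (r x)) = f (ι (r x)) := (LinearMap.congr_fun hfg (r x)).symm
    simp only [LinearMap.add_apply, LinearMap.comp_apply]
    rw [h1, hr, map_sub, sub_add_cancel]
  rw [hdec, map_add, LinearMap.trace_comp_comm' (g ∘ₗ r) ι, LinearMap.comp_assoc, hrι,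
    LinearMap.comp_id, LinearMap.trace_comp_comm' π (f ∘ₗ s), ← LinearMap.comp_assoc, hfh,
    LinearMap.comp_assoc, hs, LinearMap.comp_id]

lemma LinearMap.trace_pi_eq_sum {k ι : Type*} [Field k] [Fintype ι] {V : ι → Type*}
    [∀ i, AddCommGroup (V i)] [∀ i, Module k (V i)] [∀ i, FiniteDimensional k (V i)]
    (f : (∀ i, V i) →ₗ[k] ∀ i, V i) (g : ∀ i, V i →ₗ[k] V i)
    (h : ∀ v i, f v i = g i (v i)) :
    LinearMap.trace k _ f = ∑ i, LinearMap.trace k _ (g i) := by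
  classical
  have hdec : f = ∑ i, LinearMap.single k V i ∘ₗ (g i ∘ₗ LinearMap.proj i) := by
    refine LinearMap.ext fun v => funext fun i => ?_
    rw [h, LinearMap.sum_apply, Finset.sum_apply, Finset.sum_eq_single i]
    · simp
    · intro j _ hj
      simp [hj.symm]
    · simp
  rw [hdec, map_sum]
  refine Finset.sum_congr rfl fun i _ => ?_
  rw [LinearMap.trace_comp_comm', LinearMap.comp_assoc, LinearMap.proj_comp_single_same,
    LinearMap.comp_id]

/-- The sum of the roots of a polynomial. -/
noncomputable def sumRoots {k : Type*} [Field k] (g : k[X]) : k := -(g.nextCoeff / g.leadingCoeff)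

lemma sumRoots_C_mul {k : Type*} [Field k] {a : k} (ha : a ≠ 0) (g : k[X]) :
    sumRoots (C a * g) = sumRoots g := by
  rw [sumRoots, sumRoots, nextCoeff_C_mul, leadingCoeff_mul, leadingCoeff_C,
    mul_div_mul_left _ _ ha]

lemma sumRoots_eq_of_associated {k : Type*} [Field k] {g h : k[X]} (hgh : Associated g h) :
    sumRoots g = sumRoots h := by
  obtain ⟨u, rfl⟩ := hgh
  obtain ⟨a, ha, hu⟩ := Polynomial.isUnit_iff.1 u.isUnit
  rw [← hu, mul_comm, sumRoots_C_mul ha.ne_zero]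

lemma sumRoots_mul {k : Type*} [Field k] {g h : k[X]} (hg : g ≠ 0) (hh : h ≠ 0) :
    sumRoots (g * h) = sumRoots g + sumRoots h := by
  have hmon : ∀ f : k[X], f ≠ 0 → (C f.leadingCoeff⁻¹ * f).Monic := by
    intro f hf
    rw [mul_comm]; exact monic_mul_leadingCoeff_inv hf
  have hne : ∀ f : k[X], f ≠ 0 → f.leadingCoeff⁻¹ ≠ 0 := fun f hf =>
    inv_ne_zero (leadingCoeff_ne_zero.2 hf)
  rw [← sumRoots_C_mul (mul_ne_zero (hne g hg) (hne h hh)) (g * h), C_mul,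
    mul_mul_mul_comm, ← sumRoots_C_mul (hne g hg) g, ← sumRoots_C_mul (hne h hh) h]
  have h1 := (hmon g hg)
  have h2 := (hmon h hh)
  rw [sumRoots, sumRoots, sumRoots, (h1.mul h2).leadingCoeff, h1.leadingCoeff, h2.leadingCoeff,
    h1.nextCoeff_mul h2]
  simp only [div_one]
  ring

lemma sumRoots_prod {k ι : Type*} [Field k] (s : Finset ι) (g : ι → k[X]) (h : ∀ i ∈ s, g i ≠ 0) :
    sumRoots (∏ i ∈ s, g i) = ∑ i ∈ s, sumRoots (g i) := by
  classical
  induction s using Finset.induction_on with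
  | empty => simp [sumRoots, nextCoeff]
  | insert a s ha ih =>
    have h' := fun i hi => h i (Finset.mem_insert_of_mem hi)
    rw [Finset.prod_insert ha, Finset.sum_insert ha, sumRoots_mul (h a (Finset.mem_insert_self a s))
      (Finset.prod_ne_zero_iff.2 h'), ih h']

lemma trace_quotient_span_X {k : Type*} [Field k] {g : k[X]} (hg : g ≠ 0) :
    Algebra.trace k (k[X] ⧸ Ideal.span {g}) (Ideal.Quotient.mk _ X) = sumRoots g := by
  by_cases hu : IsUnit g
  · have : Subsingleton (k[X] ⧸ Ideal.span {g}) :=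
      Ideal.Quotient.subsingleton_iff.2 (Ideal.span_singleton_eq_top.2 hu)
    obtain ⟨a, ha, rfl⟩ := Polynomial.isUnit_iff.1 hu
    rw [Subsingleton.elim (Ideal.Quotient.mk (Ideal.span {C a}) X) 0, map_zero]
    simp [sumRoots, nextCoeff]
  have hnt : Nontrivial (AdjoinRoot g) := AdjoinRoot.nontrivial g
    (mt Polynomial.isUnit_iff_degree_eq_zero.2 hu)
  have h1 := (AdjoinRoot.powerBasis hg).trace_gen_eq_nextCoeff_minpoly
  rw [AdjoinRoot.powerBasis_gen, AdjoinRoot.minpoly_root hg] at h1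
  refine h1.trans ?_
  rw [sumRoots, mul_comm, nextCoeff_C_mul]
  rw [div_eq_inv_mul]

end IdealTrace

section IdealDegree
open Module Polynomial

variable {k B : Type*} [Field k] [CommRing B] [Algebra k[X] B] [Algebra k B]
  [IsScalarTower k k[X] B]

/-- The dimension of `B ⧸ I` over the base field. -/
noncomputable def idealDeg (k : Type*) [Field k] [Algebra k B] (I : Ideal B) : ℕ := finrank k (B ⧸ I)

/-- The trace of multiplication by `X` on `B ⧸ I`. -/
noncomputable def idealTrace (k : Type*) [Field k] [Algebra k[X] B] [Algebra k B] (I : Ideal B) : k :=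
  Algebra.trace k (B ⧸ I) (Ideal.Quotient.mk I (algebraMap k[X] B X))

lemma lmul_mk_apply (I : Ideal B) (a : B) (x : B ⧸ I) :
    Algebra.lmul k (B ⧸ I) (Ideal.Quotient.mk I a) x = a • x := (Algebra.smul_def a x).symm

lemma exists_exact_quotient_mul [IsDedekindDomain B] {I J : Ideal B} (hI : I ≠ ⊥) (hJ : J ≠ ⊥) :
    ∃ (ι : (B ⧸ J) →ₗ[B] B ⧸ (I * J)) (π : (B ⧸ (I * J)) →ₗ[B] B ⧸ I),
      Function.Injective ι ∧ Function.Surjective π ∧ LinearMap.ker π = LinearMap.range ι := by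
  obtain ⟨a, ha⟩ := IsDedekindDomain.exists_sup_span_eq (Ideal.mul_le_left : I * J ≤ I)
    (mul_ne_zero hI hJ)
  have haI : a ∈ I := ha ▸ Ideal.mem_sup_right (Ideal.mem_span_singleton_self a)
  have hker : J ≤ LinearMap.ker ((Submodule.mkQ (I * J)) ∘ₗ LinearMap.mulLeft B a) := by
    intro x hx
    rw [LinearMap.mem_ker, LinearMap.comp_apply, Submodule.mkQ_apply, Submodule.Quotient.mk_eq_zero]
    exact Ideal.mul_mem_mul haI hx
  refine ⟨Submodule.liftQ J _ hker, Submodule.mapQ (I * J) I LinearMap.id Ideal.mul_le_left,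
    ?_, ?_, ?_⟩
  · rw [← LinearMap.ker_eq_bot, Submodule.ker_liftQ_eq_bot']
    refine le_antisymm hker fun x hx => ?_
    rw [LinearMap.mem_ker, LinearMap.comp_apply, Submodule.mkQ_apply,
      Submodule.Quotient.mk_eq_zero, LinearMap.mulLeft_apply] at hx
    have h1 : I * Ideal.span {x} ≤ I * J := by
      conv_lhs => rw [← ha]
      rw [Ideal.sup_mul, Ideal.span_singleton_mul_span_singleton]
      exact sup_le Ideal.mul_le_left (by
        rwa [Ideal.span_singleton_le_iff_mem])
    have h2 := Ideal.dvd_iff_le.1 ((mul_dvd_mul_iff_left hI).1 (Ideal.dvd_iff_le.2 h1))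
    rwa [Ideal.span_singleton_le_iff_mem] at h2
  · intro x
    obtain ⟨x, rfl⟩ := Submodule.Quotient.mk_surjective _ x
    exact ⟨Submodule.Quotient.mk x, rfl⟩
  · ext x
    obtain ⟨x, rfl⟩ := Submodule.Quotient.mk_surjective _ x
    rw [LinearMap.mem_ker, Submodule.mapQ_apply, LinearMap.id_apply, Submodule.Quotient.mk_eq_zero]
    constructor
    · intro hx
      rw [← ha] at hx
      obtain ⟨y, hy, z, hz, rfl⟩ := Submodule.mem_sup.1 hx
      obtain ⟨w, rfl⟩ := Ideal.mem_span_singleton'.1 hz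
      refine ⟨Submodule.Quotient.mk w, ?_⟩
      rw [Submodule.liftQ_apply, LinearMap.comp_apply, Submodule.mkQ_apply, LinearMap.mulLeft_apply,
        Submodule.Quotient.eq, mul_comm a w]
      simpa using hy
    · rintro ⟨w, hw⟩
      obtain ⟨w, rfl⟩ := Submodule.Quotient.mk_surjective _ w
      rw [Submodule.liftQ_apply, LinearMap.comp_apply, Submodule.mkQ_apply, LinearMap.mulLeft_apply,
        Submodule.Quotient.eq] at hw
      have h1 := Ideal.mul_le_left hw
      have h2 := I.mul_mem_right w haI
      have := I.sub_mem h2 h1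
      simpa using this

section
variable [Finite k] [Ring.HasFiniteQuotients B]

lemma finite_quotient_ideal {I : Ideal B} (hI : I ≠ ⊥) : Module.Finite k (B ⧸ I) := by
  have : Finite (B ⧸ I) := Ring.HasFiniteQuotients.finiteQuotient hI
  infer_instance

lemma card_quotient_ideal {I : Ideal B} (hI : I ≠ ⊥) :
    Nat.card (B ⧸ I) = Nat.card k ^ idealDeg k I := by
  have := finite_quotient_ideal (k := k) hI
  exact Module.natCard_eq_pow_finrank

lemma idealDeg_mul [IsDedekindDomain B] {I J : Ideal B} (hI : I ≠ ⊥) (hJ : J ≠ ⊥) :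
    idealDeg k (I * J) = idealDeg k I + idealDeg k J := by
  obtain ⟨ι, π, hι, hπ, hex⟩ := exists_exact_quotient_mul hI hJ
  have h1 := finite_quotient_ideal (k := k) hI
  have h2 := finite_quotient_ideal (k := k) hJ
  have h3 := finite_quotient_ideal (k := k) (mul_ne_zero hI hJ)
  have h4 := (π.restrictScalars k).finrank_range_add_finrank_ker
  have h6 : LinearMap.range (π.restrictScalars k) = ⊤ := LinearMap.range_eq_top.2 hπ
  rw [h6, finrank_top] at h4
  have h5 : LinearMap.ker (π.restrictScalars k) = LinearMap.range (ι.restrictScalars k) := by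
    ext x; exact SetLike.ext_iff.1 hex x
  rw [h5, LinearMap.finrank_range_of_inj (f := ι.restrictScalars k) hι] at h4
  exact h4.symm

lemma idealTrace_mul [IsDedekindDomain B] {I J : Ideal B} (hI : I ≠ ⊥) (hJ : J ≠ ⊥) :
    idealTrace k (I * J) = idealTrace k I + idealTrace k J := by
  obtain ⟨ι, π, hι, hπ, hex⟩ := exists_exact_quotient_mul hI hJ
  have h1 := finite_quotient_ideal (k := k) hI
  have h2 := finite_quotient_ideal (k := k) hJ
  have h3 := finite_quotient_ideal (k := k) (mul_ne_zero hI hJ)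
  have h5 : LinearMap.ker (π.restrictScalars k) = LinearMap.range (ι.restrictScalars k) := by
    ext x; exact SetLike.ext_iff.1 hex x
  rw [idealTrace, idealTrace, idealTrace, Algebra.trace_apply, Algebra.trace_apply,
    Algebra.trace_apply, add_comm]
  refine LinearMap.trace_eq_add_of_exact (ι := ι.restrictScalars k) (π := π.restrictScalars k)
    hι hπ h5 ?_ ?_
  · refine LinearMap.ext fun x => ?_
    rw [LinearMap.comp_apply, LinearMap.comp_apply, lmul_mk_apply, lmul_mk_apply]
    exact (ι.map_smul (algebraMap k[X] B X) x).symm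
  · refine LinearMap.ext fun x => ?_
    rw [LinearMap.comp_apply, LinearMap.comp_apply, lmul_mk_apply, lmul_mk_apply]
    exact π.map_smul (algebraMap k[X] B X) x

lemma idealDeg_pow [IsDedekindDomain B] {I : Ideal B} (hI : I ≠ ⊥) (n : ℕ) :
    idealDeg k (I ^ n) = n * idealDeg k I := by
  induction n with
  | zero =>
    have : Subsingleton (B ⧸ (1 : Ideal B)) := Ideal.Quotient.subsingleton_iff.2 Ideal.one_eq_top
    simp [idealDeg, finrank_zero_of_subsingleton]
  | succ n ih => rw [pow_succ, idealDeg_mul (pow_ne_zero n hI) hI, ih]; ring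

lemma idealTrace_pow [IsDedekindDomain B] {I : Ideal B} (hI : I ≠ ⊥) (n : ℕ) :
    idealTrace k (I ^ n) = n * idealTrace k I := by
  induction n with
  | zero =>
    have : Subsingleton (B ⧸ (1 : Ideal B)) := Ideal.Quotient.subsingleton_iff.2 Ideal.one_eq_top
    rw [pow_zero, idealTrace, Subsingleton.elim (Ideal.Quotient.mk _ _) (0 : B ⧸ (1 : Ideal B))]
    simp
  | succ n ih => rw [pow_succ, idealTrace_mul (pow_ne_zero n hI) hI, ih]; push_cast; ring

end

lemma idealDeg_span_singleton [IsDomain B] [Module.Free k[X] B] [Module.Finite k[X] B] {f : B}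
    (hf : f ≠ 0) : idealDeg k (Ideal.span {f}) = (Algebra.norm k[X] f).natDegree :=
  finrank_quotient_span_eq_natDegree_norm (Module.Free.chooseBasis k[X] B) hf

lemma idealTrace_span_singleton [IsDomain B] [Module.Free k[X] B] [Module.Finite k[X] B] {f : B}
    (hf : f ≠ 0) : idealTrace k (Ideal.span {f}) = sumRoots (Algebra.norm k[X] f) := by
  let b := Module.Free.chooseBasis k[X] B
  have hI : Ideal.span {f} ≠ ⊥ := by simpa using hf
  have hne := Ideal.smithCoeffs_ne_zero b _ hI
  rw [sumRoots_eq_of_associated (associated_norm_prod_smith b hf),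
    sumRoots_prod _ _ fun i _ => hne i]
  let E := (Ideal.quotientEquivPiSpan (Ideal.span {f}) b hI).restrictScalars k
  have : ∀ i, FiniteDimensional k (k[X] ⧸ Ideal.span {Ideal.smithCoeffs b (Ideal.span {f}) hI i}) :=
    fun i => inferInstance
  rw [idealTrace, Algebra.trace_apply, ← LinearMap.trace_conj' _ E,
    LinearMap.trace_pi_eq_sum _ (fun i => Algebra.lmul k _ (Ideal.Quotient.mk _ X))]
  · exact Finset.sum_congr rfl fun i _ => trace_quotient_span_X (hne i)
  · intro v i
    have h1 := (Ideal.quotientEquivPiSpan (Ideal.span {f}) b hI).map_smul (X : k[X]) (E.symm v)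
    have h2 : (Ideal.quotientEquivPiSpan (Ideal.span {f}) b hI) (E.symm v) = v :=
      E.apply_symm_apply v
    rw [h2] at h1
    refine Eq.trans (congrFun (Eq.trans ?_ h1) i) ?_
    · rw [LinearEquiv.conj_apply_apply]
      change (Ideal.quotientEquivPiSpan (Ideal.span {f}) b hI) _ = _
      congr 1
      rw [Algebra.smul_def]
      rfl
    · rw [Pi.smul_apply, Algebra.smul_def]
      rfl

end IdealDegree

section FractionalScaling
open Module Polynomial

lemma natDegree_eq_and_sumRoots_eq {k : Type*} [Field k] {f h : k[X]} (hh : h ≠ 0)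
    (hfh : ∀ i, h.natDegree < i + 2 → f.coeff i = h.coeff i) :
    f.natDegree = h.natDegree ∧ sumRoots f = sumRoots h := by
  have h1 : f.natDegree = h.natDegree := by
    refine natDegree_eq_of_le_of_coeff_ne_zero ?_ ?_
    · refine natDegree_le_iff_coeff_eq_zero.2 fun i hi => ?_
      rw [hfh i (by omega), coeff_eq_zero_of_natDegree_lt hi]
    · rw [hfh _ (by omega)]
      exact leadingCoeff_ne_zero.2 hh
  refine ⟨h1, ?_⟩
  have h2 : f.leadingCoeff = h.leadingCoeff := by
    rw [leadingCoeff, leadingCoeff, h1, hfh _ (by omega)]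
  have h3 : f.nextCoeff = h.nextCoeff := by
    rw [nextCoeff, nextCoeff, h1]
    split_ifs with h0
    · rfl
    · exact hfh _ (by omega)
  rw [sumRoots, sumRoots, h2, h3]

variable {k B L : Type*} [Field k] [CommRing B] [Algebra k[X] B] [Algebra k B]
  [IsScalarTower k k[X] B] [Field L] [Algebra (RatFunc k) L] [Algebra k L]
  [IsScalarTower k (RatFunc k) L] [Algebra B L] [IsScalarTower k B L]
  {d : ℕ} {e : Basis (Fin d) (RatFunc k) L}

/-- The image of `B` in `L` as a `k`-subspace. -/
noncomputable def rangeSubmodule (k B L : Type*) [Field k] [CommRing B] [Algebra k B] [Field L]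
    [Algebra k L] [Algebra B L] [IsScalarTower k B L] : Submodule k L :=
  LinearMap.range (IsScalarTower.toAlgHom k B L).toLinearMap

lemma mem_rangeSubmodule {x : L} : x ∈ rangeSubmodule k B L ↔ ∃ b : B, algebraMap B L b = x :=
  Iff.rfl

/-- Conditions on a basis `e` of `L` under which the filtration at infinity it defines is
multiplicative and transverse to `B`, up to a bounded error. -/
structure IsReducedBasis (e : Basis (Fin d) (RatFunc k) L) (B : Type*) [CommRing B]
    [Algebra k[X] B] [Algebra k B] [Algebra B L] [IsScalarTower k B L] (M : ℕ) : Prop where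
  mul_mem : ∀ i j, e i * e j ∈ inftyFil e 0
  one_mem : (1 : L) ∈ inftyFil e 0
  sup_eq_top : rangeSubmodule k B L ⊔ inftyFil e M = ⊤
  inf_eq_bot : rangeSubmodule k B L ⊓ inftyFil e (-1) = ⊥
  norm_algebraMap : ∀ b : B, Algebra.norm (RatFunc k) (algebraMap B L b) =
    algebraMap k[X] (RatFunc k) (Algebra.norm k[X] b)

/-- The fractional ideal `α I`, intersected with `B`. -/
def scaleIdeal (α : L) (I : Ideal B) : Ideal B :=
  ((Submodule.map (Algebra.linearMap B L) I).map (LinearMap.mulLeft B α)).comap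
    (Algebra.linearMap B L)

lemma mem_scaleIdeal {α : L} {I : Ideal B} {b : B} :
    b ∈ scaleIdeal α I ↔ ∃ x ∈ I, algebraMap B L b = α * algebraMap B L x := by
  simp [scaleIdeal, eq_comm]

/-- The elements multiplying `I` into `B`. -/
def colonSubmodule (k : Type*) {B : Type*} (L : Type*) [Field k] [CommRing B] [Algebra k B]
    [Field L] [Algebra k L] [Algebra B L] [IsScalarTower k B L] (I : Ideal B) : Submodule k L where
  carrier := {x | ∀ y ∈ I, x * algebraMap B L y ∈ rangeSubmodule k B L}
  add_mem' := fun ha hb y hy => by rw [add_mul]; exact add_mem (ha y hy) (hb y hy)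
  zero_mem' := fun y _ => by rw [zero_mul]; exact zero_mem _
  smul_mem' := fun c x hx y hy => by rw [smul_mul_assoc]; exact Submodule.smul_mem _ _ (hx y hy)

lemma mem_colonSubmodule {I : Ideal B} {x : L} :
    x ∈ colonSubmodule k L I ↔ ∀ y ∈ I, ∃ b : B, algebraMap B L b = x * algebraMap B L y := Iff.rfl

lemma inv_mem_colonSubmodule_scaleIdeal {α : L} (hα : α ≠ 0) {I : Ideal B} :
    α⁻¹ ∈ colonSubmodule k L (scaleIdeal α I) := by
  refine mem_colonSubmodule.2 fun y hy => ?_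
  obtain ⟨x, -, hx⟩ := mem_scaleIdeal.1 hy
  exact ⟨x, by rw [hx, inv_mul_cancel_left₀ hα]⟩

lemma scaleIdeal_inv_scaleIdeal [FaithfulSMul B L] {α : L} (hα : α ≠ 0) {I : Ideal B}
    (h : α ∈ colonSubmodule k L I) : scaleIdeal α⁻¹ (scaleIdeal α I) = I := by
  ext b
  rw [mem_scaleIdeal]
  constructor
  · rintro ⟨y, hy, hb⟩
    obtain ⟨x, hx, hyx⟩ := mem_scaleIdeal.1 hy
    rw [hyx, inv_mul_cancel_left₀ hα] at hb
    rwa [FaithfulSMul.algebraMap_injective B L hb]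
  · intro hb
    obtain ⟨y, hy⟩ := mem_colonSubmodule.1 h b hb
    exact ⟨y, mem_scaleIdeal.2 ⟨b, hb, hy⟩, by rw [hy, inv_mul_cancel_left₀ hα]⟩

lemma scaleIdeal_ne_bot [FaithfulSMul B L] {α : L} (hα : α ≠ 0) {I : Ideal B} (hI : I ≠ ⊥)
    (h : α ∈ colonSubmodule k L I) : scaleIdeal α I ≠ ⊥ := by
  obtain ⟨x, hx, hx0⟩ := Submodule.exists_mem_ne_zero_of_ne_bot hI
  obtain ⟨y, hy⟩ := mem_colonSubmodule.1 h x hx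
  refine (Submodule.ne_bot_iff _).2 ⟨y, mem_scaleIdeal.2 ⟨x, hx, hy⟩, ?_⟩
  rintro rfl
  rw [map_zero, eq_comm, mul_eq_zero, FaithfulSMul.algebraMap_eq_zero_iff] at hy
  exact hy.elim hα hx0

lemma span_mul_eq_span_mul_scaleIdeal [FaithfulSMul B L] {α : L} {I : Ideal B}
    (h : α ∈ colonSubmodule k L I) {a b : B}
    (hab : algebraMap B L a = α * algebraMap B L b) :
    Ideal.span {a} * I = Ideal.span {b} * scaleIdeal α I := by
  have hinj := FaithfulSMul.algebraMap_injective B L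
  ext x
  rw [Ideal.mem_span_singleton_mul, Ideal.mem_span_singleton_mul]
  constructor
  · rintro ⟨z, hz, rfl⟩
    obtain ⟨y, hy⟩ := mem_colonSubmodule.1 h z hz
    refine ⟨y, mem_scaleIdeal.2 ⟨z, hz, hy⟩, hinj ?_⟩
    rw [map_mul, map_mul, hy, hab]; ring
  · rintro ⟨y, hy, rfl⟩
    obtain ⟨z, hz, hyz⟩ := mem_scaleIdeal.1 hy
    refine ⟨z, hz, hinj ?_⟩
    rw [map_mul, map_mul, hyz, hab]; ring

variable {M : ℕ}

lemma IsReducedBasis.one_add_ne_zero (h : IsReducedBasis e B M) {v : L}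
    (hv : v ∈ inftyFil e (-2)) : 1 + v ≠ 0 := by
  intro h0
  have h1 : (1 : L) ∈ rangeSubmodule k B L ⊓ inftyFil e (-1) :=
    ⟨mem_rangeSubmodule.2 ⟨1, map_one _⟩, by
      rw [show (1 : L) = -v by linear_combination h0]
      exact neg_mem (inftyFil_mono (by norm_num) hv)⟩
  rw [h.inf_eq_bot, Submodule.mem_bot] at h1
  exact one_ne_zero h1

section
variable [Finite k] [Ring.HasFiniteQuotients B] [IsDedekindDomain B] [Module.Free k[X] B]
  [Module.Finite k[X] B] [IsFractionRing B L]

lemma IsReducedBasis.scaleIdeal_invariants (h : IsReducedBasis e B M) {v : L}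
    (hv : v ∈ inftyFil e (-2)) {I : Ideal B} (hI : I ≠ ⊥)
    (hα : algebraMap (RatFunc k) L RatFunc.X * (1 + v) ∈ colonSubmodule k L I) :
    idealDeg k (scaleIdeal (algebraMap (RatFunc k) L RatFunc.X * (1 + v)) I) = idealDeg k I + d ∧
    idealTrace k (scaleIdeal (algebraMap (RatFunc k) L RatFunc.X * (1 + v)) I) =
      idealTrace k I := by
  set α := algebraMap (RatFunc k) L RatFunc.X * (1 + v) with hαdef
  have hα0 : α ≠ 0 := mul_ne_zero
    ((_root_.map_ne_zero _).2 RatFunc.X_ne_zero) (h.one_add_ne_zero hv)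
  obtain ⟨a, b, hb, hab⟩ := IsFractionRing.div_surjective (A := B) α
  have hb0 : b ≠ 0 := nonZeroDivisors.ne_zero hb
  have hb1 : algebraMap B L b ≠ 0 := by rwa [Ne, FaithfulSMul.algebraMap_eq_zero_iff]
  have hab' : algebraMap B L a = α * algebraMap B L b := by
    rw [← hab, div_mul_cancel₀ _ hb1]
  have ha0 : a ≠ 0 := by
    rintro rfl
    rw [map_zero, eq_comm, mul_eq_zero] at hab'
    exact hab'.elim hα0 hb1
  have hJ := scaleIdeal_ne_bot hα0 hI hα
  have key := span_mul_eq_span_mul_scaleIdeal hα hab'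
  have ha2 : Ideal.span {a} ≠ ⊥ := by simpa using ha0
  have hb2 : Ideal.span {b} ≠ ⊥ := by simpa using hb0
  have k1 := congrArg (idealDeg k) key
  have k2 := congrArg (idealTrace k) key
  rw [idealDeg_mul ha2 hI, idealDeg_mul hb2 hJ, idealDeg_span_singleton ha0,
    idealDeg_span_singleton hb0] at k1
  rw [idealTrace_mul ha2 hI, idealTrace_mul hb2 hJ, idealTrace_span_singleton ha0,
    idealTrace_span_singleton hb0] at k2
  have hN := congrArg (Algebra.norm (RatFunc k)) hab'
  have hw := norm_one_add_sub_one_mem h.mul_mem (by norm_num) hv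
  set w := Algebra.norm (RatFunc k) (1 + v) - 1 with hwdef
  have hfd : finrank (RatFunc k) L = d := by rw [finrank_eq_card_basis e, Fintype.card_fin]
  rw [map_mul, hαdef, map_mul, h.norm_algebraMap, h.norm_algebraMap, Algebra.norm_algebraMap,
    hfd, ← RatFunc.algebraMap_X, ← map_pow,
    show Algebra.norm (RatFunc k) (1 + v) = 1 + w by rw [hwdef]; ring] at hN
  have hg : Algebra.norm k[X] b ≠ 0 := Algebra.norm_ne_zero_iff.2 hb0
  set f := Algebra.norm k[X] a
  set g := Algebra.norm k[X] b
  have hdiff : algebraMap k[X] (RatFunc k) (f - X ^ d * g) ∈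
      ratDegLE k (((X ^ d * g).natDegree : ℤ) + (-2)) := by
    have : algebraMap k[X] (RatFunc k) (f - X ^ d * g) =
        algebraMap k[X] (RatFunc k) (X ^ d * g) * w := by
      rw [map_sub, hN, map_mul]; ring
    rw [this]
    exact mul_mem_ratDegLE (algebraMap_mem_ratDegLE.2 (Or.inr le_rfl)) hw
  have hXg : X ^ d * g ≠ 0 := mul_ne_zero (pow_ne_zero _ X_ne_zero) hg
  have hco := natDegree_eq_and_sumRoots_eq (f := f) hXg fun i hi => by
    rw [← sub_eq_zero, ← coeff_sub]
    rcases algebraMap_mem_ratDegLE.1 hdiff with h0 | h0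
    · rw [h0, coeff_zero]
    · exact coeff_eq_zero_of_natDegree_lt (by omega)
  have hXd : (X ^ d : k[X]) ≠ 0 := pow_ne_zero _ X_ne_zero
  have hsX : sumRoots (X ^ d : k[X]) = 0 := by
    have : sumRoots (X : k[X]) = 0 := by simp [sumRoots, nextCoeff]
    have h2 := sumRoots_prod (Finset.range d) (fun _ => (X : k[X])) fun _ _ => X_ne_zero
    simpa [this] using h2
  rw [hco.1, natDegree_mul hXd hg, natDegree_X_pow] at k1
  rw [hco.2, sumRoots_mul hXd hg, hsX, zero_add] at k2
  exact ⟨by omega, (add_left_cancel k2).symm⟩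

lemma relIndex_colonSubmodule {I : Ideal B} (hI : I ≠ ⊥) :
    (rangeSubmodule k B L).toAddSubgroup.relIndex (colonSubmodule k L I).toAddSubgroup =
      Nat.card k ^ idealDeg k I := by
  obtain ⟨f, hf, hf0⟩ := Submodule.exists_mem_ne_zero_of_ne_bot hI
  have hfI : I ∣ Ideal.span {f} := Ideal.dvd_span_singleton.2 hf
  obtain ⟨J, hJ⟩ := hfI
  have hspan : Ideal.span {f} ≠ ⊥ := by simpa using hf0
  have hJ0 : J ≠ ⊥ := by
    rintro rfl
    exact hspan (by rw [hJ, Ideal.mul_bot])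
  have hinj := FaithfulSMul.algebraMap_injective B L
  have hf1 : algebraMap B L f ≠ 0 := by rwa [Ne, FaithfulSMul.algebraMap_eq_zero_iff]
  let φ : L →+ L := AddMonoidHom.mulLeft (algebraMap B L f)
  have hφ : Function.Injective φ := mul_right_injective₀ hf1
  let ι : B →+ L := (algebraMap B L).toAddMonoidHom
  have e1 : (rangeSubmodule k B L).toAddSubgroup.map φ =
      (Submodule.toAddSubgroup (Ideal.span {f})).map ι := by
    ext x
    constructor
    · rintro ⟨y, ⟨b, rfl⟩, rfl⟩
      exact ⟨f * b, Ideal.mul_mem_right _ _ (Ideal.mem_span_singleton_self f),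
        map_mul (algebraMap B L) f b⟩
    · rintro ⟨y, hy, rfl⟩
      obtain ⟨z, rfl⟩ := Ideal.mem_span_singleton.1 hy
      exact ⟨algebraMap B L z, ⟨z, rfl⟩, (map_mul (algebraMap B L) f z).symm⟩
  have e2 : (colonSubmodule k L I).toAddSubgroup.map φ = (Submodule.toAddSubgroup J).map ι := by
    ext x
    constructor
    · rintro ⟨y, hy, rfl⟩
      have hy := mem_colonSubmodule.1 hy
      obtain ⟨z, hz⟩ := hy f hf
      refine ⟨z, ?_, hz.trans (mul_comm _ _)⟩
      have : I * Ideal.span {z} ≤ I * J := by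
        rw [← hJ, Ideal.mul_le]
        intro r hr s hs
        obtain ⟨u, rfl⟩ := Ideal.mem_span_singleton.1 hs
        obtain ⟨t, ht⟩ := hy r hr
        rw [Ideal.mem_span_singleton]
        refine ⟨t * u, hinj ?_⟩
        simp only [map_mul, hz, ht]; ring
      have h2 := Ideal.dvd_iff_le.1 ((mul_dvd_mul_iff_left hI).1 (Ideal.dvd_iff_le.2 this))
      exact h2 (Ideal.mem_span_singleton_self z)
    · rintro ⟨z, hz, rfl⟩
      refine ⟨(algebraMap B L f)⁻¹ * algebraMap B L z, ?_, mul_inv_cancel_left₀ hf1 _⟩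
      refine mem_colonSubmodule.2 fun y hy => ?_
      have : y * z ∈ Ideal.span {f} := hJ ▸ Ideal.mul_mem_mul hy hz
      obtain ⟨w, hw⟩ := Ideal.mem_span_singleton.1 this
      refine ⟨w, ?_⟩
      have := congrArg (algebraMap B L) hw
      rw [map_mul, map_mul] at this
      field_simp
      linear_combination -this
  rw [← AddSubgroup.relIndex_map_map_of_injective _ _ hφ, e1, e2,
    AddSubgroup.relIndex_map_map_of_injective _ _ hinj]
  have hle : Submodule.toAddSubgroup (Ideal.span {f}) ≤ Submodule.toAddSubgroup J :=
    fun x hx => by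
      have : Ideal.span {f} ≤ J := hJ ▸ Ideal.mul_le_right
      exact this hx
  have h1 := AddSubgroup.relIndex_mul_index hle
  have h2 : ∀ {I : Ideal B}, I ≠ ⊥ →
    (Submodule.toAddSubgroup I).index = Nat.card k ^ idealDeg k I := fun h =>
      card_quotient_ideal h
  rw [h2 hJ0, h2 hspan, congrArg (idealDeg k) hJ, idealDeg_mul hI hJ0, pow_add] at h1
  exact Nat.eq_of_mul_eq_mul_right (pow_pos Nat.card_pos _) h1

end

end FractionalScaling

section CharacterSumIdeals
open Module Polynomial

variable {k B L : Type*} [Field k] [CommRing B] [Algebra k[X] B] [Algebra k B]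
  [IsScalarTower k k[X] B] [Field L] [Algebra (RatFunc k) L] [Algebra k L]
  [IsScalarTower k (RatFunc k) L] [Algebra B L] [IsScalarTower k B L]
  {d : ℕ} {e : Basis (Fin d) (RatFunc k) L} {M : ℕ}

lemma card_coset_eq {k L : Type*} [Field k] [AddCommGroup L] [Module k L] {Λ V : Submodule k L}
    (h : Λ ⊔ V = ⊤) (z : L) :
    Nat.card {α : L // α ∈ Λ ∧ α - z ∈ V} = Nat.card (Λ ⊓ V : Submodule k L) := by
  obtain ⟨a, ha, v, hv, hz⟩ := Submodule.mem_sup.1 (h ▸ Submodule.mem_top : z ∈ Λ ⊔ V)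
  refine Nat.card_congr ((Equiv.subRight a).subtypeEquiv fun x => ?_)
  rw [Submodule.mem_inf, Equiv.subRight_apply]
  refine and_congr (Submodule.sub_mem_iff_left _ ha).symm ?_
  rw [← Submodule.add_mem_iff_left V hv, show x - z + v = x - a by rw [← hz]; abel]

lemma toAddSubgroup_inf {k L : Type*} [Field k] [AddCommGroup L] [Module k L]
    (U V : Submodule k L) : (U ⊓ V).toAddSubgroup = U.toAddSubgroup ⊓ V.toAddSubgroup := rfl

lemma rangeSubmodule_le_colonSubmodule (I : Ideal B) :
    rangeSubmodule k B L ≤ colonSubmodule k L I := by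
  rintro _ ⟨b, rfl⟩
  exact mem_colonSubmodule.2 fun y _ => ⟨b * y, map_mul (algebraMap B L) b y⟩

lemma mul_mem_colonSubmodule {I : Ideal B} {x : L} (hx : x ∈ colonSubmodule k L I) {b : L}
    (hb : b ∈ rangeSubmodule k B L) : x * b ∈ colonSubmodule k L I := by
  obtain ⟨b, rfl⟩ := hb
  refine mem_colonSubmodule.2 fun y hy => ?_
  obtain ⟨z, hz⟩ := mem_colonSubmodule.1 hx (b * y) (I.mul_mem_left b hy)
  exact ⟨z, hz.trans (by rw [map_mul, mul_assoc]; rfl)⟩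

lemma mul_X_mem_inftyFil_iff {v : L} {m n : ℤ} (hmn : n = m + 1) :
    algebraMap (RatFunc k) L RatFunc.X * v ∈ inftyFil e n ↔ v ∈ inftyFil e m := by
  subst hmn
  have h : ∀ (n : ℤ) {v : L} {m : ℤ}, v ∈ inftyFil e m →
      algebraMap (RatFunc k) L (RatFunc.X ^ n) * v ∈ inftyFil e (m + n) := fun n v m hv => by
    rw [← Algebra.smul_def, add_comm]
    exact smul_mem_inftyFil (X_zpow_mem_ratDegLE n) hv
  constructor
  · intro hv
    have := h (-1) hv
    rw [← mul_assoc, ← map_mul, zpow_neg_one, inv_mul_cancel₀ RatFunc.X_ne_zero, map_one,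
      one_mul] at this
    simpa using this
  · intro hv
    simpa using h 1 hv

variable [Finite k] [Ring.HasFiniteQuotients B]

variable (k B) in
lemma finite_setOf_idealDeg_eq (n : ℕ) : {I : Ideal B | I ≠ ⊥ ∧ idealDeg k I = n}.Finite := by
  refine (Ring.HasFiniteQuotients.finite_cardQuot_le (R := B) (Nat.card k ^ n)).subset ?_
  rintro I ⟨hI, hn⟩
  have : I.cardQuot = Nat.card k ^ idealDeg k I := card_quotient_ideal hI
  exact (this.trans (by rw [hn])).le

variable (k B) in
/-- The nonzero ideals of degree `n`. -/
noncomputable def idealsOfDeg (n : ℕ) : Finset (Ideal B) := (finite_setOf_idealDeg_eq k B n).toFinset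

lemma mem_idealsOfDeg {n : ℕ} {I : Ideal B} : I ∈ idealsOfDeg k B n ↔ I ≠ ⊥ ∧ idealDeg k I = n :=
  (finite_setOf_idealDeg_eq k B n).mem_toFinset

variable (B) in
/-- The sum of `ψ` over the traces of the ideals of degree `n`. -/
noncomputable def idealCharSum (ψ : k → ℂ) (n : ℕ) : ℂ := ∑ I ∈ idealsOfDeg k B n, ψ (idealTrace k I)

variable [IsDedekindDomain B] [Module.Free k[X] B] [Module.Finite k[X] B] [IsFractionRing B L]

lemma IsReducedBasis.colonSubmodule_sup_eq_top (h : IsReducedBasis e B M) {I : Ideal B}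
    (hI : I ≠ ⊥) (hdeg : d * (2 * M + 3) < idealDeg k I) :
    colonSubmodule k L I ⊔ inftyFil e (-3) = ⊤ := by
  by_contra hne
  obtain ⟨h1, h2⟩ := index_sup_inftyFil_le h.sup_eq_top 1
  obtain ⟨h3, h4⟩ := index_sup_inftyFil_le h.sup_eq_top 2
  rw [Nat.cast_one] at h1 h2
  rw [Nat.cast_ofNat] at h3 h4
  have hle : rangeSubmodule k B L ≤ colonSubmodule k L I := rangeSubmodule_le_colonSubmodule I
  have hV : ∀ x ∈ inftyFil e (-1), ∀ v ∈ inftyFil e (-2), x * v ∈ inftyFil e (-3) :=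
    fun x hx v hv => by
      have := mul_mem_inftyFil h.mul_mem hx hv
      rwa [show (-1 : ℤ) + -2 = -3 by norm_num] at this
  have h5 := card_le_index_of_sup_ne_top (B := rangeSubmodule k B L)
    (fun x hx b hb => mul_mem_colonSubmodule hx hb) hV hne h3
  have h6 := AddSubgroup.relIndex_eq_card_inf_mul
    (B := (rangeSubmodule k B L).toAddSubgroup) (Λ := (colonSubmodule k L I).toAddSubgroup)
    (V := (inftyFil e (-1)).toAddSubgroup) hle (by
      rw [← toAddSubgroup_inf, h.inf_eq_bot]; rfl)
  rw [relIndex_colonSubmodule hI] at h6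
  have h7 : ((rangeSubmodule k B L).toAddSubgroup ⊔ (inftyFil e (-1)).toAddSubgroup).relIndex
      (colonSubmodule k L I).toAddSubgroup ≤
      Nat.card k ^ (d * (M + 1)) := by
    rw [← Submodule.sup_toAddSubgroup]
    exact (Nat.le_of_dvd (Nat.pos_of_ne_zero h1)
      (AddSubgroup.relIndex_dvd_index_of_normal _ _)).trans h2
  have h8 : Nat.card k ^ idealDeg k I ≤ Nat.card k ^ (d * (M + 2)) * Nat.card k ^ (d * (M + 1)) := by
    rw [h6, ← toAddSubgroup_inf]
    exact Nat.mul_le_mul (h5.trans h4) h7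
  rw [← pow_add] at h8
  have := (Nat.pow_le_pow_iff_right (Finite.one_lt_card (α := k))).1 h8
  rw [← mul_add, show M + 2 + (M + 1) = 2 * M + 3 by ring] at this
  exact absurd hdeg this.not_gt

lemma IsReducedBasis.card_colonSubmodule_mul (h : IsReducedBasis e B M) {I : Ideal B}
    (hI : I ≠ ⊥) (hdeg : d * (2 * M + 3) < idealDeg k I) (j : ℕ) (hj : j ≤ 2) (z : L) :
    Nat.card {α : L // α ∈ colonSubmodule k L I ∧ α - z ∈ inftyFil e (-1 - j)} *
      ((rangeSubmodule k B L ⊔ inftyFil e (-1)).toAddSubgroup.index * Nat.card k ^ (d * j)) =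
      Nat.card k ^ idealDeg k I := by
  have hmono : inftyFil e (-1 - j) ≤ inftyFil e (-1) := inftyFil_mono (by omega)
  have hmono' : inftyFil e (-3) ≤ inftyFil e (-1 - j) := inftyFil_mono (by omega)
  have htop : colonSubmodule k L I ⊔ inftyFil e (-1 - j) = ⊤ :=
    top_le_iff.1 ((h.colonSubmodule_sup_eq_top hI hdeg).ge.trans (sup_le_sup_left hmono' _))
  have hle : rangeSubmodule k B L ≤ colonSubmodule k L I := rangeSubmodule_le_colonSubmodule I
  rw [card_coset_eq htop, ← index_sup_inftyFil_add h.inf_eq_bot, ← relIndex_colonSubmodule (L := L) hI]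
  rw [Submodule.sup_toAddSubgroup]
  refine Eq.trans ?_ (AddSubgroup.relIndex_eq_card_inf_mul_index (B := (rangeSubmodule k B L).toAddSubgroup)
    (Λ := (colonSubmodule k L I).toAddSubgroup)
    (V := (inftyFil e (-1 - j)).toAddSubgroup) hle ?_ ?_).symm
  · rw [← toAddSubgroup_inf]; rfl
  · have : rangeSubmodule k B L ⊓ inftyFil e (-1 - j) = ⊥ :=
      le_bot_iff.1 ((inf_le_inf_left _ hmono).trans h.inf_eq_bot.le)
    rw [← toAddSubgroup_inf, this]; rfl
  · rw [← Submodule.sup_toAddSubgroup, htop]; rfl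

lemma IsReducedBasis.index_pos (h : IsReducedBasis e B M) :
    0 < (rangeSubmodule k B L ⊔ inftyFil e (-1)).toAddSubgroup.index := by
  have := (index_sup_inftyFil_le h.sup_eq_top 1).1
  rw [Nat.cast_one] at this
  exact Nat.pos_of_ne_zero this

lemma IsReducedBasis.finite_coset (h : IsReducedBasis e B M) {I : Ideal B}
    (hI : I ≠ ⊥) (hdeg : d * (2 * M + 3) < idealDeg k I) (j : ℕ) (hj : j ≤ 2) (z : L) :
    {α : L | α ∈ colonSubmodule k L I ∧ α - z ∈ inftyFil e (-1 - j)}.Finite := by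
  have h1 := h.card_colonSubmodule_mul hI hdeg j hj z
  have h2 : Nat.card {α : L // α ∈ colonSubmodule k L I ∧ α - z ∈ inftyFil e (-1 - j)} ≠ 0 := by
    intro h0
    rw [h0, zero_mul] at h1
    exact (pow_pos Nat.card_pos _).ne h1
  exact Set.finite_coe_iff.1 (Nat.card_ne_zero.1 h2).2

/-- The sums of `ψ` over the ideals of large degree are, up to a power of `q`, periodic in the
degree. -/
lemma IsReducedBasis.idealCharSum_add (h : IsReducedBasis e B M) (ψ : k → ℂ) {n : ℕ}
    (hn : d * (2 * M + 3) < n) :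
    idealCharSum B ψ (n + d) = (Nat.card k : ℂ) ^ d * idealCharSum B ψ n := by
  classical
  set x : L := algebraMap (RatFunc k) L RatFunc.X with hx
  have hx0 : x ≠ 0 := (_root_.map_ne_zero _).2 RatFunc.X_ne_zero
  set G := (rangeSubmodule k B L ⊔ inftyFil e (-1)).toAddSubgroup.index
  have hG := h.index_pos
  let S : ℕ → L → Ideal B → Finset L := fun j z I =>
    if hf : {α : L | α ∈ colonSubmodule k L I ∧ α - z ∈ inftyFil e (-1 - j)}.Finite
      then hf.toFinset else ∅
  have hS : ∀ j ≤ 2, ∀ z, ∀ I : Ideal B, I ≠ ⊥ → d * (2 * M + 3) < idealDeg k I → ∀ α,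
      α ∈ S j z I ↔ α ∈ colonSubmodule k L I ∧ α - z ∈ inftyFil e (-1 - j) := by
    intro j hj z I hI hdeg α
    simp only [S, dif_pos (h.finite_coset hI hdeg j hj z), Set.Finite.mem_toFinset]
    rfl
  have hS0 : ∀ I : Ideal B, I ≠ ⊥ → d * (2 * M + 3) < idealDeg k I → ∀ α,
      α ∈ S 0 x I ↔ α ∈ colonSubmodule k L I ∧ α - x ∈ inftyFil e (-1) := by
    intro I hI hdeg α
    have := hS 0 (by norm_num) x I hI hdeg α
    rwa [show -1 - ((0 : ℕ) : ℤ) = -1 by norm_num] at this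
  have hS2 : ∀ I : Ideal B, I ≠ ⊥ → d * (2 * M + 3) < idealDeg k I → ∀ α,
      α ∈ S 2 x⁻¹ I ↔ α ∈ colonSubmodule k L I ∧ α - x⁻¹ ∈ inftyFil e (-3) := by
    intro I hI hdeg α
    have := hS 2 le_rfl x⁻¹ I hI hdeg α
    rwa [show -1 - ((2 : ℕ) : ℤ) = -3 by norm_num] at this
  have hcard : ∀ j ≤ 2, ∀ z, ∀ I : Ideal B, I ≠ ⊥ → d * (2 * M + 3) < idealDeg k I →
      (S j z I).card * (G * Nat.card k ^ (d * j)) = Nat.card k ^ idealDeg k I := by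
    intro j hj z I hI hdeg
    rw [← h.card_colonSubmodule_mul hI hdeg j hj z]
    simp only [S, dif_pos (h.finite_coset hI hdeg j hj z)]
    rw [← Set.ncard_eq_toFinset_card _ (h.finite_coset hI hdeg j hj z)]
    rfl
  have hdegJ : ∀ I ∈ idealsOfDeg k B (n + d), I ≠ ⊥ ∧ d * (2 * M + 3) < idealDeg k I := by
    intro I hI
    obtain ⟨h1, h2⟩ := mem_idealsOfDeg.1 hI
    exact ⟨h1, by omega⟩
  have hdegI : ∀ I ∈ idealsOfDeg k B n, I ≠ ⊥ ∧ d * (2 * M + 3) < idealDeg k I := by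
    intro I hI
    obtain ⟨h1, h2⟩ := mem_idealsOfDeg.1 hI
    exact ⟨h1, by omega⟩
  have hform : ∀ {α : L}, α - x ∈ inftyFil e (-1) →
      ∃ v ∈ inftyFil e (-2), α = x * (1 + v) := by
    intro α hα
    refine ⟨x⁻¹ * (α - x), ?_, by field_simp; ring⟩
    rw [← mul_X_mem_inftyFil_iff (show (-1 : ℤ) = -2 + 1 by norm_num), ← hx, mul_inv_cancel_left₀ hx0]
    exact hα
  have hform' : ∀ {v : L}, v ∈ inftyFil e (-2) → x * (1 + v) - x ∈ inftyFil e (-1) := by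
    intro v hv
    rw [show x * (1 + v) - x = x * v by ring]
    exact (mul_X_mem_inftyFil_iff (by norm_num)).2 hv
  have hinv : ∀ {v : L}, v ∈ inftyFil e (-2) → (1 + v)⁻¹ - 1 ∈ inftyFil e (-2) := by
    intro v hv
    exact one_add_inv_mem h.mul_mem h.one_mem (j := 2) (by norm_num) hv (h.one_add_ne_zero hv)
  have hform3 : ∀ {β : L}, β - x⁻¹ ∈ inftyFil e (-3) →
      ∃ v ∈ inftyFil e (-2), β = x⁻¹ * (1 + v) := by
    intro β hβ
    refine ⟨x * (β - x⁻¹), ?_, by field_simp; ring⟩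
    exact (mul_X_mem_inftyFil_iff (by norm_num)).2 hβ
  have hform3' : ∀ {v : L}, v ∈ inftyFil e (-2) →
      x⁻¹ * (1 + v) - x⁻¹ ∈ inftyFil e (-3) := by
    intro v hv
    refine (mul_X_mem_inftyFil_iff (show (-2 : ℤ) = -3 + 1 by norm_num)).1 ?_
    rw [← hx, show x * (x⁻¹ * (1 + v) - x⁻¹) = v by field_simp; ring]
    exact hv
  have key : ∑ I ∈ idealsOfDeg k B n, ∑ _α ∈ S 0 x I, ψ (idealTrace k I) =
      ∑ J ∈ idealsOfDeg k B (n + d), ∑ _β ∈ S 2 x⁻¹ J, ψ (idealTrace k J) := by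
    rw [Finset.sum_sigma', Finset.sum_sigma']
    refine Finset.sum_bij' (fun y _ => ⟨scaleIdeal y.2 y.1, y.2⁻¹⟩)
      (fun y _ => ⟨scaleIdeal y.2 y.1, y.2⁻¹⟩) ?_ ?_ ?_ ?_ ?_
    · rintro ⟨I, α⟩ hy
      obtain ⟨hI, hα⟩ := Finset.mem_sigma.1 hy
      obtain ⟨hI0, hdeg⟩ := hdegI I hI
      obtain ⟨hα1, hα2⟩ := (hS0 I hI0 hdeg α).1 hα
      obtain ⟨v, hv, rfl⟩ := hform hα2
      have hα0 := mul_ne_zero hx0 (h.one_add_ne_zero hv)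
      have hJ := h.scaleIdeal_invariants hv hI0 hα1
      have hJ0 := scaleIdeal_ne_bot hα0 hI0 hα1
      refine Finset.mem_sigma.2 ⟨mem_idealsOfDeg.2 ⟨hJ0, ?_⟩, ?_⟩
      · rw [← (mem_idealsOfDeg.1 hI).2]; exact hJ.1
      · refine (hS2 _ hJ0 (hdeg.trans_le (hJ.1 ▸ Nat.le_add_right _ _)) _).2
          ⟨inv_mem_colonSubmodule_scaleIdeal hα0, ?_⟩
        have := hform3' (hinv hv)
        rwa [add_sub_cancel, ← mul_inv] at this
    · rintro ⟨J, β⟩ hy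
      obtain ⟨hJ, hβ⟩ := Finset.mem_sigma.1 hy
      obtain ⟨hJ0, hdeg⟩ := hdegJ J hJ
      obtain ⟨hβ1, hβ2⟩ := (hS2 J hJ0 hdeg β).1 hβ
      obtain ⟨v, hv, rfl⟩ := hform3 hβ2
      have hβ0 := mul_ne_zero (inv_ne_zero hx0) (h.one_add_ne_zero hv)
      have hI0 := scaleIdeal_ne_bot hβ0 hJ0 hβ1
      have hα1 : x * (1 + ((1 + v)⁻¹ - 1)) ∈ colonSubmodule k L (scaleIdeal (x⁻¹ * (1 + v)) J) := by
        rw [add_sub_cancel, show x * (1 + v)⁻¹ = (x⁻¹ * (1 + v))⁻¹ by rw [mul_inv, inv_inv]]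
        exact inv_mem_colonSubmodule_scaleIdeal hβ0
      have hI := h.scaleIdeal_invariants (hinv hv) hI0 hα1
      have e1 : scaleIdeal (x * (1 + ((1 + v)⁻¹ - 1))) (scaleIdeal (x⁻¹ * (1 + v)) J) = J := by
        rw [add_sub_cancel, show x * (1 + v)⁻¹ = (x⁻¹ * (1 + v))⁻¹ by rw [mul_inv, inv_inv]]
        exact scaleIdeal_inv_scaleIdeal hβ0 hβ1
      rw [← hx, e1] at hI
      have hdeg' : idealDeg k (scaleIdeal (x⁻¹ * (1 + v)) J) = n := by
        have : idealDeg k J = n + d := (mem_idealsOfDeg.1 hJ).2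
        have h2 := hI.1
        omega
      refine Finset.mem_sigma.2 ⟨mem_idealsOfDeg.2 ⟨hI0, hdeg'⟩, ?_⟩
      refine (hS0 _ hI0 (by omega) _).2
          ⟨inv_mem_colonSubmodule_scaleIdeal hβ0, ?_⟩
      have := hform' (hinv hv)
      rwa [add_sub_cancel, show x * (1 + v)⁻¹ = (x⁻¹ * (1 + v))⁻¹ by rw [mul_inv, inv_inv]] at this
    · rintro ⟨I, α⟩ hy
      obtain ⟨hI, hα⟩ := Finset.mem_sigma.1 hy
      obtain ⟨hI0, hdeg⟩ := hdegI I hI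
      obtain ⟨hα1, hα2⟩ := (hS0 I hI0 hdeg α).1 hα
      obtain ⟨v, hv, rfl⟩ := hform hα2
      have hα0 := mul_ne_zero hx0 (h.one_add_ne_zero hv)
      simp only [scaleIdeal_inv_scaleIdeal hα0 hα1, inv_inv]
    · rintro ⟨J, β⟩ hy
      obtain ⟨hJ, hβ⟩ := Finset.mem_sigma.1 hy
      obtain ⟨hJ0, hdeg⟩ := hdegJ J hJ
      obtain ⟨hβ1, hβ2⟩ := (hS2 J hJ0 hdeg β).1 hβ
      obtain ⟨v, hv, rfl⟩ := hform3 hβ2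
      have hβ0 := mul_ne_zero (inv_ne_zero hx0) (h.one_add_ne_zero hv)
      simp only [scaleIdeal_inv_scaleIdeal hβ0 hβ1, inv_inv]
    · rintro ⟨I, α⟩ hy
      obtain ⟨hI, hα⟩ := Finset.mem_sigma.1 hy
      obtain ⟨hI0, hdeg⟩ := hdegI I hI
      obtain ⟨hα1, hα2⟩ := (hS0 I hI0 hdeg α).1 hα
      obtain ⟨v, hv, rfl⟩ := hform hα2
      rw [(h.scaleIdeal_invariants hv hI0 hα1).2]
  have hq0 : (Nat.card k : ℂ) ≠ 0 := Nat.cast_ne_zero.2 Nat.card_pos.ne'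
  have hG0 : (G : ℂ) ≠ 0 := Nat.cast_ne_zero.2 hG.ne'
  have hl : ∀ I ∈ idealsOfDeg k B n, ∑ _α ∈ S 0 x I, ψ (idealTrace k I) =
      ((Nat.card k : ℂ) ^ n / G) * ψ (idealTrace k I) := by
    intro I hI
    have h1 := hcard 0 (by norm_num) x I (hdegI I hI).1 (hdegI I hI).2
    rw [(mem_idealsOfDeg.1 hI).2, mul_zero, pow_zero, mul_one] at h1
    rw [Finset.sum_const, nsmul_eq_mul]
    congr 1
    rw [eq_div_iff hG0]
    exact_mod_cast h1
  have hr : ∀ J ∈ idealsOfDeg k B (n + d), ∑ _α ∈ S 2 x⁻¹ J, ψ (idealTrace k J) =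
      ((Nat.card k : ℂ) ^ (n + d) / (G * (Nat.card k : ℂ) ^ (d * 2))) * ψ (idealTrace k J) := by
    intro J hJ
    have h1 := hcard 2 le_rfl x⁻¹ J (hdegJ J hJ).1 (hdegJ J hJ).2
    rw [(mem_idealsOfDeg.1 hJ).2] at h1
    rw [Finset.sum_const, nsmul_eq_mul]
    congr 1
    rw [eq_div_iff (mul_ne_zero hG0 (pow_ne_zero _ hq0))]
    exact_mod_cast h1
  rw [Finset.sum_congr rfl hl, Finset.sum_congr rfl hr, ← Finset.mul_sum, ← Finset.mul_sum] at key
  change _ * idealCharSum B ψ n = _ * idealCharSum B ψ (n + d) at key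
  have h2 : (Nat.card k : ℂ) ^ (d * 2) = (Nat.card k : ℂ) ^ d * (Nat.card k : ℂ) ^ d := by
    rw [mul_two, pow_add]
  rw [h2, pow_add] at key
  have hqd := pow_ne_zero d hq0
  have hqn := pow_ne_zero n hq0
  field_simp at key
  linear_combination -key

end CharacterSumIdeals

section EulerProduct
open Module Polynomial UniqueFactorizationMonoid

variable {k B : Type*} [Field k] [CommRing B] [Algebra k[X] B] [Algebra k B]
  [IsScalarTower k k[X] B] [Finite k] [Ring.HasFiniteQuotients B]

variable (k B) in
/-- The nonzero prime ideals of degree `m`. -/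
noncomputable def primesOfDeg (m : ℕ) : Finset (Ideal B) :=
  have := Classical.decPred fun P : Ideal B => P.IsPrime
  (idealsOfDeg k B m).filter fun P => P.IsPrime

lemma mem_primesOfDeg {m : ℕ} {P : Ideal B} :
    P ∈ primesOfDeg k B m ↔ P ≠ ⊥ ∧ idealDeg k P = m ∧ P.IsPrime := by
  have := Classical.decPred fun P : Ideal B => P.IsPrime
  simp only [primesOfDeg, Finset.mem_filter, mem_idealsOfDeg, and_assoc]

variable (B) in
/-- The coefficients of the logarithmic derivative of the generating series of `idealCharSum`. -/
noncomputable def primeCharSum (ψ : k → ℂ) (ν : ℕ) : ℂ :=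
  ∑ m ∈ ν.divisors, ∑ P ∈ primesOfDeg k B m, m * ψ (idealTrace k P) ^ (ν / m)

lemma idealDeg_pos {P : Ideal B} (h0 : P ≠ ⊥) (hP : P ≠ ⊤) : 0 < idealDeg k P := by
  have := finite_quotient_ideal (k := k) h0
  have : Nontrivial (B ⧸ P) := Ideal.Quotient.nontrivial_iff.2 hP
  exact finrank_pos

variable [IsDedekindDomain B]

lemma idealDeg_multiset_prod (m : Multiset (Ideal B)) (hm : ∀ I ∈ m, I ≠ ⊥) :
    m.prod ≠ ⊥ ∧ idealDeg k m.prod = (m.map (idealDeg k)).sum := by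
  induction m using Multiset.induction_on with
  | empty =>
    refine ⟨?_, ?_⟩
    · rw [Multiset.prod_zero]; exact one_ne_zero
    · simpa using idealDeg_pow (k := k) (I := (⊤ : Ideal B)) top_ne_bot 0
  | cons I m ih =>
    obtain ⟨h1, h2⟩ := ih fun J hJ => hm J (Multiset.mem_cons_of_mem hJ)
    have hI := hm I (Multiset.mem_cons_self I m)
    rw [Multiset.prod_cons, Multiset.map_cons, Multiset.sum_cons]
    exact ⟨mul_ne_zero hI h1, by rw [idealDeg_mul hI h1, h2]⟩

lemma prime_pow_dvd_iff_le_count [DecidableEq (Ideal B)] {P I : Ideal B} (hP : Prime P) (hI : I ≠ ⊥) (j : ℕ) :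
    P ^ j ∣ I ↔ j ≤ (normalizedFactors I).count P := by
  rw [dvd_iff_normalizedFactors_le_normalizedFactors (pow_ne_zero _ hP.ne_zero) hI,
    hP.irreducible.normalizedFactors_pow, normalize_eq, Multiset.le_count_iff_replicate_le]

open Classical in
lemma idealDeg_eq_sum_primes {I : Ideal B} (hI : I ≠ ⊥) {n : ℕ} (hn : idealDeg k I = n) :
    n = ∑ m ∈ Finset.Icc 1 n, ∑ P ∈ primesOfDeg k B m, ∑ j ∈ Finset.Icc 1 n,
      if P ^ j ∣ I then m else 0 := by
  have hpr : ∀ P ∈ normalizedFactors I, Prime P := fun P hP => prime_of_normalized_factor P hP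
  have hprod : (normalizedFactors I).prod = I := associated_iff_eq.1 (prod_normalizedFactors hI)
  have hsum := (idealDeg_multiset_prod (k := k) (normalizedFactors I)
    fun P hP => (hpr P hP).ne_zero).2
  rw [hprod, hn, Finset.sum_multiset_map_count] at hsum
  have hcount : ∀ m ∈ Finset.Icc 1 n, ∀ P ∈ primesOfDeg k B m, (∑ j ∈ Finset.Icc 1 n,
      if P ^ j ∣ I then m else 0) = (normalizedFactors I).count P * idealDeg k P := by
    intro m hm P hP
    obtain ⟨h0, hdeg, hPp⟩ := mem_primesOfDeg.1 hP
    have hP' : Prime P := Ideal.prime_of_isPrime h0 hPp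
    have hle : (normalizedFactors I).count P ≤ n := by
      have h1 : P ^ (normalizedFactors I).count P ∣ I := (prime_pow_dvd_iff_le_count hP' hI _).2 le_rfl
      obtain ⟨J, hJ⟩ := h1
      have hJ0 : J ≠ ⊥ := by
        rintro rfl
        exact hI (by rw [hJ, Ideal.mul_bot])
      rw [hJ, idealDeg_mul (pow_ne_zero _ h0) hJ0, idealDeg_pow h0, hdeg] at hn
      have h2 := (Finset.mem_Icc.1 hm).1
      nlinarith
    rw [← Finset.sum_filter, Finset.sum_const, smul_eq_mul, hdeg]
    congr 1
    have : (Finset.Icc 1 n).filter (fun j => P ^ j ∣ I) =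
        Finset.Icc 1 ((normalizedFactors I).count P) := by
      ext j
      rw [Finset.mem_filter, prime_pow_dvd_iff_le_count hP' hI, Finset.mem_Icc, Finset.mem_Icc]
      omega
    rw [this, Nat.card_Icc, Nat.add_sub_cancel]
  rw [Finset.sum_congr rfl fun m hm => Finset.sum_congr rfl (hcount m hm)]
  rw [← Finset.sum_biUnion]
  · refine hsum.trans (Finset.sum_subset ?_ ?_)
    · intro P hP
      rw [Multiset.mem_toFinset] at hP
      have hP' := hpr P hP
      have hle : idealDeg k P ≤ n := by
        obtain ⟨J, hJ⟩ := dvd_of_mem_normalizedFactors hP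
        have hJ0 : J ≠ ⊥ := by
          rintro rfl
          exact hI (by rw [hJ, Ideal.mul_bot])
        have := idealDeg_mul (k := k) hP'.ne_zero hJ0
        rw [← hJ, hn] at this
        omega
      refine Finset.mem_biUnion.2 ⟨idealDeg k P, Finset.mem_Icc.2 ⟨?_, hle⟩, mem_primesOfDeg.2
        ⟨hP'.ne_zero, rfl, Ideal.isPrime_of_prime hP'⟩⟩
      exact idealDeg_pos hP'.ne_zero (Ideal.isPrime_of_prime hP').ne_top
    · intro P _ hP
      rw [Multiset.mem_toFinset] at hP
      rw [Multiset.count_eq_zero_of_notMem hP, zero_smul]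
  · intro m _ m' _ hne
    refine Finset.disjoint_left.2 fun P hP hP' => hne ?_
    rw [← (mem_primesOfDeg.1 hP).2.1, (mem_primesOfDeg.1 hP').2.1]

open Classical in
lemma sum_filter_pow_dvd (ψ : AddChar k ℂ) {m n j : ℕ} {P : Ideal B} (hP : P ∈ primesOfDeg k B m) :
    ∑ I ∈ idealsOfDeg k B n with P ^ j ∣ I, ψ (idealTrace k I) =
      if j * m ≤ n then ψ (idealTrace k P) ^ j * idealCharSum B ψ (n - j * m) else 0 := by
  obtain ⟨h0, hdeg, hPp⟩ := mem_primesOfDeg.1 hP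
  have hPj : P ^ j ≠ ⊥ := pow_ne_zero _ h0
  have hdegmul : ∀ J : Ideal B, J ≠ ⊥ → idealDeg k (P ^ j * J) = j * m + idealDeg k J := fun J hJ => by
    rw [idealDeg_mul hPj hJ, idealDeg_pow h0, hdeg]
  split_ifs with hjm
  · rw [idealCharSum, Finset.mul_sum]
    symm
    refine Finset.sum_bij (fun J _ => P ^ j * J) ?_ ?_ ?_ ?_
    · intro J hJ
      obtain ⟨h1, h2⟩ := mem_idealsOfDeg.1 hJ
      refine Finset.mem_filter.2 ⟨mem_idealsOfDeg.2 ⟨mul_ne_zero hPj h1, ?_⟩, dvd_mul_right _ _⟩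
      rw [hdegmul J h1]; omega
    · intro J _ J' _ h
      exact mul_left_cancel₀ hPj h
    · intro I hI
      obtain ⟨h1, J, rfl⟩ := Finset.mem_filter.1 hI
      obtain ⟨h2, h3⟩ := mem_idealsOfDeg.1 h1
      have hJ0 : J ≠ ⊥ := by
        rintro rfl
        exact h2 (Ideal.mul_bot _)
      rw [hdegmul J hJ0] at h3
      exact ⟨J, mem_idealsOfDeg.2 ⟨hJ0, by omega⟩, rfl⟩
    · intro J hJ
      obtain ⟨h1, h2⟩ := mem_idealsOfDeg.1 hJ
      rw [idealTrace_mul hPj h1, idealTrace_pow h0, AddChar.map_add_eq_mul, ← nsmul_eq_mul,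
        AddChar.map_nsmul_eq_pow]
  · refine Finset.sum_eq_zero fun I hI => absurd hI ?_
    intro hI
    obtain ⟨h1, J, rfl⟩ := Finset.mem_filter.1 hI
    obtain ⟨h2, h3⟩ := mem_idealsOfDeg.1 h1
    have hJ0 : J ≠ ⊥ := by
      rintro rfl
      exact h2 (Ideal.mul_bot _)
    rw [hdegmul J hJ0] at h3
    omega

/-- The Euler product, in logarithmic form. -/
lemma mul_idealCharSum_eq (ψ : AddChar k ℂ) (n : ℕ) :
    n * idealCharSum B ψ n =
      ∑ ν ∈ Finset.Icc 1 n, primeCharSum B ψ ν * idealCharSum B ψ (n - ν) := by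
  classical
  have h1 : (n : ℂ) * idealCharSum B ψ n = ∑ m ∈ Finset.Icc 1 n, ∑ P ∈ primesOfDeg k B m,
      ∑ j ∈ Finset.Icc 1 n, (m : ℂ) * ∑ I ∈ idealsOfDeg k B n with P ^ j ∣ I, ψ (idealTrace k I) := by
    rw [idealCharSum, Finset.mul_sum]
    have : ∀ I ∈ idealsOfDeg k B n, (n : ℂ) * ψ (idealTrace k I) =
        ∑ m ∈ Finset.Icc 1 n, ∑ P ∈ primesOfDeg k B m, ∑ j ∈ Finset.Icc 1 n,
          if P ^ j ∣ I then (m : ℂ) * ψ (idealTrace k I) else 0 := by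
      intro I hI
      obtain ⟨hI0, hdeg⟩ := mem_idealsOfDeg.1 hI
      conv_lhs => rw [idealDeg_eq_sum_primes hI0 hdeg]
      push_cast
      simp only [Finset.sum_mul, ite_mul, zero_mul]
    rw [Finset.sum_congr rfl this, Finset.sum_comm]
    refine Finset.sum_congr rfl fun m _ => ?_
    rw [Finset.sum_comm]
    refine Finset.sum_congr rfl fun P _ => ?_
    rw [Finset.sum_comm]
    refine Finset.sum_congr rfl fun j _ => ?_
    rw [Finset.mul_sum, Finset.sum_filter]
  have h2 : ∀ m ∈ Finset.Icc 1 n, ∑ P ∈ primesOfDeg k B m,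
      ∑ j ∈ Finset.Icc 1 n, (m : ℂ) * ∑ I ∈ idealsOfDeg k B n with P ^ j ∣ I, ψ (idealTrace k I) =
      ∑ j ∈ Finset.Icc 1 n with j * m ≤ n, (∑ P ∈ primesOfDeg k B m, (m : ℂ) *
        ψ (idealTrace k P) ^ j) * idealCharSum B ψ (n - j * m) := by
    intro m _
    rw [Finset.sum_comm, Finset.sum_filter]
    refine Finset.sum_congr rfl fun j _ => ?_
    rw [Finset.sum_congr rfl fun P hP => by rw [sum_filter_pow_dvd ψ hP]]
    split_ifs with hjm
    · rw [Finset.sum_mul]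
      exact Finset.sum_congr rfl fun P _ => by ring
    · simp
  rw [h1, Finset.sum_congr rfl h2]
  simp only [primeCharSum, Finset.sum_mul (s := Nat.divisors _)]
  rw [Finset.sum_sigma', Finset.sum_sigma']
  refine Finset.sum_bij' (fun x _ => ⟨x.2 * x.1, x.1⟩) (fun x _ => ⟨x.2, x.1 / x.2⟩) ?_ ?_ ?_ ?_ ?_
  · rintro ⟨m, j⟩ h
    simp only [Finset.mem_sigma, Finset.mem_Icc, Finset.mem_filter, Nat.mem_divisors] at h ⊢
    refine ⟨⟨Nat.mul_pos h.2.1.1 h.1.1, h.2.2⟩, dvd_mul_left _ _, (Nat.mul_pos h.2.1.1 h.1.1).ne'⟩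
  · rintro ⟨ν, m⟩ h
    simp only [Finset.mem_sigma, Finset.mem_Icc, Finset.mem_filter, Nat.mem_divisors] at h ⊢
    obtain ⟨⟨h1, h2⟩, ⟨j, rfl⟩, h4⟩ := h
    have hm : 0 < m := Nat.pos_of_mul_pos_right h1 |> fun h => by
      rcases Nat.eq_zero_or_pos m with rfl | h'
      · simp at h4
      · exact h'
    rw [Nat.mul_div_cancel_left _ hm]
    have hj : 0 < j := Nat.pos_of_ne_zero (by rintro rfl; simp at h4)
    refine ⟨⟨hm, ?_⟩, ⟨hj, ?_⟩, by rwa [mul_comm]⟩ <;> nlinarith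
  · rintro ⟨m, j⟩ h
    simp only [Finset.mem_sigma, Finset.mem_Icc, Finset.mem_filter] at h
    simp only [Nat.mul_div_cancel _ h.1.1]
  · rintro ⟨ν, m⟩ h
    simp only [Finset.mem_sigma, Nat.mem_divisors] at h
    simp only [Nat.div_mul_cancel h.2.1]
  · rintro ⟨m, j⟩ h
    simp only [Finset.mem_sigma, Finset.mem_Icc, Finset.mem_filter] at h
    simp only [Nat.mul_div_cancel _ h.1.1]

end EulerProduct

section PrimeHoms
open Module Polynomial

lemma pow_pow_mul_eq_self {F : Type*} [Monoid F] {p m : ℕ} {x : F} (hx : x ^ p ^ m = x) (j : ℕ) :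
    x ^ p ^ (m * j) = x := by
  induction j with
  | zero => simp
  | succ j ih => rw [mul_add, mul_one, pow_add, pow_mul, ih, hx]

lemma frobTrace_mul {F : Type} [Field F] {p m : ℕ} {x : F} (hx : x ^ p ^ m = x) (j : ℕ) :
    frobTrace p (m * j) x = j * frobTrace p m x := by
  induction j with
  | zero => simp [frobTrace]
  | succ j ih =>
    have : frobTrace p (m * (j + 1)) x = frobTrace p (m * j) x + frobTrace p m x := by
      rw [frobTrace, mul_add, mul_one, Finset.sum_range_add, frobTrace, frobTrace]
      congr 1
      refine Finset.sum_congr rfl fun i _ => ?_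
      rw [pow_add, pow_mul, pow_pow_mul_eq_self hx]
    rw [this, ih]; push_cast; ring

lemma finrank_dvd_of_forall_pow_eq {k K : Type*} [Field k] [Finite k] [Field K] [Finite K] [Algebra k K] {ν : ℕ}
    (h : ∀ x : K, x ^ Nat.card k ^ ν = x) : finrank k K ∣ ν := by
  have := Fintype.ofFinite k
  rw [← FiniteField.orderOf_frobeniusAlgHom, orderOf_dvd_iff_pow_eq_one]
  ext x
  rw [AlgHom.coe_pow, FiniteField.coe_frobeniusAlgHom, pow_iterate, AlgHom.one_apply,
    ← Nat.card_eq_fintype_card]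
  exact h x

variable {p : ℕ} [Fact p.Prime] {F : Type} [Field F] [Algebra (ZMod p) F]

open Classical in
/-- The character of `F` obtained by composing `ψ` with the trace map of the field with `p ^ ν`
elements. -/
noncomputable def frobChar (ψ : ZMod p → ℂ) (ν : ℕ) (x : F) : ℂ :=
  if h : ∃ a : ZMod p, algebraMap (ZMod p) F a = frobTrace p ν x then ψ h.choose else 0

lemma frobChar_eq {ψ : ZMod p → ℂ} {ν : ℕ} {x : F} {a : ZMod p}
    (h : frobTrace p ν x = algebraMap (ZMod p) F a) : frobChar ψ ν x = ψ a := by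
  have h' : ∃ a : ZMod p, algebraMap (ZMod p) F a = frobTrace p ν x := ⟨a, h.symm⟩
  rw [frobChar, dif_pos h']
  exact congrArg ψ ((algebraMap (ZMod p) F).injective (h'.choose_spec.trans h))

lemma norm_frobChar_le {ψ : AddChar (ZMod p) ℂ} {ν : ℕ} {x : F} : ‖frobChar ψ ν x‖ ≤ 1 := by
  rw [frobChar]
  split_ifs
  · rw [AddChar.norm_apply]
  · simp

variable {B : Type*} [CommRing B] [Algebra (ZMod p)[X] B] [Algebra (ZMod p) B]
  [IsScalarTower (ZMod p) (ZMod p)[X] B] [Ring.HasFiniteQuotients B]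
variable [IsAlgClosed F]

lemma exists_finset_algHom_of_prime {m ν : ℕ} {P : Ideal B} (hP : P ∈ primesOfDeg (ZMod p) B m)
    (hν : m ∣ ν) :
    ∃ T : Finset (B →ₐ[ZMod p] F), (∀ σ, σ ∈ T ↔ RingHom.ker σ = P) ∧ T.card = m ∧
      ∀ σ ∈ T, (∀ b, σ b ^ p ^ ν = σ b) ∧
        frobTrace p ν (σ (algebraMap (ZMod p)[X] B X)) =
          algebraMap (ZMod p) F ((ν / m : ℕ) * idealTrace (ZMod p) P) := by
  classical
  obtain ⟨h0, hdeg, hPp⟩ := mem_primesOfDeg.1 hP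
  have hfin : Finite (B ⧸ P) := Ring.HasFiniteQuotients.finiteQuotient h0
  let := Fintype.ofFinite (B ⧸ P)
  let fieldP : Field (B ⧸ P) := Fintype.fieldOfDomain (B ⧸ P)
  have : Module.Finite (ZMod p) (B ⧸ P) := inferInstance
  have hcard : Fintype.card (B ⧸ P) = p ^ m := by
    have := card_quotient_ideal (k := ZMod p) h0
    rwa [Nat.card_zmod, hdeg, Nat.card_eq_fintype_card] at this
  have hpow : ∀ x : B ⧸ P, x ^ p ^ m = x := fun x => by
    rw [← hcard]; exact FiniteField.pow_card x
  let emb : ((B ⧸ P) →ₐ[ZMod p] F) → (B →ₐ[ZMod p] F) := fun τ => τ.comp (Ideal.Quotient.mkₐ _ P)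
  have hemb : Function.Injective emb := fun τ τ' h => by
    ext x
    obtain ⟨x, rfl⟩ := Ideal.Quotient.mk_surjective x
    exact DFunLike.congr_fun h x
  have hm : 0 < m := hdeg ▸ idealDeg_pos h0 hPp.ne_top
  refine ⟨Finset.univ.image emb, fun σ => ?_, ?_, ?_⟩
  · rw [Finset.mem_image]
    constructor
    · rintro ⟨τ, -, rfl⟩
      ext b
      rw [RingHom.mem_ker]
      change τ (Ideal.Quotient.mk P b) = 0 ↔ _
      rw [map_eq_zero_iff τ (RingHom.injective τ.toRingHom), Ideal.Quotient.eq_zero_iff_mem]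
    · intro h
      exact ⟨Ideal.Quotient.liftₐ P σ fun a ha => by rwa [← h] at ha, Finset.mem_univ _, by
        ext b; rfl⟩
  · rw [Finset.card_image_of_injective _ hemb, Finset.card_univ, AlgHom.card, ← hdeg]; rfl
  · intro σ hσ
    obtain ⟨τ, -, rfl⟩ := Finset.mem_image.1 hσ
    obtain ⟨j, rfl⟩ := hν
    have hx : ∀ b, emb τ b ^ p ^ m = emb τ b := fun b => by
      change τ (Ideal.Quotient.mk P b) ^ p ^ m = τ (Ideal.Quotient.mk P b)
      rw [← map_pow, hpow]
    refine ⟨fun b => pow_pow_mul_eq_self (hx b) j, ?_⟩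
    rw [frobTrace_mul (hx _), Nat.mul_div_cancel_left _ hm, map_mul, map_natCast]
    congr 1
    change frobTrace p m (τ (Ideal.Quotient.mk P (algebraMap (ZMod p)[X] B X))) =
      algebraMap (ZMod p) F (Algebra.trace (ZMod p) (B ⧸ P) _)
    rw [← τ.commutes, FiniteField.algebraMap_trace_eq_sum_pow, map_sum, Nat.card_zmod]
    change _ = ∑ i ∈ Finset.range (idealDeg (ZMod p) P), _
    rw [hdeg, frobTrace]
    simp only [map_pow]

lemma mem_primesOfDeg_ker [FaithfulSMul (ZMod p)[X] B] {σ : B →ₐ[ZMod p] F} {ν : ℕ}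
    (hν : 0 < ν) (hσ : ∀ b, σ b ^ p ^ ν = σ b) :
    ∃ m, m ∣ ν ∧ RingHom.ker σ ∈ primesOfDeg (ZMod p) B m := by
  classical
  have hp : 1 < p := (Fact.out : p.Prime).one_lt
  have hprime : (RingHom.ker σ).IsPrime := RingHom.ker_isPrime _
  have h0 : RingHom.ker σ ≠ ⊥ := by
    intro h
    have h1 : (algebraMap (ZMod p)[X] B) (X ^ p ^ ν - X) ∈ RingHom.ker σ := by
      rw [RingHom.mem_ker, map_sub, map_sub, map_pow, map_pow]
      exact sub_eq_zero.2 (hσ _)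
    rw [h, Ideal.mem_bot, FaithfulSMul.algebraMap_eq_zero_iff] at h1
    exact FiniteField.X_pow_card_pow_sub_X_ne_zero (ZMod p) hν.ne' hp h1
  have hfin : Finite (B ⧸ RingHom.ker σ) := Ring.HasFiniteQuotients.finiteQuotient h0
  let := Fintype.ofFinite (B ⧸ RingHom.ker σ)
  let fieldP : Field (B ⧸ RingHom.ker σ) := Fintype.fieldOfDomain (B ⧸ RingHom.ker σ)
  refine ⟨idealDeg (ZMod p) (RingHom.ker σ), ?_, mem_primesOfDeg.2 ⟨h0, rfl, hprime⟩⟩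
  refine finrank_dvd_of_forall_pow_eq (k := ZMod p) (K := B ⧸ RingHom.ker σ) fun x => ?_
  obtain ⟨x, rfl⟩ := Ideal.Quotient.mk_surjective x
  rw [← map_pow, Ideal.Quotient.eq, RingHom.mem_ker, map_sub, map_pow, Nat.card_zmod, hσ, sub_self]

/-- `primeCharSum` as a sum over geometric points. -/
lemma exists_finset_primeCharSum_eq [FaithfulSMul (ZMod p)[X] B] (ψ : AddChar (ZMod p) ℂ) {ν : ℕ}
    (hν : 0 < ν) : ∃ S : Finset (B →ₐ[ZMod p] F), (∀ σ, σ ∈ S ↔ ∀ b, σ b ^ p ^ ν = σ b) ∧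
      primeCharSum B ψ ν = ∑ σ ∈ S, frobChar ψ ν (σ (algebraMap (ZMod p)[X] B X)) := by
  classical
  have hex : ∀ P : Ideal B, ∃ T : Finset (B →ₐ[ZMod p] F), ∀ m, P ∈ primesOfDeg (ZMod p) B m →
      m ∣ ν → (∀ σ, σ ∈ T ↔ RingHom.ker σ = P) ∧ T.card = m ∧
      ∀ σ ∈ T, (∀ b, σ b ^ p ^ ν = σ b) ∧
        frobTrace p ν (σ (algebraMap (ZMod p)[X] B X)) =
          algebraMap (ZMod p) F ((ν / m : ℕ) * idealTrace (ZMod p) P) := by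
    intro P
    by_cases h : P ∈ primesOfDeg (ZMod p) B (idealDeg (ZMod p) P) ∧ idealDeg (ZMod p) P ∣ ν
    · obtain ⟨T, hT⟩ := exists_finset_algHom_of_prime (F := F) h.1 h.2
      refine ⟨T, fun m hm _ => ?_⟩
      obtain rfl := (mem_primesOfDeg.1 hm).2.1
      exact hT
    · refine ⟨∅, fun m hm hmν => absurd ?_ h⟩
      obtain rfl := (mem_primesOfDeg.1 hm).2.1
      exact ⟨hm, hmν⟩
  choose T hT using hex
  have hd : ∀ {m}, m ∈ ν.divisors → m ∣ ν := fun h => Nat.dvd_of_mem_divisors h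
  refine ⟨(ν.divisors.biUnion fun m => primesOfDeg (ZMod p) B m).biUnion T, fun σ => ?_, ?_⟩
  · rw [Finset.mem_biUnion]
    constructor
    · rintro ⟨P, hP, hσ⟩
      obtain ⟨m, hm, hPm⟩ := Finset.mem_biUnion.1 hP
      exact ((hT P m hPm (hd hm)).2.2 σ hσ).1
    · intro hσ
      obtain ⟨m, hm, hker⟩ := mem_primesOfDeg_ker hν hσ
      exact ⟨_, Finset.mem_biUnion.2 ⟨m, Nat.mem_divisors.2 ⟨hm, hν.ne'⟩, hker⟩,
        ((hT _ m hker hm).1 σ).2 rfl⟩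
  · rw [Finset.sum_biUnion, Finset.sum_biUnion, primeCharSum]
    · refine Finset.sum_congr rfl fun m hm => Finset.sum_congr rfl fun P hP => ?_
      obtain ⟨-, h2, h3⟩ := hT P m hP (hd hm)
      rw [Finset.sum_congr rfl fun σ hσ => frobChar_eq (h3 σ hσ).2, Finset.sum_const, h2,
        nsmul_eq_mul, ← nsmul_eq_mul (n := ν / m), AddChar.map_nsmul_eq_pow]
    · intro m _ m' _ hne
      refine Finset.disjoint_left.2 fun P hP hP' => hne ?_
      rw [← (mem_primesOfDeg.1 hP).2.1, (mem_primesOfDeg.1 hP').2.1]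
    · intro P hP P' hP' hne
      obtain ⟨m, hm, hPm⟩ := Finset.mem_biUnion.1 hP
      obtain ⟨m', hm', hPm'⟩ := Finset.mem_biUnion.1 hP'
      refine Finset.disjoint_left.2 fun σ hσ hσ' => hne ?_
      rw [← ((hT P m hPm (hd hm)).1 σ).1 hσ, ((hT P' m' hPm' (hd hm')).1 σ).1 hσ']

end PrimeHoms

section WeightedBasis
open Module Polynomial

variable {k L : Type*} [Field k] [Field L] [Algebra (RatFunc k) L] [Algebra k L]
  [IsScalarTower k (RatFunc k) L] [Algebra k[X] L] [IsScalarTower k[X] (RatFunc k) L]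
  {H : k[X][X]} {c d : ℕ}

/-- The basis `X ^ (-c i) y ^ i`, where `y` is the generator of a power basis. -/
noncomputable def weightedBasis (pb : PowerBasis (RatFunc k) L) (hd : pb.dim = d) (c : ℕ) :
    Basis (Fin d) (RatFunc k) L :=
  Basis.isUnitSMul (w := fun i : Fin d => (RatFunc.X : RatFunc k) ^ (-(c * i : ℕ) : ℤ))
    (pb.basis.reindex (finCongr hd)) fun _ => (zpow_ne_zero _ RatFunc.X_ne_zero).isUnit

variable {pb : PowerBasis (RatFunc k) L} {hd : pb.dim = d}

lemma weightedBasis_apply (i : Fin d) :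
    weightedBasis pb hd c i = (RatFunc.X : RatFunc k) ^ (-(c * i : ℕ) : ℤ) • pb.gen ^ (i : ℕ) := by
  rw [weightedBasis, Basis.isUnitSMul_apply]
  simp

lemma gen_pow_eq (i : Fin d) :
    pb.gen ^ (i : ℕ) = (RatFunc.X : RatFunc k) ^ (c * i : ℕ) • weightedBasis pb hd c i := by
  rw [weightedBasis_apply, smul_smul, ← zpow_natCast (RatFunc.X : RatFunc k),
    ← zpow_add₀ RatFunc.X_ne_zero, add_neg_cancel, zpow_zero, one_smul]

lemma gen_mul_mem (hH : IsWeightedMonic H c d)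
    (hy : eval₂ (algebraMap k[X] L) pb.gen H = 0) {m : ℤ} {α : L}
    (hα : α ∈ inftyFil (weightedBasis pb hd c) m) :
    α * pb.gen ∈ inftyFil (weightedBasis pb hd c) (m + c) := by
  have hX : (RatFunc.X : RatFunc k) ≠ 0 := RatFunc.X_ne_zero
  refine mul_mem_inftyFil_of_basis (fun i => ?_) hα
  have hi : weightedBasis pb hd c i * pb.gen =
      (RatFunc.X : RatFunc k) ^ (-(c * i : ℕ) : ℤ) • pb.gen ^ ((i : ℕ) + 1) := by
    rw [weightedBasis_apply, smul_mul_assoc, pow_succ]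
  rw [hi]
  obtain h | h := Nat.lt_or_ge (i + 1) d
  · rw [gen_pow_eq (c := c) (hd := hd) ⟨i + 1, h⟩, smul_smul]
    have h0 := smul_mem_inftyFil (mul_mem_ratDegLE (X_zpow_mem_ratDegLE (k := k) (-(c * i : ℕ) : ℤ))
      (X_zpow_mem_ratDegLE (k := k) (c * (i + 1) : ℕ))) (basis_mem_inftyFil
        (e := weightedBasis pb hd c) ⟨i + 1, h⟩)
    rw [zpow_natCast] at h0
    convert h0 using 1
    congr 1; push_cast; ring
  · have hid : (i : ℕ) + 1 = d := by have := i.2; omega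
    have hyd : pb.gen ^ d = -∑ j : Fin d, algebraMap k[X] L (H.coeff j) * pb.gen ^ (j : ℕ) := by
      rw [eval₂_eq_sum_range, hH.natDegree_eq, Finset.sum_range_succ, ← hH.natDegree_eq,
        coeff_natDegree, hH.monic.leadingCoeff, map_one, one_mul] at hy
      rw [← Fin.sum_univ_eq_sum_range (fun j => algebraMap k[X] L (H.coeff j) * pb.gen ^ j),
        hH.natDegree_eq] at hy
      exact eq_neg_of_add_eq_zero_right hy
    rw [hid, hyd, smul_neg]
    refine neg_mem ?_
    rw [Finset.smul_sum]
    refine Submodule.sum_mem _ fun j _ => ?_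
    rw [gen_pow_eq (c := c) (hd := hd), IsScalarTower.algebraMap_apply k[X] (RatFunc k) L,
      ← Algebra.smul_def, smul_smul, smul_smul]
    have h0 := smul_mem_inftyFil (mul_mem_ratDegLE (X_zpow_mem_ratDegLE (k := k) (-(c * i : ℕ) : ℤ))
      (mul_mem_ratDegLE (algebraMap_mem_ratDegLE.2 (Or.inr
        (Int.ofNat_le.2 (hH.natDegree_coeff_le j j.2.le)))) (X_zpow_mem_ratDegLE (k := k) (c * j : ℕ))))
        (basis_mem_inftyFil (e := weightedBasis pb hd c) j)
    rw [zpow_natCast, ← mul_assoc] at h0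
    refine (inftyFil_mono (le_of_eq ?_)) h0
    have h1 : (d - j : ℕ) + (j : ℕ) = i + 1 := by have := j.2; omega
    have h2 : c * (d - j) + c * j = c * i + c := by rw [← mul_add, h1, mul_add, mul_one]
    omega

lemma mul_gen_pow_mem (hH : IsWeightedMonic H c d)
    (hy : eval₂ (algebraMap k[X] L) pb.gen H = 0) {m : ℤ} {α : L}
    (hα : α ∈ inftyFil (weightedBasis pb hd c) m) (j : ℕ) :
    α * pb.gen ^ j ∈ inftyFil (weightedBasis pb hd c) (m + (c * j : ℕ)) := by
  induction j with
  | zero => simpa using hα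
  | succ j ih =>
    rw [pow_succ, ← mul_assoc]
    convert gen_mul_mem hH hy ih using 1
    congr 1; push_cast; ring

lemma one_mem_weightedFil (hd0 : 0 < d) :
    (1 : L) ∈ inftyFil (weightedBasis pb hd c) 0 := by
  have := basis_mem_inftyFil (e := weightedBasis pb hd c) ⟨0, hd0⟩
  rwa [weightedBasis_apply, mul_zero, Nat.cast_zero, neg_zero, zpow_zero, one_smul, pow_zero] at this

theorem isReducedBasis_weightedBasis {B : Type*} [CommRing B] [Algebra k[X] B] [Algebra k B]
    [IsScalarTower k k[X] B] [Algebra B L] [IsScalarTower k B L] [IsScalarTower k[X] B L]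
    [FaithfulSMul B L]
    (hH : IsWeightedMonic H c d) (hd0 : 0 < d)
    (hy : eval₂ (algebraMap k[X] L) pb.gen H = 0) {b : B} (hb : algebraMap B L b = pb.gen)
    (hnorm : ∀ b : B, Algebra.norm (RatFunc k) (algebraMap B L b) =
      algebraMap k[X] (RatFunc k) (Algebra.norm k[X] b)) :
    IsReducedBasis (weightedBasis pb hd c) B (c * d) := by
  have hmul : ∀ i j, weightedBasis pb hd c i * weightedBasis pb hd c j ∈
      inftyFil (weightedBasis pb hd c) 0 := fun i j => by
    rw [weightedBasis_apply j, mul_smul_comm]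
    have := smul_mem_inftyFil (X_zpow_mem_ratDegLE (k := k) (-(c * j : ℕ) : ℤ))
      (mul_gen_pow_mem hH hy (basis_mem_inftyFil (e := weightedBasis pb hd c) i) j)
    rwa [zero_add, neg_add_cancel] at this
  refine ⟨hmul, one_mem_weightedFil hd0, ?_, ?_, hnorm⟩
  · rw [eq_top_iff]
    rintro z -
    choose g hg using fun i : Fin d => exists_sub_algebraMap_mem
      ((weightedBasis pb hd c).repr z i * RatFunc.X ^ (-(c * i : ℕ) : ℤ))
    refine Submodule.mem_sup.2 ⟨∑ i, algebraMap k[X] L (g i) * pb.gen ^ (i : ℕ), ?_,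
      z - ∑ i, algebraMap k[X] L (g i) * pb.gen ^ (i : ℕ), ?_, by abel⟩
    · refine mem_rangeSubmodule.2 ⟨∑ i, algebraMap k[X] B (g i) * b ^ (i : ℕ), ?_⟩
      simp [hb, ← IsScalarTower.algebraMap_apply]
    · have : z - ∑ i, algebraMap k[X] L (g i) * pb.gen ^ (i : ℕ) =
          ∑ i, ((((weightedBasis pb hd c).repr z i * RatFunc.X ^ (-(c * i : ℕ) : ℤ)) -
            algebraMap k[X] (RatFunc k) (g i)) * RatFunc.X ^ ((c * i : ℕ) : ℤ)) •
              weightedBasis pb hd c i := by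
        conv_lhs => rw [← (weightedBasis pb hd c).sum_repr z]
        rw [← Finset.sum_sub_distrib]
        refine Finset.sum_congr rfl fun i _ => ?_
        rw [gen_pow_eq (c := c) (hd := hd), IsScalarTower.algebraMap_apply k[X] (RatFunc k) L,
          ← Algebra.smul_def, smul_smul, ← sub_smul, sub_mul, mul_assoc _ _ (RatFunc.X ^ _),
          ← zpow_add₀ RatFunc.X_ne_zero, neg_add_cancel, zpow_zero, mul_one, zpow_natCast]
      rw [this]
      refine Submodule.sum_mem _ fun i _ => ?_
      have h0 := smul_mem_inftyFil (mul_mem_ratDegLE (hg i) (X_zpow_mem_ratDegLE (k := k)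
        ((c * i : ℕ) : ℤ))) (basis_mem_inftyFil (e := weightedBasis pb hd c) i)
      refine inftyFil_mono ?_ h0
      have : c * (i : ℕ) ≤ c * d := Nat.mul_le_mul_left _ i.2.le
      omega
  · rw [eq_bot_iff]
    rintro z ⟨hz, hz'⟩
    obtain ⟨b, rfl⟩ := mem_rangeSubmodule.1 hz
    have h1 := norm_mem_ratDegLE hmul hz'
    rw [hnorm, algebraMap_mem_ratDegLE] at h1
    have h2 : Algebra.norm k[X] b = 0 := h1.resolve_right (by omega)
    have h3 := hnorm b
    rw [h2, map_zero] at h3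
    have : FiniteDimensional (RatFunc k) L := pb.finite
    exact (Submodule.mem_bot k).2 (Algebra.norm_eq_zero_iff.1 h3)

end WeightedBasis

section CompareCounts
open Module Polynomial

lemma card_algHom_le_of_basis {A B F ι : Type*} [CommRing A] [CommRing B] [Field F] [Algebra A B]
    [Algebra A F] [Fintype ι] (b : Basis ι A B) (S : Finset (B →ₐ[A] F)) :
    S.card ≤ Fintype.card ι := by
  have h1 := (linearIndependent_toLinearMap A B F).comp ((↑) : S → (B →ₐ[A] F))
    Subtype.val_injective
  let E : (ι → F) ≃ₗ[F] (B →ₗ[A] F) := b.constr F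
  have : Module.Finite F (B →ₗ[A] F) := Module.Finite.equiv E
  have h2 := h1.fintype_card_le_finrank
  rwa [← E.finrank_eq, Module.finrank_fintype_fun_eq_card, Fintype.card_coe] at h2

variable {p : ℕ} [Fact p.Prime] {F : Type} [Field F] [Algebra (ZMod p) F]
  {B : Type*} [CommRing B] [Algebra (ZMod p)[X] B] [Algebra (ZMod p) B]
  [IsScalarTower (ZMod p) (ZMod p)[X] B]

lemma algHom_algebraMap (σ : B →ₐ[ZMod p] F) (f : (ZMod p)[X]) :
    σ (algebraMap (ZMod p)[X] B f) = eval₂ (algebraMap (ZMod p) F) (σ (algebraMap (ZMod p)[X] B X)) f := by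
  have h := aeval_algHom_apply (σ.comp (IsScalarTower.toAlgHom (ZMod p) (ZMod p)[X] B)) X f
  rw [aeval_X_left_apply] at h
  exact h.symm

lemma card_algHom_fiber_le {ι : Type*} [Fintype ι] (e : Basis ι (ZMod p)[X] B) (t : F)
    (S : Finset (B →ₐ[ZMod p] F)) (hS : ∀ σ ∈ S, σ (algebraMap (ZMod p)[X] B X) = t) :
    S.card ≤ Fintype.card ι := by
  classical
  let := (eval₂RingHom (algebraMap (ZMod p) F) t).toAlgebra
  let g : S → (B →ₐ[(ZMod p)[X]] F) := fun σ => { σ.1.toRingHom with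
    commutes' := fun f => by
      change σ.1 _ = eval₂ (algebraMap (ZMod p) F) t f
      rw [algHom_algebraMap, hS σ σ.2] }
  have hg : Function.Injective g := fun σ τ h => by
    ext b
    exact DFunLike.congr_fun h b
  have := card_algHom_le_of_basis e (Finset.univ.image g)
  rwa [Finset.card_image_of_injective _ hg, Finset.card_univ, Fintype.card_coe] at this

variable {H : (ZMod p)[X][X]} {c d : ℕ}

/-- Outside the zeros of `D`, the homomorphisms from `B` correspond to points. -/
lemma exists_algHom_of_conductor {y : B} {D : (ZMod p)[X]}
    (hker : ∀ f : (ZMod p)[X][X], eval₂ (algebraMap (ZMod p)[X] B) y f = 0 ↔ H ∣ f)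
    (hD : ∀ b : B, ∃ f : (ZMod p)[X][X], eval₂ (algebraMap (ZMod p)[X] B) y f = algebraMap _ B D * b)
    {x₀ y₀ : F} (hxy : eval₂ (eval₂RingHom (algebraMap (ZMod p) F) x₀) y₀ H = 0)
    (hDx : eval₂ (algebraMap (ZMod p) F) x₀ D ≠ 0) :
    ∃ σ : B →ₐ[ZMod p] F, σ (algebraMap (ZMod p)[X] B X) = x₀ ∧ σ y = y₀ := by
  choose r hr using hD
  set φ : (ZMod p)[X][X] →+* F := eval₂RingHom (eval₂RingHom (algebraMap (ZMod p) F) x₀) y₀ with hφ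
  set ι : (ZMod p)[X][X] →+* B := eval₂RingHom (algebraMap (ZMod p)[X] B) y with hι
  have hr' : ∀ b, ι (r b) = algebraMap _ B D * b := hr
  have hker' : ∀ f g, ι f = ι g → φ f = φ g := fun f g h => by
    have h1 : ι (f - g) = 0 := by rw [map_sub, h, sub_self]
    obtain ⟨q, hq⟩ := (hker (f - g)).1 h1
    have h2 : φ (f - g) = 0 := by
      rw [hq, map_mul]
      have : φ H = 0 := hxy
      rw [this, zero_mul]
    rwa [map_sub, sub_eq_zero] at h2
  have hιC : ∀ f, ι (C f) = algebraMap _ B f := fun f => eval₂_C _ _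
  have hφC : ∀ f, φ (C f) = eval₂ (algebraMap (ZMod p) F) x₀ f := fun f => eval₂_C _ _
  set u := eval₂ (algebraMap (ZMod p) F) x₀ D with hu
  have key : ∀ f b, ι f = b → φ (r b) = u * φ f := fun f b h => by
    rw [hu, ← hφC, ← map_mul]
    exact hker' _ _ (by rw [hr', map_mul, hιC, h])
  let σ : B →+* F :=
    { toFun := fun b => φ (r b) / u
      map_one' := by
        rw [key 1 1 (map_one _), map_one, mul_one, div_self hDx]
      map_zero' := by rw [key 0 0 (map_zero _), map_zero, mul_zero, zero_div]
      map_add' := fun a b => by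
        have : φ (r (a + b)) = φ (r a + r b) := hker' _ _ (by rw [map_add, hr', hr', hr', mul_add])
        rw [this, map_add, add_div]
      map_mul' := fun a b => by
        have : φ (C D * r (a * b)) = φ (r a * r b) := hker' _ _ (by
          rw [map_mul, map_mul, hr', hr', hr', hιC]; ring)
        rw [map_mul, map_mul, hφC, ← hu] at this
        field_simp
        linear_combination this }
  have hσ : ∀ f b, ι f = b → σ b = φ f := fun f b h => by
    change φ (r b) / u = _
    rw [key f b h, mul_div_cancel_left₀ _ hDx]
  refine ⟨⟨σ, fun a => ?_⟩, ?_, ?_⟩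
  · refine (hσ (C (C a)) _ ?_).trans ?_
    · rw [hιC, IsScalarTower.algebraMap_apply (ZMod p) (ZMod p)[X] B]; rfl
    · rw [hφC, eval₂_C]
  · refine (hσ (C X) _ (hιC X)).trans ?_
    rw [hφC, eval₂_X]
  · exact (hσ X _ (eval₂_X _ _)).trans (eval₂_X _ _)

lemma algHom_ext_of_conductor {y : B} {D : (ZMod p)[X]}
    (hD : ∀ b : B, ∃ f : (ZMod p)[X][X], eval₂ (algebraMap (ZMod p)[X] B) y f = algebraMap _ B D * b)
    {σ τ : B →ₐ[ZMod p] F} (hx : σ (algebraMap (ZMod p)[X] B X) = τ (algebraMap (ZMod p)[X] B X))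
    (hy : σ y = τ y) (hDx : eval₂ (algebraMap (ZMod p) F) (σ (algebraMap (ZMod p)[X] B X)) D ≠ 0) :
    σ = τ := by
  ext b
  obtain ⟨f, hf⟩ := hD b
  have h1 : σ (algebraMap _ B D * b) = τ (algebraMap _ B D * b) := by
    rw [← hf, ← AlgHom.coe_toRingHom σ, ← AlgHom.coe_toRingHom τ, hom_eval₂, hom_eval₂]
    congr 1
    refine RingHom.ext fun f => ?_
    rw [RingHom.comp_apply, RingHom.comp_apply]
    exact (algHom_algebraMap σ f).trans (by rw [hx]; exact (algHom_algebraMap τ f).symm)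
  rw [map_mul, map_mul, algHom_algebraMap σ D, algHom_algebraMap τ D, ← hx] at h1
  exact mul_left_cancel₀ hDx h1

lemma norm_sum_le_card {α : Type*} (T : Finset α) {f : α → ℂ} (hf : ∀ a, ‖f a‖ ≤ 1) :
    ‖∑ a ∈ T, f a‖ ≤ T.card := by
  refine (norm_sum_le _ _).trans ((Finset.sum_le_sum fun a _ => hf a).trans ?_)
  simp

variable [CharP F p]

lemma norm_sum_algHom_sub_le (hH : IsWeightedMonic H c d) {y : B} {D : (ZMod p)[X]} (hD0 : D ≠ 0)
    {ι : Type*} [Fintype ι] (e : Basis ι (ZMod p)[X] B)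
    (hker : ∀ f : (ZMod p)[X][X], eval₂ (algebraMap (ZMod p)[X] B) y f = 0 ↔ H ∣ f)
    (hD : ∀ b : B, ∃ f : (ZMod p)[X][X], eval₂ (algebraMap (ZMod p)[X] B) y f = algebraMap _ B D * b)
    {ν : ℕ} {S : Finset (B →ₐ[ZMod p] F)} (hS : ∀ σ, σ ∈ S ↔ ∀ b, σ b ^ p ^ ν = σ b)
    {N : Finset (F × F)} (hN : ∀ x, x ∈ N ↔ x.1 ^ p ^ ν = x.1 ∧ x.2 ^ p ^ ν = x.2 ∧
      eval₂ (eval₂RingHom (algebraMap (ZMod p) F) x.1) x.2 H = 0) {χ : F → ℂ}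
    (hχ : ∀ x, ‖χ x‖ ≤ 1) :
    ‖∑ σ ∈ S, χ (σ (algebraMap (ZMod p)[X] B X)) - ∑ x ∈ N, χ x.1‖ ≤
      (D.natDegree * (Fintype.card ι + d) : ℕ) := by
  classical
  set x : B := algebraMap (ZMod p)[X] B X with hx
  set u : F → F := fun t => eval₂ (algebraMap (ZMod p) F) t D with hu
  have hinj := (algebraMap (ZMod p) F).injective
  set Z : Finset F := (D.map (algebraMap (ZMod p) F)).roots.toFinset with hZ
  have hDm : D.map (algebraMap (ZMod p) F) ≠ 0 := (Polynomial.map_ne_zero_iff hinj).2 hD0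
  have hZu : ∀ t, t ∈ Z ↔ u t = 0 := fun t => by
    rw [hZ, Multiset.mem_toFinset, mem_roots hDm, IsRoot, eval_map]
  have hZc : Z.card ≤ D.natDegree := (Multiset.toFinset_card_le _).trans
    ((card_roots' _).trans (natDegree_map _).le)
  have hfrob : ∀ a : ZMod p, algebraMap (ZMod p) F a ^ p ^ ν = algebraMap (ZMod p) F a := fun a => by
    rw [← map_pow, ZMod.pow_card_pow]
  have hHy : eval₂ (algebraMap (ZMod p)[X] B) y H = 0 := (hker H).2 dvd_rfl
  have hpt : ∀ σ : B →ₐ[ZMod p] F, eval₂ (eval₂RingHom (algebraMap (ZMod p) F) (σ x)) (σ y) H = 0 := by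
    intro σ
    have h := congrArg σ hHy
    rw [map_zero, ← AlgHom.coe_toRingHom σ, hom_eval₂] at h
    rw [← h]
    congr 1
    refine RingHom.ext fun f => ?_
    rw [RingHom.comp_apply]
    exact (algHom_algebraMap σ f).symm
  set S₁ := S.filter fun σ => u (σ x) ≠ 0 with hS₁
  set N₁ := N.filter fun z => u z.1 ≠ 0 with hN₁
  have hbij : ∑ σ ∈ S₁, χ (σ x) = ∑ z ∈ N₁, χ z.1 := by
    refine Finset.sum_bij (fun σ _ => (σ x, σ y)) ?_ ?_ ?_ fun _ _ => rfl
    · intro σ hσ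
      obtain ⟨h1, h2⟩ := Finset.mem_filter.1 hσ
      exact Finset.mem_filter.2 ⟨(hN _).2 ⟨(hS σ).1 h1 x, (hS σ).1 h1 y, hpt σ⟩, h2⟩
    · intro σ hσ τ _ h
      obtain ⟨h3, h4⟩ := Prod.ext_iff.1 h
      exact algHom_ext_of_conductor hD h3 h4 (Finset.mem_filter.1 hσ).2
    · rintro ⟨x₀, y₀⟩ hz
      obtain ⟨h1, h2⟩ := Finset.mem_filter.1 hz
      obtain ⟨h3, h4, h5⟩ := (hN _).1 h1
      obtain ⟨σ, hσx, hσy⟩ := exists_algHom_of_conductor hker hD h5 h2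
      refine ⟨σ, Finset.mem_filter.2 ⟨(hS σ).2 ?_, ?_⟩, Prod.ext hσx hσy⟩
      · let τ : B →ₐ[ZMod p] F := { (iterateFrobenius F p ν).comp σ.toRingHom with
          commutes' := fun a => by
            change σ (algebraMap (ZMod p) B a) ^ p ^ ν = _
            rw [σ.commutes, hfrob] }
        have hτ : ∀ b, τ b = σ b ^ p ^ ν := fun b => rfl
        have : σ = τ := algHom_ext_of_conductor hD
          (by rw [hτ]; exact (by rw [hσx]; exact h3.symm : σ x = σ x ^ p ^ ν))
          (by rw [hτ, hσy]; exact h4.symm) (by rw [← hx, hσx]; exact h2)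
        intro b
        rw [← hτ, ← this]
      · rw [hσx]; exact h2
  have hS₂ : (S.filter fun σ => ¬ u (σ x) ≠ 0).card ≤ D.natDegree * Fintype.card ι := by
    refine (Finset.card_le_mul_card_image_of_maps_to (f := fun σ => σ x) (t := Z) (fun σ hσ => ?_)
      (Fintype.card ι) fun t _ => ?_).trans ?_
    · exact (hZu _).2 (not_not.1 (Finset.mem_filter.1 hσ).2)
    · exact card_algHom_fiber_le e t _ fun σ hσ => (Finset.mem_filter.1 hσ).2
    · rw [mul_comm]; exact Nat.mul_le_mul_right _ hZc
  have hN₂ : (N.filter fun z => ¬ u z.1 ≠ 0).card ≤ D.natDegree * d := by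
    refine (Finset.card_le_mul_card_image_of_maps_to (f := Prod.fst) (t := Z) (fun z hz => ?_)
      d fun t _ => ?_).trans ?_
    · exact (hZu _).2 (not_not.1 (Finset.mem_filter.1 hz).2)
    · have hm := hH.monic.map (eval₂RingHom (algebraMap (ZMod p) F) t)
      calc _ ≤ (H.map (eval₂RingHom (algebraMap (ZMod p) F) t)).roots.toFinset.card := by
            refine Finset.card_le_card_of_injOn Prod.snd (fun z hz => ?_) ?_
            · obtain ⟨h1, rfl⟩ := Finset.mem_filter.1 hz
              have h2 := ((hN z).1 (Finset.mem_filter.1 h1).1).2.2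
              simpa [Multiset.mem_toFinset, mem_roots hm.ne_zero, IsRoot, eval_map] using h2
            · intro z hz z' hz' h
              exact Prod.ext ((Finset.mem_filter.1 hz).2.trans (Finset.mem_filter.1 hz').2.symm) h
        _ ≤ d := (Multiset.toFinset_card_le _).trans ((card_roots' _).trans
            ((hH.monic.natDegree_map _).trans hH.natDegree_eq).le)
    · rw [mul_comm]; exact Nat.mul_le_mul_right _ hZc
  rw [← Finset.sum_filter_add_sum_filter_not S fun σ => u (σ x) ≠ 0,
    ← Finset.sum_filter_add_sum_filter_not N fun z => u z.1 ≠ 0, ← hS₁, ← hN₁, hbij,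
    add_sub_add_left_eq_sub]
  refine (norm_sub_le _ _).trans ((add_le_add (norm_sum_le_card _ fun a => hχ _)
    (norm_sum_le_card _ fun a => hχ _)).trans ?_)
  rw [mul_add]
  exact_mod_cast add_le_add hS₂ hN₂

end CompareCounts

section PlaneCurveField
open Module Polynomial

lemma hasFiniteQuotients_polynomial (k : Type*) [Field k] [Finite k] :
    Ring.HasFiniteQuotients k[X] where
  finiteQuotient {I} hI := by
    obtain ⟨f, rfl⟩ := (IsPrincipalIdealRing.principal I).principal
    have hf : f ≠ 0 := fun h => hI (by rw [h]; simp)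
    have : Module.Finite k (AdjoinRoot f) := (AdjoinRoot.powerBasis hf).finite
    exact Module.finite_of_finite (M := AdjoinRoot f) k

lemma isSeparable_of_powerBasis {K L : Type*} [Field K] [Field L] [Algebra K L]
    (pb : PowerBasis K L) (h : IsSeparable K pb.gen) : Algebra.IsSeparable K L := by
  have h1 := (IntermediateField.isSeparable_adjoin_simple_iff_isSeparable K L).2 h
  have h2 : IntermediateField.adjoin K {pb.gen} = ⊤ := by
    rw [← IntermediateField.toSubalgebra_inj, IntermediateField.top_toSubalgebra, eq_top_iff,
      ← pb.adjoin_gen_eq_top]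
    exact IntermediateField.algebra_adjoin_le_adjoin _ _
  rw [h2] at h1
  exact AlgEquiv.Algebra.isSeparable (IntermediateField.topEquiv (F := K) (E := L))

lemma idealCharSum_zero {k B : Type*} [Field k] [CommRing B] [Algebra k[X] B] [Algebra k B]
    [IsScalarTower k k[X] B] [Finite k] [Ring.HasFiniteQuotients B] [IsDedekindDomain B]
    (ψ : AddChar k ℂ) : idealCharSum B ψ 0 = 1 := by
  have htop : (⊤ : Ideal B) ≠ ⊥ := top_ne_bot
  have hs : Subsingleton (B ⧸ (⊤ : Ideal B)) := Ideal.Quotient.subsingleton_iff.2 rfl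
  have h1 : idealsOfDeg k B 0 = {⊤} := by
    ext I
    rw [mem_idealsOfDeg, Finset.mem_singleton]
    constructor
    · rintro ⟨h0, h⟩
      by_contra hI
      exact (idealDeg_pos h0 hI).ne' h
    · rintro rfl
      exact ⟨htop, finrank_zero_of_subsingleton⟩
  have h2 : idealTrace k (⊤ : Ideal B) = 0 := by
    have := idealTrace_mul (k := k) htop htop
    rwa [Ideal.mul_top, left_eq_add] at this
  rw [idealCharSum, h1, Finset.sum_singleton, h2, AddChar.map_zero_eq_one]

variable {p : ℕ} [Fact p.Prime] {H : (ZMod p)[X][X]} {c d : ℕ}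

theorem exists_curveCharSums (hH : IsWeightedMonic H c d) (hd0 : 0 < d) (hdp : d < p)
    (hirr : Irreducible H) (ψ : AddChar (ZMod p) ℂ) :
    ∃ C s : ℕ → ℂ, C 0 = 1 ∧
      (∀ n : ℕ, n * C n = ∑ ν ∈ Finset.Icc 1 n, s ν * C (n - ν)) ∧
      (∀ n, d * (2 * (c * d) + 3) < n → C (n + d) = (p : ℂ) ^ d * C n) ∧
      ∀ {F : Type} [Field F] [CharP F p] [IsAlgClosed F] [Algebra (ZMod p) F] (ν : ℕ) (_ : 0 < ν)
        (N : Finset (F × F)) (_ : ∀ x, x ∈ N ↔ x.1 ^ p ^ ν = x.1 ∧ x.2 ^ p ^ ν = x.2 ∧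
          eval₂ (eval₂RingHom (algebraMap (ZMod p) F) x.1) x.2 H = 0),
        ‖s ν - ∑ x ∈ N, frobChar ψ ν x.1‖ ≤ (d * (c * (d - 1)) * (2 * d) : ℕ) := by
  set g : (RatFunc (ZMod p))[X] := H.map (algebraMap (ZMod p)[X] (RatFunc (ZMod p))) with hg
  have hgm : g.Monic := hH.monic.map _
  have hgd : g.natDegree = d := (hH.monic.natDegree_map _).trans hH.natDegree_eq
  have hgi : Irreducible g := (hH.monic.irreducible_iff_irreducible_map_fraction_map).1 hirr
  have : Fact (Irreducible g) := ⟨hgi⟩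
  have hinj : Function.Injective (algebraMap (ZMod p)[X] (RatFunc (ZMod p))) :=
    IsFractionRing.injective _ _
  have hg0 : g ≠ 0 := hgm.ne_zero
  let L := AdjoinRoot g
  let pb : PowerBasis (RatFunc (ZMod p)) L := AdjoinRoot.powerBasis hg0
  have hgen : pb.gen = AdjoinRoot.root g := AdjoinRoot.powerBasis_gen hg0
  have hmin : minpoly (RatFunc (ZMod p)) pb.gen = g := by
    rw [AdjoinRoot.minpoly_powerBasis_gen hg0, hgm.leadingCoeff, inv_one, C_1, mul_one]
  have hdim : pb.dim = d := hgd
  have hfd : FiniteDimensional (RatFunc (ZMod p)) L := pb.finite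
  have hsepg : g.Separable := by
    rw [separable_iff_derivative_ne_zero hgi]
    intro h
    have h1 := congrArg (fun f => coeff f (d - 1)) h
    simp only [coeff_derivative, coeff_zero] at h1
    rw [Nat.sub_add_cancel hd0, ← hgd, coeff_natDegree, hgm.leadingCoeff, one_mul] at h1
    have h2 : ((d : ℕ) : RatFunc (ZMod p)) = 0 := by
      rw [← h1, ← Nat.cast_succ]
      congr 1
      omega
    have : CharP (RatFunc (ZMod p)) p := charP_of_injective_algebraMap
      (algebraMap (ZMod p) (RatFunc (ZMod p))).injective p
    rw [CharP.cast_eq_zero_iff (RatFunc (ZMod p)) p] at h2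
    exact absurd (Nat.le_of_dvd hd0 h2) (by omega)
  have hsep : Algebra.IsSeparable (RatFunc (ZMod p)) L :=
    isSeparable_of_powerBasis pb (by rw [IsSeparable, hmin]; exact hsepg)
  have hfaith : FaithfulSMul (ZMod p)[X] L := by
    rw [faithfulSMul_iff_algebraMap_injective,
      IsScalarTower.algebraMap_eq (ZMod p)[X] (RatFunc (ZMod p)) L]
    exact (algebraMap (RatFunc (ZMod p)) L).injective.comp hinj
  have htf : Module.IsTorsionFree (ZMod p)[X] L := inferInstance
  let B := integralClosure (ZMod p)[X] L
  have hDed : IsDedekindDomain B := integralClosure.isDedekindDomain (ZMod p)[X] (RatFunc (ZMod p)) L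
  have hfrac : IsFractionRing B L :=
    integralClosure.isFractionRing_of_finite_extension (RatFunc (ZMod p)) L
  have hfin : Module.Finite (ZMod p)[X] B :=
    IsIntegralClosure.finite (ZMod p)[X] (RatFunc (ZMod p)) L _
  have hfree : Module.Free (ZMod p)[X] B :=
    IsIntegralClosure.module_free (ZMod p)[X] (RatFunc (ZMod p)) L _
  have hkq := hasFiniteQuotients_polynomial (ZMod p)
  have hquot : Ring.HasFiniteQuotients B := Ring.HasFiniteQuotients.of_module_finite (ZMod p)[X] B
  have hrank : finrank (ZMod p)[X] B = d := by
    rw [IsIntegralClosure.rank (ZMod p)[X] (RatFunc (ZMod p)) L, pb.finrank, hdim]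
  have hnorm : ∀ b : B, Algebra.norm (RatFunc (ZMod p)) (algebraMap B L b) =
      algebraMap (ZMod p)[X] (RatFunc (ZMod p)) (Algebra.norm (ZMod p)[X] b) := fun b => by
    rw [← Algebra.intNorm_eq_norm (ZMod p)[X] B, Algebra.algebraMap_intNorm (L := L)]
  have heval : ∀ f : (ZMod p)[X][X], eval₂ (algebraMap (ZMod p)[X] L) pb.gen f =
      AdjoinRoot.mk g (f.map (algebraMap _ _)) := fun f => by
    rw [← AdjoinRoot.aeval_eq, aeval_def, eval₂_map, ← IsScalarTower.algebraMap_eq, hgen]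
  have hy : eval₂ (algebraMap (ZMod p)[X] L) pb.gen H = 0 := by
    rw [heval, ← hg, AdjoinRoot.mk_self]
  have hyint : IsIntegral (ZMod p)[X] pb.gen := ⟨H, hH.monic, hy⟩
  let y : B := ⟨pb.gen, hyint⟩
  have hred := isReducedBasis_weightedBasis (hd := hdim) (B := B) hH hd0 hy (b := y) rfl hnorm
  have hevalB : ∀ f : (ZMod p)[X][X], algebraMap B L (eval₂ (algebraMap (ZMod p)[X] B) y f) =
      eval₂ (algebraMap (ZMod p)[X] L) pb.gen f := fun f => by
    rw [hom_eval₂, ← IsScalarTower.algebraMap_eq]; rfl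
  have hBL : Function.Injective (algebraMap B L) := IsFractionRing.injective B L
  have hker : ∀ f : (ZMod p)[X][X], eval₂ (algebraMap (ZMod p)[X] B) y f = 0 ↔ H ∣ f := fun f => by
    rw [← map_eq_zero_iff _ hBL, hevalB, heval, AdjoinRoot.mk_eq_zero, hg,
      map_dvd_map _ hinj hH.monic]
  obtain ⟨D, hDdisc⟩ : ∃ D : (ZMod p)[X], algebraMap (ZMod p)[X] (RatFunc (ZMod p)) D =
      Algebra.discr (RatFunc (ZMod p)) pb.basis := by
    refine IsIntegrallyClosed.algebraMap_eq_of_integral (Algebra.discr_isIntegral _ fun i => ?_)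
    rw [pb.basis_eq_pow]
    exact hyint.pow _
  have hD0 : D ≠ 0 := fun h => Algebra.discr_not_zero_of_basis (RatFunc (ZMod p)) pb.basis
    (by rw [← hDdisc, h, map_zero])
  have hDdeg : D.natDegree ≤ d * (c * (d - 1)) := by
    have h1 : aeval pb.gen (derivative g) ∈ inftyFil (weightedBasis pb hdim c) (c * (d - 1) : ℕ) := by
      have hder : derivative g = (derivative H).map (algebraMap _ _) := derivative_map _ _
      rw [hder, aeval_def, eval₂_map, ← IsScalarTower.algebraMap_eq, derivative_apply,
        sum_over_range _ (by simp), eval₂_finsetSum, hH.natDegree_eq]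
      refine Submodule.sum_mem _ fun i hi => ?_
      rw [eval₂_mul, eval₂_C, eval₂_X_pow, IsScalarTower.algebraMap_apply (ZMod p)[X]
        (RatFunc (ZMod p)) L, ← Algebra.smul_def]
      have hi' : i ≤ d := Nat.lt_succ_iff.1 (Finset.mem_range.1 hi)
      obtain rfl | hi0 := Nat.eq_zero_or_pos i
      · simp
      have h2 := mul_gen_pow_mem hH hy (one_mem_weightedFil (pb := pb) (hd := hdim) (c := c) hd0) (i - 1)
      rw [one_mul] at h2
      have h3 : algebraMap (ZMod p)[X] (RatFunc (ZMod p)) (H.coeff i * (i : (ZMod p)[X])) ∈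
          ratDegLE (ZMod p) (c * (d - i) : ℕ) := by
        refine algebraMap_mem_ratDegLE.2 (Or.inr (Int.ofNat_le.2 ?_))
        rw [← C_eq_natCast, mul_comm]
        exact (natDegree_C_mul_le _ _).trans (hH.natDegree_coeff_le i hi')
      refine inftyFil_mono ?_ (smul_mem_inftyFil h3 h2)
      rw [zero_add, ← Nat.cast_add, ← mul_add, show d - i + (i - 1) = d - 1 by omega]
    have h2 := norm_mem_ratDegLE hred.mul_mem h1
    have h3 := Algebra.discr_powerBasis_eq_norm (RatFunc (ZMod p)) pb
    rw [hmin, ← hDdisc] at h3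
    have h4 : algebraMap (ZMod p)[X] (RatFunc (ZMod p)) D ∈
        ratDegLE (ZMod p) (d * (c * (d - 1) : ℕ)) := by
      rw [h3]
      obtain h | h := neg_one_pow_eq_or (RatFunc (ZMod p))
        (finrank (RatFunc (ZMod p)) L * (finrank (RatFunc (ZMod p)) L - 1) / 2) <;> rw [h]
      · rwa [one_mul]
      · rw [neg_one_mul]
        exact neg_mem h2
    have h5 := (algebraMap_mem_ratDegLE.1 h4).resolve_left hD0
    exact_mod_cast h5
  have hD : ∀ b : B, ∃ f : (ZMod p)[X][X],
      eval₂ (algebraMap (ZMod p)[X] B) y f = algebraMap _ B D * b := fun b => by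
    have h1 := Algebra.discr_mul_isIntegral_mem_adjoin (RatFunc (ZMod p)) (B := pb) hyint b.2
    rw [Algebra.adjoin_singleton_eq_range_aeval, ← hDdisc] at h1
    obtain ⟨f, hf⟩ := h1
    refine ⟨f, hBL ?_⟩
    rw [hevalB, ← aeval_def, map_mul, ← IsScalarTower.algebraMap_apply,
      IsScalarTower.algebraMap_apply (ZMod p)[X] (RatFunc (ZMod p)) L, ← Algebra.smul_def]
    exact hf
  refine ⟨idealCharSum B ψ, primeCharSum B ψ, idealCharSum_zero ψ, mul_idealCharSum_eq ψ,
    fun n hn => ?_, ?_⟩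
  · have := hred.idealCharSum_add ψ hn
    rwa [Nat.card_zmod] at this
  · intro F _ _ _ _ ν hν N hN
    have : FaithfulSMul (ZMod p)[X] B := by
      rw [faithfulSMul_iff_algebraMap_injective]
      intro a b hab
      have := congrArg (algebraMap B L) hab
      rw [← IsScalarTower.algebraMap_apply, ← IsScalarTower.algebraMap_apply] at this
      exact FaithfulSMul.algebraMap_injective _ _ this
    obtain ⟨S, hS, hsum⟩ := exists_finset_primeCharSum_eq (B := B) (F := F) ψ hν
    rw [hsum]
    have e := Module.finBasis (ZMod p)[X] B
    have h1 := norm_sum_algHom_sub_le (χ := frobChar ψ ν) hH hD0 e hker hD hS hN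
      fun _ => norm_frobChar_le
    refine h1.trans (Nat.cast_le.2 ?_)
    rw [Fintype.card_fin, hrank, ← two_mul]
    exact Nat.mul_le_mul_right _ hDdeg

end PlaneCurveField

section RecurrenceBound
open Polynomial Filter Topology

lemma exists_le_mul_pow_of_recurrence {a : ℕ → ℝ} {A r : ℝ} (ha : ∀ n, 0 ≤ a n) (hA : 0 ≤ A)
    (hr : 1 < r) (h : ∀ n : ℕ, n * a n ≤ A * ∑ j ∈ Finset.range n, a j) :
    ∃ D, ∀ n, a n ≤ D * r ^ n := by
  obtain ⟨m, hm⟩ := exists_nat_gt (A / (r - 1))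
  have hr0 : 0 < r - 1 := sub_pos.2 hr
  rw [div_lt_iff₀ hr0] at hm
  set D := ∑ j ∈ Finset.range (m + 1), a j with hD
  have hD0 : 0 ≤ D := Finset.sum_nonneg fun j _ => ha j
  refine ⟨D, fun n => ?_⟩
  induction n using Nat.strong_induction_on with
  | _ n ih =>
    obtain hn | hn := le_or_gt n m
    · have h1 : a n ≤ D := Finset.single_le_sum (f := a) (fun j _ => ha j)
        (Finset.mem_range.2 (Nat.lt_succ_of_le hn))
      exact h1.trans (le_mul_of_one_le_right hD0 (one_le_pow₀ hr.le))
    · have hn0 : (0 : ℝ) < n := by exact_mod_cast (Nat.zero_le m).trans_lt hn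
      have h2 : (∑ j ∈ Finset.range n, a j) * (r - 1) ≤ D * r ^ n := by
        calc _ ≤ (∑ j ∈ Finset.range n, D * r ^ j) * (r - 1) := by
              refine mul_le_mul_of_nonneg_right (Finset.sum_le_sum fun j hj => ?_) hr0.le
              exact ih j (Finset.mem_range.1 hj)
          _ = D * (r ^ n - 1) := by rw [← Finset.mul_sum, mul_assoc, geom_sum_mul]
          _ ≤ _ := by gcongr; linarith
      have h3 : A ≤ n * (r - 1) := hm.le.trans (by gcongr)
      have h4 : n * a n * (r - 1) ≤ n * (r - 1) * (D * r ^ n) := by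
        calc n * a n * (r - 1) ≤ A * (∑ j ∈ Finset.range n, a j) * (r - 1) := 
              mul_le_mul_of_nonneg_right (h n) hr0.le
          _ = A * ((∑ j ∈ Finset.range n, a j) * (r - 1)) := by ring
          _ ≤ A * (D * r ^ n) := by gcongr
          _ ≤ _ := by gcongr
      refine le_of_mul_le_mul_left ?_ (mul_pos hn0 hr0)
      linarith

/-- If `u P' = P S` where the power series `S` has radius of convergence at least `1 / ρ`, then
`P` has no zero of absolute value less than `1 / ρ`. -/
lemma one_le_norm_root_mul {P : ℂ[X]} {s : ℕ → ℂ} {A ρ : ℝ} (hρ : 0 < ρ) (hP0 : P.coeff 0 = 1)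
    (hs : ∀ ν, ‖s ν‖ ≤ A * ρ ^ ν)
    (hrec : PowerSeries.X * (derivative P : PowerSeries ℂ) = (P : PowerSeries ℂ) * PowerSeries.mk s)
    {z : ℂ} (hz : P.IsRoot z) : 1 ≤ ‖z‖ * ρ := by
  by_contra! hlt
  have hA : 0 ≤ A := by have := (norm_nonneg _).trans (hs 0); simpa using this
  have hPne : P ≠ 0 := by rintro rfl; simp at hP0
  have hz0 : z ≠ 0 := by
    rintro rfl
    rw [IsRoot, ← coeff_zero_eq_eval_zero, hP0] at hz
    exact one_ne_zero hz
  obtain ⟨t, ht1, ht2⟩ := exists_between hlt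
  have ht0 : 0 ≤ t := (by positivity : 0 ≤ ‖z‖ * ρ).trans ht1.le
  -- the value of the series
  have hbd : ∀ u : ℂ, ‖u‖ * ρ ≤ t → ∀ ν, ‖s ν * u ^ ν‖ ≤ A * t ^ ν := fun u hu ν => by
    rw [norm_mul, norm_pow]
    calc ‖s ν‖ * ‖u‖ ^ ν ≤ A * ρ ^ ν * ‖u‖ ^ ν := by gcongr; exact hs ν
      _ = A * (‖u‖ * ρ) ^ ν := by rw [mul_pow]; ring
      _ ≤ _ := by gcongr
  have hgeo : Summable fun ν : ℕ => A * t ^ ν := (summable_geometric_of_lt_one ht0 ht2).mul_left A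
  have hsum : ∀ u : ℂ, ‖u‖ * ρ ≤ t → Summable fun ν => ‖s ν * u ^ ν‖ := fun u hu =>
    Summable.of_nonneg_of_le (fun _ => norm_nonneg _) (hbd u hu) hgeo
  set f : ℂ → ℂ := fun u => ∑' ν, s ν * u ^ ν with hf
  have hfb : ∀ u : ℂ, ‖u‖ * ρ ≤ t → ‖f u‖ ≤ ∑' ν : ℕ, A * t ^ ν := fun u hu =>
    tsum_of_norm_bounded hgeo.hasSum (hbd u hu)
  have hpoly : ∀ (Q : ℂ[X]) (u : ℂ), HasSum (fun n => Q.coeff n * u ^ n) (Q.eval u) ∧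
      Summable fun n => ‖Q.coeff n * u ^ n‖ := fun Q u => by
    have h0 : ∀ n ∉ Finset.range (Q.natDegree + 1), Q.coeff n * u ^ n = 0 := fun n hn => by
      rw [coeff_eq_zero_of_natDegree_lt (by simpa using hn), zero_mul]
    refine ⟨?_, ?_⟩
    · rw [eval_eq_sum_range]
      exact hasSum_sum_of_ne_finset_zero h0
    · exact summable_of_ne_finset_zero (s := Finset.range (Q.natDegree + 1)) fun n hn => by
        rw [h0 n hn, norm_zero]
  have hid : ∀ u : ℂ, ‖u‖ * ρ ≤ t → u * (derivative P).eval u = P.eval u * f u := fun u hu => by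
    have h1 := tsum_mul_tsum_eq_tsum_sum_antidiagonal_of_summable_norm (hpoly P u).2 (hsum u hu)
    rw [(hpoly P u).1.tsum_eq] at h1
    rw [hf, h1]
    have h2 : u * (derivative P).eval u = (X * derivative P).eval u := by simp
    rw [h2, ← (hpoly _ u).1.tsum_eq]
    refine tsum_congr fun n => ?_
    have h3 := congrArg (PowerSeries.coeff n) hrec
    rw [← coe_X, ← coe_mul, coeff_coe, PowerSeries.coeff_mul] at h3
    rw [h3, Finset.sum_mul]
    refine Finset.sum_congr rfl fun ij hij => ?_
    rw [coeff_coe, PowerSeries.coeff_mk, ← Finset.HasAntidiagonal.mem_antidiagonal.1 hij, pow_add]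
    ring
  -- compare orders at `z`
  obtain ⟨Q, hQ, hQz⟩ := exists_eq_pow_rootMultiplicity_mul_and_not_dvd P hPne z
  set m := P.rootMultiplicity z with hm
  have hm0 : 0 < m := (rootMultiplicity_pos hPne).2 hz
  have hQz' : Q.eval z ≠ 0 := fun h => hQz (dvd_iff_isRoot.2 h)
  have hid2 : ∀ u : ℂ, ‖u‖ * ρ ≤ t → u ≠ z →
      u * (m * Q.eval u + (u - z) * (derivative Q).eval u) = (u - z) * Q.eval u * f u := by
    intro u hu hne
    have h1 := hid u hu
    have hder : (derivative P).eval u = (u - z) ^ (m - 1) *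
        (m * Q.eval u + (u - z) * (derivative Q).eval u) := by
      rw [hQ]
      simp only [derivative_mul, derivative_X_sub_C_pow, eval_add, eval_mul, eval_pow, eval_sub,
        eval_X, eval_C]
      obtain ⟨m', hm'⟩ : ∃ m', m = m' + 1 := ⟨m - 1, by omega⟩
      rw [hm', Nat.add_sub_cancel]; ring
    have hev : P.eval u = (u - z) ^ (m - 1) * ((u - z) * Q.eval u) := by
      conv_lhs => rw [hQ]
      obtain ⟨m', hm'⟩ : ∃ m', m = m' + 1 := ⟨m - 1, by omega⟩
      simp only [eval_mul, eval_pow, eval_sub, eval_X, eval_C]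
      rw [hm', Nat.add_sub_cancel]; ring
    rw [hder, hev] at h1
    refine mul_left_cancel₀ (pow_ne_zero (m - 1) (sub_ne_zero.2 hne)) ?_
    linear_combination h1
  have hnear : ∀ᶠ u in 𝓝 z, ‖u‖ * ρ ≤ t := by
    have : Tendsto (fun u : ℂ => ‖u‖ * ρ) (𝓝 z) (𝓝 (‖z‖ * ρ)) :=
      (continuous_norm.mul continuous_const).tendsto z
    exact (this.eventually_lt_const ht1).mono fun _ h => h.le
  have hnear' : ∀ᶠ u in 𝓝[≠] z, ‖u‖ * ρ ≤ t ∧ u ≠ z :=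
    (hnear.filter_mono nhdsWithin_le_nhds).and self_mem_nhdsWithin
  have hlim1 : Tendsto (fun u => u * (m * Q.eval u + (u - z) * (derivative Q).eval u)) (𝓝[≠] z)
      (𝓝 (z * (m * Q.eval z + (z - z) * (derivative Q).eval z))) := by
    refine Tendsto.mono_left (Continuous.tendsto ?_ z) nhdsWithin_le_nhds
    fun_prop
  have hlim2 : Tendsto (fun u => (u - z) * Q.eval u * f u) (𝓝[≠] z) (𝓝 0) := by
    refine squeeze_zero_norm' (a := fun u => ‖(u - z) * Q.eval u‖ * ∑' ν : ℕ, A * t ^ ν) ?_ ?_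
    · filter_upwards [hnear'] with u hu
      rw [norm_mul]
      gcongr
      exact hfb u hu.1
    · have : Tendsto (fun u => ‖(u - z) * Q.eval u‖ * ∑' ν : ℕ, A * t ^ ν) (𝓝 z)
          (𝓝 (‖(z - z) * Q.eval z‖ * ∑' ν : ℕ, A * t ^ ν)) := by
        refine Continuous.tendsto ?_ z
        fun_prop
      rw [sub_self, zero_mul, norm_zero, zero_mul] at this
      exact this.mono_left nhdsWithin_le_nhds
  have hlim3 := hlim2.congr' (hnear'.mono fun u hu => (hid2 u hu.1 hu.2).symm)
  have h := tendsto_nhds_unique hlim1 hlim3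
  rw [sub_self, zero_mul, add_zero] at h
  exact mul_ne_zero hz0 (mul_ne_zero (Nat.cast_ne_zero.2 hm0.ne') hQz') h

lemma norm_coeff_one_le {P : ℂ[X]} {ρ : ℝ} (hP0 : P.coeff 0 = 1)
    (hz : ∀ z, P.IsRoot z → 1 ≤ ‖z‖ * ρ) : ‖P.coeff 1‖ ≤ P.natDegree * ρ := by
  have h0 : P.eval 0 = 1 := by rw [← coeff_zero_eq_eval_zero, hP0]
  have hPne : P ≠ 0 := by rintro rfl; simp at hP0
  have h1 := (IsAlgClosed.splits P).eval_derivative_div_eval_of_ne_zero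
    (x := 0) (by rw [h0]; exact one_ne_zero)
  have h2 : (derivative P).eval 0 = P.coeff 1 := by
    rw [← coeff_zero_eq_eval_zero, coeff_derivative]; simp
  rw [h0, div_one, h2] at h1
  rw [h1]
  have key : ∀ m : Multiset ℂ, (∀ z ∈ m, 1 ≤ ‖z‖ * ρ) →
      ‖(m.map fun z => 1 / (0 - z)).sum‖ ≤ m.card * ρ := fun m hm => by
    induction m using Multiset.induction_on with
    | empty => simp
    | cons z m ih =>
      rw [Multiset.map_cons, Multiset.sum_cons, Multiset.card_cons]
      refine (norm_add_le _ _).trans ?_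
      have h3 := ih fun w hw => hm w (Multiset.mem_cons_of_mem hw)
      have h4 := hm z (Multiset.mem_cons_self z m)
      have hz0 : 0 < ‖z‖ := by
        refine (norm_nonneg z).lt_of_ne fun h => ?_
        rw [← h, zero_mul] at h4
        exact absurd h4 (by norm_num)
      have h5 : ‖1 / (0 - z)‖ ≤ ρ := by
        rw [norm_div, norm_one, zero_sub, norm_neg, div_le_iff₀ hz0, mul_comm]
        exact h4
      push_cast
      linarith
  have hρ : 0 ≤ ρ ∨ P.roots = 0 := by
    by_contra! h
    obtain ⟨z, hz'⟩ := Multiset.exists_mem_of_ne_zero h.2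
    have := hz z (isRoot_of_mem_roots hz')
    nlinarith [norm_nonneg z, mul_nonneg (norm_nonneg z) (neg_nonneg.2 h.1.le)]
  refine (key P.roots fun z h => hz z (isRoot_of_mem_roots h)).trans ?_
  obtain h | h := hρ
  · gcongr
    exact card_roots' P
  · rw [splits_iff_card_roots.1 (IsAlgClosed.splits P)]

theorem norm_sub_le_of_recurrence {C s : ℕ → ℂ} {p d n₀ : ℕ} {A ρ : ℝ} {l : ℂ} (hC0 : C 0 = 1)
    (hrec : ∀ n : ℕ, n * C n = ∑ ν ∈ Finset.Icc 1 n, s ν * C (n - ν))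
    (hper : ∀ n, n₀ < n → C (n + d) = (p : ℂ) ^ d * C n) (hd : 0 < d) (hρ : 1 < ρ)
    (hρp : ρ * ρ = p) (hs : ∀ ν, 0 < ν → ‖s ν - l ^ ν‖ ≤ A * ρ ^ ν) :
    ‖s 1 - l‖ ≤ (n₀ + 1 : ℕ) * ρ := by
  have hρ0 : 0 < ρ := one_pos.trans hρ
  have hA : 0 ≤ A := by
    have := (norm_nonneg _).trans (hs 1 one_pos)
    rw [pow_one] at this
    exact nonneg_of_mul_nonneg_left this hρ0
  let s' : ℕ → ℂ := fun ν => if ν = 0 then 0 else s ν - l ^ ν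
  have hs' : ∀ ν, ‖s' ν‖ ≤ A * ρ ^ ν := fun ν => by
    by_cases h : ν = 0
    · simp [s', h, hA]
    · simpa [s', h] using hs ν (Nat.pos_of_ne_zero h)
  let CS : PowerSeries ℂ := PowerSeries.mk C
  let E : PowerSeries ℂ := CS * (1 - PowerSeries.C l * PowerSeries.X)
  have hE0 : PowerSeries.coeff 0 E = 1 := by simp [E, CS, hC0]
  have hEs : ∀ n, PowerSeries.coeff (n + 1) E = C (n + 1) - l * C n := fun n => by
    have : E = CS - PowerSeries.C l * (CS * PowerSeries.X) := by simp only [E]; ring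
    rw [this, map_sub, PowerSeries.coeff_C_mul, PowerSeries.coeff_succ_mul_X]
    simp [CS]
  -- logarithmic derivative
  have hlog : PowerSeries.X * PowerSeries.derivative ℂ E = E * PowerSeries.mk s' := by
    let S : PowerSeries ℂ := PowerSeries.mk fun ν => if ν = 0 then 0 else s ν
    let Λ : PowerSeries ℂ := PowerSeries.mk fun ν => if ν = 0 then 0 else l ^ ν
    have h1 : PowerSeries.X * PowerSeries.derivative ℂ CS = CS * S := by
      ext n
      obtain _ | n := n
      · simp [S, CS]
      · rw [PowerSeries.coeff_succ_X_mul]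
        rw [PowerSeries.coeff_derivative, mul_comm CS S, PowerSeries.coeff_mul,
          Finset.Nat.sum_antidiagonal_eq_sum_range_succ_mk, Finset.sum_range_succ']
        have h2 := hrec (n + 1)
        rw [← Finset.Ico_add_one_right_eq_Icc, Finset.sum_Ico_eq_sum_range] at h2
        simp only [CS, S, PowerSeries.coeff_mk]
        push_cast at h2
        simp only [Nat.succ_ne_zero, if_true, if_false, zero_mul, add_zero]
        rw [mul_comm, h2]
        simp [add_comm]
    have h2 : (1 - PowerSeries.C l * PowerSeries.X) * Λ = PowerSeries.C l * PowerSeries.X := by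
      ext n
      rw [sub_mul, one_mul, map_sub, mul_assoc, PowerSeries.coeff_C_mul, PowerSeries.coeff_C_mul]
      obtain _ | n := n
      · simp [Λ]
      · rw [PowerSeries.coeff_succ_X_mul]
        obtain _ | n := n
        · simp [Λ]
        · simp [Λ, PowerSeries.coeff_X, pow_succ]
          ring
    have h3 : PowerSeries.mk s' = S - Λ := by
      ext n
      by_cases h : n = 0 <;> simp [s', S, Λ, h]
    have h4 : PowerSeries.derivative ℂ E = PowerSeries.derivative ℂ CS *
        (1 - PowerSeries.C l * PowerSeries.X) - CS * PowerSeries.C l := by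
      simp only [E, Derivation.leibniz, map_sub, smul_eq_mul]
      have h5 : PowerSeries.derivative ℂ (1 : PowerSeries ℂ) = 0 := Derivation.map_one_eq_zero _
      have h6 : PowerSeries.derivative ℂ (PowerSeries.C l) = 0 := PowerSeries.derivative_C
      have h7 : PowerSeries.derivative ℂ (PowerSeries.X : PowerSeries ℂ) = 1 :=
        PowerSeries.derivative_X
      rw [h5, h6, h7]; ring
    rw [h4, h3]
    simp only [E]
    linear_combination (1 - PowerSeries.C l * PowerSeries.X) * h1 + CS * h2
  clear_value E
  have hgrow : ∃ D, ∀ n, ‖PowerSeries.coeff n E‖ ≤ D * (ρ * ((1 + ρ) / 2)) ^ n := by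
    have h1 : ∀ n : ℕ, n * (‖PowerSeries.coeff n E‖ / ρ ^ n) ≤
        A * ∑ j ∈ Finset.range n, ‖PowerSeries.coeff j E‖ / ρ ^ j := fun n => by
      obtain _ | n := n
      · simp
      have h2 := congrArg (PowerSeries.coeff (n + 1)) hlog
      rw [PowerSeries.coeff_succ_X_mul] at h2
      rw [PowerSeries.coeff_derivative, PowerSeries.coeff_mul,
        Finset.Nat.sum_antidiagonal_eq_sum_range_succ_mk, Finset.sum_range_succ] at h2
      simp only [PowerSeries.coeff_mk, Nat.sub_self] at h2
      rw [show s' 0 = 0 by simp [s'], mul_zero, add_zero] at h2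
      have h3 : ((n + 1 : ℕ) : ℝ) * ‖PowerSeries.coeff (n + 1) E‖ ≤
          ∑ j ∈ Finset.range (n + 1), ‖PowerSeries.coeff j E‖ * (A * ρ ^ (n + 1 - j)) := by
        have h4 : ((n + 1 : ℕ) : ℝ) * ‖PowerSeries.coeff (n + 1) E‖ =
            ‖PowerSeries.coeff (n + 1) E * (n + 1)‖ := by
          rw [norm_mul, mul_comm]; norm_cast
        rw [h4, h2]
        refine (norm_sum_le _ _).trans (Finset.sum_le_sum fun j _ => ?_)
        rw [norm_mul]
        gcongr
        exact hs' _
      rw [mul_div_assoc', div_le_iff₀ (by positivity)]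
      refine h3.trans (le_of_eq ?_)
      rw [mul_assoc, Finset.sum_mul, Finset.mul_sum]
      refine Finset.sum_congr rfl fun j hj => ?_
      rw [← pow_sub_mul_pow ρ (Finset.mem_range.1 hj).le]
      field_simp
    obtain ⟨D, hD⟩ := exists_le_mul_pow_of_recurrence (fun n => by positivity) hA
      (by linarith : 1 < (1 + ρ) / 2) h1
    refine ⟨D, fun n => ?_⟩
    have := hD n
    rw [div_le_iff₀ (by positivity)] at this
    rw [mul_pow]
    linarith
  -- eventual vanishing
  have hperE : ∀ n, n₀ + 1 < n → PowerSeries.coeff (n + d) E = (p : ℂ) ^ d * PowerSeries.coeff n E := by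
    intro n hn
    obtain ⟨n, rfl⟩ : ∃ m, n = m + 1 := ⟨n - 1, by omega⟩
    rw [show n + 1 + d = n + d + 1 by ring, hEs, hEs, show n + d + 1 = n + 1 + d by ring,
      hper _ (by omega), hper _ (by omega)]
    ring
  have hvan : ∀ n, n₀ + 1 < n → PowerSeries.coeff n E = 0 := by
    intro n hn
    obtain ⟨D, hD⟩ := hgrow
    have hit : ∀ j : ℕ, PowerSeries.coeff (n + d * j) E = ((p : ℂ) ^ d) ^ j * PowerSeries.coeff n E := by
      intro j
      induction j with
      | zero => simp
      | succ j ih =>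
        rw [mul_add, mul_one, ← add_assoc, hperE _ (by omega), ih, pow_succ]; ring
    by_contra hne
    have hpos : 0 < ‖PowerSeries.coeff n E‖ := norm_pos_iff.2 hne
    set w := ((1 + ρ) / 2) with hw
    have hw0 : 0 < w := by positivity
    have hq : (w / ρ) ^ d < 1 := by
      refine pow_lt_one₀ (by positivity) ?_ hd.ne'
      rw [div_lt_one hρ0]; linarith
    have hlim : Tendsto (fun j : ℕ => D * (ρ * w) ^ n * ((w / ρ) ^ d) ^ j) atTop (𝓝 0) := by
      rw [← mul_zero (D * (ρ * w) ^ n)]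
      exact (tendsto_pow_atTop_nhds_zero_of_lt_one (by positivity) hq).const_mul _
    obtain ⟨j, hj⟩ := (hlim.eventually_lt_const hpos).exists
    have h1 := hD (n + d * j)
    rw [hit, norm_mul, norm_pow, norm_pow, Complex.norm_natCast, ← hρp, pow_add, pow_mul] at h1
    have h2 : ((ρ * w) ^ d) ^ j = ((ρ * ρ) ^ d) ^ j * ((w / ρ) ^ d) ^ j := by
      rw [← mul_pow, ← mul_pow]
      congr 2
      field_simp
    rw [h2] at h1
    have h3 : 0 < ((ρ * ρ) ^ d) ^ j := by positivity
    have h4 : ((ρ * ρ) ^ d) ^ j * ‖PowerSeries.coeff n E‖ ≤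
        ((ρ * ρ) ^ d) ^ j * (D * (ρ * w) ^ n * ((w / ρ) ^ d) ^ j) := by linarith
    exact absurd (le_of_mul_le_mul_left h4 h3) (not_le.2 hj)
  let P : ℂ[X] := PowerSeries.trunc (n₀ + 2) E
  have hP : (P : PowerSeries ℂ) = E := by
    ext n
    rw [coeff_coe, PowerSeries.coeff_trunc]
    split_ifs with h
    · rfl
    · rw [hvan n (by omega)]
  have hPc : ∀ n, P.coeff n = PowerSeries.coeff n E := fun n => by rw [← hP, coeff_coe]
  have hPdeg : P.natDegree ≤ n₀ + 1 := Nat.lt_succ_iff.1 (PowerSeries.natDegree_trunc_lt E (n₀ + 1))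
  have hP0 : P.coeff 0 = 1 := (hPc 0).trans hE0
  have hrecP : PowerSeries.X * (derivative P : PowerSeries ℂ) =
      (P : PowerSeries ℂ) * PowerSeries.mk s' := by
    rw [← PowerSeries.derivative_coe, hP, hlog]
  have h1 := norm_coeff_one_le hP0 fun z hz => one_le_norm_root_mul hρ0 hP0 hs' hrecP hz
  rw [hPc, hEs 0, zero_add, hC0, mul_one] at h1
  have h2 := hrec 1
  rw [Nat.cast_one, one_mul, Finset.Icc_self, Finset.sum_singleton, Nat.sub_self, hC0, mul_one] at h2
  rw [h2] at h1
  exact h1.trans (by gcongr)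

end RecurrenceBound

section CurveCharacterSum
open Polynomial

variable {p : ℕ} [hp : Fact p.Prime] {H : (ZMod p)[X][X]} {c d : ℕ}

lemma IsWeightedMonic.map {R S : Type*} [CommRing R] [CommRing S] [Nontrivial S] {H : R[X][X]}
    (h : IsWeightedMonic H c d) (f : R →+* S) : IsWeightedMonic (H.map (mapRingHom f)) c d where
  monic := h.monic.map _
  natDegree_eq := (h.monic.natDegree_map _).trans h.natDegree_eq
  natDegree_coeff_le i hi := by
    rw [coeff_map, coe_mapRingHom]
    exact natDegree_map_le.trans (h.natDegree_coeff_le i hi)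

lemma eval_map_mapRingHom {R S : Type*} [CommRing R] [CommRing S] (f : R →+* S) (H : R[X][X])
    (x y : S) : ((H.map (mapRingHom f)).map (evalRingHom x)).eval y =
      eval₂ (eval₂RingHom f x) y H := by
  rw [map_map, eval_map]
  congr 1
  ext <;> simp

lemma exists_algebraMap_eq_of_pow_eq {F : Type*} [Field F] [CharP F p] [Algebra (ZMod p) F] {x : F}
    (hx : x ^ p = x) : ∃ a : ZMod p, algebraMap (ZMod p) F a = x := by
  have h := (Subfield.mem_bot_iff_pow_eq_self (F := F) (p := p)).2 hx
  rw [← ZMod.fieldRange_castHom_eq_bot p] at h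
  obtain ⟨a, ha⟩ := h
  exact ⟨a, by rw [← ha]; congr 1; exact Subsingleton.elim _ _⟩

lemma exists_norm_sum_frobChar_sub_le {F : Type} [Field F] [CharP F p] [IsAlgClosed F]
    [Algebra (ZMod p) F] (hH : IsWeightedMonic H c d) (hdp : d.Coprime p)
    (hirr : Irreducible (H.map (mapRingHom (algebraMap (ZMod p) F)))) (ψ : AddChar (ZMod p) ℂ) :
    ∃ S : ℕ, ∀ (ν : ℕ) (_ : 0 < ν) (N : Finset (F × F))
      (_ : ∀ x, x ∈ N ↔ x.1 ^ p ^ ν = x.1 ∧ x.2 ^ p ^ ν = x.2 ∧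
          eval₂ (eval₂RingHom (algebraMap (ZMod p) F) x.1) x.2 H = 0),
      ‖∑ x ∈ N, frobChar ψ ν x.1 - (if ψ = 0 then (p : ℂ) ^ ν else 0)‖ ≤ S * (p : ℝ) ^ (ν - ν / 2) := by
  classical
  obtain ⟨S, hS⟩ := exists_abs_card_twist_sub_le p c d hdp
  refine ⟨S, fun ν hν N hN => ?_⟩
  have hp0 : (0 : ℝ) < p := by exact_mod_cast hp.out.pos
  have hpC : (p : ℂ) ≠ 0 := by exact_mod_cast hp.out.ne_zero
  have halg : ∀ a : ZMod p, algebraMap (ZMod p) F a ^ p = algebraMap (ZMod p) F a := fun a => by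
    rw [← map_pow, ZMod.pow_card]
  have halgν : ∀ (ν : ℕ) (a : ZMod p), algebraMap (ZMod p) F a ^ p ^ ν = algebraMap (ZMod p) F a :=
    fun ν a => by rw [← map_pow, ZMod.pow_card_pow]
  set H' := H.map (mapRingHom (algebraMap (ZMod p) F)) with hH'
  have hfix : H'.map (mapRingHom (iterateFrobenius F p ν)) = H' := by
    rw [hH', map_map, mapRingHom_comp]
    congr 2
    exact Subsingleton.elim _ _
  let Na : ZMod p → Finset (F × F) := fun a =>
    N.filter fun x => frobTrace p ν x.1 = algebraMap (ZMod p) F a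
  have hb : ∀ a, |((p * (Na a).card : ℕ) : ℤ) - (p ^ ν : ℕ)| ≤ (S * p ^ (ν - ν / 2) : ℕ) := fun a => by
    refine hS (hH.map _) hirr ν hν hfix (algebraMap (ZMod p) F a) (halg a) (Na a) fun x => ?_
    rw [Finset.mem_filter, hN, eval_map_mapRingHom]
    tauto
  have hsum : ∑ x ∈ N, frobChar ψ ν x.1 = ∑ a : ZMod p, ψ a * (Na a).card := by
    have hex : ∀ x ∈ N, ∃ a : ZMod p, algebraMap (ZMod p) F a = frobTrace p ν x.1 := by
      intro x hx
      refine exists_algebraMap_eq_of_pow_eq ?_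
      obtain ⟨h1, -⟩ := (hN x).1 hx
      have h2 := frobTrace_pow_sub (p := p) ν x.1
      rw [h1, sub_self, sub_eq_add_neg, frobTrace_add] at h2
      have h3 : frobTrace p ν (-x.1) = - frobTrace p ν x.1 := by
        have := frobTrace_add (p := p) ν x.1 (-x.1)
        rw [add_neg_cancel] at this
        have h0 : frobTrace p ν (0 : F) = 0 := by
          simp [frobTrace, hp.out.ne_zero]
        rw [h0] at this
        exact (neg_eq_of_add_eq_zero_right this.symm).symm
      have h4 : frobTrace p ν (x.1 ^ p) = frobTrace p ν x.1 ^ p := by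
        rw [frobTrace, frobTrace, sum_pow_char]
        exact Finset.sum_congr rfl fun i _ => by rw [← pow_mul, ← pow_mul, mul_comm]
      rw [h3, h4] at h2
      exact eq_of_sub_eq_zero (by rwa [← sub_eq_add_neg] at h2)
    choose! g hg using hex
    rw [← Finset.sum_fiberwise_of_maps_to (s := N) (t := Finset.univ) (g := g)
      fun _ _ => Finset.mem_univ _]
    refine Finset.sum_congr rfl fun a _ => ?_
    have : N.filter (fun x => g x = a) = Na a := by
      refine Finset.filter_congr fun x hx => ?_
      rw [← hg x hx]
      exact (algebraMap (ZMod p) F).injective.eq_iff.symm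
    rw [this, Finset.sum_congr rfl (g := fun _ => ψ a), Finset.sum_const, nsmul_eq_mul, mul_comm]
    intro x hx
    exact frobChar_eq (Finset.mem_filter.1 hx).2
  have hψ : ∑ a : ZMod p, ψ a = if ψ = 0 then (p : ℂ) else 0 := by
    rw [AddChar.sum_eq_ite, ZMod.card]
  have hid : (p : ℂ) * (∑ x ∈ N, frobChar ψ ν x.1 - (if ψ = 0 then (p : ℂ) ^ ν else 0)) =
      ∑ a : ZMod p, ψ a * ((p * (Na a).card : ℂ) - (p : ℂ) ^ ν) := by
    rw [hsum, mul_sub, Finset.mul_sum]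
    simp only [mul_sub, Finset.sum_sub_distrib]
    congr 1
    · exact Finset.sum_congr rfl fun _ _ => by ring
    · rw [← Finset.sum_mul, hψ]
      split_ifs <;> simp
  have hnorm : ‖(p : ℂ) * (∑ x ∈ N, frobChar ψ ν x.1 - (if ψ = 0 then (p : ℂ) ^ ν else 0))‖ ≤
      p * (S * (p : ℝ) ^ (ν - ν / 2)) := by
    rw [hid]
    refine (norm_sum_le _ _).trans ?_
    calc _ ≤ ∑ a : ZMod p, S * (p : ℝ) ^ (ν - ν / 2) := by
          refine Finset.sum_le_sum fun a _ => ?_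
          rw [norm_mul, AddChar.norm_apply, one_mul]
          have h1 := hb a
          have h2 : ((|((p * (Na a).card : ℕ) : ℤ) - (p ^ ν : ℕ)| : ℤ) : ℝ) ≤
              ((S * p ^ (ν - ν / 2) : ℕ) : ℤ) := by exact_mod_cast h1
          push_cast at h2
          rw [← Real.norm_eq_abs, ← Complex.norm_real] at h2
          push_cast at h2
          exact h2
      _ = _ := by rw [Finset.sum_const, Finset.card_univ, ZMod.card, nsmul_eq_mul]
  rw [norm_mul, Complex.norm_natCast] at hnorm
  exact le_of_mul_le_mul_left hnorm hp0

theorem norm_sum_curve_sub_le (hH : IsWeightedMonic H c d) (hd0 : 0 < d) (hdp : d < p)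
    (hirr : Irreducible (H.map (mapRingHom (algebraMap (ZMod p) (AlgebraicClosure (ZMod p))))))
    (ψ : AddChar (ZMod p) ℂ) :
    ‖∑ x : ZMod p × ZMod p with (H.map (evalRingHom x.1)).eval x.2 = 0, ψ x.1 -
        (if ψ = 0 then (p : ℂ) else 0)‖ ≤
      (d * (2 * (c * d) + 3) + 1 : ℕ) * √p + (d * (c * (d - 1)) * (2 * d) : ℕ) := by
  classical
  let F := AlgebraicClosure (ZMod p)
  have : CharP F p := charP_of_injective_algebraMap (algebraMap (ZMod p) F).injective p
  have hirr0 : Irreducible H := hH.monic.irreducible_of_irreducible_map _ _ hirr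
  obtain ⟨C, s, hC0, hrec, hper, hs⟩ := exists_curveCharSums hH hd0 hdp hirr0 ψ
  have hcop : d.Coprime p := Nat.Coprime.symm
    ((hp.out.coprime_iff_not_dvd).2 fun h => absurd (Nat.le_of_dvd hd0 h) (by omega))
  obtain ⟨S, hS⟩ := exists_norm_sum_frobChar_sub_le (F := F) hH hcop hirr ψ
  have hp1 : (1 : ℝ) < p := by exact_mod_cast hp.out.one_lt
  set ρ : ℝ := √p with hρ
  have hρ1 : 1 < ρ := by rw [hρ, Real.lt_sqrt] <;> simp [hp.out.one_lt]
  have hρp : ρ * ρ = p := Real.mul_self_sqrt (by positivity)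
  set E : ℕ := d * (c * (d - 1)) * (2 * d)
  have hpts : ∀ ν, 0 < ν → ∃ N : Finset (F × F), ∀ x, x ∈ N ↔ x.1 ^ p ^ ν = x.1 ∧ x.2 ^ p ^ ν = x.2 ∧
      eval₂ (eval₂RingHom (algebraMap (ZMod p) F) x.1) x.2 H = 0 := fun ν hν => by
    have hq : 1 < p ^ ν := Nat.one_lt_pow hν.ne' hp.out.one_lt
    refine ⟨(fixedPow F (p ^ ν) ×ˢ fixedPow F (p ^ ν)).filter fun x =>
      eval₂ (eval₂RingHom (algebraMap (ZMod p) F) x.1) x.2 H = 0, fun x => ?_⟩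
    rw [Finset.mem_filter, Finset.mem_product, mem_fixedPow hq, mem_fixedPow hq, and_assoc]
  have hmain := norm_sub_le_of_recurrence (A := S * ρ + E) (ρ := ρ)
    (l := if ψ = 0 then (p : ℂ) else 0) hC0 hrec hper hd0 hρ1 hρp fun ν hν => by
      obtain ⟨N, hN⟩ := hpts ν hν
      have h1 := hs ν hν N hN
      have h2 := hS ν hν N hN
      have h3 : (if ψ = 0 then (p : ℂ) else 0) ^ ν = if ψ = 0 then (p : ℂ) ^ ν else 0 := by
        split_ifs
        · rfl
        · exact zero_pow hν.ne'
      rw [h3]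
      refine (norm_sub_le_norm_sub_add_norm_sub _ (∑ x ∈ N, frobChar ψ ν x.1) _).trans ?_
      have h4 : (p : ℝ) ^ (ν - ν / 2) ≤ ρ * ρ ^ ν := by
        rw [← hρp, ← pow_two, ← pow_mul, ← pow_succ']
        exact pow_le_pow_right₀ hρ1.le (by omega)
      have h5 : (1 : ℝ) ≤ ρ ^ ν := one_le_pow₀ hρ1.le
      have h6 : (S : ℝ) * p ^ (ν - ν / 2) ≤ S * (ρ * ρ ^ ν) := by gcongr
      have h7 : (E : ℝ) ≤ E * ρ ^ ν := le_mul_of_one_le_right (Nat.cast_nonneg _) h5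
      rw [add_mul, mul_assoc]
      linarith
  obtain ⟨N, hN⟩ := hpts 1 one_pos
  have h1 := hs 1 one_pos N hN
  have h2 : ∑ x ∈ N, frobChar ψ 1 x.1 =
      ∑ x : ZMod p × ZMod p with (H.map (evalRingHom x.1)).eval x.2 = 0, ψ x.1 := by
    symm
    have hi : ∀ x : ZMod p × ZMod p, ((H.map (evalRingHom x.1)).eval x.2 = 0) ↔
        eval₂ (eval₂RingHom (algebraMap (ZMod p) F) (algebraMap (ZMod p) F x.1))
          (algebraMap (ZMod p) F x.2) H = 0 := fun x => by
      rw [← (algebraMap (ZMod p) F).injective.eq_iff, map_zero, eval_map, hom_eval₂]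
      have : (algebraMap (ZMod p) F).comp (evalRingHom x.1) =
          eval₂RingHom (algebraMap (ZMod p) F) (algebraMap (ZMod p) F x.1) := by
        ext <;> simp
      rw [this]
    refine Finset.sum_bij (fun x _ => (algebraMap (ZMod p) F x.1, algebraMap (ZMod p) F x.2)) ?_ ?_ ?_ ?_
    · intro x hx
      rw [hN, pow_one, ← map_pow, ← map_pow, ZMod.pow_card, ZMod.pow_card]
      exact ⟨rfl, rfl, (hi x).1 (Finset.mem_filter.1 hx).2⟩
    · intro x _ y _ h
      rw [Prod.mk.injEq] at h
      exact Prod.ext ((algebraMap (ZMod p) F).injective h.1) ((algebraMap (ZMod p) F).injective h.2)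
    · rintro ⟨x, y⟩ hxy
      rw [hN, pow_one] at hxy
      obtain ⟨a, rfl⟩ := exists_algebraMap_eq_of_pow_eq hxy.1
      obtain ⟨b, rfl⟩ := exists_algebraMap_eq_of_pow_eq hxy.2.1
      exact ⟨(a, b), Finset.mem_filter.2 ⟨Finset.mem_univ _, (hi (a, b)).2 hxy.2.2⟩, rfl⟩
    · intro x _
      exact (frobChar_eq (by simp [frobTrace])).symm
  rw [← h2]
  refine (norm_sub_le_norm_sub_add_norm_sub _ (s 1) _).trans ?_
  rw [norm_sub_rev] at h1
  linarith

end CurveCharacterSum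

section WeightedFactors
open Polynomial

variable {R : Type*} [CommRing R]

/-- The substitution `x ↦ T ^ l`, `y ↦ S T ^ k`, with values in `R[S][T]`. -/
noncomputable def weightHom (R : Type*) [CommRing R] (k l : ℕ) : R[X][X] →+* R[X][X] :=
  eval₂RingHom (eval₂RingHom (C.comp C) (X ^ l)) (C X * X ^ k)

lemma weightHom_C (k l : ℕ) (q : R[X]) : weightHom R k l (C q) = (expand R l q).map C := by
  rw [weightHom, coe_eval₂RingHom, eval₂_C, coe_eval₂RingHom, expand_eq_sum, eval₂_eq_sum,
    Polynomial.sum, Polynomial.sum, Polynomial.map_sum]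
  simp

lemma coeff_coeff_weightHom {k l : ℕ} (hl : 0 < l) (P : R[X][X]) (m j : ℕ) :
    ((weightHom R k l P).coeff (k * m + l * j)).coeff m = (P.coeff m).coeff j := by
  induction P using Polynomial.induction_on' with
  | add P Q hP hQ => simp only [map_add, coeff_add, hP, hQ]
  | monomial n q =>
    have h1 : weightHom R k l (monomial n q) = (expand R l q).map C * C (X ^ n) * X ^ (k * n) := by
      rw [← C_mul_X_pow_eq_monomial, map_mul, weightHom_C, map_pow]
      simp only [weightHom, coe_eval₂RingHom, eval₂_X]
      rw [mul_pow, ← C_pow, ← pow_mul, mul_assoc]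
    rw [h1, coeff_mul_X_pow', coeff_monomial]
    by_cases hmn : n = m
    · subst hmn
      rw [if_pos (Nat.le_add_right _ _), Nat.add_sub_cancel_left, coeff_mul_C, if_pos rfl, coeff_map,
        coeff_C_mul, coeff_X_pow_self, mul_one, mul_comm l j, coeff_expand_mul hl]
    · rw [if_neg hmn, coeff_zero]
      split_ifs
      · rw [coeff_mul_C, coeff_map, coeff_C_mul, coeff_X_pow, if_neg (Ne.symm hmn), mul_zero]
      · rw [coeff_zero]

lemma natDegree_weightHom_C_le (k l : ℕ) (q : R[X]) :
    (weightHom R k l (C q)).natDegree ≤ l * q.natDegree := by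
  rw [weightHom_C]
  refine natDegree_map_le.trans ?_
  rw [natDegree_expand, mul_comm]

lemma natDegree_weightHom_map_C_le (k l : ℕ) (q : R[X]) :
    (weightHom R k l (q.map C)).natDegree ≤ k * q.natDegree := by
  have h : weightHom R k l (q.map C) = ∑ i ∈ Finset.range (q.natDegree + 1),
      C (C (q.coeff i)) * (C X * X ^ k) ^ i := by
    rw [weightHom, coe_eval₂RingHom, eval₂_map, eval₂_eq_sum_range]
    simp
  rw [h]
  refine natDegree_sum_le_of_forall_le _ _ fun i hi => ?_
  rw [mul_pow, ← C_pow, ← mul_assoc, ← C_mul, ← pow_mul]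
  refine (natDegree_C_mul_X_pow_le _ _).trans ?_
  exact Nat.mul_le_mul_left k (Nat.lt_succ_iff.1 (Finset.mem_range.1 hi))

variable [IsDomain R]

lemma mul_natDegree_le_natDegree_weightHom {k l : ℕ} (hl : 0 < l) {P : R[X][X]} (hP : P.Monic) :
    k * P.natDegree ≤ (weightHom R k l P).natDegree := by
  refine le_natDegree_of_ne_zero fun h => ?_
  have := coeff_coeff_weightHom (k := k) hl P P.natDegree 0
  rw [mul_zero, add_zero, h, hP.coeff_natDegree] at this
  simp at this

/-- The weighted degree of a monic factor is determined by its degree. -/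
lemma weight_le_of_mul {k l : ℕ} (hl : 0 < l) {P Q : R[X][X]} (hP : P.Monic) (hQ : Q.Monic)
    (h : (weightHom R k l (P * Q)).natDegree ≤ k * (P * Q).natDegree) {m j : ℕ}
    (hmj : (P.coeff m).coeff j ≠ 0) : k * m + l * j ≤ k * P.natDegree := by
  have hP' := mul_natDegree_le_natDegree_weightHom (k := k) hl hP
  have hQ' := mul_natDegree_le_natDegree_weightHom (k := k) hl hQ
  have hne : ∀ {P : R[X][X]}, P.Monic → weightHom R k l P ≠ 0 := fun {P} hP h0 => by
    have := coeff_coeff_weightHom (k := k) hl P P.natDegree 0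
    rw [h0, hP.coeff_natDegree] at this
    simp at this
  rw [map_mul, natDegree_mul (hne hP) (hne hQ), hP.natDegree_mul hQ, mul_add] at h
  refine le_trans (le_natDegree_of_ne_zero fun h0 => hmj ?_)
    (show (weightHom R k l P).natDegree ≤ k * P.natDegree by omega)
  rw [← coeff_coeff_weightHom (k := k) hl P m j, h0, coeff_zero]

/-- `f(y) - g(x)` as a polynomial in `y` over `R[x]`. -/
noncomputable def separated (f g : R[X]) : R[X][X] := f.map C - C g

lemma natDegree_separated {f g : R[X]} (hf : f.Monic) :
    (separated f g).natDegree = f.natDegree := by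
  rw [separated, natDegree_sub_C, hf.natDegree_map]

lemma monic_separated {f g : R[X]} (hf : f.Monic) (hf0 : 0 < f.natDegree) :
    (separated f g).Monic := by
  refine (hf.map C).sub_of_left (degree_C_le.trans_lt ?_)
  rw [← natDegree_pos_iff_degree_pos, hf.natDegree_map]
  exact hf0

lemma natDegree_weightHom_separated_le {f g : R[X]} (hf : f.Monic) :
    (weightHom R g.natDegree f.natDegree (separated f g)).natDegree ≤
      g.natDegree * (separated f g).natDegree := by
  rw [natDegree_separated hf, separated, map_sub]
  refine (natDegree_sub_le _ _).trans (max_le (natDegree_weightHom_map_C_le _ _ _) ?_)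
  rw [mul_comm]
  exact natDegree_weightHom_C_le _ _ _

theorem irreducible_separated {f g : R[X]} (hf : f.Monic) (hf0 : 0 < f.natDegree)
    (hfg : f.natDegree.Coprime g.natDegree) :
    Irreducible (separated f g) := by
  have hm := monic_separated (g := g) hf hf0
  have hd := natDegree_separated (g := g) hf
  rw [hm.irreducible_iff_natDegree]
  refine ⟨fun h => by rw [h, natDegree_one] at hd; omega, fun P Q hP hQ hPQ => ?_⟩
  have hw := natDegree_weightHom_separated_le (g := g) hf
  have hdeg : P.natDegree + Q.natDegree = f.natDegree := by
    rw [← hP.natDegree_mul hQ, hPQ, hd]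
  have h1 : f.natDegree * (P.coeff 0).natDegree ≤ g.natDegree * P.natDegree := by
    by_cases h0 : P.coeff 0 = 0
    · simp [h0]
    have := weight_le_of_mul hf0 hP hQ (hPQ ▸ hw) (m := 0) (j := (P.coeff 0).natDegree)
      (by rw [coeff_natDegree]; exact leadingCoeff_ne_zero.2 h0)
    simpa using this
  have h2 : f.natDegree * (Q.coeff 0).natDegree ≤ g.natDegree * Q.natDegree := by
    by_cases h0 : Q.coeff 0 = 0
    · simp [h0]
    have := weight_le_of_mul hf0 hQ hP (mul_comm P Q ▸ hPQ ▸ hw) (m := 0)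
      (j := (Q.coeff 0).natDegree) (by rw [coeff_natDegree]; exact leadingCoeff_ne_zero.2 h0)
    simpa using this
  have h3 : g.natDegree ≤ (P.coeff 0).natDegree + (Q.coeff 0).natDegree := by
    have : P.coeff 0 * Q.coeff 0 = C (f.coeff 0) - g := by
      rw [← mul_coeff_zero, hPQ, separated, coeff_sub, coeff_map, coeff_C_zero]
    calc g.natDegree = (C (f.coeff 0) - g).natDegree := by
          rw [← natDegree_neg (C (f.coeff 0) - g), neg_sub, natDegree_sub_C]
      _ ≤ _ := by rw [← this]; exact natDegree_mul_le
  have h4 : f.natDegree * (P.coeff 0).natDegree = g.natDegree * P.natDegree := by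
    have h5 : f.natDegree * g.natDegree ≤
      f.natDegree * ((P.coeff 0).natDegree + (Q.coeff 0).natDegree) := Nat.mul_le_mul_left _ h3
    have h6 : f.natDegree * g.natDegree = g.natDegree * P.natDegree + g.natDegree * Q.natDegree := by
      rw [← mul_add, hdeg, mul_comm]
    rw [mul_add] at h5
    omega
  have h7 : f.natDegree ∣ P.natDegree := hfg.dvd_of_dvd_mul_left ⟨_, h4.symm⟩
  obtain h8 | h8 := Nat.eq_zero_or_pos P.natDegree
  · exact Or.inl h8
  · exact Or.inr (by have := Nat.le_of_dvd h8 h7; omega)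

end WeightedFactors

section GridOperator
open Polynomial

variable {F : Type*} [Field F]

/-- The second order difference operator of which the discrete Chebyshev polynomials on
`{0, …, k - 1}` are the eigenvectors. -/
noncomputable def gridOp (F : Type*) [Field F] (k : ℕ) : F[X] →ₗ[F] F[X] where
  toFun g := (X + 1) * ((k : F[X]) - 1 - X) * (g.comp (X + 1) - g) +
    X * ((k : F[X]) - X) * (g.comp (X - 1) - g)
  map_add' g h := by simp only [add_comp]; ring
  map_smul' a g := by simp only [smul_eq_C_mul, mul_comp, C_comp, RingHom.id_apply]; ring

lemma gridOp_apply (k : ℕ) (g : F[X]) : gridOp F k g =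
    (X + 1) * ((k : F[X]) - 1 - X) * (g.comp (X + 1) - g) +
      X * ((k : F[X]) - X) * (g.comp (X - 1) - g) := rfl

lemma gridOp_descPochhammer (k n : ℕ) : gridOp F k (descPochhammer F (n + 1)) =
    (-((n + 1) * (n + 2)) : F) • descPochhammer F (n + 1) +
      ((n + 1) ^ 2 * (k - n - 1) : F) • descPochhammer F n := by
  have h1 : descPochhammer F (n + 1) = descPochhammer F n * (X - (n : F[X])) :=
    descPochhammer_succ_right F n
  have h2 : (descPochhammer F (n + 1)).comp (X + 1) = (X + 1) * descPochhammer F n := by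
    rw [descPochhammer_succ_left, mul_comp, X_comp, comp_assoc]
    simp
  have h3 : X * (descPochhammer F (n + 1)).comp (X - 1) =
      descPochhammer F (n + 1) * (X - (n + 1 : F[X])) := by
    rw [← descPochhammer_succ_left, descPochhammer_succ_right F (n + 1)]
    push_cast; rfl
  rw [gridOp_apply, h2, mul_assoc X, mul_comm _ (Polynomial.comp _ _ - _), ← mul_assoc, mul_sub X,
    h3, h1, smul_eq_C_mul, smul_eq_C_mul]
  simp only [C_neg, C_mul, C_add, C_sub, C_pow, C_1, C_ofNat, ← C_eq_natCast]
  ring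

lemma descPochhammer_mem_degreeLT (n : ℕ) : descPochhammer F n ∈ degreeLT F (n + 1) := by
  rw [mem_degreeLT, degree_eq_natDegree (monic_descPochhammer F n).ne_zero,
    descPochhammer_natDegree]
  exact_mod_cast Nat.lt_succ_self n

lemma sub_smul_mem_degreeLT {n : ℕ} {g q : F[X]} (hg : g ∈ degreeLT F (n + 1))
    (hq : q ∈ degreeLT F (n + 1)) (hqn : q.coeff n = 1) : g - g.coeff n • q ∈ degreeLT F n := by
  rw [mem_degreeLT, degree_lt_iff_coeff_zero] at hg hq ⊢
  intro m hm
  rw [coeff_sub, coeff_smul, smul_eq_mul]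
  obtain rfl | hm := hm.eq_or_lt
  · rw [hqn, mul_one, sub_self]
  · rw [hg m hm, hq m hm, mul_zero, sub_zero]

lemma coeff_descPochhammer_self (n : ℕ) : (descPochhammer F n).coeff n = 1 := by
  have := monic_descPochhammer F n
  rwa [Monic, leadingCoeff, descPochhammer_natDegree] at this

lemma gridOp_descPochhammer_add_mem (k n : ℕ) :
    gridOp F k (descPochhammer F n) + (n * (n + 1) : F) • descPochhammer F n ∈ degreeLT F n := by
  obtain _ | n := n
  · simp [gridOp_apply]
  · have : gridOp F k (descPochhammer F (n + 1)) +
        (((n + 1 : ℕ) : F) * ((n + 1 : ℕ) + 1)) • descPochhammer F (n + 1) =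
        ((n + 1) ^ 2 * (k - n - 1) : F) • descPochhammer F n := by
      rw [gridOp_descPochhammer, add_right_comm, ← add_smul]
      push_cast
      rw [show (-((n + 1) * (n + 2)) + (n + 1) * (n + 1 + 1) : F) = 0 by ring, zero_smul, zero_add]
    rw [this]
    exact Submodule.smul_mem _ _ (descPochhammer_mem_degreeLT n)

lemma degreeLT_le_succ (n : ℕ) : degreeLT F n ≤ degreeLT F (n + 1) := degreeLT_mono (Nat.le_succ n)

lemma exists_gridOp_add_smul_eq (k : ℕ) (μ : F) : ∀ n : ℕ, (∀ r < n, μ ≠ r * (r + 1)) →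
    ∀ g ∈ degreeLT F n, ∃ h ∈ degreeLT F n, gridOp F k h + μ • h = g := by
  intro n
  induction n with
  | zero =>
    intro _ g hg
    have : g = 0 := by simpa [mem_degreeLT] using hg
    exact ⟨0, Submodule.zero_mem _, by simp [this]⟩
  | succ n ih =>
    intro hμ g hg
    have hne : μ - n * (n + 1) ≠ 0 := sub_ne_zero.2 (hμ n n.lt_succ_self)
    set e := descPochhammer F n
    set c := g.coeff n / (μ - n * (n + 1)) with hc
    have h1 : g - c • (gridOp F k e + μ • e) ∈ degreeLT F n := by
      have : g - c • (gridOp F k e + μ • e) = (g - g.coeff n • e) -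
          c • (gridOp F k e + (n * (n + 1) : F) • e) := by
        have h2 : g.coeff n = c * (μ - n * (n + 1)) := by rw [hc, div_mul_cancel₀ _ hne]
        rw [h2]
        module
      rw [this]
      exact Submodule.sub_mem _ (sub_smul_mem_degreeLT hg (descPochhammer_mem_degreeLT n)
        (coeff_descPochhammer_self n)) (Submodule.smul_mem _ _ (gridOp_descPochhammer_add_mem k n))
    obtain ⟨h, hh, hh'⟩ := ih (fun r hr => hμ r (hr.trans n.lt_succ_self)) _ h1
    refine ⟨h + c • e, Submodule.add_mem _ (degreeLT_le_succ n hh)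
      (Submodule.smul_mem _ _ (descPochhammer_mem_degreeLT n)), ?_⟩
    rw [map_add, map_smul]
    rw [eq_sub_iff_add_eq] at hh'
    rw [← hh']
    module

lemma exists_gridOp_eigenvector (k m : ℕ) (hm : ∀ r < m, (m * (m + 1) : F) ≠ r * (r + 1)) :
    ∃ q ∈ degreeLT F (m + 1), q.coeff m = 1 ∧ gridOp F k q = -(m * (m + 1) : F) • q := by
  obtain ⟨h, hh, hh'⟩ := exists_gridOp_add_smul_eq k (m * (m + 1) : F) m hm _
    (gridOp_descPochhammer_add_mem k m)
  refine ⟨descPochhammer F m - h, Submodule.sub_mem _ (descPochhammer_mem_degreeLT m)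
    (degreeLT_le_succ m hh), ?_, ?_⟩
  · rw [coeff_sub, coeff_descPochhammer_self]
    rw [mem_degreeLT, degree_lt_iff_coeff_zero] at hh
    rw [hh m le_rfl, sub_zero]
  · rw [map_sub, eq_sub_iff_add_eq.2 hh']
    module

lemma linearMap_eq_zero_of_degreeLT {q : ℕ → F[X]} {n : ℕ} (L : F[X] →ₗ[F] F)
    (hq : ∀ r < n, q r ∈ degreeLT F (r + 1) ∧ (q r).coeff r = 1) (hL : ∀ r < n, L (q r) = 0) :
    ∀ g ∈ degreeLT F n, L g = 0 := by
  induction n with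
  | zero =>
    intro g hg
    have : g = 0 := by simpa [mem_degreeLT] using hg
    rw [this, map_zero]
  | succ n ih =>
    intro g hg
    have h1 := ih (fun r hr => hq r (hr.trans n.lt_succ_self))
      (fun r hr => hL r (hr.trans n.lt_succ_self)) _
      (sub_smul_mem_degreeLT hg (hq n n.lt_succ_self).1 (hq n n.lt_succ_self).2)
    rwa [map_sub, map_smul, hL n n.lt_succ_self, smul_zero, sub_zero] at h1

/-- The Dirichlet form of `gridOp`. -/
lemma sum_mul_eval_gridOp (n : ℕ) (z : ℕ → F) (v : F[X]) :
    ∑ j ∈ Finset.range (n + 1), z j * (gridOp F (n + 1) v).eval (j : F) =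
      ∑ j ∈ Finset.range n, (j + 1) * (n - j) * (v.eval ((j + 1 : ℕ) : F) - v.eval (j : F)) *
        (z j - z (j + 1)) := by
  let b : ℕ → F := fun j => (j + 1) * (n - j) * (v.eval ((j + 1 : ℕ) : F) - v.eval (j : F))
  have h0 : ∀ j : ℕ, (gridOp F (n + 1) v).eval (j : F) = b j - if j = 0 then 0 else b (j - 1) := by
    intro j
    rw [gridOp_apply]
    simp only [eval_add, eval_mul, eval_sub, eval_comp, eval_X, eval_one, eval_natCast]
    obtain _ | j := j
    · simp [b]
    · simp only [b, Nat.succ_ne_zero, if_false, Nat.add_sub_cancel]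
      push_cast
      rw [add_sub_cancel_right (j : F) 1]
      ring
  have key : ∀ m : ℕ, ∑ j ∈ Finset.range (m + 1), z j * (gridOp F (n + 1) v).eval (j : F) =
      ∑ j ∈ Finset.range m, b j * (z j - z (j + 1)) + z m * b m := by
    intro m
    induction m with
    | zero => simp [h0]
    | succ m ih =>
      rw [Finset.sum_range_succ, ih, Finset.sum_range_succ, h0, if_neg (Nat.succ_ne_zero m),
        Nat.add_sub_cancel]
      ring
  rw [key n]
  simp [b]

variable {k : ℕ}

/-- The bilinear form on polynomial functions on `{0, …, k - 1}` with matrix `M`. -/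
noncomputable def gridForm (k : ℕ) (M : ℕ → ℕ → F) : F[X] →ₗ[F] F[X] →ₗ[F] F :=
  LinearMap.mk₂ F (fun u v => ∑ i ∈ Finset.range k, ∑ j ∈ Finset.range k,
      u.eval (i : F) * M i j * v.eval (j : F))
    (fun u u' v => by simp only [eval_add, add_mul, Finset.sum_add_distrib])
    (fun a u v => by simp only [eval_smul, smul_eq_mul, Finset.mul_sum, mul_assoc])
    (fun u v v' => by simp only [eval_add, mul_add, Finset.sum_add_distrib])
    (fun a u v => by
      simp only [eval_smul, smul_eq_mul, Finset.mul_sum]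
      exact Finset.sum_congr rfl fun i _ => Finset.sum_congr rfl fun j _ => by ring)

lemma gridForm_apply (M : ℕ → ℕ → F) (u v : F[X]) : gridForm k M u v =
    ∑ i ∈ Finset.range k, ∑ j ∈ Finset.range k, u.eval (i : F) * M i j * v.eval (j : F) := rfl

lemma gridForm_one_apply (u v : F[X]) : gridForm k (fun i j => if i = j then 1 else 0) u v =
    ∑ i ∈ Finset.range k, u.eval (i : F) * v.eval (i : F) := by
  rw [gridForm_apply]
  refine Finset.sum_congr rfl fun i hi => ?_
  rw [Finset.sum_eq_single_of_mem i hi fun j _ hj => by rw [if_neg (Ne.symm hj)]; ring]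
  rw [if_pos rfl, mul_one]

/-- A matrix which, together with its transpose, preserves the degree filtration commutes with
`gridOp`. -/
theorem gridForm_gridOp_comm (hdist : ∀ m < k, ∀ r < m, (m * (m + 1) : F) ≠ r * (r + 1))
    {M : ℕ → ℕ → F}
    (hrow : ∀ n ≤ k, ∀ g ∈ degreeLT F n, ∃ h ∈ degreeLT F n, ∀ i < k,
      ∑ j ∈ Finset.range k, M i j * g.eval (j : F) = h.eval (i : F))
    (hcol : ∀ n ≤ k, ∀ g ∈ degreeLT F n, ∃ h ∈ degreeLT F n, ∀ j < k,
      ∑ i ∈ Finset.range k, M i j * g.eval (i : F) = h.eval (j : F))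
    {u v : F[X]} (hu : u ∈ degreeLT F k) (hv : v ∈ degreeLT F k) :
    gridForm k M (gridOp F k u) v = gridForm k M u (gridOp F k v) := by
  obtain _ | k := k
  · simp [gridForm_apply]
  choose q hq1 hq2 hq3 using fun m : {m // m < k + 1} =>
    exists_gridOp_eigenvector (F := F) (k + 1) m (hdist m m.2)
  let Q : ℕ → F[X] := fun m => if h : m < k + 1 then q ⟨m, h⟩ else 0
  have hQ : ∀ m, m < k + 1 → Q m ∈ degreeLT F (m + 1) ∧ (Q m).coeff m = 1 := fun m hm => by
    simp only [Q, dif_pos hm]; exact ⟨hq1 ⟨m, hm⟩, hq2 ⟨m, hm⟩⟩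
  have hQe : ∀ m, m < k + 1 → gridOp F (k + 1) (Q m) = -(m * (m + 1) : F) • Q m := fun m hm => by
    simp only [Q, dif_pos hm]; exact hq3 ⟨m, hm⟩
  set I : F[X] →ₗ[F] F[X] →ₗ[F] F := gridForm (k + 1) (fun i j => if i = j then 1 else 0) with hI
  have hIsymm : ∀ u v : F[X], I u v = I v u := fun u v => by
    rw [hI, gridForm_one_apply, gridForm_one_apply]
    exact Finset.sum_congr rfl fun _ _ => mul_comm _ _
  have hself : ∀ u v : F[X], I u (gridOp F (k + 1) v) = I v (gridOp F (k + 1) u) := fun u v => by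
    rw [hI, gridForm_one_apply, gridForm_one_apply, sum_mul_eval_gridOp k (fun j => u.eval (j : F)),
      sum_mul_eval_gridOp k (fun j => v.eval (j : F))]
    exact Finset.sum_congr rfl fun _ _ => by ring
  have hneq : ∀ m < k + 1, ∀ n < k + 1, m ≠ n → (m * (m + 1) : F) ≠ n * (n + 1) := by
    intro m hm n hn hmn
    obtain h | h := lt_or_gt_of_ne hmn
    · exact (hdist n hn m h).symm
    · exact hdist m hm n h
  have hort : ∀ n < k + 1, ∀ m < k + 1, n ≠ m → I (Q n) (Q m) = 0 := by
    intro n hn m hm hnm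
    have h := hself (Q n) (Q m)
    rw [hQe m hm, hQe n hn, map_smul, map_smul, hIsymm (Q m) (Q n), smul_eq_mul, smul_eq_mul] at h
    have h2 : ((n * (n + 1) : F) - m * (m + 1)) * I (Q n) (Q m) = 0 := by linear_combination h
    exact (mul_eq_zero.1 h2).resolve_left (sub_ne_zero.2 (hneq n hn m hm hnm))
  have hort' : ∀ n < k + 1, ∀ g ∈ degreeLT F n, I (Q n) g = 0 := fun n hn =>
    linearMap_eq_zero_of_degreeLT (q := Q) (I (Q n)) (fun r hr => hQ r (hr.trans hn))
      fun r hr => hort n hn r (hr.trans hn) hr.ne'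
  have hM0 : ∀ n < k + 1, ∀ m < k + 1, n ≠ m → gridForm (k + 1) M (Q n) (Q m) = 0 := by
    intro n hn m hm hnm
    obtain h | h := lt_or_gt_of_ne hnm
    · obtain ⟨g, hg, hg'⟩ := hcol (n + 1) hn _ (hQ n hn).1
      have h1 := hort' m hm g (degreeLT_mono h hg)
      rw [hI, gridForm_one_apply] at h1
      rw [← h1, gridForm_apply, Finset.sum_comm]
      refine Finset.sum_congr rfl fun j hj => ?_
      rw [← hg' j (Finset.mem_range.1 hj), Finset.mul_sum]
      exact Finset.sum_congr rfl fun i _ => by ring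
    · obtain ⟨g, hg, hg'⟩ := hrow (m + 1) hm _ (hQ m hm).1
      have h1 := hort' n hn g (degreeLT_mono h hg)
      rw [hI, gridForm_one_apply] at h1
      rw [← h1, gridForm_apply]
      refine Finset.sum_congr rfl fun i hi => ?_
      rw [← hg' i (Finset.mem_range.1 hi), Finset.mul_sum]
      exact Finset.sum_congr rfl fun j _ => by ring
  let B : F[X] →ₗ[F] F[X] →ₗ[F] F := (gridForm (k + 1) M).comp (gridOp F (k + 1)) -
    (gridForm (k + 1) M).compl₂ (gridOp F (k + 1))
  have hB : ∀ u v, B u v = gridForm (k + 1) M (gridOp F (k + 1) u) v -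
    gridForm (k + 1) M u (gridOp F (k + 1) v) := fun u v => rfl
  have hBQ : ∀ n < k + 1, ∀ m < k + 1, B (Q n) (Q m) = 0 := by
    intro n hn m hm
    rw [hB, hQe n hn, hQe m hm, map_smul, map_smul, LinearMap.smul_apply]
    obtain rfl | hnm := eq_or_ne n m
    · exact sub_self _
    · rw [hM0 n hn m hm hnm, smul_zero, smul_zero, sub_zero]
  have h1 : ∀ n < k + 1, ∀ g ∈ degreeLT F (k + 1), B (Q n) g = 0 := fun n hn =>
    linearMap_eq_zero_of_degreeLT (q := Q) (B (Q n)) hQ fun m hm => hBQ n hn m hm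
  have h2 := linearMap_eq_zero_of_degreeLT (q := Q) (B.flip v) hQ (fun n hn => h1 n hn v hv) u hu
  rw [LinearMap.flip_apply, hB] at h2
  exact sub_eq_zero.1 h2

lemma exists_mem_degreeLT_eval_eq (hinj : Set.InjOn (fun i : ℕ => (i : F)) (Finset.range k))
    (r : ℕ → F) : ∃ g ∈ degreeLT F k, ∀ i < k, g.eval (i : F) = r i := by
  refine ⟨Lagrange.interpolate (Finset.range k) (fun i : ℕ => (i : F)) r, ?_, fun i hi => ?_⟩
  · rw [mem_degreeLT]
    have := Lagrange.degree_interpolate_lt r hinj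
    rwa [Finset.card_range] at this
  · exact Lagrange.eval_interpolate_at_node r hinj (Finset.mem_range.2 hi)

theorem sum_row_sub_eq {n : ℕ} (hinj : Set.InjOn (fun i : ℕ => (i : F)) (Finset.range (n + 2)))
    (hdist : ∀ m < n + 2, ∀ r < m, (m * (m + 1) : F) ≠ r * (r + 1))
    {M : ℕ → ℕ → F}
    (hrow : ∀ m ≤ n + 2, ∀ g ∈ degreeLT F m, ∃ h ∈ degreeLT F m, ∀ i < n + 2,
      ∑ j ∈ Finset.range (n + 2), M i j * g.eval (j : F) = h.eval (i : F))
    (hcol : ∀ m ≤ n + 2, ∀ g ∈ degreeLT F m, ∃ h ∈ degreeLT F m, ∀ j < n + 2,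
      ∑ i ∈ Finset.range (n + 2), M i j * g.eval (i : F) = h.eval (j : F)) {l : ℕ} (hl : l ≤ n) :
    (n + 1) * ∑ j ∈ Finset.range (l + 1), (M 1 j - M 0 j) =
      (l + 1) * (n + 1 - l) * (M 0 (l + 1) - M 0 l) := by
  obtain ⟨u, hu, hu'⟩ := exists_mem_degreeLT_eval_eq hinj fun i => if i = 0 then (1 : F) else 0
  obtain ⟨v, hv, hv'⟩ := exists_mem_degreeLT_eval_eq hinj fun i => if i ≤ l then (1 : F) else 0
  have key := gridForm_gridOp_comm hdist hrow hcol hu hv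
  have h1 : gridForm (n + 2) M (gridOp F (n + 2) u) v =
      ∑ i ∈ Finset.range (n + 2), (∑ j ∈ Finset.range (n + 2), M i j * v.eval (j : F)) *
        (gridOp F (n + 2) u).eval (i : F) := by
    rw [gridForm_apply]
    refine Finset.sum_congr rfl fun i _ => ?_
    rw [Finset.sum_mul]
    exact Finset.sum_congr rfl fun j _ => by ring
  have h2 : gridForm (n + 2) M u (gridOp F (n + 2) v) =
      ∑ j ∈ Finset.range (n + 2), M 0 j * (gridOp F (n + 2) v).eval (j : F) := by
    rw [gridForm_apply, Finset.sum_eq_single_of_mem 0 (by simp)]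
    · rw [hu' 0 (by omega), if_pos rfl]
      simp only [one_mul]
    · intro i hi h0
      rw [hu' i (Finset.mem_range.1 hi), if_neg h0]
      simp
  have h3 : ∀ i, ∑ j ∈ Finset.range (n + 2), M i j * v.eval (j : F) =
      ∑ j ∈ Finset.range (l + 1), M i j := by
    intro i
    rw [← Finset.sum_subset (Finset.range_subset_range.2 (show l + 1 ≤ n + 2 by omega))]
    · refine Finset.sum_congr rfl fun j hj => ?_
      rw [Finset.mem_range] at hj
      rw [hv' j (by omega), if_pos (by omega), mul_one]
    · intro j hj hj'
      rw [Finset.mem_range] at hj hj'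
      rw [hv' j hj, if_neg (by omega), mul_zero]
  have h4 := sum_mul_eval_gridOp (n + 1)
    (fun i => ∑ j ∈ Finset.range (n + 2), M i j * v.eval (j : F)) u
  have h5 := sum_mul_eval_gridOp (n + 1) (fun j => M 0 j) v
  rw [Finset.sum_eq_single_of_mem (s := Finset.range (n + 1)) 0 (by simp)] at h4
  · rw [Finset.sum_eq_single_of_mem (s := Finset.range (n + 1)) l (by simp; omega)] at h5
    · rw [h1, h2] at key
      have h6 := h4.symm.trans (key.trans h5)
      simp only [h3] at h6
      rw [hu' 0 (by omega), hu' (0 + 1) (by omega), if_pos rfl, if_neg (by omega),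
        hv' l (by omega), hv' (l + 1) (by omega), if_pos le_rfl, if_neg (by omega)] at h6
      rw [Finset.sum_sub_distrib]
      push_cast at h6
      linear_combination h6
    · intro j hj hjl
      rw [Finset.mem_range] at hj
      rw [hv' j (by omega), hv' (j + 1) (by omega)]
      obtain h | h := lt_or_gt_of_ne hjl
      · rw [if_pos (by omega), if_pos (by omega)]; ring
      · rw [if_neg (by omega), if_neg (by omega)]; ring
  · intro j hj hj0
    rw [Finset.mem_range] at hj
    rw [hu' j (by omega), hu' (j + 1) (by omega), if_neg (by omega), if_neg hj0]; ring

end GridOperator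

section GridFactors
open Polynomial

lemma coeff_coeff_swap {R : Type*} [CommSemiring R] (P : R[X][X]) (m j : ℕ) :
    ((Bivariate.swap P).coeff m).coeff j = (P.coeff j).coeff m := by
  induction P using Polynomial.induction_on' with
  | add P Q hP hQ => rw [map_add, coeff_add, coeff_add, hP, hQ, coeff_add, coeff_add]
  | monomial n f =>
    induction f using Polynomial.induction_on' with
    | add P Q hP hQ =>
      rw [map_add, map_add, coeff_add, coeff_add, hP, hQ, coeff_add, coeff_add]
    | monomial i r =>
      rw [Bivariate.swap_monomial_monomial]
      simp only [coeff_monomial]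
      by_cases h1 : i = m <;> by_cases h2 : n = j <;> simp [h1, h2, coeff_monomial]

lemma eval_map_evalRingHom_swap {R : Type*} [CommRing R] (P : R[X][X]) (x y : R) :
    ((Bivariate.swap P).map (evalRingHom x)).eval y = (P.map (evalRingHom y)).eval x := by
  induction P using Polynomial.induction_on' with
  | add P Q hP hQ => rw [map_add, Polynomial.map_add, eval_add, hP, hQ, Polynomial.map_add, eval_add]
  | monomial n f =>
    rw [Bivariate.swap_monomial]
    have h : (evalRingHom x).comp (C : R →+* R[X]) = RingHom.id R := by ext; simp
    rw [Polynomial.map_mul, map_map, h, map_id, map_C, coe_evalRingHom, map_monomial]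
    simp [mul_comm]

variable {F : Type*} [Field F]

lemma exists_sum_roots_pow_eq {P : F[X][X]} {a : ℕ} (hP : IsWeightedMonic P 1 a) (m : ℕ) :
    ∃ N : F[X], N.natDegree ≤ m ∧ ∀ (x : F) (s : Finset F),
      (P.map (evalRingHom x)).roots = s.val → s.card = a → ∑ y ∈ s, y ^ m = N.eval x := by
  induction m using Nat.strong_induction_on with
  | _ m ih =>
  obtain rfl | hm := Nat.eq_zero_or_pos m
  · refine ⟨(a : F[X]), by simp, fun x s _ hs => ?_⟩
    simp [hs]
  choose N hN hN' using ih
  let E : ℕ → F[X] := fun r => if r ≤ a then (-1) ^ r * P.coeff (a - r) else 0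
  have hE : ∀ r, (E r).natDegree ≤ r := by
    intro r
    by_cases hr : r ≤ a
    · simp only [E, if_pos hr]
      have h1 := hP.natDegree_coeff_le (a - r) (Nat.sub_le _ _)
      have h2 : ((-1 : F[X]) ^ r).natDegree = 0 := by
        rw [← C_1, ← C_neg, ← C_pow, natDegree_C]
      have h3 := natDegree_mul_le (p := (-1 : F[X]) ^ r) (q := P.coeff (a - r))
      omega
    · simp [E, if_neg hr]
  have hE' : ∀ (r : ℕ) (x : F) (s : Finset F), (P.map (evalRingHom x)).roots = s.val →
      s.card = a → s.val.esymm r = (E r).eval x := by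
    intro r x s hs hsa
    have hdeg : (P.map (evalRingHom x)).natDegree = a := by
      rw [hP.monic.natDegree_map, hP.natDegree_eq]
    by_cases hr : r ≤ a
    · have h1 := coeff_eq_esymm_roots_of_card (p := P.map (evalRingHom x))
        (by rw [hs, hdeg]; exact hsa) (k := a - r) (by omega)
      rw [hdeg, (hP.monic.map _).leadingCoeff, one_mul, Nat.sub_sub_self hr, hs, coeff_map,
        coe_evalRingHom] at h1
      simp only [E, if_pos hr, eval_mul, h1, eval_pow, eval_neg, eval_one]
      rw [← mul_assoc, ← mul_pow]; simp
    · simp only [E, if_neg hr, eval_zero]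
      rw [Multiset.esymm, Multiset.powersetCard_eq_empty]
      · simp
      · rw [Finset.card_val]; omega
  let M : ℕ → F[X] := fun r => if h : r < m then N r h else 0
  have hM : ∀ r, (M r).natDegree ≤ r := fun r => by
    by_cases h : r < m
    · simp only [M, dif_pos h]; exact hN r h
    · simp [M, dif_neg h]
  refine ⟨(-1) ^ (m + 1) * (m : F[X]) * E m -
    ∑ b ∈ Finset.HasAntidiagonal.antidiagonal m with b.1 ∈ Set.Ioo 0 m,
      (-1) ^ b.1 * E b.1 * M b.2, ?_, fun x s hs hsa => ?_⟩
  · have h2 : ∀ r : ℕ, ((-1 : F[X]) ^ r).natDegree = 0 := fun r => by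
      rw [← C_1, ← C_neg, ← C_pow, natDegree_C]
    refine (natDegree_sub_le _ _).trans (max_le ?_ ?_)
    · refine natDegree_mul_le.trans ?_
      have h3 := natDegree_mul_le (p := (-1 : F[X]) ^ (m + 1)) (q := (m : F[X]))
      rw [h2, natDegree_natCast] at h3
      have := hE m
      omega
    · refine natDegree_sum_le_of_forall_le _ _ fun b hb => ?_
      rw [Finset.mem_filter, Finset.HasAntidiagonal.mem_antidiagonal] at hb
      refine natDegree_mul_le.trans ?_
      have h3 := natDegree_mul_le (p := (-1 : F[X]) ^ b.1) (q := E b.1)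
      have := hE b.1
      have := hM b.2
      rw [h2] at h3
      omega
  · have key := congrArg (MvPolynomial.aeval (fun y : s => (y : F)))
      (MvPolynomial.psum_eq_mul_esymm_sub_sum s F m hm)
    have hval : Multiset.map (fun y : s => (y : F)) Finset.univ.val = s.val := by
      exact Multiset.attach_map_val s.val
    have hps : ∀ r, MvPolynomial.aeval (fun y : s => (y : F)) (MvPolynomial.psum s F r) =
        ∑ y ∈ s, y ^ r := fun r => by
      rw [MvPolynomial.psum, map_sum]
      simp only [map_pow, MvPolynomial.aeval_X]
      exact Finset.sum_coe_sort s (fun y => y ^ r)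
    simp only [map_sub, map_mul, map_pow, map_neg, map_one, map_natCast, map_sum, hps,
      MvPolynomial.aeval_esymm_eq_multiset_esymm, hval] at key
    rw [key]
    simp only [eval_sub, eval_mul, eval_pow, eval_neg, eval_one, eval_natCast, eval_finsetSum,
      hE' _ x s hs hsa]
    congr 1
    refine Finset.sum_congr rfl fun b hb => ?_
    rw [Finset.mem_filter, Finset.HasAntidiagonal.mem_antidiagonal] at hb
    have hb2 : b.2 < m := by have := hb.2.1; omega
    simp only [M, dif_pos hb2]
    rw [hN' b.2 hb2 x s hs hsa]

lemma exists_sum_roots_eval_eq {P : F[X][X]} {a : ℕ} (hP : IsWeightedMonic P 1 a) {n : ℕ}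
    {g : F[X]} (hg : g ∈ degreeLT F n) : ∃ h ∈ degreeLT F n, ∀ (x : F) (s : Finset F),
      (P.map (evalRingHom x)).roots = s.val → s.card = a → ∑ y ∈ s, g.eval y = h.eval x := by
  choose N hN hN' using exists_sum_roots_pow_eq hP
  refine ⟨∑ i ∈ Finset.range n, g.coeff i • N i, ?_, fun x s hs hsa => ?_⟩
  · refine Submodule.sum_mem _ fun i hi => Submodule.smul_mem _ _ ?_
    rw [mem_degreeLT]
    refine degree_le_natDegree.trans_lt ?_
    rw [Finset.mem_range] at hi
    exact_mod_cast (hN i).trans_lt hi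
  · obtain rfl | hn := Nat.eq_zero_or_pos n
    · have : g = 0 := by simpa [mem_degreeLT] using hg
      simp [this]
    · have hgn : g.natDegree < n := by
        rw [mem_degreeLT] at hg
        by_cases h0 : g = 0
        · rwa [h0, natDegree_zero]
        · exact (natDegree_lt_iff_degree_lt h0).2 hg
      simp only [eval_eq_sum_range' hgn, eval_finsetSum, eval_smul, smul_eq_mul]
      rw [Finset.sum_comm]
      refine Finset.sum_congr rfl fun i _ => ?_
      rw [← Finset.mul_sum, hN' i x s hs hsa]

end GridFactors

section DiagonalIrreducible
open Polynomial

variable {F : Type*} [Field F] {p : ℕ} [CharP F p]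

lemma descPochhammer_eq_prod (k : ℕ) :
    descPochhammer F k = ∏ j ∈ Finset.range k, (X - C (j : F)) := by
  induction k with
  | zero => simp
  | succ k ih => rw [descPochhammer_succ_right, ih, Finset.prod_range_succ, C_eq_natCast]

lemma natCast_inj_of_lt {i j : ℕ} (hi : i < p) (hj : j < p) (h : (i : F) = j) : i = j :=
  CharP.natCast_injOn_Iio F p hi hj h

lemma isRoot_descPochhammer {k : ℕ} {y : F} (h : (descPochhammer F k).eval y = 0) :
    ∃ j < k, (j : F) = y := by
  rw [descPochhammer_eval_eq_prod_range, Finset.prod_eq_zero_iff] at h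
  obtain ⟨j, hj, h⟩ := h
  exact ⟨j, Finset.mem_range.1 hj, (sub_eq_zero.1 h).symm⟩

lemma descPochhammer_eval_natCast_of_lt {i k : ℕ} (hi : i < k) :
    (descPochhammer F k).eval (i : F) = 0 := by
  rw [descPochhammer_eval_eq_prod_range, Finset.prod_eq_zero (Finset.mem_range.2 hi) (sub_self _)]

lemma descPochhammer_splits (k : ℕ) : (descPochhammer F k).Splits := by
  rw [descPochhammer_eq_prod]
  exact Splits.prod fun j _ => Splits.X_sub_C _

lemma squarefree_descPochhammer {k : ℕ} (hk : k ≤ p) : Squarefree (descPochhammer F k) := by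
  refine Separable.squarefree ?_
  rw [descPochhammer_eq_prod, ← Fin.prod_univ_eq_prod_range (fun j : ℕ => X - C (j : F)) k,
    separable_prod_X_sub_C_iff]
  exact fun i j h => Fin.ext (natCast_inj_of_lt (i.2.trans_le hk) (j.2.trans_le hk) h)

lemma map_evalRingHom_separated (f g : F[X]) (x : F) :
    (separated f g).map (evalRingHom x) = f - C (g.eval x) := by
  have h : (evalRingHom x).comp (C : F →+* F[X]) = RingHom.id F := by ext; simp
  rw [separated, Polynomial.map_sub, map_map, h, map_id, map_C, coe_evalRingHom]

open Classical in
/-- The incidence matrix of the curve `P = 0` with the grid of natural numbers. -/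
noncomputable def incidence (P : F[X][X]) (i j : ℕ) : ℤ :=
  if (P.map (evalRingHom (i : F))).eval (j : F) = 0 then 1 else 0

lemma incidence_eq_zero_or_one (P : F[X][X]) (i j : ℕ) :
    incidence P i j = 0 ∨ incidence P i j = 1 := by
  unfold incidence; split_ifs <;> simp

lemma incidence_eq_one_iff {P : F[X][X]} {i j : ℕ} :
    incidence P i j = 1 ↔ (P.map (evalRingHom (i : F))).eval (j : F) = 0 := by
  unfold incidence
  split_ifs with h
  · exact iff_of_true rfl h
  · exact iff_of_false zero_ne_one h

lemma incidence_congr {P Q : F[X][X]} {i j i' j' : ℕ}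
    (h : (P.map (evalRingHom (i : F))).eval (j : F) = 0 ↔
      (Q.map (evalRingHom (i' : F))).eval (j' : F) = 0) : incidence P i j = incidence Q i' j' := by
  unfold incidence
  by_cases h0 : (P.map (evalRingHom (i : F))).eval (j : F) = 0
  · rw [if_pos h0, if_pos (h.1 h0)]
  · rw [if_neg h0, if_neg fun h1 => h0 (h.2 h1)]

lemma roots_map_evalRingHom_eq {k a : ℕ} (hk : k ≤ p) {P : F[X][X]} (hP : IsWeightedMonic P 1 a)
    (hdvd : P ∣ separated (descPochhammer F k) (descPochhammer F k)) {i : ℕ} (hi : i < k) :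
    ∃ s : Finset F, (P.map (evalRingHom (i : F))).roots = s.val ∧ s.card = a ∧
      ∀ g : F[X], ∑ j ∈ Finset.range k, (incidence P i j : F) * g.eval (j : F) =
        ∑ y ∈ s, g.eval y := by
  classical
  set q := P.map (evalRingHom (i : F)) with hq
  have hqm : q.Monic := hP.monic.map _
  have hdvd' : q ∣ descPochhammer F k := by
    have := Polynomial.map_dvd (evalRingHom (i : F)) hdvd
    rwa [map_evalRingHom_separated, descPochhammer_eval_natCast_of_lt hi, C_0, sub_zero] at this
  have hf0 := (monic_descPochhammer F k).ne_zero
  have hsplit := (descPochhammer_splits k).of_dvd hf0 hdvd'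
  have hnodup : q.roots.Nodup := by
    refine nodup_roots (Separable.of_dvd ?_ hdvd')
    rw [descPochhammer_eq_prod, ← Fin.prod_univ_eq_prod_range (fun j : ℕ => X - C (j : F)) k,
      separable_prod_X_sub_C_iff]
    exact fun i j h => Fin.ext (natCast_inj_of_lt (i.2.trans_le hk) (j.2.trans_le hk) h)
  refine ⟨⟨q.roots, hnodup⟩, rfl, ?_, fun g => ?_⟩
  · rw [Finset.card_mk, ← hsplit.natDegree_eq_card_roots, hq, hP.monic.natDegree_map,
      hP.natDegree_eq]
  · have hinj : Set.InjOn (fun j : ℕ => (j : F)) (Finset.range k) := fun i hi j hj h =>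
      natCast_inj_of_lt ((Finset.mem_range.1 hi).trans_le hk) ((Finset.mem_range.1 hj).trans_le hk) h
    have hs : (⟨q.roots, hnodup⟩ : Finset F) =
        ((Finset.range k).filter fun j : ℕ => q.eval (j : F) = 0).image fun j : ℕ => (j : F) := by
      ext y
      rw [Finset.mem_mk, mem_roots hqm.ne_zero, IsRoot.def, Finset.mem_image]
      constructor
      · intro hy
        obtain ⟨j, hj, rfl⟩ := isRoot_descPochhammer (eval_eq_zero_of_dvd_of_eval_eq_zero hdvd' hy)
        exact ⟨j, Finset.mem_filter.2 ⟨Finset.mem_range.2 hj, hy⟩, rfl⟩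
      · rintro ⟨j, hj, rfl⟩
        exact (Finset.mem_filter.1 hj).2
    rw [hs, Finset.sum_image (hinj.mono (Finset.coe_subset.2 (Finset.filter_subset _ _))),
      Finset.sum_filter]
    refine Finset.sum_congr rfl fun j _ => ?_
    unfold incidence
    rw [← hq]
    split_ifs <;> simp

lemma exists_sum_incidence_mul_eval_eq {k a : ℕ} (hk : k ≤ p) {P : F[X][X]}
    (hP : IsWeightedMonic P 1 a)
    (hdvd : P ∣ separated (descPochhammer F k) (descPochhammer F k)) {n : ℕ} {g : F[X]}
    (hg : g ∈ degreeLT F n) : ∃ h ∈ degreeLT F n, ∀ i < k,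
      ∑ j ∈ Finset.range k, (incidence P i j : F) * g.eval (j : F) = h.eval (i : F) := by
  obtain ⟨h, hh, hh'⟩ := exists_sum_roots_eval_eq hP hg
  refine ⟨h, hh, fun i hi => ?_⟩
  obtain ⟨s, hs, hsa, hs'⟩ := roots_map_evalRingHom_eq hk hP hdvd hi
  rw [hs' g, hh' i s hs hsa]

variable {k : ℕ} {P Q : F[X][X]}

lemma natDegree_descPochhammer_separated :
    (separated (descPochhammer F k) (descPochhammer F k)).natDegree = k := by
  rw [natDegree_separated (monic_descPochhammer F k), descPochhammer_natDegree]

lemma add_le_of_mul_eq_separated (hk : 0 < k) (hP : P.Monic) (hQ : Q.Monic)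
    (h : P * Q = separated (descPochhammer F k) (descPochhammer F k)) {m j : ℕ}
    (hmj : (P.coeff m).coeff j ≠ 0) : m + j ≤ P.natDegree := by
  have h1 := natDegree_weightHom_separated_le (monic_descPochhammer F k) (g := descPochhammer F k)
  rw [descPochhammer_natDegree, ← h] at h1
  have := weight_le_of_mul hk hP hQ h1 hmj
  rw [← mul_add] at this
  exact Nat.le_of_mul_le_mul_left this hk

lemma isWeightedMonic_of_add_le {R : Type*} [CommRing R] {P : R[X][X]} (hP : P.Monic)
    (h : ∀ m j, (P.coeff m).coeff j ≠ 0 → m + j ≤ P.natDegree) :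
    IsWeightedMonic P 1 P.natDegree := by
  refine ⟨hP, rfl, fun i hi => ?_⟩
  rw [one_mul, natDegree_le_iff_coeff_eq_zero]
  intro j hj
  by_contra h0
  have := h i j h0
  omega

lemma isWeightedMonic_of_mul_eq_separated (hk : 0 < k) (hP : P.Monic) (hQ : Q.Monic)
    (h : P * Q = separated (descPochhammer F k) (descPochhammer F k)) :
    IsWeightedMonic P 1 P.natDegree :=
  isWeightedMonic_of_add_le hP fun _ _ => add_le_of_mul_eq_separated hk hP hQ h

/-- A normalisation of the transpose of a factor of a diagonal curve. -/
lemma exists_transpose (hk : 0 < k) (hP : P.Monic) (hQ : Q.Monic)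
    (h : P * Q = separated (descPochhammer F k) (descPochhammer F k)) :
    ∃ P' : F[X][X], IsWeightedMonic P' 1 P.natDegree ∧
      P' ∣ separated (descPochhammer F k) (descPochhammer F k) ∧
      ∀ i j, incidence P' j i = incidence P i j := by
  set f := descPochhammer F k with hf
  have hPw := fun m j => add_le_of_mul_eq_separated (m := m) (j := j) hk hP hQ h
  have hQw := fun m j => add_le_of_mul_eq_separated (m := m) (j := j) hk hQ hP (by rwa [mul_comm])
  have hdeg : P.natDegree + Q.natDegree = k := by
    rw [← hP.natDegree_mul hQ, h, natDegree_descPochhammer_separated]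
  have h0 : P.coeff 0 * Q.coeff 0 = C (f.coeff 0) - f := by
    rw [← mul_coeff_zero, h, separated, coeff_sub, coeff_map, coeff_C_zero]
  have h0' : (P.coeff 0 * Q.coeff 0).natDegree = k := by
    rw [h0, natDegree_sub, natDegree_sub_C, hf, descPochhammer_natDegree]
  have hbd : ∀ {P : F[X][X]}, (∀ m j, (P.coeff m).coeff j ≠ 0 → m + j ≤ P.natDegree) →
      (P.coeff 0).natDegree ≤ P.natDegree := fun {P} hP => by
    rw [natDegree_le_iff_coeff_eq_zero]
    intro j hj
    by_contra h0
    have := hP 0 j h0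
    omega
  have hu : (P.coeff 0).coeff P.natDegree ≠ 0 := by
    have h1 := natDegree_mul_le (p := P.coeff 0) (q := Q.coeff 0)
    have h2 := hbd hPw
    have h3 := hbd hQw
    have h4 : (P.coeff 0).natDegree = P.natDegree := by omega
    rw [← h4]
    refine leadingCoeff_ne_zero.2 fun h5 => ?_
    rw [h5, zero_mul, natDegree_zero] at h0'
    omega
  set u := (P.coeff 0).coeff P.natDegree
  have hc : ∀ m j, (((C (C u⁻¹) : F[X][X]) * Bivariate.swap P).coeff m).coeff j =
      u⁻¹ * (P.coeff j).coeff m := fun m j => by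
    rw [coeff_C_mul, coeff_C_mul, coeff_coeff_swap]
  have hle : ∀ m j, (((C (C u⁻¹) : F[X][X]) * Bivariate.swap P).coeff m).coeff j ≠ 0 →
      m + j ≤ P.natDegree := fun m j hmj => by
    rw [hc] at hmj
    rw [add_comm]
    exact hPw j m (right_ne_zero_of_mul hmj)
  have hnd : ((C (C u⁻¹) : F[X][X]) * Bivariate.swap P).natDegree ≤ P.natDegree := by
    rw [natDegree_le_iff_coeff_eq_zero]
    intro m hm
    ext j
    by_contra h0
    have := hle m j h0
    omega
  have htop : ((C (C u⁻¹) : F[X][X]) * Bivariate.swap P).coeff P.natDegree = 1 := by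
    ext j
    rw [coeff_one]
    split_ifs with hj
    · rw [hj, hc, inv_mul_cancel₀ hu]
    · by_contra h0
      have := hle _ j h0
      omega
  have hmon := monic_of_natDegree_le_of_coeff_eq_one _ hnd htop
  have hnd' : ((C (C u⁻¹) : F[X][X]) * Bivariate.swap P).natDegree = P.natDegree :=
    le_antisymm hnd (le_natDegree_of_ne_zero (by rw [htop]; exact one_ne_zero))
  refine ⟨C (C u⁻¹) * Bivariate.swap P, ?_, ?_, fun i j => incidence_congr ?_⟩
  · rw [← hnd']
    exact isWeightedMonic_of_add_le hmon fun m j hmj => by rw [hnd']; exact hle m j hmj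
  · have h1 : Bivariate.swap P ∣ -separated f f := by
      refine ⟨Bivariate.swap Q, ?_⟩
      rw [← map_mul, h, separated, map_sub, Bivariate.swap_map_C, Bivariate.swap_C]
      ring
    have h2 : IsUnit (C (C u⁻¹) : F[X][X]) :=
      ((IsUnit.mk0 _ (inv_ne_zero hu)).map C).map C
    exact (h2.mul_left_dvd).2 ((dvd_neg).1 h1)
  · rw [Polynomial.map_mul, eval_mul, eval_map_evalRingHom_swap, map_C, eval_C, coe_evalRingHom,
      eval_C, mul_eq_zero, or_iff_right (inv_ne_zero hu)]

end DiagonalIrreducible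

section DiagonalIrreducible
open Polynomial

variable {F : Type*} [Field F] {p : ℕ} [CharP F p]

lemma intCast_eq_intCast_of_abs_sub_lt {a b : ℤ} (h : (a : F) = b) (hab : |a - b| < p) : a = b := by
  have h1 : ((a - b : ℤ) : F) = 0 := by rw [Int.cast_sub, h, sub_self]
  rw [CharP.intCast_eq_zero_iff F p] at h1
  exact sub_eq_zero.1 (Int.eq_zero_of_abs_lt_dvd h1 hab)

variable {n : ℕ} {P Q : F[X][X]}

lemma incidence_relation (hp : 4 * (n + 2) ^ 2 < p) (hP : P.Monic) (hQ : Q.Monic)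
    (h : P * Q = separated (descPochhammer F (n + 2)) (descPochhammer F (n + 2))) {l : ℕ}
    (hl : l + 1 ≤ n) :
    (n + 1) * (incidence P 1 (l + 1) - incidence P 0 (l + 1)) =
      (l + 2) * (n - l) * (incidence P 0 (l + 2) - incidence P 0 (l + 1)) -
        (l + 1) * (n + 1 - l) * (incidence P 0 (l + 1) - incidence P 0 l) := by
  have hk : 0 < n + 2 := by omega
  have hkp : n + 2 ≤ p := by nlinarith
  have hinj : Set.InjOn (fun i : ℕ => (i : F)) (Finset.range (n + 2)) := fun i hi j hj h =>
    natCast_inj_of_lt ((Finset.mem_range.1 hi).trans_le hkp)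
      ((Finset.mem_range.1 hj).trans_le hkp) h
  have hdist : ∀ m < n + 2, ∀ r < m, (m * (m + 1) : F) ≠ r * (r + 1) := by
    intro m hm r hr h
    have h1 : ((m * (m + 1) : ℕ) : F) = ((r * (r + 1) : ℕ) : F) := by exact_mod_cast h
    have h2 := natCast_inj_of_lt (p := p) (by nlinarith) (by nlinarith) h1
    nlinarith
  obtain ⟨P', hP', hdvd', hinc⟩ := exists_transpose hk hP hQ h
  have hPw := isWeightedMonic_of_mul_eq_separated hk hP hQ h
  have key := fun {l : ℕ} (hl : l ≤ n) => sum_row_sub_eq (M := fun i j => (incidence P i j : F))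
    hinj hdist
    (fun m _ g hg => exists_sum_incidence_mul_eval_eq hkp hPw (Dvd.intro _ h) hg)
    (fun m _ g hg => by
      simp only [← hinc]
      exact exists_sum_incidence_mul_eval_eq hkp hP' hdvd' hg) hl
  have h1 := key hl
  have h2 := key (show l ≤ n by omega)
  rw [Finset.sum_range_succ, mul_add, h2] at h1
  have hn : ∀ i j, -1 ≤ incidence P i j ∧ incidence P i j ≤ 1 ∧ 0 ≤ incidence P i j := fun i j => by
    rcases incidence_eq_zero_or_one P i j with h | h <;> rw [h] <;> norm_num
  refine intCast_eq_intCast_of_abs_sub_lt (F := F) (p := p) ?_ ?_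
  · push_cast at h1 ⊢
    linear_combination h1
  · obtain ⟨r, rfl⟩ : ∃ r, n = l + 1 + r := ⟨n - (l + 1), by omega⟩
    have hp' : (4 * (l + 1 + r + 2) ^ 2 : ℤ) < p := by exact_mod_cast hp
    have hb : ∀ (c x y : ℤ), 0 ≤ c → (0 ≤ x ∧ x ≤ 1) → (0 ≤ y ∧ y ≤ 1) → |c * (x - y)| ≤ c := by
      intro c x y hc hx hy
      rw [abs_mul, abs_of_nonneg hc]
      refine mul_le_of_le_one_right hc (abs_le.2 ⟨by linarith, by linarith⟩)
    have hI := fun i j => And.intro (hn i j).2.2 (hn i j).2.1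
    push_cast
    have e1 := hb ((l + 1 + r + 1 : ℕ) : ℤ) _ _ (by positivity) (hI 1 (l + 1)) (hI 0 (l + 1))
    have e2 := hb ((l + 2) * (r + 1) : ℕ) _ _ (by positivity) (hI 0 (l + 2)) (hI 0 (l + 1))
    have e3 := hb ((l + 1) * (r + 2) : ℕ) _ _ (by positivity) (hI 0 (l + 1)) (hI 0 l)
    push_cast at e1 e2 e3
    rw [show (l + 1 + r - l : ℤ) = r + 1 by ring, show (l + 1 + r + 1 - l : ℤ) = r + 2 by ring]
    have hl0 : (0 : ℤ) ≤ l := by positivity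
    have hr0 : (0 : ℤ) ≤ r := by positivity
    rw [abs_le] at e1 e2 e3
    rw [abs_lt]
    constructor <;> nlinarith

/-- Jumps in the first row can only occur next to its ends. -/
lemma incidence_eq_succ (hp : 4 * (n + 2) ^ 2 < p) (hP : P.Monic) (hQ : Q.Monic)
    (h : P * Q = separated (descPochhammer F (n + 2)) (descPochhammer F (n + 2))) {l : ℕ}
    (hl : l + 1 < n) : incidence P 0 (l + 2) = incidence P 0 (l + 1) := by
  have key := incidence_relation hp hP hQ h hl.le
  obtain ⟨r, rfl⟩ : ∃ r, n = l + 2 + r := ⟨n - (l + 2), by omega⟩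
  have hq : (0 : ℤ) ≤ l * r := by positivity
  have hl0 : (0 : ℤ) ≤ l := by positivity
  have hr0 : (0 : ℤ) ≤ r := by positivity
  push_cast at key
  rcases incidence_eq_zero_or_one P 0 (l + 2) with h2 | h2 <;>
  rcases incidence_eq_zero_or_one P 0 (l + 1) with h1 | h1 <;>
  rcases incidence_eq_zero_or_one P 0 l with h0 | h0 <;>
  rcases incidence_eq_zero_or_one P 1 (l + 1) with h3 | h3 <;>
  rw [h0, h1, h2, h3] at key <;> first | (exfalso; nlinarith) | rw [h1, h2]

lemma incidence_eq_one (hp : 4 * (n + 2) ^ 2 < p) (hP : P.Monic) (hQ : Q.Monic)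
    (h : P * Q = separated (descPochhammer F (n + 2)) (descPochhammer F (n + 2))) {l : ℕ} (hl : l + 1 ≤ n) : incidence P 0 (l + 1) = incidence P 0 1 := by
  induction l with
  | zero => rfl
  | succ l ih => rw [incidence_eq_succ hp hP hQ h (by omega), ih (by omega)]

lemma false_of_eval_eq_zero_iff [Fact p.Prime] (hp : 4 * (n + 2) ^ 2 < p) (hn : Odd n)
    (hP : P.Monic) (hQ : Q.Monic)
    (h : P * Q = separated (descPochhammer F (n + 2)) (descPochhammer F (n + 2)))
    (hz : ∀ j < n + 2, (P.map (evalRingHom 0)).eval (j : F) = 0 ↔ j = n + 1) : False := by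
  have hn0 : 0 < n := hn.pos
  have hk : 0 < n + 2 := by omega
  have hkp : n + 2 ≤ p := by nlinarith
  have hz' : ∀ j < n + 2, incidence P 0 j = if j = n + 1 then 1 else 0 := by
    intro j hj
    have := hz j hj
    unfold incidence
    rw [Nat.cast_zero]
    by_cases h1 : j = n + 1
    · rw [if_pos (this.2 h1), if_pos h1]
    · rw [if_neg fun h2 => h1 (this.1 h2), if_neg h1]
  have hPw := isWeightedMonic_of_mul_eq_separated hk hP hQ h
  obtain ⟨s, hs, hsa, hsum⟩ := roots_map_evalRingHom_eq hkp hPw (Dvd.intro _ h) hk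
  have hdeg : (P.natDegree : F) = ((1 : ℕ) : F) := by
    have := hsum 1
    simp only [eval_one, mul_one, Finset.sum_const, hsa, nsmul_eq_mul] at this
    rw [← this, Finset.sum_congr rfl fun j hj => by rw [hz' j (Finset.mem_range.1 hj)]]
    simp
  have hPk : P.natDegree ≤ n + 2 := by
    rw [← natDegree_descPochhammer_separated (F := F) (k := n + 2), ← h, hP.natDegree_mul hQ]
    exact Nat.le_add_right _ _
  have hdeg1 : P.natDegree = 1 := natCast_inj_of_lt (p := p) (by nlinarith) (by nlinarith) hdeg
  have hrel := incidence_relation hp hP hQ h (l := n - 1) (by omega)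
  have hw : incidence P 1 n = 1 := by
    obtain ⟨m, rfl⟩ : ∃ m, n = m + 1 := ⟨n - 1, by omega⟩
    simp only [Nat.add_sub_cancel] at hrel
    rw [hz' (m + 1) (by omega), hz' (m + 2) (by omega), hz' m (by omega), if_neg (by omega),
      if_pos rfl, if_neg (by omega)] at hrel
    push_cast at hrel
    have h1 : ((m : ℤ) + 1 + 1) * (incidence P 1 (m + 1) - 1) = 0 := by linarith
    rcases mul_eq_zero.1 h1 with h2 | h2
    · omega
    · omega
  rw [incidence_eq_one_iff] at hw
  have hz1 := (hz (n + 1) (by omega)).2 rfl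
  have hform : P = X + C (P.coeff 0) := by
    have := hP.eq_X_add_C hdeg1
    exact this
  have hc0 : (P.coeff 0).natDegree ≤ 1 := by
    have := hPw.natDegree_coeff_le 0 (Nat.zero_le _)
    rwa [hdeg1] at this
  rw [hform] at hw hz1
  simp only [Polynomial.map_add, map_X, map_C, coe_evalRingHom, eval_add, eval_X, eval_C] at hw hz1
  obtain ⟨α, β, hαβ⟩ := exists_eq_X_add_C_of_natDegree_le_one hc0
  rw [hαβ] at hw hz1
  simp only [eval_add, eval_mul, eval_X, eval_C, Nat.cast_add, Nat.cast_one, mul_zero, mul_one,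
    zero_add] at hw hz1
  have hα : α = 1 := by linear_combination hw - hz1
  have h2 := congrArg (fun H => (H.map (evalRingHom (-1))).eval ((n + 2 : ℕ) : F)) h
  simp only [Polynomial.map_mul, eval_mul, map_evalRingHom_separated, eval_sub, eval_C] at h2
  rw [hform, hαβ] at h2
  simp only [Polynomial.map_add, map_X, map_C, coe_evalRingHom, eval_add, eval_X, eval_C,
    eval_mul] at h2
  have hz2 : ((n + 2 : ℕ) : F) + (α * -1 + β) = 0 := by
    rw [hα]; push_cast; linear_combination hz1
  rw [hz2, zero_mul, descPochhammer_eval_eq_descFactorial, Nat.descFactorial_self] at h2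
  have h3 : (descPochhammer F (n + 2)).eval (-1) = -((n + 2).factorial : F) := by
    rw [descPochhammer_eval_eq_prod_range, ← Finset.prod_range_add_one_eq_factorial]
    have : ∀ j ∈ Finset.range (n + 2), (-1 - (j : F)) = (-1) * ((j + 1 : ℕ) : F) := fun j _ => by
      push_cast; ring
    rw [Finset.prod_congr rfl this, Finset.prod_mul_distrib, Finset.prod_const, Finset.card_range,
      (show Odd (n + 2) by exact hn.add_even even_two).neg_one_pow, Nat.cast_prod, neg_one_mul]
  rw [h3] at h2
  have h4 : ((2 * (n + 2).factorial : ℕ) : F) = 0 := by push_cast; linear_combination -h2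
  rw [CharP.cast_eq_zero_iff F p] at h4
  have hpr : p.Prime := Fact.out
  rcases hpr.dvd_mul.1 h4 with h5 | h5
  · have := Nat.le_of_dvd two_pos h5
    nlinarith
  · have := (hpr.dvd_factorial).1 h5
    nlinarith

/-- The curve `f(x) = f(y)` with its diagonal removed is irreducible, for `f` a falling factorial
of odd length. -/
theorem irreducible_of_mul_eq_separated [Fact p.Prime] (hp : 4 * (n + 2) ^ 2 < p) (hn : Odd n)
    {G : F[X][X]}
    (hG : (X - C X) * G = separated (descPochhammer F (n + 2)) (descPochhammer F (n + 2))) :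
    Irreducible G := by
  have hkp : n + 2 ≤ p := by nlinarith
  have hf : (descPochhammer F (n + 2)).Monic := monic_descPochhammer F _
  have hm : (separated (descPochhammer F (n + 2)) (descPochhammer F (n + 2))).Monic :=
    monic_separated hf (by rw [descPochhammer_natDegree]; omega)
  have hX : (X - C X : F[X][X]).Monic := monic_X_sub_C X
  have hGm : G.Monic := hX.of_mul_monic_left (by rwa [hG])
  have hdeg : 1 + G.natDegree = n + 2 := by
    rw [← natDegree_descPochhammer_separated (F := F) (k := n + 2), ← hG, hX.natDegree_mul hGm, natDegree_X_sub_C]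
  rw [hGm.irreducible_iff_natDegree]
  refine ⟨fun h => by rw [h, natDegree_one] at hdeg; omega, fun P Q hP hQ hPQ => ?_⟩
  by_contra! hpos
  have hdisj : ∀ {A B : F[X]} {y : F}, A * B ∣ descPochhammer F (n + 2) → A.eval y = 0 →
      B.eval y = 0 → False := fun {A B y} hAB hA hB =>
    not_isUnit_X_sub_C y (squarefree_descPochhammer hkp _
      ((mul_dvd_mul (dvd_iff_isRoot.2 hA) (dvd_iff_isRoot.2 hB)).trans hAB))
  have aux : ∀ {P Q : F[X][X]}, P.Monic → Q.Monic → P * Q = G → P.natDegree ≠ 0 →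
      P * (Q * (X - C X)) = separated (descPochhammer F (n + 2)) (descPochhammer F (n + 2)) ∧
      P.map (evalRingHom 0) * (Q.map (evalRingHom 0) * X) = descPochhammer F (n + 2) ∧
      ∃ j, 0 < j ∧ j < n + 2 ∧ (P.map (evalRingHom 0)).eval (j : F) = 0 := by
    intro P Q hP hQ hPQ hP0
    have h1 : P * (Q * (X - C X)) =
        separated (descPochhammer F (n + 2)) (descPochhammer F (n + 2)) := by
      rw [← hG, ← hPQ]; ring
    have h2 : P.map (evalRingHom 0) * (Q.map (evalRingHom 0) * X) = descPochhammer F (n + 2) := by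
      have := congrArg (Polynomial.map (evalRingHom (0 : F))) h1
      rw [map_evalRingHom_separated, ← Nat.cast_zero, descPochhammer_eval_natCast_of_lt (by omega),
        C_0, sub_zero] at this
      rw [← this]
      simp
    refine ⟨h1, h2, ?_⟩
    obtain ⟨s, hs, hsa, -⟩ := roots_map_evalRingHom_eq (i := 0) hkp
      (isWeightedMonic_of_mul_eq_separated (by omega) hP (hQ.mul hX) h1) (Dvd.intro _ h1) (by omega)
    obtain ⟨y, hy⟩ : s.Nonempty := Finset.card_pos.1 (by omega)
    rw [← Finset.mem_val, ← hs, mem_roots (hP.map _).ne_zero, IsRoot.def, Nat.cast_zero] at hy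
    obtain ⟨j, hj, rfl⟩ := isRoot_descPochhammer
      (eval_eq_zero_of_dvd_of_eval_eq_zero (Dvd.intro _ h2) hy)
    refine ⟨j, Nat.pos_of_ne_zero fun h0 => ?_, hj, hy⟩
    rw [h0, Nat.cast_zero] at hy
    refine hdisj (y := 0) h2.dvd hy ?_
    simp
  have main : ∀ {P Q : F[X][X]}, P.Monic → Q.Monic → P * Q = G → P.natDegree ≠ 0 →
      incidence P 0 1 = 0 → False := by
    intro P Q hP hQ hPQ hP0 h01
    obtain ⟨h1, h2, j, hj0, hj, hjP⟩ := aux hP hQ hPQ hP0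
    have hne : ∀ i, i < n + 2 → (P.map (evalRingHom 0)).eval (i : F) = 0 → i = n + 1 := by
      intro i hi hiP
      have hi0 : i ≠ 0 := fun h0 => by
        rw [h0, Nat.cast_zero] at hiP
        refine hdisj (y := 0) h2.dvd hiP ?_
        simp
      by_contra hin
      have h3 := incidence_eq_one hp hP (hQ.mul hX) h1 (l := i - 1) (by omega)
      rw [Nat.sub_add_cancel (by omega), h01] at h3
      have h4 : incidence P 0 i = 1 := by
        rw [incidence_eq_one_iff, Nat.cast_zero]; exact hiP
      rw [h3] at h4
      exact zero_ne_one h4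
    exact false_of_eval_eq_zero_iff hp hn hP (hQ.mul hX) h1 fun i hi =>
      ⟨hne i hi, fun h => by rw [h, ← hne j hj hjP]; exact hjP⟩
  rcases incidence_eq_zero_or_one P 0 1 with h0 | h0
  · exact main hP hQ hPQ hpos.1 h0
  · refine main hQ hP (by rw [mul_comm, hPQ]) hpos.2 ?_
    refine (incidence_eq_zero_or_one Q 0 1).resolve_right fun h1 => ?_
    rw [incidence_eq_one_iff, Nat.cast_zero] at h0 h1
    have h2 := (aux hP hQ hPQ hpos.1).2.1
    rw [← mul_assoc] at h2
    exact hdisj (Dvd.intro _ h2) h0 h1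

end DiagonalIrreducible

section ShearedCurve
open Polynomial

/-- The curve `f(x) = g(y)` in the coordinates `t = a x + v⁻¹ y` (inner variable) and `x` (outer
variable). -/
noncomputable def sheared {R : Type*} [CommRing R] (f g : R[X]) (a v : R) : R[X][X] :=
  f.map C - g.eval₂ (C.comp C) (C (C v) * (C X - C (C a) * X))

section CommRing
variable {R : Type*} [CommRing R] (f g : R[X]) (a v : R)

lemma sheared_map {S : Type*} [CommRing S] (i : R →+* S) :
    (sheared f g a v).map (mapRingHom i) = sheared (f.map i) (g.map i) (i a) (i v) := by
  rw [sheared, sheared, Polynomial.map_sub, Polynomial.map_map, Polynomial.map_map,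
    ← coe_mapRingHom (mapRingHom i), hom_eval₂, eval₂_map]
  congr 1
  · congr 1; ext <;> simp
  · congr 1
    · ext <;> simp
    · simp

lemma eval_map_sheared (t u : R) : ((sheared f g a v).map (evalRingHom t)).eval u =
    f.eval u - g.eval (v * (t - a * u)) := by
  have h : (evalRingHom t).comp (C : R →+* R[X]) = RingHom.id R := by ext; simp
  rw [sheared, Polynomial.map_sub, eval_sub, Polynomial.map_map, h, Polynomial.map_id,
    ← coe_mapRingHom, ← coe_evalRingHom u, hom_eval₂, hom_eval₂]
  congr 1
  have h2 : (evalRingHom u).comp ((mapRingHom (evalRingHom t)).comp ((C : R[X] →+* R[X][X]).comp C)) =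
      RingHom.id R := by ext; simp
  rw [h2]
  simp [eval₂_id]

/-- Substitution of two bivariate polynomials in a bivariate polynomial. -/
noncomputable def bisubst (r s : R[X][X]) : R[X][X] →+* R[X][X] :=
  eval₂RingHom (eval₂RingHom (C.comp C) r) s

lemma bisubst_C_C (r s : R[X][X]) (c : R) : bisubst r s (C (C c)) = C (C c) := by simp [bisubst]
lemma bisubst_C_X (r s : R[X][X]) : bisubst r s (C X) = r := by simp [bisubst]
lemma bisubst_X (r s : R[X][X]) : bisubst r s X = s := by simp [bisubst]

lemma bisubst_separated (r s : R[X][X]) : bisubst r s (separated g f) =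
    g.eval₂ (C.comp C) s - f.eval₂ (C.comp C) r := by
  rw [separated, map_sub, bisubst, coe_eval₂RingHom, eval₂_map, eval₂_C]
  congr 1
  congr 1
  ext; simp

lemma bisubst_comp_eq_id {r s r' s' : R[X][X]} (h1 : bisubst r s r' = C X)
    (h2 : bisubst r s s' = X) : (bisubst r s).comp (bisubst r' s') = RingHom.id _ := by
  refine ringHom_ext' (ringHom_ext' (RingHom.ext fun c => ?_) ?_) ?_
  · simp [bisubst_C_C]
  · simp [bisubst_C_X, h1]
  · simp [bisubst_X, h2]

variable {f g}

lemma isWeightedMonic_sheared [Nontrivial R] (hf : f.Monic) (hfg : g.natDegree < f.natDegree) :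
    IsWeightedMonic (sheared f g a v) 1 f.natDegree := by
  set q := g.eval₂ (C.comp C) (C (C v) * (C X - C (C a) * X) : R[X][X]) with hq
  have hw : (weightHom R 1 1 q).natDegree ≤ g.natDegree := by
    rw [hq, hom_eval₂]
    have hd : (weightHom R 1 1 (C (C v) * (C X - C (C a) * X))).natDegree ≤ 1 := by
      have : weightHom R 1 1 (C (C v) * (C X - C (C a) * X)) =
          C (C v) * (X - C (C a) * (C X * X)) := by simp [weightHom]
      rw [this]
      compute_degree
    rw [eval₂_eq_sum_range]
    refine natDegree_sum_le_of_forall_le _ _ fun i hi => ?_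
    rw [Finset.mem_range] at hi
    refine natDegree_mul_le.trans ?_
    have h1 := natDegree_pow_le_of_le i hd
    have h2 : ((weightHom R 1 1).comp (C.comp C) (g.coeff i)).natDegree = 0 := by
      have : (weightHom R 1 1).comp (C.comp C) (g.coeff i) = C (C (g.coeff i)) := by
        simp [weightHom]
      rw [this, natDegree_C]
    omega
  have hq0 : ∀ m j, (q.coeff m).coeff j ≠ 0 → m + j ≤ g.natDegree := fun m j hmj => by
    refine le_trans (le_natDegree_of_ne_zero fun h0 => hmj ?_) hw
    have := coeff_coeff_weightHom (k := 1) one_pos q m j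
    rw [one_mul, one_mul] at this
    rw [← this, h0, coeff_zero]
  have hle : ∀ m j, ((sheared f g a v).coeff m).coeff j ≠ 0 → m + j ≤ f.natDegree := by
    intro m j hmj
    by_contra! hlt
    apply hmj
    rw [sheared, coeff_sub, coeff_sub, ← hq, coeff_map, coeff_C]
    have h1 : (q.coeff m).coeff j = 0 := by
      by_contra h0
      have := hq0 m j h0
      omega
    rw [h1, sub_zero]
    split_ifs with hj
    · exact coeff_eq_zero_of_natDegree_lt (by omega)
    · rfl
  have hnd : (sheared f g a v).natDegree ≤ f.natDegree := by
    rw [natDegree_le_iff_coeff_eq_zero]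
    intro m hm
    ext j
    by_contra h0
    have := hle m j h0
    omega
  have htop : (sheared f g a v).coeff f.natDegree = 1 := by
    have h1 : q.coeff f.natDegree = 0 := by
      ext j
      by_contra h0
      have := hq0 _ j h0
      omega
    rw [sheared, coeff_sub, ← hq, h1, sub_zero, coeff_map, hf.coeff_natDegree, C_1]
  have hnd' := le_antisymm hnd (le_natDegree_of_ne_zero (by rw [htop]; exact one_ne_zero))
  have := isWeightedMonic_of_add_le (monic_of_natDegree_le_of_coeff_eq_one _ hnd htop)
    (fun m j hmj => by rw [hnd']; exact hle m j hmj)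
  rwa [hnd'] at this

end CommRing

variable {K : Type*} [Field K]

lemma irreducible_sheared {f g : K[X]} (a : K) {v : K} (hv : v ≠ 0)
    (h : Irreducible (separated g f)) : Irreducible (sheared f g a v) := by
  set r : K[X][X] := X
  set s : K[X][X] := C (C v) * (C X - C (C a) * X)
  set r' : K[X][X] := C (C a) * C X + C (C v⁻¹) * X
  set s' : K[X][X] := C X
  have hv1 : (C (C v) * C (C v⁻¹) : K[X][X]) = 1 := by
    rw [← C_mul, ← C_mul, mul_inv_cancel₀ hv, C_1, C_1]
  let e : K[X][X] ≃+* K[X][X] := RingEquiv.ofRingHom (bisubst r s) (bisubst r' s')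
    (bisubst_comp_eq_id (by
      simp only [r', map_add, map_mul, bisubst_C_C, bisubst_C_X, bisubst_X, r, s]
      linear_combination (C X - C (C a) * X) * hv1) (by
      simp only [s', r, bisubst_C_X]))
    (bisubst_comp_eq_id (by simp only [s', r, bisubst_X]) (by
      simp only [s, s', r', map_sub, map_mul, bisubst_C_C, bisubst_C_X, bisubst_X]
      linear_combination X * hv1))
  have h1 : e (separated g f) = -sheared f g a v := by
    change bisubst r s (separated g f) = _
    rw [bisubst_separated, sheared, neg_sub]
    congr 1
  rw [← ((Associated.refl (sheared f g a v)).neg_left).irreducible_iff, ← h1]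
  exact (MulEquiv.irreducible_iff e).2 h

end ShearedCurve

section PochhammerSums
open Polynomial

lemma separated_map {R S : Type*} [CommRing R] [CommRing S] (i : R →+* S) (f g : R[X]) :
    (separated f g).map (mapRingHom i) = separated (f.map i) (g.map i) := by
  rw [separated, separated, Polynomial.map_sub, Polynomial.map_map, Polynomial.map_map, map_C,
    coe_mapRingHom]
  congr 2
  ext <;> simp

lemma irreducible_separated_descPochhammer {K : Type*} [Field K] {k l : ℕ} (hl : 0 < l)
    (hkl : k.Coprime l) : Irreducible (separated (descPochhammer K l) (descPochhammer K k)) := by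
  refine irreducible_separated (monic_descPochhammer K l) ?_ ?_
  · rwa [descPochhammer_natDegree]
  · rw [descPochhammer_natDegree, descPochhammer_natDegree]; exact hkl.symm

lemma isWeightedMonic_separated {R : Type*} [CommRing R] [IsDomain R] {f g : R[X]} (hf : f.Monic)
    (hf0 : 0 < f.natDegree) {c : ℕ} (hc : g.natDegree ≤ c * f.natDegree) :
    IsWeightedMonic (separated f g) c f.natDegree := by
  refine ⟨monic_separated hf hf0, natDegree_separated hf, fun i _ => ?_⟩
  rw [separated, coeff_sub, coeff_map, coeff_C]
  split_ifs with hi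
  · rw [hi, Nat.sub_zero, natDegree_sub, natDegree_sub_C]; exact hc
  · rw [sub_zero, natDegree_C]; exact Nat.zero_le _

variable {p : ℕ} [Fact p.Prime]

lemma weil_constant_le {c d X : ℕ} (hcd : c * d ≤ 2 * X) (hd : d ≤ X) (hX : 3 ≤ X)
    (hXp : X ^ 2 ≤ p) : (d * (2 * (c * d) + 3) + 1 : ℕ) * √(p : ℝ) +
      (d * (c * (d - 1)) * (2 * d) : ℕ) ≤ 12 * X ^ 2 * √(p : ℝ) := by
  have hs : (X : ℝ) ≤ √p := Real.le_sqrt_of_sq_le (by exact_mod_cast hXp)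
  have h1 : d * (2 * (c * d) + 3) + 1 ≤ 6 * X ^ 2 := by nlinarith
  have h2 : d * (c * (d - 1)) * (2 * d) ≤ 4 * X ^ 3 := by
    have h3 : d * (c * (d - 1)) ≤ X * (2 * X) := by
      calc d * (c * (d - 1)) = (d - 1) * (c * d) := by ring
        _ ≤ X * (2 * X) := Nat.mul_le_mul (by omega) hcd
    calc d * (c * (d - 1)) * (2 * d) ≤ X * (2 * X) * (2 * X) := Nat.mul_le_mul h3 (by omega)
      _ = 4 * X ^ 3 := by ring
  have h1' : ((d * (2 * (c * d) + 3) + 1 : ℕ) : ℝ) ≤ 6 * X ^ 2 := by exact_mod_cast h1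
  have h2' : ((d * (c * (d - 1)) * (2 * d) : ℕ) : ℝ) ≤ 4 * X ^ 3 := by exact_mod_cast h2
  have h4 : (X : ℝ) ^ 3 ≤ X ^ 2 * √p := by
    rw [pow_succ]; exact mul_le_mul_of_nonneg_left hs (by positivity)
  have h5 := mul_le_mul_of_nonneg_right h1' (Real.sqrt_nonneg p)
  have h6 : (0 : ℝ) ≤ X ^ 2 * √p := by positivity
  linarith

lemma stdAddChar_ne_zero : (ZMod.stdAddChar : AddChar (ZMod p) ℂ) ≠ 0 := by
  have h := ZMod.isPrimitive_stdAddChar p (one_ne_zero)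
  rw [AddChar.mulShift_one] at h
  exact h

lemma mulShift_stdAddChar_eq_zero_iff {h : ZMod p} :
    AddChar.mulShift (ZMod.stdAddChar : AddChar (ZMod p) ℂ) h = 0 ↔ h = 0 := by
  constructor
  · intro h0
    by_contra hne
    exact ZMod.isPrimitive_stdAddChar p hne h0
  · rintro rfl
    exact AddChar.mulShift_zero _

variable {k l X : ℕ}

lemma norm_sum_pochhammer_curve_le (hl : 0 < l) (hlk : l < k) (hkl : k.Coprime l) (hkX : k ≤ X)
    (hX : 3 ≤ X) (hXp : X ^ 2 ≤ p) (a b : ZMod p) (hb : b ≠ 0) :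
    ‖∑ x : ZMod p × ZMod p with
        (descPochhammer (ZMod p) k).eval x.1 = (descPochhammer (ZMod p) l).eval x.2,
        ZMod.stdAddChar (a * x.1 + b * x.2)‖ ≤ 12 * X ^ 2 * √(p : ℝ) := by
  set f := descPochhammer (ZMod p) k
  set g := descPochhammer (ZMod p) l
  have hfk : f.natDegree = k := descPochhammer_natDegree (ZMod p) k
  have hgl : g.natDegree = l := descPochhammer_natDegree (ZMod p) l
  have hH := isWeightedMonic_sheared (f := f) (g := g) a b⁻¹ (monic_descPochhammer _ k)
    (by rw [hfk, hgl]; exact hlk)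
  rw [hfk] at hH
  have hirr : Irreducible ((sheared f g a b⁻¹).map
      (mapRingHom (algebraMap (ZMod p) (AlgebraicClosure (ZMod p))))) := by
    rw [sheared_map]
    refine irreducible_sheared _ ?_ ?_
    · rw [map_inv₀]
      exact inv_ne_zero ((_root_.map_ne_zero _).2 hb)
    · rw [descPochhammer_map, descPochhammer_map]
      exact irreducible_separated_descPochhammer hl hkl
  have key := norm_sum_curve_sub_le hH (hl.trans hlk) (by nlinarith) hirr ZMod.stdAddChar
  rw [if_neg stdAddChar_ne_zero, sub_zero] at key
  refine le_trans (le_of_eq ?_) (key.trans (weil_constant_le (by omega) hkX hX hXp))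
  congr 1
  refine Finset.sum_bij' (fun x _ => (a * x.1 + b * x.2, x.1))
    (fun x _ => (x.2, b⁻¹ * (x.1 - a * x.2))) ?_ ?_ ?_ ?_ ?_
  · intro x hx
    rw [Finset.mem_filter] at hx ⊢
    refine ⟨Finset.mem_univ _, ?_⟩
    rw [eval_map_sheared, sub_eq_zero, hx.2, add_sub_cancel_left, inv_mul_cancel_left₀ hb]
  · intro x hx
    rw [Finset.mem_filter, eval_map_sheared, sub_eq_zero] at hx
    rw [Finset.mem_filter]
    exact ⟨Finset.mem_univ _, hx.2⟩
  · intro x _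
    simp [inv_mul_cancel_left₀ hb]
  · intro x _
    simp [mul_inv_cancel_left₀ hb]
  · intro x _
    rfl

lemma norm_sum_pochhammer_curve_sub_le (hl : 0 < l) (hlk : l < k) (hkl : k.Coprime l) (hkX : k ≤ X)
    (hX : 3 ≤ X) (hXp : X ^ 2 ≤ p) (a : ZMod p) :
    ‖∑ x : ZMod p × ZMod p with
        (descPochhammer (ZMod p) k).eval x.1 = (descPochhammer (ZMod p) l).eval x.2,
        ZMod.stdAddChar (a * x.1) - (if a = 0 then (p : ℂ) else 0)‖ ≤ 12 * X ^ 2 * √(p : ℝ) := by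
  set f := descPochhammer (ZMod p) k
  set g := descPochhammer (ZMod p) l
  have hfk : f.natDegree = k := descPochhammer_natDegree (ZMod p) k
  have hgl : g.natDegree = l := descPochhammer_natDegree (ZMod p) l
  have hdiv := Nat.div_add_mod k l
  have hmod := Nat.mod_lt k hl
  have hH := isWeightedMonic_separated (f := g) (g := f) (monic_descPochhammer _ l)
    (by rw [hgl]; exact hl) (c := k / l + 1) (by rw [hfk, hgl]; nlinarith)
  rw [hgl] at hH
  have hirr : Irreducible ((separated g f).map
      (mapRingHom (algebraMap (ZMod p) (AlgebraicClosure (ZMod p))))) := by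
    rw [separated_map, descPochhammer_map, descPochhammer_map]
    exact irreducible_separated_descPochhammer hl hkl
  have key := norm_sum_curve_sub_le hH hl (by nlinarith) hirr (AddChar.mulShift ZMod.stdAddChar a)
  simp only [mulShift_stdAddChar_eq_zero_iff, map_evalRingHom_separated, eval_sub, eval_C,
    AddChar.mulShift_apply, sub_eq_zero] at key
  have hc : (k / l + 1) * l ≤ 2 * X := by rw [add_mul, one_mul, mul_comm (k / l) l]; omega
  refine le_trans (le_of_eq ?_) (key.trans (weil_constant_le hc (by omega) hX hXp))
  congr 3
  exact Finset.filter_congr fun x _ => eq_comm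

/-- The exponential sums along `f(x) = g(y)` for falling factorials of coprime lengths. -/
theorem norm_sum_pochhammer_pair_sub_le (hl : 0 < l) (hk : 0 < k) (hne : k ≠ l) (hkl : k.Coprime l)
    (hkX : k ≤ X) (hlX : l ≤ X) (hX : 3 ≤ X) (hXp : X ^ 2 ≤ p) (a b : ZMod p) :
    ‖∑ x : ZMod p × ZMod p with
        (descPochhammer (ZMod p) k).eval x.1 = (descPochhammer (ZMod p) l).eval x.2,
        ZMod.stdAddChar (a * x.1 + b * x.2) - (if a = 0 ∧ b = 0 then (p : ℂ) else 0)‖ ≤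
      12 * X ^ 2 * √(p : ℝ) := by
  have main : ∀ {k l : ℕ}, 0 < l → l < k → k.Coprime l → k ≤ X → ∀ a b : ZMod p,
    ‖∑ x : ZMod p × ZMod p with
        (descPochhammer (ZMod p) k).eval x.1 = (descPochhammer (ZMod p) l).eval x.2,
        ZMod.stdAddChar (a * x.1 + b * x.2) - (if a = 0 ∧ b = 0 then (p : ℂ) else 0)‖ ≤
      12 * X ^ 2 * √(p : ℝ) := by
    intro k l hl hlk hkl hkX a b
    by_cases hb : b = 0
    · subst hb
      have := norm_sum_pochhammer_curve_sub_le hl hlk hkl hkX hX hXp a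
      simpa using this
    · rw [if_neg fun h => hb h.2, sub_zero]
      exact norm_sum_pochhammer_curve_le hl hlk hkl hkX hX hXp a b hb
  obtain h | h := lt_or_gt_of_ne hne
  · refine le_trans (le_of_eq ?_) (main hk h hkl.symm hlX b a)
    congr 2
    · refine Finset.sum_equiv (Equiv.prodComm _ _) (fun x => ?_) fun x _ => ?_
      · simp only [Finset.mem_filter, Finset.mem_univ, true_and, Equiv.prodComm_apply, Prod.fst_swap,
          Prod.snd_swap]
        exact eq_comm
      · simp [add_comm]
    · simp only [and_comm]
  · exact main hl h hkl hkX a b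

/-- The exponential sums along `f(x) = f(y)`, `x ≠ y`, for a falling factorial of odd length. -/
theorem exists_norm_sum_pochhammer_diag_sub_le (hk : Odd k) (hk3 : 3 ≤ k) (hkX : k ≤ X)
    (hXp : 5 * X ^ 2 ≤ p) : ∃ V : Finset (ZMod p × ZMod p),
      (∀ x y : ZMod p, (descPochhammer (ZMod p) k).eval x = (descPochhammer (ZMod p) k).eval y →
        x = y ∨ (x, y) ∈ V) ∧
      ∀ a : ZMod p, ‖∑ x ∈ V, ZMod.stdAddChar (a * x.1) - (if a = 0 then (p : ℂ) else 0)‖ ≤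
        12 * X ^ 2 * √(p : ℝ) := by
  obtain ⟨n, rfl⟩ : ∃ n, k = n + 2 := ⟨k - 2, by omega⟩
  have hn : Odd n := by
    rw [Nat.odd_add] at hk; exact hk.2 even_two
  set f := descPochhammer (ZMod p) (n + 2) with hf
  have hfk : f.natDegree = n + 2 := descPochhammer_natDegree (ZMod p) (n + 2)
  have hfm : f.Monic := monic_descPochhammer _ _
  obtain ⟨G, hG⟩ : (Polynomial.X - C Polynomial.X : (ZMod p)[X][X]) ∣ separated f f := by
    rw [dvd_iff_isRoot, IsRoot.def, separated, eval_sub, eval_C, eval_map, eval₂_C_X, sub_self]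
  have hm : (separated f f).Monic := monic_separated hfm (by rw [hfk]; omega)
  have hX : (Polynomial.X - C Polynomial.X : (ZMod p)[X][X]).Monic := monic_X_sub_C _
  have hGm : G.Monic := hX.of_mul_monic_left (by rwa [← hG])
  have hdeg : 1 + G.natDegree = n + 2 := by
    rw [← natDegree_X_sub_C (Polynomial.X : (ZMod p)[X]), ← hX.natDegree_mul hGm, ← hG,
      natDegree_descPochhammer_separated]
  have hw := isWeightedMonic_of_mul_eq_separated (k := n + 2) (by omega) hGm hX
    (by rw [mul_comm]; exact hG.symm)
  have hGd : G.natDegree = n + 1 := by omega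
  rw [hGd] at hw
  have hp : 4 * (n + 2) ^ 2 < p := by nlinarith
  have hirr : Irreducible (G.map
      (mapRingHom (algebraMap (ZMod p) (AlgebraicClosure (ZMod p))))) := by
    have : CharP (AlgebraicClosure (ZMod p)) p :=
      charP_of_injective_algebraMap (algebraMap (ZMod p) (AlgebraicClosure (ZMod p))).injective p
    refine irreducible_of_mul_eq_separated (p := p) hp hn ?_
    have := congrArg (Polynomial.map
      (mapRingHom (algebraMap (ZMod p) (AlgebraicClosure (ZMod p))))) hG
    rw [separated_map, descPochhammer_map, Polynomial.map_mul] at this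
    rw [this]
    simp
  refine ⟨Finset.univ.filter fun x => (G.map (evalRingHom x.1)).eval x.2 = 0, fun x y hxy => ?_,
    fun a => ?_⟩
  · have := congrArg (fun H => (H.map (evalRingHom x)).eval y) hG
    simp only [map_evalRingHom_separated, eval_sub, eval_C, Polynomial.map_mul, eval_mul,
      Polynomial.map_sub, map_X, map_C, coe_evalRingHom, eval_X] at this
    rw [hxy, sub_self, eq_comm, mul_eq_zero] at this
    rcases this with h | h
    · exact Or.inl (sub_eq_zero.1 h).symm
    · exact Or.inr (Finset.mem_filter.2 ⟨Finset.mem_univ _, h⟩)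
  · have key := norm_sum_curve_sub_le hw (by omega) (by nlinarith) hirr
      (AddChar.mulShift ZMod.stdAddChar a)
    simp only [mulShift_stdAddChar_eq_zero_iff, AddChar.mulShift_apply] at key
    exact key.trans (weil_constant_le (by omega) (by omega) (by omega) (by omega))

end PochhammerSums

section IncompleteSums
open Finset

variable {p : ℕ} [Fact p.Prime]

lemma norm_stdAddChar_sub_one (j : ℕ) :
    ‖(ZMod.stdAddChar (j : ZMod p) : ℂ) - 1‖ = |2 * Real.sin (Real.pi * j / p)| := by
  have h := ZMod.stdAddChar_coe (N := p) (j : ℤ)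
  rw [Int.cast_natCast] at h
  have h2 : (2 * Real.pi * Complex.I * ((j : ℤ) : ℂ) / (p : ℂ)) =
      Complex.I * ((2 * Real.pi * j / p : ℝ) : ℂ) := by
    push_cast; ring
  rw [h, h2, Complex.norm_exp_I_mul_ofReal_sub_one, Real.norm_eq_abs]
  congr 3
  ring

lemma two_mul_div_le_sin_pi_mul_div {j : ℕ} (hj : 2 * j ≤ p) :
    2 * j / p ≤ Real.sin (Real.pi * j / p) := by
  have hp : (0 : ℝ) < p := Nat.cast_pos.2 (Fact.out : p.Prime).pos
  have h1 : Real.pi * j / p ≤ Real.pi / 2 := by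
    rw [div_le_div_iff₀ hp two_pos]
    have : (2 * j : ℝ) ≤ p := by exact_mod_cast hj
    nlinarith [Real.pi_pos]
  refine le_trans (le_of_eq ?_) (Real.mul_le_sin (by positivity) h1)
  field_simp

lemma inv_norm_stdAddChar_sub_one_le {j : ℕ} (hj0 : 0 < j) (hjp : j < p) :
    2 / ‖(ZMod.stdAddChar (j : ZMod p) : ℂ) - 1‖ ≤
      p / 2 * ((j : ℝ)⁻¹ + ((p - j : ℕ) : ℝ)⁻¹) := by
  have hp : (0 : ℝ) < p := Nat.cast_pos.2 (Fact.out : p.Prime).pos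
  have hj : (0 : ℝ) < j := Nat.cast_pos.2 hj0
  have hpj : (0 : ℝ) < (p - j : ℕ) := Nat.cast_pos.2 (by omega)
  have key : ∀ i : ℕ, 0 < i → 2 * i ≤ p →
      2 / |2 * Real.sin (Real.pi * i / p)| ≤ p / 2 * (i : ℝ)⁻¹ := by
    intro i hi hip
    have hi' : (0 : ℝ) < i := Nat.cast_pos.2 hi
    have h := two_mul_div_le_sin_pi_mul_div hip
    have h0 : (0 : ℝ) < 2 * i / p := by positivity
    rw [abs_of_pos (by linarith)]
    calc 2 / (2 * Real.sin (Real.pi * i / p)) ≤ 2 / (2 * (2 * i / p)) := by gcongr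
      _ = p / 2 * (i : ℝ)⁻¹ := by field_simp
  rw [norm_stdAddChar_sub_one, mul_add]
  by_cases h : 2 * j ≤ p
  · exact (key j hj0 h).trans (le_add_of_nonneg_right (by positivity))
  · have h2 := key (p - j) (by omega) (by omega)
    have h3 : Real.sin (Real.pi * (p - j : ℕ) / p) = Real.sin (Real.pi * j / p) := by
      rw [← Real.sin_pi_sub (Real.pi * j / p), Nat.cast_sub hjp.le]
      congr 1
      field_simp
    rw [h3] at h2
    exact h2.trans (le_add_of_nonneg_left (by positivity))

lemma norm_sum_Ico_stdAddChar_le {h : ZMod p} (hh : h ≠ 0) (a m : ℕ) :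
    ‖∑ n ∈ Ico a (a + m), (ZMod.stdAddChar (-(h * (n : ZMod p))) : ℂ)‖ ≤
      2 / ‖(ZMod.stdAddChar h : ℂ) - 1‖ := by
  have hn : ∀ x : ZMod p, ‖(ZMod.stdAddChar x : ℂ)‖ = 1 := fun x => AddChar.norm_apply _ _
  have hne : (ZMod.stdAddChar (-h) : ℂ) ≠ 1 := by
    rw [← (ZMod.stdAddChar (N := p)).map_zero_eq_one]
    exact fun h' => hh (neg_eq_zero.1 (ZMod.injective_stdAddChar h'))
  have h1 : ∀ n : ℕ, (ZMod.stdAddChar (-(h * (n : ZMod p))) : ℂ) = ZMod.stdAddChar (-h) ^ n := by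
    intro n
    rw [← AddChar.map_nsmul_eq_pow, nsmul_eq_mul]
    congr 1; ring
  have h2 : ‖(ZMod.stdAddChar (-h) : ℂ) - 1‖ = ‖(ZMod.stdAddChar h : ℂ) - 1‖ := by
    have : (ZMod.stdAddChar (-h) : ℂ) - 1 =
        -(ZMod.stdAddChar (-h) * ((ZMod.stdAddChar h : ℂ) - 1)) := by
      rw [mul_sub, ← AddChar.map_add_eq_mul, neg_add_cancel, AddChar.map_zero_eq_one]; ring
    rw [this, norm_neg, norm_mul, hn, one_mul]
  simp_rw [h1]
  rw [geom_sum_Ico hne (Nat.le_add_right a m), norm_div, h2]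
  gcongr
  refine (norm_sub_le _ _).trans (le_of_eq ?_)
  rw [norm_pow, norm_pow, hn, one_pow, one_pow]; norm_num

lemma sum_inv_range_le : ∑ j ∈ Ico 1 p, (j : ℝ)⁻¹ ≤ 1 + Real.log p := by
  have h := harmonic_le_one_add_log p
  refine le_trans ?_ h
  rw [harmonic_eq_sum_Icc, Rat.cast_sum]
  push_cast
  exact sum_le_sum_of_subset_of_nonneg (fun x hx => by simp at hx ⊢; omega)
    fun _ _ _ => by positivity

lemma sum_norm_sum_Ico_stdAddChar_le {a m : ℕ} (hm : m ≤ p) :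
    ∑ h : ZMod p, ‖∑ n ∈ Ico a (a + m), (ZMod.stdAddChar (-(h * (n : ZMod p))) : ℂ)‖ ≤
      p * (2 + Real.log p) := by
  have hp : 0 < p := (Fact.out : p.Prime).pos
  have h0 : ∑ h : ZMod p, ‖∑ n ∈ Ico a (a + m), (ZMod.stdAddChar (-(h * (n : ZMod p))) : ℂ)‖ =
      ∑ j ∈ range p, ‖∑ n ∈ Ico a (a + m), (ZMod.stdAddChar (-((j : ZMod p) * (n : ZMod p))) : ℂ)‖ := by
    refine sum_nbij' ZMod.val (fun j => (j : ZMod p)) ?_ ?_ ?_ ?_ ?_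
    · intro x _; exact mem_range.2 (ZMod.val_lt x)
    · intro j _; exact mem_univ _
    · intro x _; exact ZMod.natCast_zmod_val x
    · intro j hj; exact ZMod.val_cast_of_lt (mem_range.1 hj)
    · intro x _; rw [ZMod.natCast_zmod_val]
  rw [h0, range_eq_Ico, sum_eq_sum_Ico_succ_bot hp]
  have h1 : ‖∑ n ∈ Ico a (a + m), (ZMod.stdAddChar (-(((0 : ℕ) : ZMod p) * (n : ZMod p))) : ℂ)‖ ≤ p := by
    simp only [Nat.cast_zero, zero_mul, neg_zero, AddChar.map_zero_eq_one, sum_const, Nat.card_Ico,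
      add_tsub_cancel_left, nsmul_eq_mul, mul_one, Complex.norm_natCast]
    exact_mod_cast hm
  have h2 : ∑ j ∈ Ico (0 + 1) p,
      ‖∑ n ∈ Ico a (a + m), (ZMod.stdAddChar (-((j : ZMod p) * (n : ZMod p))) : ℂ)‖ ≤
      ∑ j ∈ Ico 1 p, p / 2 * ((j : ℝ)⁻¹ + ((p - j : ℕ) : ℝ)⁻¹) := by
    refine sum_le_sum fun j hj => ?_
    obtain ⟨hj1, hj2⟩ := mem_Ico.1 hj
    have hne : (j : ZMod p) ≠ 0 := fun h =>
      absurd (Nat.le_of_dvd (by omega) ((ZMod.natCast_eq_zero_iff j p).1 h)) (by omega)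
    exact (norm_sum_Ico_stdAddChar_le hne a m).trans
      (inv_norm_stdAddChar_sub_one_le (by omega) hj2)
  have h3 : ∑ j ∈ Ico 1 p, ((p - j : ℕ) : ℝ)⁻¹ = ∑ j ∈ Ico 1 p, (j : ℝ)⁻¹ := by
    refine sum_nbij' (fun j => p - j) (fun j => p - j) ?_ ?_ ?_ ?_ ?_
    all_goals intro j hj; simp at hj ⊢
    all_goals omega
  rw [← mul_sum, sum_add_distrib, h3] at h2
  have h4 := sum_inv_range_le (p := p)
  have hp' : (0 : ℝ) < p := Nat.cast_pos.2 hp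
  nlinarith

/-- Completion of sums over an interval. -/
theorem norm_sum_Ico_sub_le {w : ZMod p → ℂ} {M : ℂ} {B : ℝ}
    (hw : ∀ h : ZMod p, ‖∑ x, w x * ZMod.stdAddChar (h * x) - (if h = 0 then M else 0)‖ ≤ B)
    {a m : ℕ} (hm : m ≤ p) :
    ‖∑ n ∈ Ico a (a + m), w (n : ZMod p) - M * m / p‖ ≤ B * (2 + Real.log p) := by
  have hp : (0 : ℝ) < p := Nat.cast_pos.2 (Fact.out : p.Prime).pos
  have hpC : (p : ℂ) ≠ 0 := by exact_mod_cast hp.ne'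
  have hB : 0 ≤ B := (norm_nonneg _).trans (hw 0)
  have key : ∑ h : ZMod p, (∑ x, w x * ZMod.stdAddChar (h * x) - (if h = 0 then M else 0)) *
      ∑ n ∈ Ico a (a + m), (ZMod.stdAddChar (-(h * (n : ZMod p))) : ℂ) =
      p * (∑ n ∈ Ico a (a + m), w (n : ZMod p) - M * m / p) := by
    have h1 : ∀ n : ℕ, ∑ h : ZMod p, (∑ x, w x * ZMod.stdAddChar (h * x)) *
        (ZMod.stdAddChar (-(h * (n : ZMod p))) : ℂ) = p * w (n : ZMod p) := by
      intro n
      simp_rw [sum_mul]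
      rw [sum_comm]
      have : ∀ x : ZMod p, ∑ h : ZMod p, w x * ZMod.stdAddChar (h * x) *
          (ZMod.stdAddChar (-(h * (n : ZMod p))) : ℂ) = w x * (if x - (n : ZMod p) = 0 then (p : ℂ) else 0) := by
        intro x
        have h2 := AddChar.sum_mulShift (x - (n : ZMod p)) (ZMod.isPrimitive_stdAddChar p)
        rw [ZMod.card] at h2
        push_cast at h2
        rw [← h2, mul_sum]
        refine sum_congr rfl fun h _ => ?_
        rw [mul_assoc, ← AddChar.map_add_eq_mul]
        congr 2; ring
      simp_rw [this, sub_eq_zero]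
      simp [mul_comm]
    have h3 : ∑ h : ZMod p, (if h = 0 then M else 0) *
        ∑ n ∈ Ico a (a + m), (ZMod.stdAddChar (-(h * (n : ZMod p))) : ℂ) = M * m := by
      simp
    simp_rw [sub_mul]
    rw [sum_sub_distrib, h3]
    simp_rw [mul_sum]
    rw [sum_comm]
    simp_rw [h1]
    rw [← mul_sum]
    field_simp
  have h4 : (p : ℝ) * ‖∑ n ∈ Ico a (a + m), w (n : ZMod p) - M * m / p‖ ≤
      B * (p * (2 + Real.log p)) := by
    calc _ = ‖(p : ℂ) * (∑ n ∈ Ico a (a + m), w (n : ZMod p) - M * m / p)‖ := by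
          rw [norm_mul, Complex.norm_natCast]
      _ ≤ ∑ h : ZMod p, B * ‖∑ n ∈ Ico a (a + m), (ZMod.stdAddChar (-(h * (n : ZMod p))) : ℂ)‖ := by
          rw [← key]
          refine (norm_sum_le _ _).trans (sum_le_sum fun h _ => ?_)
          rw [norm_mul]
          exact mul_le_mul_of_nonneg_right (hw h) (norm_nonneg _)
      _ ≤ _ := by
          rw [← mul_sum]
          exact mul_le_mul_of_nonneg_left (sum_norm_sum_Ico_stdAddChar_le hm) hB
  refine le_of_mul_le_mul_left ?_ hp
  linarith

lemma norm_sum_Ico_sum_Ico_sub_le {w : ZMod p → ZMod p → ℂ} {M : ℂ} {B : ℝ}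
    (hw : ∀ a b : ZMod p, ‖∑ x, ∑ y, w x y * ZMod.stdAddChar (a * x + b * y) -
      (if a = 0 ∧ b = 0 then M else 0)‖ ≤ B) {a m : ℕ} (hm : m ≤ p) :
    ‖∑ i ∈ Ico a (a + m), ∑ j ∈ Ico a (a + m), w (i : ZMod p) (j : ZMod p) - M * m ^ 2 / p ^ 2‖ ≤
      B * (2 + Real.log p) ^ 2 := by
  have h1 : ∀ b : ZMod p, ‖∑ i ∈ Ico a (a + m), (∑ y, w (i : ZMod p) y * ZMod.stdAddChar (b * y)) -
      (if b = 0 then M else 0) * m / p‖ ≤ B * (2 + Real.log p) := by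
    intro b
    refine norm_sum_Ico_sub_le (w := fun x => ∑ y, w x y * ZMod.stdAddChar (b * y))
      (M := if b = 0 then M else 0) (fun h => ?_) hm
    refine le_trans (le_of_eq ?_) (hw h b)
    congr 2
    · refine sum_congr rfl fun x _ => ?_
      rw [sum_mul]
      refine sum_congr rfl fun y _ => ?_
      rw [AddChar.map_add_eq_mul]; ring
    · rw [ite_and]
  have h2 := norm_sum_Ico_sub_le (w := fun y => ∑ i ∈ Ico a (a + m), w (i : ZMod p) y)
    (M := M * m / p) (B := B * (2 + Real.log p)) (fun b => ?_) (a := a) hm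
  · rw [sum_comm]
    refine le_trans (le_of_eq ?_) (h2.trans (le_of_eq (by ring)))
    congr 2
    ring
  · refine le_trans (le_of_eq ?_) (h1 b)
    congr 2
    · simp_rw [sum_mul]
      exact sum_comm
    · split_ifs <;> simp

end IncompleteSums

section Counting
open Finset

lemma card_sq_le_card_mul_card_collisions {α β : Type*} [DecidableEq β] (f : α → β) (S : Finset α)
    (R : Finset β) (h : ∀ s ∈ S, f s ∈ R) :
    #S ^ 2 ≤ #R * #{x ∈ S ×ˢ S | f x.1 = f x.2} := by
  have h2 : #{x ∈ S ×ˢ S | f x.1 = f x.2} = ∑ z ∈ R, #{s ∈ S | f s = z} ^ 2 := by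
    rw [card_eq_sum_card_fiberwise (f := fun x => f x.1) (t := R)]
    · refine sum_congr rfl fun z _ => ?_
      rw [sq, ← card_product]
      congr 1
      ext x
      simp only [mem_filter, mem_product]
      constructor
      · rintro ⟨⟨⟨h1, h2⟩, h3⟩, h4⟩
        exact ⟨⟨h1, h4⟩, h2, h3 ▸ h4⟩
      · rintro ⟨⟨h1, h4⟩, h2, h3⟩
        exact ⟨⟨⟨h1, h2⟩, h4.trans h3.symm⟩, h4⟩
    · intro x hx
      exact h _ (mem_product.1 (mem_filter.1 hx).1).1
  rw [h2, card_eq_sum_card_fiberwise h]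
  exact sq_sum_le_card_mul_sum_sq

variable {p : ℕ} [Fact p.Prime] {k l X : ℕ}

lemma norm_sum_Ico_sum_Ico_indicator_sub_le {V : Finset (ZMod p × ZMod p)} {B : ℝ}
    (hV : ∀ a b : ZMod p, ‖∑ x ∈ V, ZMod.stdAddChar (a * x.1 + b * x.2) -
      (if a = 0 ∧ b = 0 then (p : ℂ) else 0)‖ ≤ B) {a m : ℕ} (hm : m ≤ p) :
    (#{x ∈ Ico a (a + m) ×ˢ Ico a (a + m) | ((x.1 : ZMod p), (x.2 : ZMod p)) ∈ V} : ℝ) ≤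
      m ^ 2 / p + B * (2 + Real.log p) ^ 2 := by
  have hpC : (p : ℂ) ≠ 0 := by exact_mod_cast (Fact.out : p.Prime).ne_zero
  have h := norm_sum_Ico_sum_Ico_sub_le (w := fun x y => if (x, y) ∈ V then (1 : ℂ) else 0)
    (M := (p : ℂ)) (B := B) (fun c d => ?_) (a := a) hm
  · have h1 : ∑ i ∈ Ico a (a + m), ∑ j ∈ Ico a (a + m),
        (if ((i : ZMod p), (j : ZMod p)) ∈ V then (1 : ℂ) else 0) - p * m ^ 2 / p ^ 2 =
        (((#{x ∈ Ico a (a + m) ×ˢ Ico a (a + m) | ((x.1 : ZMod p), (x.2 : ZMod p)) ∈ V} : ℝ) -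
          m ^ 2 / p : ℝ) : ℂ) := by
      rw [← sum_product', sum_boole]
      push_cast
      congr 1
      field_simp
    rw [h1, Complex.norm_real, Real.norm_eq_abs] at h
    linarith [le_abs_self ((#{x ∈ Ico a (a + m) ×ˢ Ico a (a + m) |
      ((x.1 : ZMod p), (x.2 : ZMod p)) ∈ V} : ℝ) - m ^ 2 / p)]
  · refine le_trans (le_of_eq ?_) (hV c d)
    congr 2
    rw [← sum_product']
    simp

lemma card_pochhammer_pair_le (hl : 0 < l) (hk : 0 < k) (hne : k ≠ l) (hkl : k.Coprime l)
    (hkX : k ≤ X) (hlX : l ≤ X) (hX : 3 ≤ X) (hXp : X ^ 2 ≤ p) {a m : ℕ} (hm : m ≤ p) :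
    (#{x ∈ Ico a (a + m) ×ˢ Ico a (a + m) | (descPochhammer (ZMod p) k).eval (x.1 : ZMod p) =
      (descPochhammer (ZMod p) l).eval (x.2 : ZMod p)} : ℝ) ≤
      m ^ 2 / p + 12 * X ^ 2 * √(p : ℝ) * (2 + Real.log p) ^ 2 := by
  have h := norm_sum_Ico_sum_Ico_indicator_sub_le
    (norm_sum_pochhammer_pair_sub_le (p := p) hl hk hne hkl hkX hlX hX hXp) (a := a) hm
  simpa only [mem_filter, mem_univ, true_and] using h

lemma card_pochhammer_diag_le (hk : Odd k) (hk3 : 3 ≤ k) (hkX : k ≤ X) (hXp : 5 * X ^ 2 ≤ p)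
    {a m : ℕ} (ham : a + m ≤ p) :
    (#{x ∈ Ico a (a + m) ×ˢ Ico a (a + m) | (descPochhammer (ZMod p) k).eval (x.1 : ZMod p) =
      (descPochhammer (ZMod p) k).eval (x.2 : ZMod p)} : ℝ) ≤
      2 * m + 12 * X ^ 2 * √(p : ℝ) * (2 + Real.log p) := by
  have hpC : (p : ℂ) ≠ 0 := by exact_mod_cast (Fact.out : p.Prime).ne_zero
  obtain ⟨V, hV, hVs⟩ := exists_norm_sum_pochhammer_diag_sub_le (p := p) hk hk3 hkX hXp
  set J := Ico a (a + m)
  have hinj : ∀ i ∈ J, ∀ j ∈ J, (i : ZMod p) = j → i = j := fun i hi j hj h => by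
    have hi' := (mem_Ico.1 hi).2
    have hj' := (mem_Ico.1 hj).2
    exact natCast_inj_of_lt (by omega) (by omega) h
  have h1 := norm_sum_Ico_sub_le (w := fun x => ∑ y, if (x, y) ∈ V then (1 : ℂ) else 0)
    (M := (p : ℂ)) (B := 12 * X ^ 2 * √(p : ℝ)) (fun c => ?_) (a := a) (m := m) (by omega)
  · have h2 : ∑ i ∈ J, ∑ y : ZMod p, (if ((i : ZMod p), y) ∈ V then (1 : ℂ) else 0) - p * m / p =
        (((#{x ∈ J ×ˢ (univ : Finset (ZMod p)) | ((x.1 : ZMod p), x.2) ∈ V} : ℝ) - m : ℝ) : ℂ) := by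
      rw [← sum_product', sum_boole]
      push_cast
      congr 1
      field_simp
    rw [h2, Complex.norm_real, Real.norm_eq_abs] at h1
    have h3 := (le_abs_self _).trans h1
    have h4 : #{x ∈ J ×ˢ J | (descPochhammer (ZMod p) k).eval (x.1 : ZMod p) =
        (descPochhammer (ZMod p) k).eval (x.2 : ZMod p)} ≤
        #J + #{x ∈ J ×ˢ (univ : Finset (ZMod p)) | ((x.1 : ZMod p), x.2) ∈ V} := by
      calc _ ≤ #({x ∈ J ×ˢ J | x.1 = x.2} ∪
            {x ∈ J ×ˢ J | ((x.1 : ZMod p), (x.2 : ZMod p)) ∈ V}) := by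
            refine card_le_card fun x hx => ?_
            obtain ⟨hxJ, hx⟩ := mem_filter.1 hx
            have hxJ' := mem_product.1 hxJ
            rw [mem_union, mem_filter, mem_filter]
            exact (hV _ _ hx).imp (fun h => ⟨hxJ, hinj _ hxJ'.1 _ hxJ'.2 h⟩) fun h => ⟨hxJ, h⟩
        _ ≤ _ := by
            refine (card_union_le _ _).trans (Nat.add_le_add ?_ ?_)
            · refine card_le_card_of_injOn Prod.fst (fun x hx => ?_) fun x hx y hy hxy => ?_
              · exact (mem_product.1 (mem_filter.1 hx).1).1
              · have hx' := (mem_filter.1 hx).2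
                have hy' := (mem_filter.1 hy).2
                exact Prod.ext hxy (hx'.symm.trans (hxy.trans hy'))
            · refine card_le_card_of_injOn (fun x => (x.1, (x.2 : ZMod p))) (fun x hx => ?_)
                fun x hx y hy hxy => ?_
              · obtain ⟨hxJ, hx⟩ := mem_filter.1 hx
                exact mem_filter.2 ⟨mem_product.2 ⟨(mem_product.1 hxJ).1, mem_univ _⟩, hx⟩
              · have hx' := mem_product.1 (mem_filter.1 hx).1
                have hy' := mem_product.1 (mem_filter.1 hy).1
                obtain ⟨h1, h2⟩ := Prod.mk.inj hxy
                exact Prod.ext h1 (hinj _ hx'.2 _ hy'.2 h2)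
    have h5 : (#J : ℝ) = m := by simp [J]
    have h6 : (#{x ∈ J ×ˢ J | (descPochhammer (ZMod p) k).eval (x.1 : ZMod p) =
        (descPochhammer (ZMod p) k).eval (x.2 : ZMod p)} : ℝ) ≤
        #J + #{x ∈ J ×ˢ (univ : Finset (ZMod p)) | ((x.1 : ZMod p), x.2) ∈ V} := by
      exact_mod_cast h4
    rw [h5] at h6
    linarith
  · refine le_trans (le_of_eq ?_) (hVs c)
    congr 2
    simp_rw [sum_mul]
    rw [← sum_product']
    simp

lemma eval_descPochhammer_mem {L N n : ℕ} (hLN : L + N < p) (hn : L + 1 + k ≤ n)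
    (hnN : n ≤ L + N) : (descPochhammer (ZMod p) k).eval (n : ZMod p) ∈
      (intervalFactorials p L N ×ˢ intervalFactorials p L N).image fun x => x.1 / x.2 := by
  have hmem : ∀ i, L + 1 ≤ i → i ≤ L + N → (i.factorial : ZMod p) ∈ intervalFactorials p L N :=
    fun i h1 h2 => mem_image.2 ⟨i, mem_Icc.2 ⟨h1, h2⟩, rfl⟩
  refine mem_image.2 ⟨(n.factorial, (n - k).factorial),
    mem_product.2 ⟨hmem n (by omega) hnN, hmem (n - k) (by omega) (by omega)⟩, ?_⟩
  have h0 : ((n - k).factorial : ZMod p) ≠ 0 := by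
    rw [Ne, ZMod.natCast_eq_zero_iff, (Fact.out : p.Prime).dvd_factorial]
    omega
  rw [descPochhammer_eval_eq_descFactorial, div_eq_iff h0,
    ← Nat.factorial_mul_descFactorial (show k ≤ n by omega)]
  push_cast
  ring

/-- The main inequality: `𝒦` is a set of odd primes up to `X`. -/
theorem card_sq_mul_sq_le {L N : ℕ} (hLN : L + N < p) (hXN : X ≤ N) (hX : 3 ≤ X)
    (hXp : 5 * X ^ 2 ≤ p) (𝒦 : Finset ℕ) (h𝒦 : ∀ k ∈ 𝒦, k.Prime ∧ 3 ≤ k ∧ k ≤ X) :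
    (#𝒦 * (N - X : ℕ) : ℝ) ^ 2 ≤ #(intervalFactorials p L N) ^ 2 *
      (#𝒦 ^ 2 * ((N - X : ℕ) ^ 2 / p + 2 * (12 * X ^ 2 * √(p : ℝ) * (2 + Real.log p) ^ 2)) +
        2 * #𝒦 * (N - X : ℕ)) := by
  set m := N - X with hm
  set a := L + 1 + X with ha
  have ham : a + m = L + N + 1 := by omega
  set J := Ico a (a + m) with hJ
  set P : ℝ := 12 * X ^ 2 * √(p : ℝ) * (2 + Real.log p) ^ 2 with hP
  set A := intervalFactorials p L N
  have hcs := card_sq_le_card_mul_card_collisions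
    (fun x : ℕ × ℕ => (descPochhammer (ZMod p) x.1).eval (x.2 : ZMod p)) (𝒦 ×ˢ J)
    ((A ×ˢ A).image fun x => x.1 / x.2) fun x hx => by
      obtain ⟨h1, h2⟩ := mem_product.1 hx
      have h3 := (h𝒦 _ h1).2.2
      rw [mem_Ico] at h2
      exact eval_descPochhammer_mem hLN (by omega) (by omega)
  have hR : #((A ×ˢ A).image fun x => x.1 / x.2) ≤ #A ^ 2 :=
    card_image_le.trans (by rw [card_product, sq])
  have hcol : #{x ∈ (𝒦 ×ˢ J) ×ˢ (𝒦 ×ˢ J) | (descPochhammer (ZMod p) x.1.1).eval (x.1.2 : ZMod p) =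
      (descPochhammer (ZMod p) x.2.1).eval (x.2.2 : ZMod p)} =
      ∑ k ∈ 𝒦, ∑ l ∈ 𝒦, #{x ∈ J ×ˢ J | (descPochhammer (ZMod p) k).eval (x.1 : ZMod p) =
        (descPochhammer (ZMod p) l).eval (x.2 : ZMod p)} := by
    simp only [card_filter, sum_product]
    refine sum_congr rfl fun k _ => ?_
    rw [sum_comm]
  have hlog : 0 ≤ Real.log p := Real.log_natCast_nonneg p
  have hP0 : 0 ≤ P := by positivity
  have hbd : ∀ k ∈ 𝒦, ∀ l ∈ 𝒦, (#{x ∈ J ×ˢ J | (descPochhammer (ZMod p) k).eval (x.1 : ZMod p) =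
        (descPochhammer (ZMod p) l).eval (x.2 : ZMod p)} : ℝ) ≤
        (m ^ 2 / p + P) + if k = l then 2 * m + P else 0 := by
    intro k hk l hl
    obtain ⟨hkp, hk3, hkX⟩ := h𝒦 k hk
    obtain ⟨hlp, hl3, hlX⟩ := h𝒦 l hl
    by_cases hkl : k = l
    · subst hkl
      have h1 := card_pochhammer_diag_le (p := p) (hkp.odd_of_ne_two (by omega)) hk3 hkX hXp
        (a := a) (m := m) (by omega)
      have h2 : 12 * X ^ 2 * √(p : ℝ) * (2 + Real.log p) ≤ P :=
        mul_le_mul_of_nonneg_left (by nlinarith) (by positivity)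
      have h3 : (0 : ℝ) ≤ m ^ 2 / p := by positivity
      rw [if_pos rfl]
      linarith
    · rw [if_neg hkl, add_zero]
      exact card_pochhammer_pair_le (by omega) (by omega) hkl
        ((Nat.coprime_primes hkp hlp).2 hkl) hkX hlX hX (by omega) (by omega)
  have hsum : (∑ k ∈ 𝒦, ∑ l ∈ 𝒦, (#{x ∈ J ×ˢ J | (descPochhammer (ZMod p) k).eval (x.1 : ZMod p) =
        (descPochhammer (ZMod p) l).eval (x.2 : ZMod p)} : ℝ)) ≤
        #𝒦 ^ 2 * (m ^ 2 / p + P) + #𝒦 * (2 * m + P) := by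
    refine (sum_le_sum fun k hk => sum_le_sum fun l hl => hbd k hk l hl).trans (le_of_eq ?_)
    simp only [sum_add_distrib, sum_ite_eq, sum_const, nsmul_eq_mul]
    rw [sum_congr rfl fun k hk => if_pos hk]
    simp only [sum_const, nsmul_eq_mul]
    ring
  have hK : (#𝒦 : ℝ) * P ≤ #𝒦 ^ 2 * P := by
    refine mul_le_mul_of_nonneg_right ?_ hP0
    exact_mod_cast Nat.le_self_pow two_ne_zero _
  have hJm : #J = m := by simp [hJ]
  rw [hcol, card_product, hJm] at hcs
  have hcs' : (#𝒦 * m : ℝ) ^ 2 ≤ #A ^ 2 * ∑ k ∈ 𝒦, ∑ l ∈ 𝒦,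
      (#{x ∈ J ×ˢ J | (descPochhammer (ZMod p) k).eval (x.1 : ZMod p) =
        (descPochhammer (ZMod p) l).eval (x.2 : ZMod p)} : ℝ) := by
    exact_mod_cast hcs.trans (Nat.mul_le_mul_right _ hR)
  refine hcs'.trans (mul_le_mul_of_nonneg_left ?_ (by positivity))
  linarith

end Counting

section PrimeCount
open Finset Real

lemma eventually_le_card_odd_primes : ∃ X₀ : ℕ, ∀ X : ℕ, X₀ ≤ X →
    X / (2 * log X) ≤ #{q ∈ range (X + 1) | q.Prime ∧ 3 ≤ q} := by
  have h : ∀ᶠ x : ℝ in Filter.atTop, 16 * log x ≤ x := by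
    have := (isLittleO_log_id_atTop.def (show (0 : ℝ) < 1 / 16 by norm_num))
    filter_upwards [this, Filter.eventually_ge_atTop 1] with x hx h1
    rw [norm_eq_abs, norm_eq_abs, abs_of_nonneg (log_nonneg h1), id, abs_of_pos (by linarith)] at hx
    linarith
  obtain ⟨X₀, hX₀⟩ := Filter.eventually_atTop.1 (h.natCast_atTop)
  refine ⟨max X₀ 12, fun X hX => ?_⟩
  have h16 : 16 * log (X : ℝ) ≤ X := hX₀ X ((le_max_left _ _).trans hX)
  have hX3 : 12 ≤ X := (le_max_right _ _).trans hX
  have hX3' : (12 : ℝ) ≤ X := by exact_mod_cast hX3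
  have hlog : 0 < log (X : ℝ) := log_pos (by linarith)
  have hpi := Chebyshev.pi_ge X
  have h1 : X.primeCounting ≤ #{q ∈ range (X + 1) | q.Prime ∧ 3 ≤ q} + 1 := by
    rw [Nat.primeCounting, Nat.primeCounting', Nat.count_eq_card_filter_range]
    refine (card_le_card (t := {q ∈ range (X + 1) | q.Prime ∧ 3 ≤ q} ∪ {2}) ?_).trans
      (card_union_le _ _)
    intro q hq
    obtain ⟨hq1, hq2⟩ := mem_filter.1 hq
    rw [mem_union, mem_filter, mem_singleton]
    have := hq2.two_le
    by_cases h : q = 2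
    · exact Or.inr h
    · exact Or.inl ⟨hq1, hq2, by omega⟩
  have h1' : (X.primeCounting : ℝ) ≤ #{q ∈ range (X + 1) | q.Prime ∧ 3 ≤ q} + 1 := by
    exact_mod_cast h1
  have h2 : log ((X : ℝ) + 1) ≤ log X + log 2 := by
    rw [← log_mul (by linarith) two_ne_zero]
    exact log_le_log (by linarith) (by linarith)
  have h3 : X / (2 * log X) + 1 ≤ (X * log 2 - log (X + 1)) / log (X : ℝ) := by
    rw [le_div_iff₀ hlog]
    have h4 : (X / (2 * log (X : ℝ)) + 1) * log X = X / 2 + log X := by field_simp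
    have := log_two_gt_d9
    have := log_two_lt_d9
    have h5 : X * 0.69 ≤ X * log 2 := mul_le_mul_of_nonneg_left (by linarith) (by linarith)
    rw [h4]
    linarith
  linarith

end PrimeCount

section Parameters
open Finset Real

variable {p : ℕ} [Fact p.Prime]

/-- The main inequality, solved for the size of the set. -/
lemma one_sub_mul_sqrt_le {δ K m P A : ℝ} {q : ℝ} (hq : 0 < q) (hδ : 0 < δ) (hδ1 : δ < 1)
    (hK : 0 < K) (hm : 0 < m) (hA : 0 ≤ A) (hP : 4 * P * q ≤ δ * m ^ 2) (hKm : 4 * q ≤ δ * (K * m))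
    (h : (K * m) ^ 2 ≤ A ^ 2 * (K ^ 2 * (m ^ 2 / q + 2 * P) + 2 * K * m)) :
    (1 - δ) * √q ≤ A := by
  have h1 : K ^ 2 * (m ^ 2 / q + 2 * P) + 2 * K * m ≤ (K * m) ^ 2 * ((1 + δ) / q) := by
    have h2 : 2 * P ≤ δ / 2 * m ^ 2 / q := by rw [le_div_iff₀ hq]; linarith
    have h3 : 2 ≤ δ / 2 * (K * m) / q := by rw [le_div_iff₀ hq]; linarith
    have h4 := mul_le_mul_of_nonneg_left h2 (sq_nonneg K)
    have h5 := mul_le_mul_of_nonneg_left h3 (mul_pos hK hm).le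
    have h6 : (K * m) ^ 2 * ((1 + δ) / q) =
        K ^ 2 * (m ^ 2 / q) + K ^ 2 * (δ / 2 * m ^ 2 / q) + K * m * (δ / 2 * (K * m) / q) := by
      field_simp; ring
    rw [h6, mul_add]
    linarith
  have h7 : (K * m) ^ 2 * 1 ≤ (K * m) ^ 2 * (A ^ 2 * ((1 + δ) / q)) := by
    have := h.trans (mul_le_mul_of_nonneg_left h1 (sq_nonneg A))
    linarith
  have h8 := le_of_mul_le_mul_left h7 (by positivity)
  have h9 : q ≤ A ^ 2 * (1 + δ) := by
    rw [← mul_div_assoc, le_div_iff₀ hq] at h8; linarith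
  refine abs_le_of_sq_le_sq' ?_ hA |>.2
  rw [mul_pow, sq_sqrt hq.le]
  have h10 : (1 - δ) ^ 2 * (1 + δ) ≤ 1 := by nlinarith [mul_pos hδ hδ]
  have h11 := mul_le_mul_of_nonneg_left h9 (sq_nonneg (1 - δ))
  nlinarith [sq_nonneg A]

lemma completion_error_le {δ C t ℓ x N m : ℝ} (hδ : 0 < δ) (hCδ : 2 ^ 20 ≤ δ ^ 3 * C)
    (hC : 1 ≤ C) (ht : 0 < t) (hℓ : 2 ≤ ℓ) (hx : 0 ≤ x) (hN0 : 0 < N)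
    (hN : C * t ^ 7 * ℓ ≤ N) (hxN : x * (δ * N) ≤ 32 * t ^ 8 * ℓ) (hmN : N / 2 ≤ m) :
    4 * (12 * x ^ 2 * t ^ 4 * (2 + ℓ) ^ 2) * t ^ 8 ≤ δ * m ^ 2 := by
  have h1 : 2 + ℓ ≤ 2 * ℓ := by linarith
  have h3 : (N / 2) ^ 2 ≤ m ^ 2 := by gcongr
  have h6 : C ^ 4 * t ^ 28 * ℓ ^ 4 ≤ N ^ 4 := by
    calc C ^ 4 * t ^ 28 * ℓ ^ 4 = (C * t ^ 7 * ℓ) ^ 4 := by ring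
      _ ≤ _ := by gcongr
  have h7 : C ≤ C ^ 4 := le_self_pow₀ hC (by norm_num)
  have h8 : 2 ^ 20 ≤ δ ^ 3 * C ^ 4 := hCδ.trans (by gcongr)
  have h9 : 2 ^ 20 * (t ^ 28 * ℓ ^ 4) ≤ δ ^ 3 * N ^ 4 := by
    calc _ ≤ δ ^ 3 * C ^ 4 * (t ^ 28 * ℓ ^ 4) := by gcongr
      _ = δ ^ 3 * (C ^ 4 * t ^ 28 * ℓ ^ 4) := by ring
      _ ≤ _ := by gcongr
  refine le_of_mul_le_mul_right ?_ (show 0 < (δ * N) ^ 2 by positivity)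
  calc 4 * (12 * x ^ 2 * t ^ 4 * (2 + ℓ) ^ 2) * t ^ 8 * (δ * N) ^ 2
      ≤ 4 * (12 * x ^ 2 * t ^ 4 * (2 * ℓ) ^ 2) * t ^ 8 * (δ * N) ^ 2 := by gcongr
    _ = 192 * t ^ 12 * ℓ ^ 2 * (x * (δ * N)) ^ 2 := by ring
    _ ≤ 192 * t ^ 12 * ℓ ^ 2 * (32 * t ^ 8 * ℓ) ^ 2 := by gcongr
    _ = 196608 * (t ^ 28 * ℓ ^ 4) := by ring
    _ ≤ δ ^ 3 * N ^ 4 / 4 := by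
        have : 0 ≤ t ^ 28 * ℓ ^ 4 := by positivity
        linarith
    _ = δ * (N / 2) ^ 2 * (δ * N) ^ 2 := by ring
    _ ≤ δ * m ^ 2 * (δ * N) ^ 2 := by gcongr

/-- The theorem with the parameters made explicit; `t` is the eighth root of `p`. -/
lemma one_sub_mul_sqrt_le_card {δ C t : ℝ} (hδ : 0 < δ) (hδ1 : δ < 1) (hCδ : 64 ≤ δ * C)
    (hCδ' : 2 ^ 20 ≤ δ ^ 3 * C) (ht : 0 ≤ t) (htp : t ^ 8 = p) (hp : 16 ^ 2 ≤ p) {X₀ : ℕ}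
    (hX₀ : ∀ X : ℕ, X₀ ≤ X → X / (2 * log X) ≤ #{q ∈ range (X + 1) | q.Prime ∧ 3 ≤ q})
    (hpX₀ : X₀ ≤ log p) {L N : ℕ} (hLN : L + N < p) (hN : C * t ^ 7 * log p ≤ N) :
    (1 - δ) * √(p : ℝ) ≤ #(intervalFactorials p L N) := by
  have hpR : (256 : ℝ) ≤ p := by exact_mod_cast hp
  have hp0 : (0 : ℝ) < p := by linarith
  have ht2 : 2 ≤ t := by
    by_contra! h
    have := pow_lt_pow_left₀ h ht (n := 8) (by norm_num)
    rw [htp] at this; norm_num at this; linarith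
  have hℓ : 5 ≤ log p := by
    have h1 : log (256 : ℝ) ≤ log p := log_le_log (by norm_num) hpR
    have h2 : log (256 : ℝ) = 8 * log 2 := by
      rw [show (256 : ℝ) = 2 ^ 8 by norm_num, log_pow]; norm_num
    linarith [log_two_gt_d9]
  set ℓ := log (p : ℝ) with hℓd
  have hs : √(p : ℝ) = t ^ 4 := by
    rw [← htp, show t ^ 8 = (t ^ 4) ^ 2 by ring, sqrt_sq (by positivity)]
  have hC : 0 < C := by
    by_contra! h
    nlinarith
  have hC64 : 64 ≤ C := by nlinarith
  have hN0 : (0 : ℝ) < N := lt_of_lt_of_le (by positivity) hN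
  have hNp : (N : ℝ) ≤ p := by exact_mod_cast (by omega : N ≤ p)
  have hy : 0 < 16 * p * ℓ / (δ * N) := by positivity
  obtain ⟨X, hXd⟩ : ∃ X, X = ⌈16 * p * ℓ / (δ * N)⌉₊ := ⟨_, rfl⟩
  have hX1 : 16 * p * ℓ / (δ * N) ≤ X := hXd ▸ Nat.le_ceil _
  have hX2 : (X : ℝ) < 16 * p * ℓ / (δ * N) + 1 := hXd ▸ Nat.ceil_lt_add_one hy.le
  have hyℓ : 16 * ℓ ≤ 16 * p * ℓ / (δ * N) := by
    rw [le_div_iff₀ (by positivity)]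
    have : δ * N ≤ p := by nlinarith
    nlinarith
  have hX2' : (X : ℝ) ≤ 32 * p * ℓ / (δ * N) := by
    have : 32 * p * ℓ / (δ * N) = 2 * (16 * p * ℓ / (δ * N)) := by ring
    linarith
  have hXN : X * (δ * N) ≤ 32 * p * ℓ := (le_div_iff₀ (by positivity)).1 hX2'
  have hXt : (X : ℝ) ≤ t / 2 := by
    refine hX2'.trans ?_
    rw [div_le_iff₀ (by positivity), ← htp]
    have h1 := mul_le_mul_of_nonneg_left hN hδ.le
    have h2 := mul_le_mul_of_nonneg_right hCδ (show 0 ≤ t ^ 7 * ℓ by positivity)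
    nlinarith
  have hX3 : 3 ≤ X := by
    have : (3 : ℝ) ≤ X := by linarith
    exact_mod_cast this
  have hX3' : (3 : ℝ) ≤ X := by exact_mod_cast hX3
  have htN : t ≤ N := by
    have h1 : t ≤ t ^ 7 := le_self_pow₀ (by linarith) (by norm_num)
    have h2 : t ^ 7 * 1 ≤ t ^ 7 * (C * ℓ) := mul_le_mul_of_nonneg_left (by nlinarith) (by positivity)
    linarith
  have hXN2 : 2 * X ≤ N := by
    have : (2 * X : ℝ) ≤ N := by linarith
    exact_mod_cast this
  have hXp : 5 * X ^ 2 ≤ p := by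
    have h1 : (5 * X ^ 2 : ℝ) ≤ p := by
      have h2 : (X : ℝ) ^ 2 ≤ (t / 2) ^ 2 := by gcongr
      have h3 : t ^ 2 * 2 ^ 6 ≤ t ^ 2 * t ^ 6 := by gcongr
      rw [← htp]
      nlinarith
    exact_mod_cast h1
  have hK := hX₀ X (by
    have : (X₀ : ℝ) ≤ X := by linarith
    exact_mod_cast this)
  set 𝒦 := {q ∈ range (X + 1) | q.Prime ∧ 3 ≤ q} with h𝒦
  have hmain := card_sq_mul_sq_le hLN (by omega) hX3 hXp 𝒦 fun k hk => by
    obtain ⟨h1, h2, h3⟩ := mem_filter.1 hk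
    exact ⟨h2, h3, by have := mem_range.1 h1; omega⟩
  set m := N - X with hm
  have hmN : (N : ℝ) / 2 ≤ m := by
    rw [div_le_iff₀ two_pos]
    exact_mod_cast (by omega : N ≤ m * 2)
  have hXleP : (X : ℝ) ≤ p := by
    exact_mod_cast (by omega : X ≤ p)
  have hKlow : X / (2 * ℓ) ≤ #𝒦 := by
    refine le_trans ?_ hK
    have h1 : 0 < log (X : ℝ) := log_pos (by linarith)
    have h2 : log (X : ℝ) ≤ ℓ := log_le_log (by linarith) hXleP
    gcongr
  have hKpos : (0 : ℝ) < #𝒦 := lt_of_lt_of_le (by positivity) hKlow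
  refine one_sub_mul_sqrt_le hp0 hδ hδ1 hKpos (by linarith) (by positivity) ?_ ?_ hmain
  · have := completion_error_le (x := X) hδ hCδ' (by linarith) (by linarith) (by linarith)
      (by positivity) hN0 hN (by rwa [htp]) hmN
    rwa [htp, ← hs] at this
  · have h1 : 16 * p * ℓ ≤ X * (δ * N) := (div_le_iff₀ (by positivity)).1 hX1
    have h2 : X / (2 * ℓ) * (N / 2) ≤ #𝒦 * m := by gcongr
    have h3 : 4 * p ≤ X / (2 * ℓ) * (N / 2) * δ := by
      rw [show X / (2 * ℓ) * ((N : ℝ) / 2) * δ = X * (δ * N) / (4 * ℓ) by field_simp; ring,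
        le_div_iff₀ (by positivity)]
      linarith
    have h4 := mul_le_mul_of_nonneg_right h2 hδ.le
    linarith

end Parameters

/-- **Corollary.** For `N ≫ p^{7/8}·log p`, `|A_N| ≥ (1 + o(1))·√p`: for every `ε > 0` there are
`C > 0` and `p₀` such that every prime `p > p₀` and all admissible `L, N` with
`N ≥ C·p^{7/8}·log p` satisfy `|A_N| ≥ (1 − ε)·√p`. -/
theorem card_intervalFactorials_ge :
    ∀ ε : ℝ, ε > 0 → ∃ C : ℝ, C > 0 ∧ ∃ p₀ : ℕ, ∀ p : ℕ, p.Prime → p > p₀ →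
      ∀ L N : ℕ, 0 < L + 1 → L + 1 < L + N → L + N < p →
      (N : ℝ) ≥ C * (p : ℝ) ^ ((7 : ℝ) / 8) * Real.log p →
      ((intervalFactorials p L N).card : ℝ) ≥ (1 - ε) * Real.sqrt p := by
  intro ε hε
  obtain ⟨X₀, hX₀⟩ := eventually_le_card_odd_primes
  set δ := min ε (1 / 2) with hδd
  have hδ : 0 < δ := lt_min hε (by norm_num)
  have hδ1 : δ < 1 := (min_le_right _ _).trans_lt (by norm_num)
  refine ⟨64 / δ + 2 ^ 20 / δ ^ 3, by positivity, max (16 ^ 2) ⌈Real.exp X₀⌉₊,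
    fun p hp hpp L N _ _ hLN hN => ?_⟩
  have := Fact.mk hp
  have hp0 : (0 : ℝ) < p := Nat.cast_pos.2 hp.pos
  have hexp : Real.exp X₀ ≤ p := Nat.ceil_le.1 ((le_max_right _ _).trans hpp.le)
  have key := one_sub_mul_sqrt_le_card (t := (p : ℝ) ^ ((1 : ℝ) / 8)) hδ hδ1
    (C := 64 / δ + 2 ^ 20 / δ ^ 3) ?_ ?_ (by positivity) ?_ ((le_max_left _ _).trans hpp.le) hX₀
    ((Real.le_log_iff_exp_le hp0).2 hexp) hLN ?_
  · refine le_trans (mul_le_mul_of_nonneg_right ?_ (Real.sqrt_nonneg _)) key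
    linarith [min_le_left ε (1 / 2)]
  · rw [mul_add, mul_div_cancel₀ _ hδ.ne']
    exact le_add_of_nonneg_right (by positivity)
  · rw [mul_add, mul_div_cancel₀ _ (pow_pos hδ 3).ne']
    exact le_add_of_nonneg_left (by positivity)
  · rw [← Real.rpow_natCast, ← Real.rpow_mul hp0.le]
    norm_num
  · rw [← Real.rpow_natCast ((p : ℝ) ^ ((1 : ℝ) / 8)), ← Real.rpow_mul hp0.le]
    norm_num at hN ⊢
    exact hN
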